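/- For every positive integer q, the integral group homology of PSL_2(O_{-13}) with trivial ℤ-coefficients is given, as an abelian group, by: H_1 ≅ ℤ³ ⊕ (ℤ/2)²; H_2 ≅ ℤ² ⊕ ℤ/4 ⊕ (ℤ/3)² ⊕ ℤ/2; and for each integer k ≥ 0: H_{4k+3} ≅ (ℤ/2)^{4k+3} ⊕ (ℤ/3)², H_{4k+4} ≅ (ℤ/2)^{4k+4}, H_{4k+5} ≅ (ℤ/2)^{4k+5}, and H_{4k+6} ≅ (ℤ/2)^{4k+6} ⊕ (ℤ/3)². -/

import Mathlib

/-!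
Group homology via the inhomogeneous bar complex (trivial coefficients).
-/

namespace BarHomology

/-- The `n`-th term of the inhomogeneous bar complex of `G` with trivial coefficients in `A`. -/
abbrev chains (G : Type) (A : Type) [AddCommGroup A] (n : ℕ) : Type := (Fin n → G) →₀ A

/-- The differential of the inhomogeneous bar complex with trivial coefficients:
`d (g₁, …, g_{n+1}) = (g₂, …, g_{n+1}) + ∑_{j=1}^{n} (-1)^j (g₁, …, g_j g_{j+1}, …, g_{n+1})
  + (-1)^{n+1} (g₁, …, g_n)`. -/
noncomputable def d (k : Type) [CommRing k] (G : Type) [Group G] (A : Type) [AddCommGroup A]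
    [Module k A] (n : ℕ) : chains G A (n + 1) →ₗ[k] chains G A n :=
  Finsupp.lsum k fun g =>
    (Finsupp.lsingle (fun i => g i.succ) : A →ₗ[k] chains G A n)
      + ∑ j : Fin (n + 1),
          ((-1 : k) ^ ((j : ℕ) + 1)) • (Finsupp.lsingle (Fin.contractNth j (· * ·) g))

/-- The cycles: everything in degree `0`, the kernel of the differential in positive degrees. -/
noncomputable def cycles (k : Type) [CommRing k] (G : Type) [Group G] (A : Type) [AddCommGroup A]
    [Module k A] : (n : ℕ) → Submodule k (chains G A n)
  | 0 => ⊤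
  | (n + 1) => LinearMap.ker (d k G A n)

/-- The boundaries, viewed as a submodule of the cycles. -/
noncomputable def boundariesIn (k : Type) [CommRing k] (G : Type) [Group G] (A : Type)
    [AddCommGroup A] [Module k A] (n : ℕ) : Submodule k (cycles k G A n) :=
  (LinearMap.range (d k G A n)).comap (cycles k G A n).subtype

/-- Group homology of `G` in degree `n` with trivial coefficients in the `k`-module `A`,
defined as cycles modulo boundaries in the inhomogeneous bar complex. -/
abbrev GroupHomology (k : Type) [CommRing k] (G : Type) [Group G] (A : Type) [AddCommGroup A]
    [Module k A] (n : ℕ) : Type :=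
  ↥(cycles k G A n) ⧸ boundariesIn k G A n

section Maps

variable {k : Type} [CommRing k] {G G' : Type} [Group G] [Group G'] {A : Type} [AddCommGroup A]
  [Module k A]

/-- The chain map induced by a group homomorphism. -/
noncomputable def chainsMap (k : Type) [CommRing k] (A : Type) [AddCommGroup A] [Module k A]
    (φ : G →* G') (n : ℕ) : chains G A n →ₗ[k] chains G' A n :=
  Finsupp.lmapDomain A k (fun f => φ ∘ f)

lemma comp_contractNth (φ : G →* G') {n : ℕ} (j : Fin (n + 1)) (g : Fin (n + 1) → G) :
    φ ∘ Fin.contractNth j (· * ·) g = Fin.contractNth j (· * ·) (φ ∘ g) := by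
  funext i
  rcases lt_trichotomy (i : ℕ) (j : ℕ) with h | h | h
  · simp [Function.comp_apply, Fin.contractNth_apply_of_lt _ _ _ _ h]
  · simp [Function.comp_apply, Fin.contractNth_apply_of_eq _ _ _ _ h, map_mul]
  · simp [Function.comp_apply, Fin.contractNth_apply_of_gt _ _ _ _ h]

lemma chainsMap_comm (φ : G →* G') (n : ℕ) :
    (d k G' A n).comp (chainsMap k A φ (n + 1))
      = (chainsMap k A φ n).comp (d k G A n) := by
  apply Finsupp.lhom_ext
  intro g a
  simp only [LinearMap.comp_apply, chainsMap, Finsupp.lmapDomain_apply, Finsupp.mapDomain_single,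
    d, Finsupp.lsum_single, LinearMap.add_apply, LinearMap.sum_apply, LinearMap.smul_apply,
    Finsupp.lsingle_apply, map_add, map_sum, map_smul]
  congr 1
  refine Finset.sum_congr rfl fun j _ => ?_
  rw [comp_contractNth]

lemma chainsMap_mem_cycles (φ : G →* G') {n : ℕ} {x : chains G A n}
    (hx : x ∈ cycles k G A n) : chainsMap k A φ n x ∈ cycles k G' A n := by
  cases n with
  | zero => trivial
  | succ n =>
    simp only [cycles, LinearMap.mem_ker] at hx ⊢
    have := LinearMap.congr_fun (chainsMap_comm (k := k) (A := A) φ n) x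
    simp only [LinearMap.comp_apply] at this
    rw [this, hx, map_zero]

/-- The map induced by a group homomorphism on cycles. -/
noncomputable def cyclesMap (k : Type) [CommRing k] (A : Type) [AddCommGroup A] [Module k A]
    (φ : G →* G') (n : ℕ) : ↥(cycles k G A n) →ₗ[k] ↥(cycles k G' A n) :=
  (chainsMap k A φ n).restrict fun _ hx => chainsMap_mem_cycles φ hx

/-- The map induced by a group homomorphism on group homology with trivial coefficients. -/
noncomputable def inducedMap (k : Type) [CommRing k] (A : Type) [AddCommGroup A] [Module k A]
    (φ : G →* G') (n : ℕ) :
    GroupHomology k G A n →ₗ[k] GroupHomology k G' A n :=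
  Submodule.mapQ (boundariesIn k G A n) (boundariesIn k G' A n) (cyclesMap k A φ n) (by
    rintro ⟨x, hx⟩ hb
    simp only [boundariesIn, Submodule.mem_comap, Submodule.subtype_apply,
      LinearMap.mem_range] at hb ⊢
    obtain ⟨w, hw⟩ := hb
    refine ⟨chainsMap k A φ (n + 1) w, ?_⟩
    have := LinearMap.congr_fun (chainsMap_comm (k := k) (A := A) φ n) w
    simp only [LinearMap.comp_apply] at this
    rw [this, hw]
    rfl)

end Maps

end BarHomology

open BarHomology

/-- The projective special linear group `PSL₂(R)`, i.e. `SL₂(R)` modulo its center. -/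
abbrev PSL2 (R : Type) [CommRing R] : Type :=
  Matrix.ProjectiveSpecialLinearGroup (Fin 2) R

/-! ### Free modules over a group ring and comparison of free resolutions -/

namespace FreeRes

set_option linter.unusedSectionVars false

open Finsupp

variable {G : Type} [Group G] {X Y Z : Type}

/-- The free `ℤ[G]`-module on `X`. -/
abbrev FG (G X : Type) : Type := (G × X) →₀ ℤ

/-- Left translation by `g`. -/
noncomputable def act (g : G) : FG G X →ₗ[ℤ] FG G X :=
  Finsupp.lmapDomain ℤ ℤ fun p => (g * p.1, p.2)

@[simp] lemma act_single (g h : G) (x : X) (a : ℤ) :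
    act g (single (h, x) a) = single (g * h, x) a := by
  simp [act]

lemma act_act (g h : G) (z : FG G X) : act g (act h z) = act (g * h) z := by
  simp [act, ← Finsupp.mapDomain_comp, Function.comp_def, mul_assoc]

lemma act_one (z : FG G X) : act (1 : G) z = z := by
  have : (fun p : G × X => ((1 : G) * p.1, p.2)) = id := by ext <;> simp
  rw [act, Finsupp.lmapDomain_apply, this, Finsupp.mapDomain_id]

/-- The equivariant extension of a map defined on generators. -/
noncomputable def lift (f : X → FG G Y) : FG G X →ₗ[ℤ] FG G Y :=
  Finsupp.linearCombination ℤ fun p => act p.1 (f p.2)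

@[simp] lemma lift_single (f : X → FG G Y) (g : G) (x : X) (a : ℤ) :
    lift f (single (g, x) a) = a • act g (f x) := by
  simp [lift]

lemma hom_ext {M : Type} [AddCommGroup M] {f g : FG G X →ₗ[ℤ] M}
    (h : ∀ γ x, f (single (γ, x) 1) = g (single (γ, x) 1)) : f = g := by
  refine Finsupp.lhom_ext fun p a => ?_
  rw [show single p a = a • (single p 1 : FG G X) by simp, map_smul, map_smul]
  exact congrArg _ (h p.1 p.2)

lemma lift_act (f : X → FG G Y) (g : G) (z : FG G X) : lift f (act g z) = act g (lift f z) := by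
  have : (lift f).comp (act g) = (act g).comp (lift f) :=
    hom_ext fun γ x => by simp [act_act]
  exact LinearMap.congr_fun this z

lemma lift_lift (f : X → FG G Y) (f' : Y → FG G Z) (z : FG G X) :
    lift f' (lift f z) = lift (fun x => lift f' (f x)) z := by
  have : (lift f').comp (lift f) = lift fun x => lift f' (f x) :=
    hom_ext fun γ x => by simp [lift_act]
  exact LinearMap.congr_fun this z

lemma lift_sub (f f' : X → FG G Y) (z : FG G X) :
    lift (fun x => f x - f' x) z = lift f z - lift f' z := by
  have : lift (fun x => f x - f' x) = lift f - lift f' :=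
    hom_ext fun γ x => by simp
  exact LinearMap.congr_fun this z

lemma lift_id (z : FG G X) : lift (fun x => single ((1 : G), x) 1) z = z := by
  have : lift (fun x : X => single ((1 : G), x) 1) = LinearMap.id :=
    hom_ext fun γ x => by simp
  exact LinearMap.congr_fun this z

lemma lift_congr {f f' : X → FG G Y} (h : ∀ x, f x = f' x) : lift f = lift f' := by
  rw [funext h]

/-- The map to coinvariants. -/
noncomputable def coinv : FG G X →ₗ[ℤ] (X →₀ ℤ) := Finsupp.lmapDomain ℤ ℤ Prod.snd

@[simp] lemma coinv_single (g : G) (x : X) (a : ℤ) :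
    coinv (single (g, x) a) = single x a := by
  simp [coinv]

lemma coinv_act (g : G) (z : FG G X) : coinv (act g z) = coinv z := by
  have : coinv.comp (act g) = (coinv : FG G X →ₗ[ℤ] _) := hom_ext fun γ x => by simp
  exact LinearMap.congr_fun this z

/-- The map on coinvariants induced by `lift f`. -/
noncomputable def colift (f : X → FG G Y) : (X →₀ ℤ) →ₗ[ℤ] (Y →₀ ℤ) :=
  Finsupp.linearCombination ℤ fun x => coinv (f x)

@[simp] lemma colift_single (f : X → FG G Y) (x : X) (a : ℤ) :
    colift f (single x a) = a • coinv (f x) := by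
  simp [colift]

lemma coinv_lift (f : X → FG G Y) (z : FG G X) : coinv (lift f z) = colift f (coinv z) := by
  have : coinv.comp (lift f) = (colift f).comp coinv :=
    hom_ext fun γ x => by simp [coinv_act]
  exact LinearMap.congr_fun this z

lemma colift_colift (f : X → FG G Y) (f' : Y → FG G Z) (z : X →₀ ℤ) :
    colift f' (colift f z) = colift (fun x => lift f' (f x)) z := by
  have : (colift f').comp (colift f) = colift fun x => lift f' (f x) :=
    Finsupp.lhom_ext fun x a => by simp [coinv_lift]
  exact LinearMap.congr_fun this z

lemma colift_sub (f f' : X → FG G Y) (z : X →₀ ℤ) :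
    colift (fun x => f x - f' x) z = colift f z - colift f' z := by
  have : colift (fun x => f x - f' x) = colift f - colift f' :=
    Finsupp.lhom_ext fun x a => by simp [smul_sub]
  exact LinearMap.congr_fun this z

lemma colift_add (f f' : X → FG G Y) (z : X →₀ ℤ) :
    colift (fun x => f x + f' x) z = colift f z + colift f' z := by
  have : colift (fun x => f x + f' x) = colift f + colift f' :=
    Finsupp.lhom_ext fun x a => by simp
  exact LinearMap.congr_fun this z

lemma colift_id (z : X →₀ ℤ) : colift (fun x => single ((1 : G), x) 1) z = z := by
  have : colift (fun x : X => single ((1 : G), x) 1) = LinearMap.id :=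
    Finsupp.lhom_ext fun x a => by simp
  exact LinearMap.congr_fun this z

lemma colift_zero (z : X →₀ ℤ) : colift (fun _ : X => (0 : FG G Y)) z = 0 := by
  have : colift (fun _ : X => (0 : FG G Y)) = 0 :=
    Finsupp.lhom_ext fun x a => by simp
  exact LinearMap.congr_fun this z

/-- The augmentation extending a function on generators. -/
noncomputable def aug (e : X → ℤ) : FG G X →ₗ[ℤ] ℤ :=
  Finsupp.linearCombination ℤ fun p => e p.2

@[simp] lemma aug_single (e : X → ℤ) (g : G) (x : X) (a : ℤ) :
    aug e (single (g, x) a) = a * e x := by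
  simp [aug]

lemma aug_lift (e : Y → ℤ) (f : X → FG G Y) (z : FG G X) :
    aug e (lift f z) = aug (fun x => aug e (f x)) z := by
  have hact : ∀ (g : G) (z : FG G Y), aug e (act g z) = aug e z := fun g z => by
    have : (aug e).comp (act g) = aug e := hom_ext fun γ x => by simp
    exact LinearMap.congr_fun this z
  have : (aug e).comp (lift f) = aug fun x => aug e (f x) :=
    hom_ext fun γ x => by simp [hact]
  exact LinearMap.congr_fun this z

variable (G) in
/-- A resolution of the trivial module `ℤ` by free `ℤ[G]`-modules. -/
structure Resolution where
  X : ℕ → Type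
  d : ∀ n, X (n + 1) → FG G (X n)
  e : X 0 → ℤ
  d_d : ∀ n x, lift (d n) (d (n + 1) x) = 0
  e_d : ∀ x, aug e (d 0 x) = 0
  exact : ∀ n z, lift (d n) z = 0 → ∃ w, lift (d (n + 1)) w = z
  exact_zero : ∀ z, aug e z = 0 → ∃ w, lift (d 0) w = z
  surj : ∃ z : FG G (X 0), aug e z = 1

namespace Resolution

variable (P Q : Resolution G)

lemma lift_d_d (n : ℕ) (z) : lift (P.d n) (lift (P.d (n + 1)) z) = 0 := by
  rw [lift_lift, lift_congr (P.d_d n)]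
  have : lift (fun _ => 0) = (0 : FG G (P.X (n + 2)) →ₗ[ℤ] FG G (P.X n)) :=
    hom_ext fun γ x => by simp
  exact LinearMap.congr_fun this z

lemma exists_chainMap : ∃ f : ∀ n, P.X n → FG G (Q.X n),
    (∀ x, aug Q.e (f 0 x) = P.e x) ∧
    ∀ n x, lift (Q.d n) (f (n + 1) x) = lift (f n) (P.d n x) := by
  let T (n : ℕ) : Type :=
    {f : P.X n → FG G (Q.X n) // ∀ x, ∃ w, lift (Q.d n) w = lift f (P.d n x)}
  have step : ∀ n (f : T n), ∃ f' : T (n + 1),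
      ∀ x, lift (Q.d n) (f'.1 x) = lift f.1 (P.d n x) := by
    intro n f
    choose f' hf' using f.2
    refine ⟨⟨f', fun x => Q.exact n _ ?_⟩, hf'⟩
    rw [lift_lift, lift_congr hf', ← lift_lift, P.d_d, map_zero]
  choose s hs using step
  obtain ⟨c, hc⟩ := Q.surj
  let f₀ : P.X 0 → FG G (Q.X 0) := fun x => P.e x • c
  have hf₀ : ∀ x, aug Q.e (f₀ x) = P.e x := fun x => by simp [f₀, hc]
  let t₀ : T 0 := ⟨f₀, fun x => Q.exact_zero _ (by
    rw [aug_lift, show (fun x => aug Q.e (f₀ x)) = P.e from funext hf₀, P.e_d])⟩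
  let t : ∀ n, T n := fun n => Nat.rec t₀ (fun n f => s n f) n
  exact ⟨fun n => (t n).1, hf₀, fun n x => hs n (t n) x⟩

lemma exists_homotopy (f : ∀ n, P.X n → FG G (P.X n)) (h0 : ∀ x, aug P.e (f 0 x) = 0)
    (hf : ∀ n x, lift (P.d n) (f (n + 1) x) = lift (f n) (P.d n x)) :
    ∃ h : ∀ n, P.X n → FG G (P.X (n + 1)),
      ∀ n x, lift (P.d (n + 1)) (h (n + 1) x) = f (n + 1) x - lift (h n) (P.d n x) := by
  let T (n : ℕ) : Type :=
    {h : P.X n → FG G (P.X (n + 1)) //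
      ∀ x, ∃ w, lift (P.d (n + 1)) w = f (n + 1) x - lift h (P.d n x)}
  have step : ∀ n (h : T n), ∃ h' : T (n + 1),
      ∀ x, lift (P.d (n + 1)) (h'.1 x) = f (n + 1) x - lift h.1 (P.d n x) := by
    intro n h
    choose h' hh' using h.2
    refine ⟨⟨h', fun x => P.exact (n + 1) _ ?_⟩, hh'⟩
    rw [map_sub, hf, lift_lift, lift_congr hh', lift_sub, ← lift_lift (P.d n), P.d_d, map_zero,
      sub_zero, sub_self]
  choose s hs using step
  have hbase : ∃ h : P.X 0 → FG G (P.X 1), ∀ x, lift (P.d 0) (h x) = f 0 x := by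
    choose h hh using fun x => P.exact_zero (f 0 x) (h0 x)
    exact ⟨h, hh⟩
  obtain ⟨b, hb⟩ := hbase
  let t₀ : T 0 := ⟨b, fun x => P.exact 0 _ (by
    rw [map_sub, hf, lift_lift, lift_congr hb, sub_self])⟩
  let t : ∀ n, T n := fun n => Nat.rec t₀ (fun n f => s n f) n
  exact ⟨fun n => (t n).1, fun n x => hs n (t n) x⟩

/-- Homology of the complex of coinvariants in positive degrees. -/
abbrev H (n : ℕ) : Type :=
  LinearMap.ker (colift (P.d n)) ⧸
    (LinearMap.range (colift (P.d (n + 1)))).comap (LinearMap.ker (colift (P.d n))).subtype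

section

variable {P Q}
variable (f : ∀ n, P.X n → FG G (Q.X n))
  (hf : ∀ n x, lift (Q.d n) (f (n + 1) x) = lift (f n) (P.d n x))

lemma colift_comm (f : ∀ n, P.X n → FG G (Q.X n))
    (hf : ∀ n x, lift (Q.d n) (f (n + 1) x) = lift (f n) (P.d n x)) (n : ℕ) (z) :
    colift (Q.d n) (colift (f (n + 1)) z) = colift (f n) (colift (P.d n) z) := by
  rw [colift_colift, colift_colift]
  congr 2
  exact funext (hf n)

/-- The map on homology of coinvariants induced by a chain map. -/
noncomputable def mapH (n : ℕ) : P.H n →ₗ[ℤ] Q.H n :=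
  Submodule.mapQ _ _ ((colift (f (n + 1))).restrict (fun z hz => by
    rw [LinearMap.mem_ker] at hz ⊢
    rw [colift_comm f hf, hz, map_zero])) (by
    rintro ⟨z, hz⟩ ⟨w, hw⟩
    exact ⟨colift (f (n + 2)) w, by
      rw [colift_comm f hf, hw]; rfl⟩)

end

lemma comp_mapH (f : ∀ n, P.X n → FG G (Q.X n))
    (hf : ∀ n x, lift (Q.d n) (f (n + 1) x) = lift (f n) (P.d n x))
    (hf0 : ∀ x, aug Q.e (f 0 x) = P.e x)
    (g : ∀ n, Q.X n → FG G (P.X n))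
    (hg : ∀ n x, lift (P.d n) (g (n + 1) x) = lift (g n) (Q.d n x))
    (hg0 : ∀ x, aug P.e (g 0 x) = Q.e x) (n : ℕ) (x : P.H n) :
    mapH g hg n (mapH f hf n x) = x := by
  obtain ⟨⟨z, hz⟩, rfl⟩ := Submodule.Quotient.mk_surjective _ x
  rw [LinearMap.mem_ker] at hz
  obtain ⟨h, hh⟩ := P.exists_homotopy (fun n x => lift (g n) (f n x) - single ((1 : G), x) 1)
    (fun x => by
      rw [map_sub, aug_lift, show (fun x => aug P.e (g 0 x)) = Q.e from funext hg0, hf0]; simp)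
    (fun n x => by
      rw [map_sub, lift_sub, lift_id, lift_lift, lift_congr (hg n), ← lift_lift, hf, ← lift_lift]
      simp [act_one])
  refine (Submodule.Quotient.eq _).2 ⟨colift (h (n + 1)) z, ?_⟩
  have e1 : colift (P.d (n + 1)) (colift (h (n + 1)) z) =
      colift (g (n + 1)) (colift (f (n + 1)) z) - z - colift (h n) (colift (P.d n) z) := by
    rw [colift_colift, show (fun x => lift (P.d (n + 1)) (h (n + 1) x)) = _ from funext (hh n),
      colift_sub, colift_sub, colift_id, ← colift_colift, ← colift_colift]
  rw [e1, hz, map_zero, sub_zero]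
  rfl

/-- Any two free resolutions have the same homology of coinvariants. -/
lemma nonempty_equiv (n : ℕ) : Nonempty (P.H n ≃ₗ[ℤ] Q.H n) := by
  obtain ⟨f, hf0, hf⟩ := exists_chainMap P Q
  obtain ⟨g, hg0, hg⟩ := exists_chainMap Q P
  exact ⟨LinearEquiv.ofLinearMap (mapH f hf n) (mapH g hg n)
    (LinearMap.ext fun x => comp_mapH Q P g hg hg0 f hf hf0 n x)
    (LinearMap.ext fun x => comp_mapH P Q f hf hf0 g hg hg0 n x)⟩

end Resolution

end FreeRes

/-! ### The bar resolution -/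

namespace FreeRes

open Finsupp

variable (G : Type) [Group G]

/-- The differential of the bar resolution on generators. -/
noncomputable def barD (n : ℕ) (g : Fin (n + 1) → G) : FG G (Fin n → G) :=
  single (g 0, fun i => g i.succ) 1 +
    ∑ j : Fin (n + 1), single (1, Fin.contractNth j (· * ·) g) ((-1) ^ ((j : ℕ) + 1))

/-- The contracting homotopy of the bar resolution. -/
noncomputable def barS (n : ℕ) : FG G (Fin n → G) →ₗ[ℤ] FG G (Fin (n + 1) → G) :=
  Finsupp.lmapDomain ℤ ℤ fun p => (1, Fin.cons p.1 p.2)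

variable {G}

@[simp] lemma barS_single (n : ℕ) (g : G) (x : Fin n → G) (a : ℤ) :
    barS G n (single (g, x) a) = single (1, Fin.cons g x) a := by
  simp [barS]

lemma contractNth_zero_cons {n : ℕ} (g : G) (x : Fin (n + 1) → G) :
    Fin.contractNth (0 : Fin (n + 2)) (· * ·) (Fin.cons g x) =
      (Fin.cons (g * x 0) (fun i => x i.succ) : Fin (n + 1) → G) := by
  funext i
  refine Fin.cases ?_ (fun i => ?_) i
  · rw [Fin.contractNth_apply_of_eq _ _ _ _ rfl]; rfl
  · rw [Fin.contractNth_apply_of_gt _ _ _ _ (by simp)]; rfl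

lemma contractNth_succ_cons {n : ℕ} (j : Fin (n + 1)) (g : G) (x : Fin (n + 1) → G) :
    Fin.contractNth j.succ (· * ·) (Fin.cons g x) =
      (Fin.cons g (Fin.contractNth j (· * ·) x) : Fin (n + 1) → G) := by
  funext i
  refine Fin.cases ?_ (fun i => ?_) i
  · rw [Fin.contractNth_apply_of_lt _ _ _ _ (by simp)]; rfl
  · rcases lt_trichotomy (i : ℕ) (j : ℕ) with h | h | h
    · rw [Fin.contractNth_apply_of_lt _ _ _ _ (by simpa using h), Fin.cons_succ,
        Fin.contractNth_apply_of_lt _ _ _ _ h]; rfl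
    · rw [Fin.contractNth_apply_of_eq _ _ _ _ (by simpa using h), Fin.cons_succ,
        Fin.cons_succ, Fin.contractNth_apply_of_eq _ _ _ _ h]; rfl
    · rw [Fin.contractNth_apply_of_gt _ _ _ _ (by simpa using h), Fin.cons_succ,
        Fin.cons_succ, Fin.contractNth_apply_of_gt _ _ _ _ h]

lemma bar_homotopy (n : ℕ) (z : FG G (Fin (n + 1) → G)) :
    lift (barD G (n + 1)) (barS G (n + 1) z) + barS G n (lift (barD G n) z) = z := by
  have : (lift (barD G (n + 1))).comp (barS G (n + 1)) + (barS G n).comp (lift (barD G n)) =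
      LinearMap.id := by
    refine hom_ext fun γ x => ?_
    simp only [LinearMap.add_apply, LinearMap.comp_apply, barS_single, lift_single, one_smul,
      barD, map_add, map_sum, act_single, LinearMap.id_apply, mul_one]
    rw [Fin.sum_univ_succ (n := n + 1)]
    simp only [Fin.cons_zero, Fin.cons_succ, contractNth_zero_cons, contractNth_succ_cons,
      Fin.val_zero, Fin.val_succ, zero_add, pow_one, pow_succ _ (_ + 1), mul_neg, mul_one,
      single_neg, Finset.sum_neg_distrib, one_mul]
    abel
  exact LinearMap.congr_fun this z

lemma bar_homotopy_zero (z : FG G (Fin 0 → G)) :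
    lift (barD G 0) (barS G 0 z) + single (1, Fin.elim0) (aug (fun _ => 1) z) = z := by
  have : (lift (barD G 0)).comp (barS G 0) +
      (Finsupp.lsingle (1, Fin.elim0)).comp (aug (fun _ => 1)) =
      (LinearMap.id : FG G (Fin 0 → G) →ₗ[ℤ] _) := by
    refine hom_ext fun γ x => ?_
    have e : ∀ y : Fin 0 → G, y = Fin.elim0 := fun y => Subsingleton.elim _ _
    simp [act_one, barD, e (fun i => _)]
  exact LinearMap.congr_fun this z

lemma barD_eq_lift (n : ℕ) (x : Fin (n + 1) → G) :
    barD G n x = lift (barD G n) (barS G n (single (x 0, fun i => x i.succ) 1)) := by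
  simp only [barS_single, lift_single, act_one, one_smul]
  congr 1
  exact (Fin.cons_self_tail x).symm

lemma bar_d_d (n : ℕ) : ∀ x, lift (barD G n) (barD G (n + 1) x) = 0 := by
  induction n with
  | zero =>
    intro x
    rw [barD_eq_lift]
    set w := (single (x 0, fun i => x i.succ) 1 : FG G (Fin 1 → G))
    have h1 := bar_homotopy 0 w
    have h2 := bar_homotopy_zero (lift (barD G 0) w)
    have h3 : aug (fun _ => 1) (lift (barD G 0) w) = 0 := by
      rw [aug_lift, show (fun x => aug (fun _ => (1 : ℤ)) (barD G 0 x)) = fun _ => 0 by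
        funext y; simp [barD]]
      simp [w]
    rw [← eq_sub_iff_add_eq] at h1
    rw [h3, single_zero, add_zero] at h2
    rw [h1, map_sub, h2, sub_self]
  | succ n ih =>
    intro x
    rw [barD_eq_lift]
    set w := (single (x 0, fun i => x i.succ) 1 : FG G (Fin (n + 2) → G))
    have h1 := bar_homotopy (n + 1) w
    have h2 := bar_homotopy n (lift (barD G (n + 1)) w)
    have h3 : lift (barD G n) (lift (barD G (n + 1)) w) = 0 := by
      simp [w, lift_act, ih]
    rw [← eq_sub_iff_add_eq] at h1
    rw [h3, map_zero, add_zero] at h2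
    rw [h1, map_sub, h2, sub_self]

variable (G) in
/-- The bar resolution. -/
noncomputable def barRes : Resolution G where
  X n := Fin n → G
  d n := barD G n
  e _ := 1
  d_d := bar_d_d
  e_d x := by simp [barD]
  exact n z hz := ⟨barS G (n + 1) z, by simpa [hz] using bar_homotopy n z⟩
  exact_zero z hz := ⟨barS G 0 z, by
    have := bar_homotopy_zero z
    simp only [hz, single_zero, add_zero] at this
    exact this⟩
  surj := ⟨single (1, Fin.elim0) 1, by simp⟩

lemma colift_barD (n : ℕ) : colift (barD G n) = BarHomology.d ℤ G ℤ n := by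
  refine Finsupp.lhom_ext fun x a => ?_
  simp [barD, BarHomology.d, map_add, map_sum, smul_add, Finset.smul_sum, mul_comm]

/-- Group homology computed from a free resolution. -/
theorem Resolution.groupHomology (P : Resolution G) (n : ℕ) :
    Nonempty (BarHomology.GroupHomology ℤ G ℤ (n + 1) ≃+ P.H n) := by
  obtain ⟨e⟩ := (barRes G).nonempty_equiv P n
  have key : ∀ d1 d2, d1 = colift (barD G n) → d2 = colift (barD G (n + 1)) →
      Nonempty ((LinearMap.ker d1 ⧸ (LinearMap.range d2).comap (LinearMap.ker d1).subtype) ≃+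
        (barRes G).H n) := by
    rintro _ _ rfl rfl
    exact ⟨AddEquiv.refl _⟩
  obtain ⟨e'⟩ := key _ _ (colift_barD n).symm (colift_barD (n + 1)).symm
  exact ⟨e'.trans e.toAddEquiv⟩

/-- Group homology is invariant under isomorphism. -/
theorem groupHomology_congr {G G' : Type} [Group G] [Group G'] (e : G ≃* G') (n : ℕ) :
    Nonempty (BarHomology.GroupHomology ℤ G ℤ n ≃+ BarHomology.GroupHomology ℤ G' ℤ n) := by
  have key : ∀ {G G' : Type} [Group G] [Group G'] (e : G ≃* G') (x),
      BarHomology.inducedMap ℤ ℤ e.symm.toMonoidHom n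
        (BarHomology.inducedMap ℤ ℤ e.toMonoidHom n x) = x := by
    intro G G' _ _ e x
    obtain ⟨⟨z, hz⟩, rfl⟩ := Submodule.Quotient.mk_surjective _ x
    refine congrArg (Submodule.Quotient.mk) (Subtype.ext ?_)
    change Finsupp.mapDomain _ (Finsupp.mapDomain _ z) = z
    rw [← Finsupp.mapDomain_comp]
    convert Finsupp.mapDomain_id
    funext f i
    simp
  exact ⟨(LinearEquiv.ofLinearMap (BarHomology.inducedMap ℤ ℤ e.toMonoidHom n)
    (BarHomology.inducedMap ℤ ℤ e.symm.toMonoidHom n) (LinearMap.ext fun x => key e.symm x)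
    (LinearMap.ext fun x => key e x)).toAddEquiv⟩

end FreeRes

namespace Bianchi

/-- Matrices of determinant one over `ℤ[√-13]`, entry `e` being `e0 + e1 √-13`. -/
@[ext] structure S where
  a0 : ℤ
  a1 : ℤ
  b0 : ℤ
  b1 : ℤ
  c0 : ℤ
  c1 : ℤ
  d0 : ℤ
  d1 : ℤ
  re : a0 * d0 - 13 * (a1 * d1) - (b0 * c0 - 13 * (b1 * c1)) = 1
  im : a0 * d1 + a1 * d0 - (b0 * c1 + b1 * c0) = 0

namespace S

instance : DecidableEq S := fun A B =>
  decidable_of_iff (A.a0 = B.a0 ∧ A.a1 = B.a1 ∧ A.b0 = B.b0 ∧ A.b1 = B.b1 ∧ A.c0 = B.c0 ∧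
    A.c1 = B.c1 ∧ A.d0 = B.d0 ∧ A.d1 = B.d1) S.ext_iff.symm

instance : One S := ⟨⟨1, 0, 0, 0, 0, 0, 1, 0, by norm_num, by norm_num⟩⟩

instance : Neg S := ⟨fun A => ⟨-A.a0, -A.a1, -A.b0, -A.b1, -A.c0, -A.c1, -A.d0, -A.d1,
  by linear_combination A.re, by linear_combination A.im⟩⟩

instance : Inv S := ⟨fun A => ⟨A.d0, A.d1, -A.b0, -A.b1, -A.c0, -A.c1, A.a0, A.a1,
  by linear_combination A.re, by linear_combination A.im⟩⟩

instance : Mul S := ⟨fun A B =>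
  ⟨A.a0 * B.a0 - 13 * (A.a1 * B.a1) + (A.b0 * B.c0 - 13 * (A.b1 * B.c1)),
   A.a0 * B.a1 + A.a1 * B.a0 + (A.b0 * B.c1 + A.b1 * B.c0),
   A.a0 * B.b0 - 13 * (A.a1 * B.b1) + (A.b0 * B.d0 - 13 * (A.b1 * B.d1)),
   A.a0 * B.b1 + A.a1 * B.b0 + (A.b0 * B.d1 + A.b1 * B.d0),
   A.c0 * B.a0 - 13 * (A.c1 * B.a1) + (A.d0 * B.c0 - 13 * (A.d1 * B.c1)),
   A.c0 * B.a1 + A.c1 * B.a0 + (A.d0 * B.c1 + A.d1 * B.c0),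
   A.c0 * B.b0 - 13 * (A.c1 * B.b1) + (A.d0 * B.d0 - 13 * (A.d1 * B.d1)),
   A.c0 * B.b1 + A.c1 * B.b0 + (A.d0 * B.d1 + A.d1 * B.d0),
   by
    linear_combination (B.a0 * B.d0 - 13 * (B.a1 * B.d1) - (B.b0 * B.c0 - 13 * (B.b1 * B.c1))) *
      A.re - 13 * (B.a0 * B.d1 + B.a1 * B.d0 - (B.b0 * B.c1 + B.b1 * B.c0)) * A.im + B.re,
   by
    linear_combination (B.a0 * B.d0 - 13 * (B.a1 * B.d1) - (B.b0 * B.c0 - 13 * (B.b1 * B.c1))) *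
      A.im + (B.a0 * B.d1 + B.a1 * B.d0 - (B.b0 * B.c1 + B.b1 * B.c0)) * A.re + B.im⟩⟩

@[simp] theorem one_a0 : (1 : S).a0 = 1 := rfl
@[simp] theorem one_a1 : (1 : S).a1 = 0 := rfl
@[simp] theorem one_b0 : (1 : S).b0 = 0 := rfl
@[simp] theorem one_b1 : (1 : S).b1 = 0 := rfl
@[simp] theorem one_c0 : (1 : S).c0 = 0 := rfl
@[simp] theorem one_c1 : (1 : S).c1 = 0 := rfl
@[simp] theorem one_d0 : (1 : S).d0 = 1 := rfl
@[simp] theorem one_d1 : (1 : S).d1 = 0 := rfl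
@[simp] theorem neg_a0 (A : S) : (-A).a0 = -A.a0 := rfl
@[simp] theorem neg_a1 (A : S) : (-A).a1 = -A.a1 := rfl
@[simp] theorem neg_b0 (A : S) : (-A).b0 = -A.b0 := rfl
@[simp] theorem neg_b1 (A : S) : (-A).b1 = -A.b1 := rfl
@[simp] theorem neg_c0 (A : S) : (-A).c0 = -A.c0 := rfl
@[simp] theorem neg_c1 (A : S) : (-A).c1 = -A.c1 := rfl
@[simp] theorem neg_d0 (A : S) : (-A).d0 = -A.d0 := rfl
@[simp] theorem neg_d1 (A : S) : (-A).d1 = -A.d1 := rfl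
@[simp] theorem inv_a0 (A : S) : A⁻¹.a0 = A.d0 := rfl
@[simp] theorem inv_a1 (A : S) : A⁻¹.a1 = A.d1 := rfl
@[simp] theorem inv_b0 (A : S) : A⁻¹.b0 = -A.b0 := rfl
@[simp] theorem inv_b1 (A : S) : A⁻¹.b1 = -A.b1 := rfl
@[simp] theorem inv_c0 (A : S) : A⁻¹.c0 = -A.c0 := rfl
@[simp] theorem inv_c1 (A : S) : A⁻¹.c1 = -A.c1 := rfl
@[simp] theorem inv_d0 (A : S) : A⁻¹.d0 = A.a0 := rfl
@[simp] theorem inv_d1 (A : S) : A⁻¹.d1 = A.a1 := rfl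
@[simp] theorem mul_a0 (A B : S) : (A * B).a0 =
    A.a0 * B.a0 - 13 * (A.a1 * B.a1) + (A.b0 * B.c0 - 13 * (A.b1 * B.c1)) := rfl
@[simp] theorem mul_a1 (A B : S) : (A * B).a1 =
    A.a0 * B.a1 + A.a1 * B.a0 + (A.b0 * B.c1 + A.b1 * B.c0) := rfl
@[simp] theorem mul_b0 (A B : S) : (A * B).b0 =
    A.a0 * B.b0 - 13 * (A.a1 * B.b1) + (A.b0 * B.d0 - 13 * (A.b1 * B.d1)) := rfl
@[simp] theorem mul_b1 (A B : S) : (A * B).b1 =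
    A.a0 * B.b1 + A.a1 * B.b0 + (A.b0 * B.d1 + A.b1 * B.d0) := rfl
@[simp] theorem mul_c0 (A B : S) : (A * B).c0 =
    A.c0 * B.a0 - 13 * (A.c1 * B.a1) + (A.d0 * B.c0 - 13 * (A.d1 * B.c1)) := rfl
@[simp] theorem mul_c1 (A B : S) : (A * B).c1 =
    A.c0 * B.a1 + A.c1 * B.a0 + (A.d0 * B.c1 + A.d1 * B.c0) := rfl
@[simp] theorem mul_d0 (A B : S) : (A * B).d0 =
    A.c0 * B.b0 - 13 * (A.c1 * B.b1) + (A.d0 * B.d0 - 13 * (A.d1 * B.d1)) := rfl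
@[simp] theorem mul_d1 (A B : S) : (A * B).d1 =
    A.c0 * B.b1 + A.c1 * B.b0 + (A.d0 * B.d1 + A.d1 * B.d0) := rfl

instance : Group S := Group.ofLeftAxioms
  (fun A B C => by ext <;> simp only [mul_a0, mul_a1, mul_b0, mul_b1, mul_c0, mul_c1, mul_d0,
    mul_d1] <;> ring)
  (fun A => by ext <;> simp)
  (fun A => by
    have h := A.re
    have h' := A.im
    ext <;> simp <;> linarith)

theorem neg_mul (A B : S) : -A * B = -(A * B) := by ext <;> simp <;> ring
theorem mul_neg (A B : S) : A * -B = -(A * B) := by ext <;> simp <;> ring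
theorem neg_neg (A : S) : -(-A) = A := by ext <;> simp
theorem neg_inv (A : S) : (-A)⁻¹ = -A⁻¹ := by ext <;> simp

/-- Equality up to sign. -/
def setoid : Setoid S where
  r A B := A = B ∨ A = -B
  iseqv := ⟨fun _ => Or.inl rfl, by
    rintro A B (h | h)
    · exact Or.inl h.symm
    · exact Or.inr (by rw [h, neg_neg]), by
    rintro A B C (rfl | rfl) (rfl | rfl)
    · exact Or.inl rfl
    · exact Or.inr rfl
    · exact Or.inr rfl
    · exact Or.inl (neg_neg _)⟩

end S

/-- The group `PSL₂(ℤ[√-13])`. -/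
def Γ : Type := Quotient S.setoid

namespace Γ

/-- The class of a matrix. -/
def mk (A : S) : Γ := Quotient.mk S.setoid A

theorem mk_eq_mk {A B : S} : mk A = mk B ↔ A = B ∨ A = -B :=
  ⟨fun h => Quotient.exact (s := S.setoid) h, fun h => Quotient.sound (s := S.setoid) h⟩

theorem mk_surj (g : Γ) : ∃ A, mk A = g := Quotient.exists_rep g

instance : DecidableEq Γ :=
  @Quotient.decidableEq S S.setoid fun A B =>
    show Decidable (A = B ∨ A = -B) from inferInstance

instance : One Γ := ⟨mk 1⟩
instance : Mul Γ := ⟨Quotient.map₂ (sa := S.setoid) (sb := S.setoid) (sc := S.setoid) (· * ·) (by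
  rintro A B (rfl | rfl) C D (rfl | rfl)
  · exact Or.inl rfl
  · exact Or.inr (S.mul_neg _ _)
  · exact Or.inr (S.neg_mul _ _)
  · exact Or.inl (by simp only [S.mul_neg, S.neg_mul, S.neg_neg]))⟩
instance : Inv Γ := ⟨Quotient.map (sa := S.setoid) (sb := S.setoid) (·⁻¹) (by
  rintro A B (rfl | rfl)
  · exact Or.inl rfl
  · exact Or.inr (S.neg_inv _))⟩

theorem mk_mul (A B : S) : mk (A * B) = mk A * mk B := rfl
theorem mk_inv (A : S) : mk A⁻¹ = (mk A)⁻¹ := rfl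
theorem mk_one : mk 1 = 1 := rfl

instance : Group Γ := Group.ofLeftAxioms
  (by
    intro g h k
    obtain ⟨A, rfl⟩ := mk_surj g
    obtain ⟨B, rfl⟩ := mk_surj h
    obtain ⟨C, rfl⟩ := mk_surj k
    rw [← mk_mul, ← mk_mul, ← mk_mul, ← mk_mul, mul_assoc])
  (by
    intro g
    obtain ⟨A, rfl⟩ := mk_surj g
    rw [← mk_one, ← mk_mul, one_mul])
  (by
    intro g
    obtain ⟨A, rfl⟩ := mk_surj g
    rw [← mk_inv, ← mk_mul, inv_mul_cancel, mk_one])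

/-- The projection from matrices. -/
def proj : S →* Γ where
  toFun := mk
  map_one' := rfl
  map_mul' _ _ := rfl

end Γ
end Bianchi

namespace Bianchi
open NumberField

section ringOfIntegers
variable {K : Type*} [Field K] [NumberField K]

theorem sq_ne_neg_thirteen (r : ℚ) : r ^ 2 ≠ -13 := fun h => by nlinarith [sq_nonneg r]

theorem linearIndependent_one_root {α : K} (hα : α ^ 2 = -13) :
    LinearIndependent ℚ ![(1 : K), α] := by
  rw [LinearIndependent.pair_iff]
  intro s t h
  rw [Algebra.smul_def, Algebra.smul_def, mul_one] at h
  have ht : t = 0 := by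
    by_contra ht
    refine sq_ne_neg_thirteen (-s / t) ?_
    have h2 : algebraMap ℚ K ((-s / t) ^ 2) = algebraMap ℚ K (-13) := by
      have h3 : α = algebraMap ℚ K (-s / t) := by
        have : algebraMap ℚ K t ≠ 0 := by simpa using ht
        rw [map_div₀, map_neg, eq_div_iff this]
        linear_combination h
      rw [map_pow, ← h3, hα]
      simp
    exact (algebraMap ℚ K).injective h2
  subst ht
  simpa using h

theorem isIntegral_int_of_cast {r : ℚ} (h : IsIntegral ℤ (algebraMap ℚ K r)) :
    ∃ n : ℤ, (n : ℚ) = r := by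
  rw [isIntegral_algebraMap_iff (algebraMap ℚ K).injective] at h
  exact IsIntegrallyClosed.isIntegral_iff.mp h

theorem rat_int_of_sq {u : ℚ} {n : ℤ} (h : u ^ 2 = n) : ∃ m : ℤ, (m : ℚ) = u := by
  have : IsIntegral ℤ u := by
    refine IsIntegral.of_pow (n := 2) (by norm_num) ?_
    rw [h]
    exact isIntegral_algebraMap (x := n)
  exact IsIntegrallyClosed.isIntegral_iff.mp this

theorem exists_int_int_of_trace_norm {r s : ℚ} {R M : ℤ} (hR : (R : ℚ) = 2 * r)
    (hM : (M : ℚ) = r ^ 2 + 13 * s ^ 2) : ∃ m n : ℤ, (m : ℚ) = r ∧ (n : ℚ) = s := by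
  obtain ⟨u, hu⟩ := rat_int_of_sq (u := 26 * s) (n := 13 * (4 * M - R ^ 2)) (by
    push_cast
    rw [hR, hM]
    ring)
  have hu2 : u ^ 2 = 13 * (4 * M - R ^ 2) := by
    have : (u : ℚ) ^ 2 = 13 * (4 * M - R ^ 2) := by rw [hu, hR, hM]; ring
    exact_mod_cast this
  have h13 : (13 : ℤ) ∣ u := by
    have : Prime (13 : ℤ) := by norm_num
    exact this.dvd_of_dvd_pow ⟨_, hu2⟩
  obtain ⟨t, rfl⟩ := h13
  have ht : R ^ 2 + 13 * t ^ 2 = 4 * M := by nlinarith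
  have hmod : R % 2 = 0 ∧ t % 2 = 0 := by
    have h4 : (R ^ 2 + 13 * t ^ 2) % 4 = 0 := by omega
    have : ∀ a b : ZMod 4, a ^ 2 + 13 * b ^ 2 = 0 → (a = 0 ∨ a = 2) ∧ (b = 0 ∨ b = 2) := by
      decide
    have h5 := this (R : ZMod 4) (t : ZMod 4) (by
      have := (ZMod.intCast_zmod_eq_zero_iff_dvd (R ^ 2 + 13 * t ^ 2) 4).2
        (Int.dvd_of_emod_eq_zero h4)
      push_cast at this
      exact this)
    have key : ∀ a : ℤ, ((a : ZMod 4) = 0 ∨ (a : ZMod 4) = 2) → a % 2 = 0 := by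
      rintro a (h | h)
      · have := (ZMod.intCast_zmod_eq_zero_iff_dvd a 4).1 h
        omega
      · have h' : ((a - 2 : ℤ) : ZMod 4) = 0 := by push_cast; rw [h]; decide
        have := (ZMod.intCast_zmod_eq_zero_iff_dvd (a - 2) 4).1 h'
        omega
    exact ⟨key R h5.1, key t h5.2⟩
  refine ⟨R / 2, t / 2, ?_, ?_⟩
  · obtain ⟨k, hk⟩ : ∃ k, R = 2 * k := ⟨R / 2, by omega⟩
    rw [hk] at hR ⊢
    push_cast at hR
    rw [Int.mul_ediv_cancel_left _ (by norm_num)]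
    linarith
  · obtain ⟨k, hk⟩ : ∃ k, t = 2 * k := ⟨t / 2, by omega⟩
    rw [hk] at hu ⊢
    push_cast at hu
    rw [Int.mul_ediv_cancel_left _ (by norm_num)]
    linarith

theorem exists_int_add_int_mul {α : K} (hdeg : Module.finrank ℚ K = 2) (hα : α ^ 2 = -13)
    {x : K} (hx : IsIntegral ℤ x) : ∃ m n : ℤ, x = m + n * α := by
  have hli := linearIndependent_one_root hα
  have hcard : Fintype.card (Fin 2) = Module.finrank ℚ K := by rw [hdeg, Fintype.card_fin]
  obtain ⟨b, hb⟩ : ∃ b : Module.Basis (Fin 2) ℚ K, ⇑b = ![(1 : K), α] :=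
    ⟨basisOfLinearIndependentOfCardEqFinrank hli hcard,
      coe_basisOfLinearIndependentOfCardEqFinrank hli hcard⟩
  have hb0 : b 0 = 1 := by rw [hb]; rfl
  have hb1 : b 1 = α := by rw [hb]; rfl
  have hαα : α * α = -13 := by rw [← sq, hα]
  have htr : Algebra.trace ℚ K α = 0 := by
    rw [Algebra.trace_eq_matrix_trace b, Matrix.trace, Fin.sum_univ_two]
    simp only [Matrix.diag, Algebra.leftMulMatrix_eq_repr_mul, hb0, hb1, mul_one]
    have h1 : α * α = (-13 : ℚ) • b 0 := by
      rw [hαα, hb0, Algebra.smul_def]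
      simp
    rw [h1, map_smul, ← hb1]
    simp
  obtain ⟨r, s, hrs⟩ : ∃ r s : ℚ, x = algebraMap ℚ K r + algebraMap ℚ K s * α := by
    refine ⟨b.repr x 0, b.repr x 1, ?_⟩
    conv_lhs => rw [← b.sum_repr x, Fin.sum_univ_two, hb0, hb1, Algebra.smul_def, Algebra.smul_def,
      mul_one]
  have htx : Algebra.trace ℚ K x = 2 * r := by
    rw [hrs, map_add, ← Algebra.smul_def, map_smul, htr, Algebra.trace_algebraMap, hdeg]
    simp
  have hi : IsIntegral ℤ (algebraMap ℚ K (2 * r)) := by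
    rw [← htx]
    exact (Algebra.isIntegral_trace hx).algebraMap
  have hn : IsIntegral ℤ (algebraMap ℚ K (r ^ 2 + 13 * s ^ 2)) := by
    have : algebraMap ℚ K (r ^ 2 + 13 * s ^ 2) = algebraMap ℚ K (2 * r) * x - x * x := by
      rw [hrs]
      simp only [map_add, map_mul, map_pow, map_ofNat]
      linear_combination ((algebraMap ℚ K s) ^ 2) * hαα
    rw [this]
    exact (hi.mul hx).sub (hx.mul hx)
  obtain ⟨R, hR⟩ := isIntegral_int_of_cast hi
  obtain ⟨M, hM⟩ := isIntegral_int_of_cast hn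
  obtain ⟨m, n, rfl, rfl⟩ := exists_int_int_of_trace_norm hR hM
  exact ⟨m, n, by rw [hrs]; simp⟩

theorem root_coords_unique {α : K} (hα : α ^ 2 = -13) {m n m' n' : ℤ}
    (h : (m : K) + n * α = m' + n' * α) : m = m' ∧ n = n' := by
  have hli := linearIndependent_one_root hα
  rw [LinearIndependent.pair_iff] at hli
  have := hli (m - m') (n - n') (by
    rw [Algebra.smul_def, Algebra.smul_def]
    simp only [map_sub, map_intCast]
    linear_combination h)
  constructor
  · exact_mod_cast sub_eq_zero.1 this.1
  · exact_mod_cast sub_eq_zero.1 this.2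

end ringOfIntegers

section toSL
variable {R : Type*} [CommRing R]

/-- The matrix over `R` obtained by sending `√-13` to a given root. -/
def toSLFun (α : R) (hα : α ^ 2 = -13) (A : S) : Matrix.SpecialLinearGroup (Fin 2) R :=
  ⟨!![(A.a0 : R) + A.a1 * α, A.b0 + A.b1 * α; A.c0 + A.c1 * α, A.d0 + A.d1 * α], by
    have h1 := congrArg (Int.cast : ℤ → R) A.re
    have h2 := congrArg (Int.cast : ℤ → R) A.im
    push_cast at h1 h2
    rw [Matrix.det_fin_two_of]
    linear_combination h1 + α * h2 + (A.a1 * A.d1 - A.b1 * A.c1 : R) * hα⟩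

theorem coe_toSLFun (α : R) (hα : α ^ 2 = -13) (A : S) :
    (toSLFun α hα A : Matrix (Fin 2) (Fin 2) R) =
    !![(A.a0 : R) + A.a1 * α, A.b0 + A.b1 * α; A.c0 + A.c1 * α, A.d0 + A.d1 * α] := rfl

/-- The homomorphism sending `√-13` to a given root. -/
def toSL (α : R) (hα : α ^ 2 = -13) : S →* Matrix.SpecialLinearGroup (Fin 2) R where
  toFun := toSLFun α hα
  map_one' := by
    apply Subtype.ext
    rw [coe_toSLFun, Matrix.SpecialLinearGroup.coe_one, Matrix.one_fin_two]
    simp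
  map_mul' A B := by
    apply Subtype.ext
    rw [Matrix.SpecialLinearGroup.coe_mul, coe_toSLFun, coe_toSLFun, coe_toSLFun,
      Matrix.mul_fin_two]
    simp only [S.mul_a0, S.mul_a1, S.mul_b0, S.mul_b1, S.mul_c0, S.mul_c1, S.mul_d0, S.mul_d1]
    push_cast
    congr 1
    ext i j
    fin_cases i <;> fin_cases j <;> simp
    · linear_combination (-(A.a1 * B.a1 + A.b1 * B.c1 : R)) * hα
    · linear_combination (-(A.a1 * B.b1 + A.b1 * B.d1 : R)) * hα
    · linear_combination (-(A.c1 * B.a1 + A.d1 * B.c1 : R)) * hα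
    · linear_combination (-(A.c1 * B.b1 + A.d1 * B.d1 : R)) * hα

theorem coe_toSL (α : R) (hα : α ^ 2 = -13) (A : S) : (toSL α hα A : Matrix (Fin 2) (Fin 2) R) =
    !![(A.a0 : R) + A.a1 * α, A.b0 + A.b1 * α; A.c0 + A.c1 * α, A.d0 + A.d1 * α] := rfl

theorem toSL_bijective (α : R) (hα : α ^ 2 = -13) (hex : ∀ x : R, ∃ m n : ℤ, x = m + n * α)
    (huniq : ∀ m n m' n' : ℤ, (m : R) + n * α = m' + n' * α → m = m' ∧ n = n') :
    Function.Bijective (toSL α hα) := by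
  constructor
  · intro A B h
    have h' : (toSL α hα A : Matrix (Fin 2) (Fin 2) R) = toSL α hα B := by rw [h]
    rw [coe_toSL, coe_toSL] at h'
    have e := fun i j => congrFun (congrFun h' i) j
    have h00 := huniq _ _ _ _ (by simpa using e 0 0)
    have h01 := huniq _ _ _ _ (by simpa using e 0 1)
    have h10 := huniq _ _ _ _ (by simpa using e 1 0)
    have h11 := huniq _ _ _ _ (by simpa using e 1 1)
    ext
    exacts [h00.1, h00.2, h01.1, h01.2, h10.1, h10.2, h11.1, h11.2]
  · intro M
    obtain ⟨a0, a1, ha⟩ := hex (M.1 0 0)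
    obtain ⟨b0, b1, hb⟩ := hex (M.1 0 1)
    obtain ⟨c0, c1, hc⟩ := hex (M.1 1 0)
    obtain ⟨d0, d1, hd⟩ := hex (M.1 1 1)
    have hdet := M.2
    rw [Matrix.det_fin_two, ha, hb, hc, hd] at hdet
    have := huniq (a0 * d0 - 13 * (a1 * d1) - (b0 * c0 - 13 * (b1 * c1)))
      (a0 * d1 + a1 * d0 - (b0 * c1 + b1 * c0)) 1 0 (by
        push_cast
        linear_combination hdet - (a1 * d1 - b1 * c1 : R) * hα)
    refine ⟨⟨a0, a1, b0, b1, c0, c1, d0, d1, this.1, this.2⟩, ?_⟩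
    ext i j
    rw [coe_toSL]
    fin_cases i <;> fin_cases j <;> simp [ha, hb, hc, hd]

theorem toSL_mem_center [NoZeroDivisors R] (α : R) (hα : α ^ 2 = -13)
    (hinj : Function.Injective (toSL α hα)) (A : S) :
    toSL α hα A ∈ Subgroup.center (Matrix.SpecialLinearGroup (Fin 2) R) ↔ A = 1 ∨ A = -1 := by
  have hneg : (toSL α hα (-1) : Matrix (Fin 2) (Fin 2) R) = Matrix.scalar (Fin 2) (-1) := by
    ext i j
    rw [coe_toSL]
    fin_cases i <;> fin_cases j <;> simp
  rw [Matrix.SpecialLinearGroup.mem_center_iff, Fintype.card_fin]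
  constructor
  · rintro ⟨r, hr, h⟩
    have hr' : (r - 1) * (r + 1) = 0 := by linear_combination hr
    rcases mul_eq_zero.1 hr' with h1 | h1
    · left
      apply hinj
      rw [map_one]
      apply Subtype.ext
      rw [← h, sub_eq_zero.1 h1, map_one]
      rfl
    · right
      apply hinj
      apply Subtype.ext
      rw [← h, hneg, eq_neg_of_add_eq_zero_left h1]
  · rintro (rfl | rfl)
    · exact ⟨1, by simp, by rw [map_one, map_one]; rfl⟩
    · exact ⟨-1, by simp, hneg.symm⟩

end toSL

theorem equiv_PSL2 (K : Type) [Field K] [NumberField K] (hdeg : Module.finrank ℚ K = 2)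
    (hK : ∃ α : K, α ^ 2 = -13) : Nonempty (PSL2 (𝓞 K) ≃* Γ) := by
  obtain ⟨α', hα'⟩ := hK
  have hint : IsIntegral ℤ α' := by
    refine IsIntegral.of_pow (n := 2) (by norm_num) ?_
    rw [hα']
    simpa using isIntegral_algebraMap (R := ℤ) (A := K) (x := -13)
  obtain ⟨α, rfl⟩ : ∃ α : 𝓞 K, (α : K) = α' := ⟨⟨α', hint⟩, rfl⟩
  have hα : α ^ 2 = -13 := by
    apply RingOfIntegers.ext
    push_cast
    exact hα'
  have hbij := toSL_bijective α hα (by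
    intro x
    obtain ⟨m, n, h⟩ := exists_int_add_int_mul hdeg hα' (RingOfIntegers.isIntegral_coe x)
    refine ⟨m, n, ?_⟩
    apply RingOfIntegers.ext
    push_cast
    exact h) (by
    intro m n m' n' h
    have := congrArg (fun x : 𝓞 K => (x : K)) h
    push_cast at this
    exact root_coords_unique hα' this)
  let φ : S →* PSL2 (𝓞 K) := (QuotientGroup.mk' _).comp (toSL α hα)
  have hφ : ∀ A B, φ A = φ B ↔ Γ.mk A = Γ.mk B := by
    intro A B
    have h1 : φ A = φ B ↔ A⁻¹ * B = 1 ∨ A⁻¹ * B = -1 := by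
      rw [← toSL_mem_center α hα hbij.1, map_mul, map_inv]
      exact QuotientGroup.eq
    rw [h1, Γ.mk_eq_mk, inv_mul_eq_one, inv_mul_eq_iff_eq_mul, S.mul_neg, mul_one]
    refine or_congr Iff.rfl ⟨fun h => by rw [h, S.neg_neg], fun h => by rw [h, S.neg_neg]⟩
  let ψ : Γ →* PSL2 (𝓞 K) :=
    { toFun := Quotient.lift (s := S.setoid) φ fun A B h => (hφ A B).2 (Γ.mk_eq_mk.2 h)
      map_one' := map_one φ
      map_mul' := by
        intro g h
        obtain ⟨A, rfl⟩ := Γ.mk_surj g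
        obtain ⟨B, rfl⟩ := Γ.mk_surj h
        exact map_mul φ A B }
  have hψ : Function.Bijective ψ := by
    constructor
    · intro g h
      obtain ⟨A, rfl⟩ := Γ.mk_surj g
      obtain ⟨B, rfl⟩ := Γ.mk_surj h
      exact (hφ A B).1
    · intro g
      obtain ⟨M, rfl⟩ := QuotientGroup.mk'_surjective _ g
      obtain ⟨A, rfl⟩ := hbij.2 M
      exact ⟨Γ.mk A, rfl⟩
  exact ⟨(MulEquiv.ofBijective ψ hψ).symm⟩

end Bianchi

namespace Bianchi

/-- Linear functionals `A a + C c + X x + Y y` on binary Hermitian forms over `ℤ[√-13]`. -/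
abbrev Fn : Type := ℤ × ℤ × ℤ × ℤ

/-- The value of a functional at the rank one form of the vector `(p, q)`. -/
def val (f : Fn) (p0 p1 q0 q1 : ℤ) : ℤ :=
  f.1 * (p0 * p0 + 13 * (p1 * p1)) + f.2.1 * (q0 * q0 + 13 * (q1 * q1)) +
    f.2.2.1 * (p0 * q0 + 13 * (p1 * q1)) + f.2.2.2 * (p1 * q0 - p0 * q1)

/-- The value of a functional at the image of `(p, q)` under a matrix. -/
def valS (f : Fn) (A : S) (p0 p1 q0 q1 : ℤ) : ℤ :=
  val f (A.a0 * p0 - 13 * (A.a1 * p1) + (A.b0 * q0 - 13 * (A.b1 * q1)))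
    (A.a0 * p1 + A.a1 * p0 + (A.b0 * q1 + A.b1 * q0))
    (A.c0 * p0 - 13 * (A.c1 * p1) + (A.d0 * q0 - 13 * (A.d1 * q1)))
    (A.c0 * p1 + A.c1 * p0 + (A.d0 * q1 + A.d1 * q0))

/-- Pulling a functional back along a matrix. -/
def compS (f : Fn) (A : S) : Fn :=
  (valS f A 1 0 0 0, valS f A 0 0 1 0, valS f A 1 0 1 0 - valS f A 1 0 0 0 - valS f A 0 0 1 0,
    valS f A 0 1 1 0 - 13 * valS f A 1 0 0 0 - valS f A 0 0 1 0)

theorem val_compS (f : Fn) (A : S) (p0 p1 q0 q1 : ℤ) :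
    val (compS f A) p0 p1 q0 q1 = valS f A p0 p1 q0 q1 := by
  simp only [val, compS, valS]
  ring

theorem valS_mul (f : Fn) (A B : S) (p0 p1 q0 q1 : ℤ) :
    valS f (A * B) p0 p1 q0 q1 = valS (compS f A) B p0 p1 q0 q1 := by
  conv_rhs => rw [valS, val_compS, valS]
  rw [valS]
  congr 1 <;> simp only [S.mul_a0, S.mul_a1, S.mul_b0, S.mul_b1, S.mul_c0, S.mul_c1, S.mul_d0,
    S.mul_d1] <;> ring

theorem compS_mul (f : Fn) (A B : S) : compS f (A * B) = compS (compS f A) B := by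
  conv_lhs => rw [compS]
  simp only [valS_mul]
  rfl

theorem valS_neg (f : Fn) (A : S) (p0 p1 q0 q1 : ℤ) :
    valS f (-A) p0 p1 q0 q1 = valS f A p0 p1 q0 q1 := by
  simp only [valS, val, S.neg_a0, S.neg_a1, S.neg_b0, S.neg_b1, S.neg_c0, S.neg_c1, S.neg_d0,
    S.neg_d1]
  ring

theorem valS_lin (f g : Fn) (k l : ℤ) (A : S) (p0 p1 q0 q1 : ℤ) :
    valS (k • f + l • g) A p0 p1 q0 q1 = k * valS f A p0 p1 q0 q1 + l * valS g A p0 p1 q0 q1 := by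
  simp only [valS, val, Prod.fst_add, Prod.snd_add, Prod.smul_fst, Prod.smul_snd, smul_eq_mul]
  ring

theorem compS_lin (f g : Fn) (k l : ℤ) (A : S) :
    compS (k • f + l • g) A = k • compS f A + l • compS g A := by
  simp only [compS, valS_lin]
  ext <;> simp <;> ring

/-- Pulling a functional back along an element of `Γ`. -/
def comp (f : Fn) : Γ → Fn := Quotient.lift (s := S.setoid) (compS f) (by
  rintro A B (rfl | rfl)
  · rfl
  · simp only [compS, valS_neg])

theorem comp_mk (f : Fn) (A : S) : comp f (Γ.mk A) = compS f A := rfl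

theorem comp_mul (f : Fn) (g h : Γ) : comp f (g * h) = comp (comp f g) h := by
  obtain ⟨A, rfl⟩ := Γ.mk_surj g
  obtain ⟨B, rfl⟩ := Γ.mk_surj h
  exact compS_mul f A B

theorem comp_lin (f g : Fn) (k l : ℤ) (h : Γ) :
    comp (k • f + l • g) h = k • comp f h + l • comp g h := by
  obtain ⟨A, rfl⟩ := Γ.mk_surj h
  exact compS_lin f g k l A

theorem comp_one (f : Fn) : comp f 1 = f := by
  show compS f 1 = f
  ext <;> simp [compS, valS, val] <;> ring

/-- A sufficient condition for a functional to be nonnegative on rank one forms. -/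
def Psd (f : Fn) : Prop :=
  0 ≤ f.1 ∧ 0 ≤ f.2.1 ∧ 13 * f.2.2.1 ^ 2 + f.2.2.2 ^ 2 ≤ 52 * (f.1 * f.2.1)

instance (f : Fn) : Decidable (Psd f) := inferInstanceAs (Decidable (_ ∧ _ ∧ _))

theorem Psd.val_nonneg {f : Fn} (h : Psd f) (p0 p1 q0 q1 : ℤ) : 0 ≤ val f p0 p1 q0 q1 := by
  obtain ⟨A, C, X, Y⟩ := f
  obtain ⟨hA, hC, hD⟩ := h
  simp only at hA hC hD
  rw [val]
  simp only
  rcases hA.eq_or_lt with h0 | h0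
  · subst h0
    have hX : X = 0 := by nlinarith [sq_nonneg X, sq_nonneg Y]
    have hY : Y = 0 := by nlinarith [sq_nonneg X, sq_nonneg Y]
    subst hX hY
    nlinarith [mul_nonneg hC (mul_self_nonneg q0), mul_nonneg hC (mul_self_nonneg q1)]
  · have key : 52 * A * (A * (p0 * p0 + 13 * (p1 * p1)) + C * (q0 * q0 + 13 * (q1 * q1)) +
        X * (p0 * q0 + 13 * (p1 * q1)) + Y * (p1 * q0 - p0 * q1)) =
        13 * (2 * A * p0 + X * q0 - Y * q1) ^ 2 + (26 * A * p1 + 13 * X * q1 + Y * q0) ^ 2 +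
        (52 * (A * C) - 13 * X ^ 2 - Y ^ 2) * (q0 ^ 2 + 13 * q1 ^ 2) := by ring
    have : 0 ≤ (52 * (A * C) - 13 * X ^ 2 - Y ^ 2) * (q0 ^ 2 + 13 * q1 ^ 2) :=
      mul_nonneg (by linarith) (by positivity)
    by_contra hneg
    push Not at hneg
    nlinarith [sq_nonneg (2 * A * p0 + X * q0 - Y * q1),
      sq_nonneg (26 * A * p1 + 13 * X * q1 + Y * q0)]

/-- Nonnegativity at four spanning rank one forms. -/
def Nonneg (f : Fn) : Prop :=
  0 ≤ f.1 ∧ 0 ≤ f.2.1 ∧ 0 ≤ f.1 + f.2.1 + f.2.2.1 ∧ 0 ≤ 13 * f.1 + f.2.1 + f.2.2.2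

theorem Psd.nonneg_comp {f : Fn} (h : Psd f) (g : Γ) : Nonneg (comp f g) := by
  obtain ⟨A, rfl⟩ := Γ.mk_surj g
  have h' : ∀ p0 p1 q0 q1, 0 ≤ val (compS f A) p0 p1 q0 q1 := fun p0 p1 q0 q1 => by
    rw [val_compS]
    exact h.val_nonneg _ _ _ _
  have h1 : 0 ≤ val (compS f A) 1 0 0 0 := h' 1 0 0 0
  have h2 : 0 ≤ val (compS f A) 0 0 1 0 := h' 0 0 1 0
  have h3 : 0 ≤ val (compS f A) 1 0 1 0 := h' 1 0 1 0
  have h4 : 0 ≤ val (compS f A) 0 1 1 0 := h' 0 1 1 0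
  rw [comp_mk]
  simp only [val] at h1 h2 h3 h4
  refine ⟨?_, ?_, ?_, ?_⟩ <;> linarith

/-- Lexicographic negativity. -/
def Neg (f : Fn) : Prop :=
  f.1 < 0 ∨ f.1 = 0 ∧ (f.2.1 < 0 ∨ f.2.1 = 0 ∧ (f.2.2.1 < 0 ∨ f.2.2.1 = 0 ∧ f.2.2.2 < 0))

instance (f : Fn) : Decidable (Neg f) := inferInstanceAs (Decidable (_ ∨ _))

theorem Neg.add {f g : Fn} (hf : Neg f) (hg : Neg g) : Neg (f + g) := by
  simp only [Neg, Prod.fst_add, Prod.snd_add] at *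
  omega

theorem Neg.smul {f : Fn} (hf : Neg f) {k : ℤ} (hk : 0 < k) : Neg (k • f) := by
  simp only [Neg, Prod.smul_fst, Prod.smul_snd, smul_eq_mul] at *
  rcases hf with h | ⟨h, h' | ⟨h', h'' | ⟨h'', h3⟩⟩⟩
  · exact Or.inl (mul_neg_of_pos_of_neg hk h)
  · exact Or.inr ⟨by rw [h, mul_zero], Or.inl (mul_neg_of_pos_of_neg hk h')⟩
  · exact Or.inr ⟨by rw [h, mul_zero], Or.inr ⟨by rw [h', mul_zero],
      Or.inl (mul_neg_of_pos_of_neg hk h'')⟩⟩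
  · exact Or.inr ⟨by rw [h, mul_zero], Or.inr ⟨by rw [h', mul_zero],
      Or.inr ⟨by rw [h'', mul_zero], mul_neg_of_pos_of_neg hk h3⟩⟩⟩

theorem Neg.not_nonneg {f : Fn} (hf : Neg f) : ¬ Nonneg f := by
  simp only [Neg, Nonneg] at *
  omega

theorem not_neg_neg_iff {f : Fn} (hf : f ≠ 0) : Neg (-f) ↔ ¬ Neg f := by
  have : ¬ (f.1 = 0 ∧ f.2.1 = 0 ∧ f.2.2.1 = 0 ∧ f.2.2.2 = 0) := fun h =>
    hf (Prod.ext h.1 (Prod.ext h.2.1 (Prod.ext h.2.2.1 h.2.2.2)))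
  simp only [Neg, Prod.fst_neg, Prod.snd_neg]
  omega

/-- The lexicographic size of a nonnegative functional. -/
def size (f : Fn) : ℕ ×ₗ ℕ ×ₗ ℕ ×ₗ ℕ :=
  toLex (f.1.toNat, toLex (f.2.1.toNat, toLex ((f.1 + f.2.1 + f.2.2.1).toNat,
    (13 * f.1 + f.2.1 + f.2.2.2).toNat)))

theorem size_lt {f g : Fn} (hf : Nonneg f) (hg : Nonneg g) (h : Neg (f - g)) :
    size f < size g := by
  simp only [size, Prod.Lex.toLex_lt_toLex, Nonneg, Neg, Prod.fst_sub, Prod.snd_sub] at *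
  omega

end Bianchi

namespace Bianchi

/-- The four families of chambers. -/
abbrev Jt : Type := Bool × Bool

/-- The sign attached to a Boolean. -/
def sgn : Bool → ℤ
  | true => -1
  | false => 1

/-- A functional with the signs of its last two coordinates changed. -/
def flip (j : Jt) (f : Fn) : Fn := (f.1, f.2.1, sgn j.1 * f.2.2.1, sgn j.2 * f.2.2.2)

/-- Conjugation of a matrix by an isometry of the chamber structure. -/
def phi (j : Jt) (A : S) : S where
  a0 := A.a0
  a1 := sgn j.1 * sgn j.2 * A.a1
  b0 := sgn j.1 * A.b0
  b1 := sgn j.2 * A.b1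
  c0 := sgn j.1 * A.c0
  c1 := sgn j.2 * A.c1
  d0 := A.d0
  d1 := sgn j.1 * sgn j.2 * A.d1
  re := by
    rcases j with ⟨_ | _, _ | _⟩ <;> simp only [sgn] <;> linear_combination A.re
  im := by
    rcases j with ⟨_ | _, _ | _⟩ <;> simp only [sgn] <;>
      first | linear_combination A.im | linear_combination -A.im

/-- The ten facets of the fundamental chamber. -/
def facet (s : Fin 10) : Fn :=
  ![(0, 0, 1, 0), (0, 0, 0, 1), (0, 1, -2, 0), (0, 1, 0, -2), (1, -1, 0, 0), (1, 3, -1, -13),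
    (3, 4, 0, -26), (2, 2, -2, -13), (3, 4, -2, -24), (2, 2, -1, -14)] s

/-- The functional of a facet of a chamber at the identity. -/
def E (j : Jt) (s : Fin 10) : Fn := flip j (facet s)

/-- Matrices crossing the facets of the fundamental chamber. -/
def n0 (s : Fin 10) : S :=
  ![1, 1, ⟨1, 0, 1, 0, 0, 0, 1, 0, by decide, by decide⟩,
    ⟨1, 0, 0, 1, 0, 0, 1, 0, by decide, by decide⟩,
    ⟨0, 0, 1, 0, -1, 0, 0, 0, by decide, by decide⟩,
    ⟨1, 1, -5, 0, 3, 0, -1, 1, by decide, by decide⟩,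
    ⟨0, 1, 4, 0, 3, 0, 0, -1, by decide, by decide⟩,
    ⟨2, 1, 4, 0, 4, 0, 2, -1, by decide, by decide⟩,
    ⟨12, -1, 0, 4, 0, -3, 12, 1, by decide, by decide⟩,
    ⟨14, -1, 0, 4, 0, -4, 14, 1, by decide, by decide⟩] s

/-- The element of `Γ` crossing a facet. -/
def cross (j : Jt) (s : Fin 10) : Γ := Γ.mk (phi j (n0 s))

/-- Whether crossing a facet changes the second label rather than the first. -/
def vertical (s : Fin 10) : Bool :=
  ![false, true, false, true, false, true, false, false, true, true] s

/-- The label of the neighbour across a facet. -/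
def jmv (j : Jt) (s : Fin 10) : Jt := if vertical s then (j.1, !j.2) else (!j.1, j.2)

/-- The symmetry of the fundamental chamber. -/
def tau (s : Fin 10) : Fin 10 := ![7, 9, 6, 8, 4, 5, 2, 0, 3, 1] s

/-- The relabelling of facets when crossing a facet. -/
def relabel (s t : Fin 10) : Fin 10 := if s = 5 then tau t else t

/-- The matrix describing how facets are reflected. -/
def cartan (t s : Fin 10) : ℤ :=
  ![![2, 0, -1, 0, 0, -1, 0, -4, -13, -26], ![0, 2, 0, -1, 0, -1, -1, -2, -12, -28],
    ![-4, 0, 2, 0, -1, 0, -3, 0, -13, -52], ![0, -4, 0, 2, -1, 0, -1, -4, -15, -48],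
    ![0, 0, -1, -13, 2, -4, -1, 0, -13, 0], ![-2, -26, 0, 0, -2, 2, 0, -2, 0, -26],
    ![0, -52, -3, -13, -1, 0, 2, -4, 0, 0], ![-4, -26, 0, -13, 0, -1, -1, 2, 0, 0],
    ![-4, -48, -1, -15, -1, 0, 0, 0, 2, -4], ![-2, -28, -1, -12, 0, -1, 0, 0, -1, 2]] t s

/-- The base functional used to measure heights. -/
def R (j : Jt) : Fn := flip j (7, 9, -4, -52)

/-- The change of the base functional when crossing a facet. -/
def incr (s : Fin 10) : ℤ := ![8, 104, 3, 39, 2, 4, 3, 8, 39, 104] s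

theorem E_cross (j : Jt) (s t : Fin 10) :
    comp (E (jmv j s) (relabel s t)) (cross j s)⁻¹ = E j t - cartan t s • E j s := by
  revert j s t
  decide +kernel

theorem R_cross (j : Jt) (s : Fin 10) :
    comp (R (jmv j s)) (cross j s)⁻¹ = R j + incr s • E j s := by
  revert j s
  decide +kernel

theorem cross_cross (j : Jt) (s : Fin 10) : cross j s * cross (jmv j s) s = 1 := by
  revert j s
  decide +kernel

/-- Chambers: translates of the four chambers around the base vertex. -/
abbrev Chamber : Type := Γ × Jt

/-- Left translation of chambers. -/
def trans (g : Γ) (x : Chamber) : Chamber := (g * x.1, x.2)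

/-- Crossing a facet of a chamber. -/
def mv (x : Chamber) (s : Fin 10) : Chamber := (x.1 * cross x.2 s, jmv x.2 s)

theorem trans_mv (g : Γ) (x : Chamber) (s : Fin 10) : trans g (mv x s) = mv (trans g x) s := by
  simp [trans, mv, mul_assoc]

theorem jmv_jmv (j : Jt) (s : Fin 10) : jmv (jmv j s) s = j := by
  revert j s
  decide

theorem mv_mv (x : Chamber) (s : Fin 10) : mv (mv x s) s = x := by
  refine Prod.ext ?_ (jmv_jmv x.2 s)
  show x.1 * cross x.2 s * cross (jmv x.2 s) s = x.1
  rw [mul_assoc, cross_cross, mul_one]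

/-- The facet functionals of a chamber. -/
def normal (x : Chamber) (s : Fin 10) : Fn := comp (E x.2 s) x.1⁻¹

theorem normal_mv (x : Chamber) (s t : Fin 10) :
    normal (mv x s) (relabel s t) = normal x t - cartan t s • normal x s := by
  have := comp_lin (E x.2 t) (E x.2 s) 1 (-cartan t s) x.1⁻¹
  rw [one_smul, one_smul, neg_smul, neg_smul, ← sub_eq_add_neg, ← sub_eq_add_neg] at this
  rw [normal, normal, normal, ← this, ← E_cross, mv, mul_inv_rev, comp_mul]

theorem relabel_self (s : Fin 10) : relabel s s = s := by
  revert s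
  decide

theorem normal_mv_self (x : Chamber) (s : Fin 10) : normal (mv x s) s = -normal x s := by
  have h := normal_mv x s s
  have h2 : ∀ s, cartan s s = 2 := by decide
  rw [relabel_self, h2] at h
  rw [h, two_smul]
  abel

theorem E_ne_zero (j : Jt) (s : Fin 10) : E j s ≠ 0 := by
  revert j s
  decide

theorem comp_zero (g : Γ) : comp 0 g = 0 := by
  have := comp_lin 0 0 0 0 g
  simpa using this

theorem normal_ne_zero (x : Chamber) (s : Fin 10) : normal x s ≠ 0 := by
  intro h
  apply E_ne_zero x.2 s
  have := congrArg (fun f => comp f x.1) h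
  simpa [normal, ← comp_mul, comp_one, comp_zero] using this

/-- A facet is a descent of a chamber if the chamber lies on its far side. -/
def Desc (x : Chamber) (s : Fin 10) : Prop := Neg (normal x s)

instance (x : Chamber) (s : Fin 10) : Decidable (Desc x s) := inferInstanceAs (Decidable (Neg _))

theorem desc_mv_self (x : Chamber) (s : Fin 10) : Desc (mv x s) s ↔ ¬ Desc x s := by
  rw [Desc, normal_mv_self, not_neg_neg_iff (normal_ne_zero x s), Desc]

/-- The base functional of a chamber. -/
def base (x : Chamber) : Fn := comp (R x.2) x.1⁻¹

theorem base_nonneg (x : Chamber) : Nonneg (base x) := by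
  have h : ∀ j, Psd (R j) := by decide +kernel
  exact (h x.2).nonneg_comp _

/-- The height of a chamber. -/
def ht (x : Chamber) : ℕ ×ₗ ℕ ×ₗ ℕ ×ₗ ℕ := size (base x)

theorem ht_lt {x y : Chamber} (h : Neg (base x - base y)) : ht x < ht y :=
  size_lt (base_nonneg x) (base_nonneg y) h

theorem base_mv (x : Chamber) (s : Fin 10) :
    base (mv x s) = base x + incr s • normal x s := by
  have := comp_lin (R x.2) (E x.2 s) 1 (incr s) x.1⁻¹
  rw [one_smul, one_smul] at this
  rw [base, base, normal, ← this, ← R_cross, mv, mul_inv_rev, comp_mul]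

theorem ht_mv_lt {x : Chamber} {s : Fin 10} (h : Desc x s) : ht (mv x s) < ht x := by
  apply ht_lt
  rw [base_mv, add_sub_cancel_left]
  have hc : ∀ s, 0 < incr s := by decide
  exact h.smul (hc s)

/-- Facets that meet. -/
def adj (s t : Fin 10) : Bool := decide (cartan s t * cartan t s < 4 ∨ s = t)

/-- Two facets which are not adjacent have a nonnegative combination which is positive. -/
theorem exists_psd (j : Jt) (s t : Fin 10) (h : adj s t = false) :
    ∃ k ∈ [((1 : ℤ), (1 : ℤ)), (2, 1), (1, 2)], Psd (k.1 • E j s + k.2 • E j t) := by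
  revert j s t
  decide +kernel

theorem Desc.adj {x : Chamber} {s t : Fin 10} (hs : Desc x s) (ht : Desc x t) :
    adj s t = true := by
  by_contra h
  obtain ⟨k, hk, hp⟩ := exists_psd x.2 s t (by simpa using h)
  have hpos : 0 < k.1 ∧ 0 < k.2 := by
    have : ∀ k ∈ [((1 : ℤ), (1 : ℤ)), (2, 1), (1, 2)], 0 < k.1 ∧ 0 < k.2 := by decide
    exact this k hk
  have := hp.nonneg_comp x.1⁻¹
  rw [comp_lin] at this
  exact ((hs.smul hpos.1).add (ht.smul hpos.2)).not_nonneg this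

theorem cusp_cases {a c x y : ℤ} (h : a * c = x ^ 2 + 13 * y ^ 2)
    (h0 : 0 ≤ x) (h1 : 0 ≤ y) (h2 : 0 ≤ c - 2 * x) (h3 : 0 ≤ c - 2 * y) (h4 : 0 ≤ a - c)
    (h5 : 0 ≤ a + 3 * c - x - 13 * y) (h6 : 0 ≤ 3 * a + 4 * c - 26 * y)
    (h7 : 0 ≤ 2 * a + 2 * c - 2 * x - 13 * y) (h8 : 0 ≤ 3 * a + 4 * c - 2 * x - 24 * y)
    (h9 : 0 ≤ 2 * a + 2 * c - x - 14 * y) :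
    c = 0 ∨ (x = y ∧ a = 4 * y ∧ 2 * c = 7 * y) := by
  have e : 12 * (x * y * (2 * a + 2 * c - 2 * x - 13 * y)) +
      9 * (x * (a + 3 * c - x - 13 * y) * (2 * a + 2 * c - 2 * x - 13 * y)) +
      12 * (x * (2 * a + 2 * c - 2 * x - 13 * y) * (2 * a + 2 * c - x - 14 * y)) +
      5 * (y * (c - 2 * x) * (3 * a + 4 * c - 26 * y)) +
      39 * (y * (a + 3 * c - x - 13 * y) * (2 * a + 2 * c - x - 14 * y)) +
      (c - 2 * x) * (a + 3 * c - x - 13 * y) * (3 * a + 4 * c - 26 * y) +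
      5 * ((c - 2 * x) * (3 * a + 4 * c - 26 * y) * (2 * a + 2 * c - x - 14 * y)) +
      13 * ((c - 2 * y) * (a - c) * (3 * a + 4 * c - 2 * x - 24 * y)) = 0 := by
    linear_combination (72 * a + 96 * c - 42 * x - 546 * y) * h
  have p1 := mul_nonneg (mul_nonneg h0 h1) h7
  have p2 := mul_nonneg (mul_nonneg h0 h5) h7
  have p3 := mul_nonneg (mul_nonneg h0 h7) h9
  have p4 := mul_nonneg (mul_nonneg h1 h2) h6
  have p5 := mul_nonneg (mul_nonneg h1 h5) h9
  have p6 := mul_nonneg (mul_nonneg h2 h5) h6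
  have p7 := mul_nonneg (mul_nonneg h2 h6) h9
  have p8 := mul_nonneg (mul_nonneg h3 h4) h8
  have q1 : x * y * (2 * a + 2 * c - 2 * x - 13 * y) = 0 := by linarith
  have q3 : x * (2 * a + 2 * c - 2 * x - 13 * y) * (2 * a + 2 * c - x - 14 * y) = 0 := by linarith
  have q5 : y * (a + 3 * c - x - 13 * y) * (2 * a + 2 * c - x - 14 * y) = 0 := by linarith
  have q4 : y * (c - 2 * x) * (3 * a + 4 * c - 26 * y) = 0 := by linarith
  have q6 : (c - 2 * x) * (a + 3 * c - x - 13 * y) * (3 * a + 4 * c - 26 * y) = 0 := by linarith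
  have q7 : (c - 2 * x) * (3 * a + 4 * c - 26 * y) * (2 * a + 2 * c - x - 14 * y) = 0 := by linarith
  have q8 : (c - 2 * y) * (a - c) * (3 * a + 4 * c - 2 * x - 24 * y) = 0 := by linarith
  clear p1 p2 p3 p4 p5 p6 p7 p8 e
  by_contra hcon
  have hc : 0 < c := by
    rcases lt_or_ge 0 c with h' | h'
    · exact h'
    · exact absurd (Or.inl (by linarith)) hcon
  simp only [mul_eq_zero] at q1 q3 q4 q5 q6 q7 q8
  rcases q8 with (q8 | q8) | q8 <;> rcases q1 with (q1 | q1) | q1 <;>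
    rcases q7 with (q7 | q7) | q7 <;> (exfalso; omega)

theorem not_neg_fst {f : Fn} (h : ¬ Neg f) : 0 ≤ f.1 := by
  simp only [Neg] at h
  omega

theorem not_neg_snd {f : Fn} (h : ¬ Neg f) (h0 : f.1 = 0) : 0 ≤ f.2.1 := by
  simp only [Neg] at h
  omega

theorem not_neg_third {f : Fn} (h : ¬ Neg f) (h0 : f.1 = 0) (h1 : f.2.1 = 0) : 0 ≤ f.2.2.1 := by
  simp only [Neg] at h
  omega

theorem not_neg_fourth {f : Fn} (h : ¬ Neg f) (h0 : f.1 = 0) (h1 : f.2.1 = 0) (h2 : f.2.2.1 = 0) :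
    0 ≤ f.2.2.2 := by
  simp only [Neg] at h
  omega

theorem norm_ne_eight (p q : ℤ) : p * p + 13 * (q * q) ≠ 8 * 1 := by
  intro h
  have n0 := mul_self_nonneg p
  have n1 := mul_self_nonneg q
  have h10 : q * q = 0 := by omega
  rw [h10] at h
  have h2 : p < 3 := by nlinarith
  have h3 : -3 < p := by nlinarith
  interval_cases p <;> omega

theorem lower_left_eq_zero {A : S} {j : Jt} (h : ∀ s, 0 ≤ (compS (E j s) A).1) :
    A.c0 = 0 ∧ A.c1 = 0 := by
  have hj1 : sgn j.1 * sgn j.1 = 1 := by cases j.1 <;> rfl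
  have hj2 : sgn j.2 * sgn j.2 = 1 := by cases j.2 <;> rfl
  set a := A.a0 * A.a0 + 13 * (A.a1 * A.a1) with ha
  set c := A.c0 * A.c0 + 13 * (A.c1 * A.c1) with hc
  set x := A.a0 * A.c0 + 13 * (A.a1 * A.c1) with hx
  set y := A.a1 * A.c0 - A.a0 * A.c1 with hy
  have iso : a * c = (sgn j.1 * x) ^ 2 + 13 * (sgn j.2 * y) ^ 2 := by
    linear_combination -(x ^ 2) * hj1 - 13 * y ^ 2 * hj2
  have key : ∀ s, (compS (E j s) A).1 = (facet s).1 * a + (facet s).2.1 * c +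
      (facet s).2.2.1 * (sgn j.1 * x) + (facet s).2.2.2 * (sgn j.2 * y) := fun s => by
    simp only [compS, valS, val, E, flip, ha, hc, hx, hy]
    ring
  simp only [key] at h
  have hh := cusp_cases iso (by simpa [facet] using h 0) (by simpa [facet] using h 1)
    (by linarith [show 0 ≤ 0 * a + 1 * c + -2 * (sgn j.1 * x) + 0 * (sgn j.2 * y) from h 2])
    (by linarith [show 0 ≤ 0 * a + 1 * c + 0 * (sgn j.1 * x) + -2 * (sgn j.2 * y) from h 3])
    (by linarith [show 0 ≤ 1 * a + -1 * c + 0 * (sgn j.1 * x) + 0 * (sgn j.2 * y) from h 4])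
    (by linarith [show 0 ≤ 1 * a + 3 * c + -1 * (sgn j.1 * x) + -13 * (sgn j.2 * y) from h 5])
    (by linarith [show 0 ≤ 3 * a + 4 * c + 0 * (sgn j.1 * x) + -26 * (sgn j.2 * y) from h 6])
    (by linarith [show 0 ≤ 2 * a + 2 * c + -2 * (sgn j.1 * x) + -13 * (sgn j.2 * y) from h 7])
    (by linarith [show 0 ≤ 3 * a + 4 * c + -2 * (sgn j.1 * x) + -24 * (sgn j.2 * y) from h 8])
    (by linarith [show 0 ≤ 2 * a + 2 * c + -1 * (sgn j.1 * x) + -14 * (sgn j.2 * y) from h 9])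
  have hc0 : c = 0 := by
    rcases hh with hh | ⟨h1, h2, h3⟩
    · exact hh
    · exfalso
      obtain ⟨k, hk⟩ : ∃ k, sgn j.2 * y = 2 * k := ⟨c - 3 * (sgn j.2 * y), by linarith⟩
      have hxk : x = sgn j.1 * (2 * k) := by linear_combination sgn j.1 * (h1 + hk) - x * hj1
      have hyk : y = sgn j.2 * (2 * k) := by linear_combination sgn j.2 * hk - y * hj2
      have hak : a = 8 * k := by linarith
      have hck : c = 7 * k := by linarith
      have hdet : a * (A.d0 * A.d0 + 13 * (A.d1 * A.d1)) + c * (A.b0 * A.b0 + 13 * (A.b1 * A.b1))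
          - 2 * (x * (A.b0 * A.d0 + 13 * (A.b1 * A.d1)) + 13 * y * (A.b1 * A.d0 - A.b0 * A.d1))
          = 1 := by
        linear_combination (A.a0 * A.d0 - 13 * (A.a1 * A.d1) - (A.b0 * A.c0 - 13 * (A.b1 * A.c1))
          + 1) * A.re + 13 * (A.a0 * A.d1 + A.a1 * A.d0 - (A.b0 * A.c1 + A.b1 * A.c0)) * A.im
      have hdvd : k ∣ 1 := by
        rw [← hdet, hak, hck, hxk, hyk]
        exact ⟨8 * (A.d0 * A.d0 + 13 * (A.d1 * A.d1)) + 7 * (A.b0 * A.b0 + 13 * (A.b1 * A.b1))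
          - 4 * (sgn j.1 * (A.b0 * A.d0 + 13 * (A.b1 * A.d1)) +
            13 * sgn j.2 * (A.b1 * A.d0 - A.b0 * A.d1)), by ring⟩
      have ha0 : 0 ≤ a := by
        have n0 := mul_self_nonneg A.a0
        have n1 := mul_self_nonneg A.a1
        linarith
      have hk1 : k = 1 := Int.eq_one_of_dvd_one (by linarith) hdvd
      rw [hk1, ha] at hak
      exact norm_ne_eight _ _ hak
  have n0 := mul_self_nonneg A.c0
  have n1 := mul_self_nonneg A.c1
  exact ⟨mul_self_eq_zero.1 (by linarith), mul_self_eq_zero.1 (by linarith)⟩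

/-- A chamber without descents is the fundamental chamber. -/
theorem eq_root_of_no_desc {x : Chamber} (h : ∀ s, ¬ Desc x s) : x = (1, false, false) := by
  obtain ⟨γ, j⟩ := x
  obtain ⟨A, hA⟩ := Γ.mk_surj γ⁻¹
  have h' : ∀ s, ¬ Neg (compS (E j s) A) := fun s => by
    have := h s
    rwa [Desc, normal, ← hA] at this
  obtain ⟨hc0, hc1⟩ := lower_left_eq_zero fun s => not_neg_fst (h' s)
  have hre := A.re
  have him := A.im
  rw [hc0, hc1] at hre him
  have hN : (A.a0 * A.a0 + 13 * (A.a1 * A.a1)) * (A.d0 * A.d0 + 13 * (A.d1 * A.d1)) = 1 := by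
    linear_combination (A.a0 * A.d0 - 13 * (A.a1 * A.d1) + 1) * hre +
      13 * (A.a0 * A.d1 + A.a1 * A.d0) * him
  have n0 := mul_self_nonneg A.a0
  have n1 := mul_self_nonneg A.a1
  have hNa : A.a0 * A.a0 + 13 * (A.a1 * A.a1) = 1 :=
    Int.eq_one_of_dvd_one (by linarith) ⟨_, hN.symm⟩
  have ha1 : A.a1 = 0 := mul_self_eq_zero.1 (by omega)
  rw [ha1] at hre him hNa
  have haa : A.a0 * A.a0 = 1 := by linarith
  have hd0 : A.d0 = A.a0 := by linear_combination A.a0 * hre - A.d0 * haa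
  have hd1 : A.d1 = 0 := by linear_combination A.a0 * him - A.d1 * haa
  have key : ∀ s, compS (E j s) A = ((facet s).1,
      (facet s).1 * (A.b0 * A.b0 + 13 * (A.b1 * A.b1)) + (facet s).2.1 +
        sgn j.1 * (facet s).2.2.1 * (A.a0 * A.b0) + sgn j.2 * (facet s).2.2.2 * (A.a0 * A.b1),
      2 * (facet s).1 * (A.a0 * A.b0) + sgn j.1 * (facet s).2.2.1,
      26 * (facet s).1 * (A.a0 * A.b1) + sgn j.2 * (facet s).2.2.2) := fun s => by
    simp only [compS, valS, val, E, flip, hc0, hc1, ha1, hd0, hd1]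
    ext
    · linear_combination (facet s).1 * haa
    · linear_combination (facet s).2.1 * haa
    · linear_combination sgn j.1 * (facet s).2.2.1 * haa
    · linear_combination sgn j.2 * (facet s).2.2.2 * haa
  simp only [key] at h'
  have e0 := not_neg_snd (h' 0) rfl
  have e1 := not_neg_snd (h' 1) rfl
  have e2 := not_neg_snd (h' 2) rfl
  have e3 := not_neg_snd (h' 3) rfl
  simp [facet] at e0 e1 e2 e3
  have hb0 : sgn j.1 * (A.a0 * A.b0) = 0 := by
    have : sgn j.1 * 2 * (A.a0 * A.b0) = 2 * (sgn j.1 * (A.a0 * A.b0)) := by ring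
    omega
  have hb1 : sgn j.2 * (A.a0 * A.b1) = 0 := by
    have : sgn j.2 * 2 * (A.a0 * A.b1) = 2 * (sgn j.2 * (A.a0 * A.b1)) := by ring
    omega
  have f0 := not_neg_third (h' 0) rfl (by simp [facet, hb0])
  have f1 := not_neg_fourth (h' 1) rfl (by simp [facet, hb1]) (by simp [facet])
  simp [facet] at f0 f1
  obtain ⟨j1, j2⟩ := j
  have hj1 : j1 = false := by
    cases j1
    · rfl
    · exact absurd f0 (by simp [sgn])
  have hj2 : j2 = false := by
    cases j2
    · rfl
    · exact absurd f1 (by simp [sgn])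
  subst hj1 hj2
  have hb0' : A.b0 = 0 := by
    have hb0 : 1 * (A.a0 * A.b0) = 0 := hb0
    linear_combination A.a0 * hb0 - A.b0 * haa
  have hb1' : A.b1 = 0 := by
    have hb1 : 1 * (A.a0 * A.b1) = 0 := hb1
    linear_combination A.a0 * hb1 - A.b1 * haa
  have hA1 : Γ.mk A = 1 := by
    rw [← Γ.mk_one, Γ.mk_eq_mk]
    rcases mul_self_eq_one_iff.1 haa with h1 | h1
    · left
      ext <;> simp [*]
    · right
      ext <;> simp [*]
  rw [hA1, eq_comm, inv_eq_one] at hA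
  rw [hA]

end Bianchi

namespace Bianchi

/-- Types of cells of the fundamental chamber and of its mirrors. -/
inductive Ty
  | a | b | a2 | b2 | e06 | e27 | e4 | e5 | f
  | r104 | r124 | r946 | r947 | r305 | r325 | r856 | r857 | q14 | q94 | q35 | q85
  deriving DecidableEq

namespace Ty

instance : Fintype Ty :=
  ⟨{a, b, a2, b2, e06, e27, e4, e5, f, r104, r124, r946, r947, r305, r325, r856, r857, q14, q94,
    q35, q85}, fun c => by cases c <;> decide⟩

/-- Facets of a chamber containing a cell, except for its mirror. -/
def walls : Ty → List (Fin 10)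
  | a => [0, 4, 6]
  | b => [0, 5, 6]
  | a2 => [2, 4, 7]
  | b2 => [2, 5, 7]
  | e06 => [0, 6]
  | e27 => [2, 7]
  | e4 => [4]
  | e5 => [5]
  | f => []
  | r104 => [0, 4]
  | r124 => [2, 4]
  | r946 => [4, 6]
  | r947 => [4, 7]
  | r305 => [0, 5]
  | r325 => [2, 5]
  | r856 => [5, 6]
  | r857 => [5, 7]
  | q14 => [4]
  | q94 => [4]
  | q35 => [5]
  | q85 => [5]

/-- The mirror crossed by a cell. -/
def mirror : Ty → Option (Fin 10)
  | r104 | r124 | q14 => some 1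
  | r946 | r947 | q94 => some 9
  | r305 | r325 | q35 => some 3
  | r856 | r857 | q85 => some 8
  | _ => none

/-- The effect of the symmetry of the fundamental chamber on cells. -/
def swap : Ty → Ty
  | a => a2
  | a2 => a
  | b => b2
  | b2 => b
  | e06 => e27
  | e27 => e06
  | e4 => e4
  | e5 => e5
  | f => f
  | r104 => r947
  | r947 => r104
  | r124 => r946
  | r946 => r124
  | r305 => r857
  | r857 => r305
  | r325 => r856
  | r856 => r325
  | q14 => q94
  | q94 => q14
  | q35 => q85
  | q85 => q35

/-- The relabelling of cells when crossing a facet. -/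
def twist (s : Fin 10) (c : Ty) : Ty := if s = 5 then swap c else c

end Ty

/-- A chamber together with one of its cells. -/
abbrev Corner : Type := Chamber × Ty

/-- Left translation of corners. -/
def ctrans (g : Γ) (k : Corner) : Corner := (trans g k.1, k.2)

/-- Crossing a facet containing the cell. -/
def cmv (k : Corner) (s : Fin 10) : Corner := (mv k.1 s, k.2.twist s)

theorem ctrans_cmv (g : Γ) (k : Corner) (s : Fin 10) :
    ctrans g (cmv k s) = cmv (ctrans g k) s := by
  simp only [ctrans, cmv, trans_mv]

theorem cmv_cmv (k : Corner) (s : Fin 10) : cmv (cmv k s) s = k := by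
  refine Prod.ext (mv_mv k.1 s) ?_
  have : ∀ s c, Ty.twist s (Ty.twist s c) = c := by decide
  exact this s k.2

theorem ctrans_one_eq (k : Corner) : ctrans k.1.1 ((1, k.1.2), k.2) = k := by
  simp [ctrans, trans]

theorem exists_ctrans (k : Corner) : ∃ g j c, k = ctrans g ((1, j), c) :=
  ⟨k.1.1, k.1.2, k.2, (ctrans_one_eq k).symm⟩

theorem walls_cmv {k : Corner} {s : Fin 10} (hs : s ∈ k.2.walls) : s ∈ (cmv k s).2.walls := by
  have : ∀ c : Ty, ∀ s ∈ c.walls, s ∈ (c.twist s).walls := by decide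
  exact this k.2 s hs

theorem base_trans (g : Γ) (x : Chamber) : base (trans g x) = comp (base x) g⁻¹ := by
  rw [base, base, trans, mul_inv_rev, comp_mul]

/-- The representative of a cell: the chamber without descents through the cell, on the far
side of the mirror. -/
def own (k : Corner) : Corner :=
  match h : k.2.walls.find? (fun s => Desc k.1 s) with
  | some s => own (cmv k s)
  | none =>
    match k.2.mirror with
    | none => k
    | some i => if Desc k.1 i then k else cmv k i
termination_by ht k.1
decreasing_by
  exact ht_mv_lt (by simpa using List.find?_some h)

/-- Braid paths around codimension two cells, with the coefficients of the heights. -/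
def path (s t : Fin 10) : List (Fin 10 × ℤ × ℤ) :=
  match s.val, t.val with
  | 0, 4 => [(4, 8, 0), (0, 8, 2)]
  | 0, 5 => [(5, 8, 0), (7, 16, 4), (5, 24, 12), (0, 24, 16), (5, 16, 16), (7, 8, 12)]
  | 0, 6 => [(6, 8, 0), (0, 8, 3)]
  | 2, 4 => [(4, 3, 0), (2, 5, 2), (4, 5, 5), (2, 3, 5)]
  | 2, 5 => [(5, 3, 0), (6, 3, 4)]
  | 2, 7 => [(7, 3, 0), (2, 3, 8)]
  | 4, 0 => [(0, 2, 0), (4, 2, 8)]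
  | 4, 2 => [(2, 2, 0), (4, 5, 3), (2, 5, 5), (4, 2, 5)]
  | 4, 6 => [(6, 2, 0), (4, 5, 3), (6, 5, 5), (4, 2, 5)]
  | 4, 7 => [(7, 2, 0), (4, 2, 8)]
  | 5, 0 => [(7, 4, 0), (5, 12, 8), (0, 16, 16), (5, 16, 24), (7, 12, 24), (5, 4, 16)]
  | 5, 2 => [(6, 4, 0), (5, 4, 3)]
  | 5, 6 => [(2, 4, 0), (5, 4, 3)]
  | 5, 7 => [(0, 4, 0), (5, 12, 8), (7, 16, 16), (5, 16, 24), (0, 12, 24), (5, 4, 16)]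
  | 6, 0 => [(0, 3, 0), (6, 3, 8)]
  | 6, 4 => [(4, 3, 0), (6, 5, 2), (4, 5, 5), (6, 3, 5)]
  | 6, 5 => [(5, 3, 0), (2, 3, 4)]
  | 7, 2 => [(2, 8, 0), (7, 8, 3)]
  | 7, 4 => [(4, 8, 0), (7, 8, 2)]
  | 7, 5 => [(5, 8, 0), (0, 16, 4), (5, 24, 12), (7, 24, 16), (5, 16, 16), (0, 8, 12)]
  | _, _ => []

/-- A path of facets through a cell which stays below the starting chamber. -/
def descending (j : Jt) (s t : Fin 10) : List (Fin 10 × ℤ × ℤ) → Corner → Corner → Bool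
  | [], y, z => y = z
  | (l, α, β) :: L, y, z => l ∈ y.2.walls ∧ 0 ≤ α ∧ 0 ≤ β ∧ 0 < α + β ∧
      base y.1 = R j + (α • E j s + β • E j t) ∧ descending j s t L (cmv y l) z

theorem descending_path (j : Jt) (c : Ty) : ∀ s ∈ c.walls, ∀ t ∈ c.walls, s ≠ t →
    descending j s t (path s t) (cmv ((1, j), c) s) (cmv ((1, j), c) t) = true := by
  revert j c
  decide +kernel

theorem ht_lt_of_descending {g : Γ} {j : Jt} {s t : Fin 10} (hs : Desc (g, j) s)
    (ht' : Desc (g, j) t) {L : List (Fin 10 × ℤ × ℤ)} {y z : Corner}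
    (h : descending j s t L y z = true) (hz : ht (ctrans g z).1 < ht (g, j)) :
    ht (ctrans g y).1 < ht (g, j) := by
  match L, h with
  | [], h =>
    simp only [descending, decide_eq_true_eq] at h
    rwa [h]
  | (l, α, β) :: L, h =>
    simp only [descending, decide_eq_true_eq, Bool.decide_and, Bool.and_eq_true] at h
    obtain ⟨h1, h2, h3, h4, h5, h6⟩ := h
    apply ht_lt
    have e : base (g, j) = comp (R j) g⁻¹ := rfl
    have := comp_lin (R j) (α • E j s + β • E j t) 1 1 g⁻¹
    rw [one_smul, one_smul, one_smul, comp_lin] at this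
    rw [ctrans, base_trans, h5, e, this, one_smul, add_sub_cancel_left]
    rcases h2.eq_or_lt with h | h
    · rw [← h, zero_smul, zero_add]
      exact Neg.smul ht' (by linarith)
    rcases h3.eq_or_lt with h' | h'
    · rw [← h', zero_smul, add_zero]
      exact Neg.smul hs h
    exact (Neg.smul hs h).add (Neg.smul ht' h')

theorem own_eq_of_descending {g : Γ} {j : Jt} {s t : Fin 10} (hs : Desc (g, j) s)
    (ht' : Desc (g, j) t)
    (IH : ∀ y : Corner, ht y.1 < ht (g, j) → ∀ s ∈ y.2.walls, Desc y.1 s →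
      own (cmv y s) = own y) (L : List (Fin 10 × ℤ × ℤ)) (y z : Corner)
    (h : descending j s t L y z = true) (hz : ht (ctrans g z).1 < ht (g, j)) :
    own (ctrans g y) = own (ctrans g z) := by
  induction L generalizing y with
  | nil =>
    simp only [descending, decide_eq_true_eq] at h
    rw [h]
  | cons p L ih =>
    obtain ⟨l, α, β⟩ := p
    have hy := ht_lt_of_descending hs ht' h hz
    simp only [descending, decide_eq_true_eq, Bool.decide_and, Bool.and_eq_true] at h
    obtain ⟨h1, -, -, -, -, h6⟩ := h
    rw [← ih (cmv y l) h6]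
    have hy' := ht_lt_of_descending hs ht' h6 hz
    by_cases hd : Desc (ctrans g y).1 l
    · rw [ctrans_cmv, IH _ hy l h1 hd]
    · have := IH _ hy' l (walls_cmv h1) (by
        rw [ctrans_cmv]
        exact (desc_mv_self _ _).2 hd)
      rw [ctrans_cmv, cmv_cmv] at this
      rw [ctrans_cmv, this]

/-- The representative of a cell does not depend on the chamber. -/
theorem own_cmv (k : Corner) (s : Fin 10) (hs : s ∈ k.2.walls) : own (cmv k s) = own k := by
  have down : ∀ (k : Corner), ∀ s ∈ k.2.walls, Desc k.1 s → own (cmv k s) = own k := by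
    intro k
    induction h : ht k.1 using WellFoundedLT.induction generalizing k with
    | _ m IH =>
      subst h
      intro s hs hd
      conv_rhs => rw [own]
      split
      · rename_i t ht'
        have htd : Desc k.1 t := by simpa using List.find?_some ht'
        have htm := List.mem_of_find?_eq_some ht'
        by_cases hst : s = t
        · rw [hst]
        have := own_eq_of_descending (g := k.1.1) (j := k.1.2) hd htd
          (fun y hy => IH _ hy y rfl) _ _ _ (descending_path k.1.2 k.2 s hs t htm hst)
          (by rw [ctrans_cmv, ctrans_one_eq]; exact ht_mv_lt htd)
        rwa [ctrans_cmv, ctrans_cmv, ctrans_one_eq] at this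
      · rename_i h
        rw [List.find?_eq_none] at h
        exact absurd hd (by simpa using h s hs)
  by_cases hd : Desc k.1 s
  · exact down k s hs hd
  · have := down (cmv k s) s (walls_cmv hs) ((desc_mv_self _ _).2 hd)
    rw [cmv_cmv] at this
    exact this.symm

/-- A corner is owned if its chamber has no descent through the cell except for the mirror. -/
def Owned (k : Corner) : Prop :=
  (∀ s ∈ k.2.walls, ¬ Desc k.1 s) ∧ ∀ i ∈ k.2.mirror, Desc k.1 i

instance (k : Corner) : Decidable (Owned k) :=
  inferInstanceAs (Decidable ((∀ s ∈ k.2.walls, ¬ Desc k.1 s) ∧ ∀ i ∈ k.2.mirror, Desc k.1 i))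

theorem cartan_mirror (c : Ty) : ∀ i ∈ c.mirror, ∀ s ∈ c.walls,
    cartan s i = 0 ∧ relabel i s = s ∧ cartan i s = 0 ∧ relabel s i ∈ (c.twist s).mirror ∧
      ∀ i' ∈ (c.twist s).mirror, i' = relabel s i := by
  revert c
  decide +kernel

theorem desc_mirror {k : Corner} {i s : Fin 10} (hi : i ∈ k.2.mirror) (hs : s ∈ k.2.walls) :
    Desc (mv k.1 i) s ↔ Desc k.1 s := by
  obtain ⟨h1, h2, -⟩ := cartan_mirror k.2 i hi s hs
  have := normal_mv k.1 i s
  rw [h1, h2, zero_smul, sub_zero] at this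
  rw [Desc, this, Desc]

theorem twist_mirror {c : Ty} {i : Fin 10} (hi : i ∈ c.mirror) : c.twist i = c := by
  revert c i
  decide

theorem own_of_forall {k : Corner} (h : ∀ s ∈ k.2.walls, ¬ Desc k.1 s) :
    own k = match k.2.mirror with
    | none => k
    | some i => if Desc k.1 i then k else cmv k i := by
  rw [own]
  split
  · rename_i t ht'
    exact absurd (by simpa using List.find?_some ht') (h t (List.mem_of_find?_eq_some ht'))
  · rfl

theorem own_of_owned {k : Corner} (h : Owned k) : own k = k := by
  rw [own_of_forall h.1]
  split
  · rfl
  · rename_i i hi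
    rw [if_pos (h.2 i hi)]

theorem owned_own (k : Corner) : Owned (own k) := by
  induction h : ht k.1 using WellFoundedLT.induction generalizing k with
  | _ m IH =>
    subst h
    rw [own]
    split
    · rename_i s hs
      exact IH _ (ht_mv_lt (by simpa using List.find?_some hs)) _ rfl
    · rename_i h
      rw [List.find?_eq_none] at h
      have h : ∀ s ∈ k.2.walls, ¬ Desc k.1 s := by simpa using h
      split
      · rename_i hm
        exact ⟨h, by simp [hm]⟩
      · rename_i i hi
        split_ifs with hd
        · exact ⟨h, by simpa [hi] using hd⟩
        · have e : (cmv k i).2 = k.2 := twist_mirror hi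
          refine ⟨?_, ?_⟩
          · rw [e]
            exact fun s hs => (desc_mirror hi hs).not.2 (h s hs)
          · rw [e, hi]
            intro j hj
            cases hj
            exact (desc_mv_self _ _).2 hd

theorem cmv_comm (j : Jt) (c : Ty) : ∀ i ∈ c.mirror, ∀ s ∈ c.walls,
    cmv (cmv ((1, j), c) i) s = cmv (cmv ((1, j), c) s) (relabel s i) := by
  revert j c
  decide +kernel

theorem own_mirror (k : Corner) (i : Fin 10) (hi : i ∈ k.2.mirror) : own (cmv k i) = own k := by
  induction h : ht k.1 using WellFoundedLT.induction generalizing k i with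
  | _ m IH =>
    subst h
    have e : (cmv k i).2 = k.2 := twist_mirror hi
    by_cases hd : ∃ s ∈ k.2.walls, Desc k.1 s
    · obtain ⟨s, hs, hd⟩ := hd
      rw [← own_cmv k s hs, ← own_cmv (cmv k i) s (e ▸ hs)]
      have := congrArg (ctrans k.1.1) (cmv_comm k.1.2 k.2 i hi s hs)
      simp only [ctrans_cmv, ctrans_one_eq] at this
      rw [this]
      exact IH _ (ht_mv_lt hd) _ _ (cartan_mirror k.2 i hi s hs).2.2.2.1 rfl
    · push Not at hd
      have hd' : ∀ s ∈ (cmv k i).2.walls, ¬ Desc (cmv k i).1 s := by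
        rw [e]
        exact fun s hs => (desc_mirror hi hs).not.2 (hd s hs)
      rw [own_of_forall hd, own_of_forall hd', e]
      rw [Option.mem_def] at hi
      simp only [hi, cmv_cmv]
      have := desc_mv_self k.1 i
      change Desc (cmv k i).1 i ↔ _ at this
      simp only [this]
      split_ifs <;> rfl

theorem mirror_twist (c : Ty) (s : Fin 10) : c.mirror = none → (c.twist s).mirror = none := by
  revert c s
  decide

/-- Passing to the representative lowers the height. -/
theorem own_eq_or_ht_lt (k : Corner) (h : ∀ i ∈ k.2.mirror, Desc k.1 i) :
    own k = k ∨ ht (own k).1 < ht k.1 := by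
  induction hk : ht k.1 using WellFoundedLT.induction generalizing k with
  | _ m IH =>
    subst hk
    by_cases hd : ∃ s ∈ k.2.walls, Desc k.1 s
    · right
      obtain ⟨s, hs, hd⟩ := hd
      rw [← own_cmv k s hs]
      have hlt : ht (cmv k s).1 < ht k.1 := ht_mv_lt hd
      have := IH _ hlt (cmv k s) (by
        intro i hi
        rcases hm : k.2.mirror with _ | i'
        · have := mirror_twist _ s hm
          change i ∈ (k.2.twist s).mirror at hi
          simp [this] at hi
        · obtain ⟨-, -, h1, h2, h3⟩ := cartan_mirror k.2 i' hm s hs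
          rw [h3 i hi]
          have e := normal_mv k.1 s i'
          rw [h1, zero_smul, sub_zero] at e
          rw [Desc, cmv, e]
          exact h i' hm) rfl
      rcases this with h' | h'
      · rwa [h']
      · exact h'.trans hlt
    · push Not at hd
      exact Or.inl (own_of_owned ⟨hd, h⟩)

theorem ht_own_le (k : Corner) (h : ∀ i ∈ k.2.mirror, Desc k.1 i) : ht (own k).1 ≤ ht k.1 := by
  rcases own_eq_or_ht_lt k h with h | h
  · rw [h]
  · exact h.le

end Bianchi

namespace Bianchi



/-! ### Integral combinations given by lists -/

section Lists

variable {α β M M' : Type} [AddCommGroup M] [AddCommGroup M']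

/-- The integral combination described by a list. -/
def lsum (v : α → M) (L : List (ℤ × α)) : M := (L.map fun p => p.1 • v p.2).sum

@[simp] theorem lsum_nil (v : α → M) : lsum v [] = 0 := rfl

@[simp] theorem lsum_cons (v : α → M) (p : ℤ × α) (L : List (ℤ × α)) :
    lsum v (p :: L) = p.1 • v p.2 + lsum v L := rfl

@[simp] theorem lsum_append (v : α → M) (L L' : List (ℤ × α)) :
    lsum v (L ++ L') = lsum v L + lsum v L' := by
  simp [lsum]

theorem lsum_map (v : β → M) (f : α → β) (L : List (ℤ × α)) :
    lsum v (L.map fun p => (p.1, f p.2)) = lsum (fun a => v (f a)) L := by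
  simp [lsum, Function.comp_def]

theorem map_lsum (φ : M →ₗ[ℤ] M') (v : α → M) (L : List (ℤ × α)) :
    φ (lsum v L) = lsum (fun a => φ (v a)) L := by
  induction L with
  | nil => simp
  | cons p L ih => simp [ih]

theorem lsum_congr {v v' : α → M} {L : List (ℤ × α)} (h : ∀ p ∈ L, v p.2 = v' p.2) :
    lsum v L = lsum v' L := by
  unfold lsum
  rw [List.map_congr_left fun p hp => by rw [h p hp]]

theorem lsum_mem {v : α → M} {L : List (ℤ × α)} (N : Submodule ℤ M) (h : ∀ p ∈ L, v p.2 ∈ N) :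
    lsum v L ∈ N := by
  induction L with
  | nil => simp
  | cons p L ih =>
    rw [lsum_cons]
    exact N.add_mem (N.smul_mem _ (h p (by simp))) (ih fun q hq => h q (by simp [hq]))

/-- Scaling a list. -/
def lscale (a : ℤ) (L : List (ℤ × α)) : List (ℤ × α) := L.map fun p => (a * p.1, p.2)

@[simp] theorem lsum_lscale (v : α → M) (a : ℤ) (L : List (ℤ × α)) :
    lsum v (lscale a L) = a • lsum v L := by
  induction L with
  | nil => simp [lscale]
  | cons p L ih =>
    rw [lscale] at ih ⊢
    rw [List.map_cons, lsum_cons, ih, lsum_cons, smul_add, mul_smul]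

/-- Substituting lists for the entries of a list. -/
def lbind (f : α → List (ℤ × β)) (L : List (ℤ × α)) : List (ℤ × β) :=
  L.flatMap fun p => lscale p.1 (f p.2)

@[simp] theorem lsum_lbind (v : β → M) (f : α → List (ℤ × β)) (L : List (ℤ × α)) :
    lsum v (lbind f L) = lsum (fun a => lsum v (f a)) L := by
  induction L with
  | nil => simp [lbind]
  | cons p L ih =>
    rw [lbind] at ih ⊢
    rw [List.flatMap_cons, lsum_append, ih, lsum_lscale, lsum_cons]

/-- A test for the vanishing of a combination, where `r` recognises equal entries. -/
def cancel [DecidableEq α] (r : α → α → Bool) : ℕ → List (ℤ × α) → Bool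
  | _, [] => true
  | 0, _ :: _ => false
  | n + 1, (a, x) :: L =>
    match L.find? fun p => r x p.2 with
    | none => decide (a = 0) && cancel r n L
    | some p => cancel r n ((a + p.1, x) :: L.erase p)

theorem lsum_eq_zero_of_cancel [DecidableEq α] {r : α → α → Bool} {v : α → M}
    (hr : ∀ x y, r x y = true → v x = v y) :
    ∀ (n : ℕ) (L : List (ℤ × α)), cancel r n L = true → lsum v L = 0
  | _, [], _ => rfl
  | 0, _ :: _, h => by simp [cancel] at h
  | n + 1, (a, x) :: L, h => by
    rw [cancel] at h
    split at h
    · rw [Bool.and_eq_true, decide_eq_true_eq] at h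
      rw [lsum_cons, lsum_eq_zero_of_cancel hr n L h.2, h.1, zero_smul, zero_add]
    · rename_i p hp
      have h1 := lsum_eq_zero_of_cancel hr n _ h
      have h2 : lsum v L = p.1 • v p.2 + lsum v (L.erase p) := by
        rw [← lsum_cons]
        exact ((List.perm_cons_erase (List.mem_of_find?_eq_some hp)).map _).sum_eq
      rw [lsum_cons] at h1 ⊢
      rw [h2, ← hr x p.2 (by simpa using List.find?_some hp), ← h1, add_smul, add_assoc]

end Lists

/-! ### The cellular chain complex -/

/-- Orientation signs of cells. -/
def sg (j : Jt) : Ty → ℤ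
  | .a | .b | .a2 | .b2 | .e06 | .e27 | .e4 | .f => 1
  | .r856 | .r857 => -sgn j.2
  | _ => sgn j.2

/-- The part of the boundary of a cell in its own chamber, up to orientation. -/
def lb0 : Ty → List (ℤ × Ty)
  | .e06 => [(1, .b), (-1, .a)]
  | .e27 => [(1, .b2), (-1, .a2)]
  | .e4 => [(1, .a2), (-1, .a)]
  | .e5 => [(1, .b2), (-1, .b)]
  | .f => [(1, .e4), (1, .e27), (-1, .e5), (-1, .e06)]
  | .r104 | .r946 => [(1, .a)]
  | .r124 | .r947 => [(1, .a2)]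
  | .r305 | .r856 => [(1, .b)]
  | .r325 | .r857 => [(1, .b2)]
  | .q14 => [(1, .e4), (-1, .r124), (1, .r104)]
  | .q94 => [(1, .e4), (-1, .r947), (1, .r946)]
  | .q35 => [(1, .e5), (-1, .r325), (1, .r305)]
  | .q85 => [(1, .e5), (-1, .r857), (1, .r856)]
  | _ => []

/-- The part of the boundary of a cell across its mirror, up to orientation. -/
def mb0 : Ty → List (ℤ × Ty)
  | .r104 | .r946 => [(-1, .a)]
  | .r124 | .r947 => [(-1, .a2)]
  | .r305 | .r856 => [(-1, .b)]
  | .r325 | .r857 => [(-1, .b2)]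
  | .q14 | .q94 => [(-1, .e4)]
  | .q35 | .q85 => [(-1, .e5)]
  | _ => []

/-- The oriented boundary in the own chamber. -/
def lb (j : Jt) (c : Ty) : List (ℤ × Ty) := (lb0 c).map fun p => (sg j c * p.1 * sg j p.2, p.2)

/-- The oriented boundary across the mirror. -/
def mb (j : Jt) (c : Ty) : List (ℤ × Ty) :=
  (mb0 c).map fun p => (sg j c * p.1 * sg (j.1, !j.2) p.2, p.2)

/-- The boundary of a corner. -/
def bd (k : Corner) : List (ℤ × Corner) :=
  (lb k.1.2 k.2).map (fun p => (p.1, (k.1, p.2))) ++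
    match k.2.mirror with
    | none => []
    | some i => (mb k.1.2 k.2).map fun p => (p.1, (mv k.1 i, p.2))

theorem bd_ctrans (g : Γ) (k : Corner) :
    bd (ctrans g k) = (bd k).map fun p => (p.1, ctrans g p.2) := by
  rw [bd, bd, List.map_append, List.map_map]
  congr 1
  rcases h : k.2.mirror with _ | i
  · simp [ctrans, h]
  · simp [ctrans, h, Function.comp_def, trans_mv]
    rfl

/-- Chains on corners. -/
abbrev KK : Type := Corner →₀ ℤ

/-- The basis element of a corner. -/
noncomputable abbrev kk (k : Corner) : KK := Finsupp.single k 1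

/-- Identifying a corner with its representative. -/
noncomputable def kappa : KK →ₗ[ℤ] KK := Finsupp.lmapDomain ℤ ℤ own

@[simp] theorem kappa_kk (k : Corner) : kappa (kk k) = kk (own k) := by
  simp [kappa]

/-- The boundary map. -/
noncomputable def del : KK →ₗ[ℤ] KK := Finsupp.linearCombination ℤ fun k => lsum kk (bd k)

@[simp] theorem del_kk (k : Corner) : del (kk k) = lsum kk (bd k) := by
  simp [del]

theorem KK_ext {M : Type} [AddCommGroup M] {f g : KK →ₗ[ℤ] M} (h : ∀ k, f (kk k) = g (kk k)) :
    f = g := by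
  refine Finsupp.lhom_ext fun p a => ?_
  rw [show Finsupp.single p a = a • (kk p) by simp, map_smul, map_smul, h]

/-- Corners related by at most `n` crossings through the cell. -/
def conn : ℕ → Corner → Corner → Bool
  | 0, k, k' => decide (k = k')
  | n + 1, k, k' => decide (k = k') || (k.2.walls.any fun s => conn n (cmv k s) k') ||
      k.2.mirror.any fun i => conn n (cmv k i) k'

theorem own_eq_of_conn (g : Γ) : ∀ (n : ℕ) (k k' : Corner), conn n k k' = true →
    own (ctrans g k) = own (ctrans g k')
  | 0, k, k', h => by
    rw [conn, decide_eq_true_eq] at h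
    rw [h]
  | n + 1, k, k', h => by
    rw [conn, Bool.or_eq_true, Bool.or_eq_true, decide_eq_true_eq, List.any_eq_true,
      Option.any_eq_true] at h
    rcases h with (h | ⟨s, hs, h⟩) | ⟨i, hi, h⟩
    · rw [h]
    · rw [← own_eq_of_conn g n _ _ h, ctrans_cmv, own_cmv (ctrans g k) s hs]
    · rw [← own_eq_of_conn g n _ _ h, ctrans_cmv, own_mirror (ctrans g k) i hi]

theorem own_eq_of_conn_one {n : ℕ} {k k' : Corner} (h : conn n k k' = true) : own k = own k' := by
  have := own_eq_of_conn 1 n k k' h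
  simpa [ctrans, trans] using this

theorem cancel_bd_walls (j : Jt) (c : Ty) : ∀ s ∈ c.walls, cancel (conn 1) 12
    (bd (cmv ((1, j), c) s) ++ lscale (-1) (bd ((1, j), c))) = true := by
  revert j c
  decide +kernel

theorem cancel_bd_mirror (j : Jt) (c : Ty) : ∀ s ∈ c.mirror, cancel (conn 1) 12
    (bd (cmv ((1, j), c) s) ++ lscale (-1) (bd ((1, j), c))) = true := by
  revert j c
  decide +kernel

theorem cancel_bd_bd (j : Jt) (c : Ty) :
    cancel (conn 1) 30 (lbind bd (bd ((1, j), c))) = true := by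
  revert j c
  decide +kernel

theorem kappa_lsum_bd_ctrans (g : Γ) (L : List (ℤ × Corner)) {n m : ℕ}
    (h : cancel (conn n) m L = true) : lsum (fun k => kk (own (ctrans g k))) L = 0 :=
  lsum_eq_zero_of_cancel (fun x y hxy => by rw [own_eq_of_conn g n x y hxy]) m L h

theorem kappa_del_kk (k : Corner) :
    kappa (del (kk k)) = lsum (fun y => kk (own (ctrans k.1.1 y))) (bd ((1, k.1.2), k.2)) := by
  conv_lhs => rw [← ctrans_one_eq k]
  rw [del_kk, bd_ctrans, map_lsum, lsum_map]
  simp only [kappa_kk]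

theorem kappa_del_cmv (k : Corner) (s : Fin 10) (hs : s ∈ k.2.walls ∨ s ∈ k.2.mirror) :
    kappa (del (kk (cmv k s))) = kappa (del (kk k)) := by
  have h : cancel (conn 1) 12
      (bd (cmv ((1, k.1.2), k.2) s) ++ lscale (-1) (bd ((1, k.1.2), k.2))) = true := by
    rcases hs with hs | hs
    · exact cancel_bd_walls _ _ s hs
    · exact cancel_bd_mirror _ _ s hs
  have := kappa_lsum_bd_ctrans k.1.1 _ h
  rw [lsum_append, lsum_lscale, neg_one_smul, ← sub_eq_add_neg, sub_eq_zero, ← kappa_del_kk] at this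
  rw [← this]
  conv_lhs => rw [← ctrans_one_eq k]
  rw [← ctrans_cmv, del_kk, bd_ctrans, map_lsum, lsum_map]
  simp only [kappa_kk]

/-- Functions invariant under the crossings through cells take the same value at the
representative of a cell. -/
theorem apply_own {α : Type} (F : Corner → α)
    (hF : ∀ k s, s ∈ k.2.walls ∨ s ∈ k.2.mirror → F (cmv k s) = F k) (k : Corner) :
    F (own k) = F k := by
  induction h : ht k.1 using WellFoundedLT.induction generalizing k with
  | _ m IH =>
    subst h
    rw [own]
    split
    · rename_i s hs
      have hd : Desc k.1 s := by simpa using List.find?_some hs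
      rw [IH _ (ht_mv_lt hd) (cmv k s) rfl, hF k s (Or.inl (List.mem_of_find?_eq_some hs))]
    · split
      · rfl
      · rename_i i hi
        split_ifs
        · rfl
        · rw [hF k i (Or.inr hi)]

theorem kappa_del_own (k : Corner) : kappa (del (kk (own k))) = kappa (del (kk k)) :=
  apply_own (fun k => kappa (del (kk k))) kappa_del_cmv k

theorem kappa_del_kappa (z : KK) : kappa (del (kappa z)) = kappa (del z) := by
  have : (kappa ∘ₗ del) ∘ₗ kappa = kappa ∘ₗ del := KK_ext fun k => by
    simpa using kappa_del_own k
  exact LinearMap.congr_fun this z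

theorem kappa_del_del (z : KK) : kappa (del (del z)) = 0 := by
  have : kappa ∘ₗ del ∘ₗ del = 0 := KK_ext fun k => by
    have := kappa_lsum_bd_ctrans k.1.1 _ (cancel_bd_bd k.1.2 k.2)
    rw [lsum_lbind] at this
    conv_lhs => rw [← ctrans_one_eq k]
    simp only [LinearMap.comp_apply, del_kk, LinearMap.zero_apply]
    rw [bd_ctrans, map_lsum, map_lsum, lsum_map, ← this]
    refine lsum_congr fun p _ => ?_
    rw [del_kk, bd_ctrans, map_lsum, lsum_map]
    simp only [kappa_kk]
  exact LinearMap.congr_fun this z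

theorem kappa_kappa (z : KK) : kappa (kappa z) = kappa z := by
  have : kappa ∘ₗ kappa = kappa := KK_ext fun k => by
    simp [own_of_owned (owned_own k)]
  exact LinearMap.congr_fun this z

/-- The augmentation of a cell. -/
def eps : Ty → ℤ
  | .a | .b | .a2 | .b2 => 1
  | _ => 0

/-- The augmentation. -/
noncomputable def kaug : KK →ₗ[ℤ] ℤ := Finsupp.linearCombination ℤ fun k => eps k.2

@[simp] theorem kaug_kk (k : Corner) : kaug (kk k) = eps k.2 := by
  simp [kaug]

end Bianchi

namespace Bianchi

/-! ### Contracting the complex of cells -/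

/-- The sublists of a list whose members are pairwise adjacent. -/
def cliques : List (Fin 10) → List (List (Fin 10))
  | [] => [[]]
  | s :: L => cliques L ++ ((cliques L).filter fun C => C.all (adj s)).map (s :: ·)

theorem filter_mem_cliques {p : Fin 10 → Bool}
    (hp : ∀ s t, p s = true → p t = true → adj s t = true) :
    ∀ L : List (Fin 10), L.filter p ∈ cliques L
  | [] => by simp [cliques]
  | s :: L => by
    have ih := filter_mem_cliques hp L
    rw [cliques, List.mem_append]
    by_cases h : p s = true
    · refine Or.inr (List.mem_map.2 ⟨L.filter p, List.mem_filter.2 ⟨ih, ?_⟩, by simp [h]⟩)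
      exact List.all_eq_true.2 fun t ht => hp s t h (List.mem_filter.1 ht).2
    · exact Or.inl (by simpa [h] using ih)

/-- The descents of a chamber. -/
def descents (x : Chamber) : List (Fin 10) := (List.finRange 10).filter fun s => Desc x s

theorem mem_descents {x : Chamber} {s : Fin 10} : s ∈ descents x ↔ Desc x s := by
  simp [descents]

theorem descents_mem_cliques (x : Chamber) : descents x ∈ cliques (List.finRange 10) :=
  filter_mem_cliques (fun _ _ hs ht => Desc.adj (by simpa using hs) (by simpa using ht)) _

/-- Cells owned by a chamber with descents `J`. -/
def ownedTy (J : List (Fin 10)) (c : Ty) : Bool :=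
  c.walls.all (fun s => s ∉ J) && c.mirror.all fun i => i ∈ J

theorem ownedTy_iff {x : Chamber} {c : Ty} : ownedTy (descents x) c = true ↔ Owned (x, c) := by
  simp [ownedTy, Owned, mem_descents, Option.all_eq_true]

/-- The contraction of the cells owned by a chamber, up to orientation. -/
def con0 (J : List (Fin 10)) (c : Ty) : List (ℤ × Ty) :=
  if 4 ∈ J then
    match c with
    | .b => [(1, .e06)]
    | .b2 => [(1, .e27)]
    | .e5 => [(-1, .f)]
    | _ => []
  else if 5 ∈ J then
    match c with
    | .a => [(-1, .e06)]
    | .a2 => [(-1, .e27)]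
    | .e4 => [(1, .f)]
    | _ => []
  else if 0 ∈ J ∨ 6 ∈ J then
    match c with
    | .a2 => [(1, .e4)]
    | .b2 => [(1, .e4), (1, .e27)]
    | .e5 => [(-1, .f)]
    | .r124 => [(-1, .q14)]
    | .r947 => [(-1, .q94)]
    | .r325 => [(-1, .q35), (-1, .f)]
    | .r857 => [(-1, .q85), (-1, .f)]
    | _ => []
  else if 2 ∈ J ∨ 7 ∈ J then
    match c with
    | .a => [(-1, .e4)]
    | .b => [(1, .e06), (-1, .e4)]
    | .e5 => [(-1, .f)]
    | .r104 => [(1, .q14)]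
    | .r946 => [(1, .q94)]
    | .r305 => [(1, .q35), (1, .f)]
    | .r856 => [(1, .q85), (1, .f)]
    | _ => []
  else if 1 ∈ J then
    match c with
    | .a => [(1, .r104)]
    | .b => [(1, .e06), (1, .r104)]
    | .a2 => [(1, .e4), (1, .r104)]
    | .b2 => [(1, .e4), (1, .e27), (1, .r104)]
    | .e5 => [(-1, .f)]
    | .r124 => [(-1, .q14)]
    | _ => []
  else if 9 ∈ J then
    match c with
    | .a => [(1, .r946)]
    | .b => [(1, .e06), (1, .r946)]
    | .a2 => [(1, .e4), (1, .r946)]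
    | .b2 => [(1, .e4), (1, .e27), (1, .r946)]
    | .e5 => [(-1, .f)]
    | .r947 => [(-1, .q94)]
    | _ => []
  else if 3 ∈ J then
    match c with
    | .b => [(1, .r305)]
    | .a => [(-1, .e06), (1, .r305)]
    | .b2 => [(1, .e5), (1, .r305)]
    | .a2 => [(-1, .e27), (1, .e5), (1, .r305)]
    | .e4 => [(1, .f)]
    | .r325 => [(-1, .q35)]
    | _ => []
  else if 8 ∈ J then
    match c with
    | .b => [(1, .r856)]
    | .a => [(-1, .e06), (1, .r856)]
    | .b2 => [(1, .e5), (1, .r856)]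
    | .a2 => [(-1, .e27), (1, .e5), (1, .r856)]
    | .e4 => [(1, .f)]
    | .r857 => [(-1, .q85)]
    | _ => []
  else
    match c with
    | .b => [(1, .e06)]
    | .a2 => [(1, .e4)]
    | .b2 => [(1, .e4), (1, .e27)]
    | .e5 => [(-1, .f)]
    | _ => []

/-- The oriented contraction of the cells owned by a chamber. -/
def con (J : List (Fin 10)) (j : Jt) (c : Ty) : List (ℤ × Ty) :=
  if ownedTy J c then (con0 J c).map fun p => (sg j c * p.1 * sg j p.2, p.2) else []

/-- The boundary within the cells owned by a chamber. -/
def lbo (J : List (Fin 10)) (j : Jt) (c : Ty) : List (ℤ × Ty) :=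
  (lb j c).filter fun p => ownedTy J p.2

theorem ownedTy_con {J : List (Fin 10)} (hJ : J ∈ cliques (List.finRange 10)) (j : Jt) (c : Ty) :
    ∀ p ∈ con J j c, ownedTy J p.2 = true := by
  have : ∀ J ∈ cliques (List.finRange 10), ∀ j c, ∀ p ∈ con J j c, ownedTy J p.2 = true := by
    decide +kernel
  exact this J hJ j c

theorem cancel_con {J : List (Fin 10)} (hJ : J ∈ cliques (List.finRange 10)) (j : Jt) (c : Ty)
    (hc : ownedTy J c = true) :
    cancel (fun x y => decide (x = y)) 30 ((1, c) :: (lscale (-1) (lbind (lbo J j) (con J j c)) ++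
      lscale (-1) (lbind (con J j) (lbo J j c)) ++ if J = [] then [(-eps c, .a)] else [])) =
      true := by
  have : ∀ J ∈ cliques (List.finRange 10), ∀ j c, ownedTy J c = true →
      cancel (fun x y => decide (x = y)) 30
        ((1, c) :: (lscale (-1) (lbind (lbo J j) (con J j c)) ++
          lscale (-1) (lbind (con J j) (lbo J j c)) ++ if J = [] then [(-eps c, .a)] else [])) =
        true := by
    decide +kernel
  exact this J hJ j c hc

theorem mirror_mb (j : Jt) (c : Ty) : ∀ p ∈ mb j c, p.2.mirror = none := by
  revert j c
  decide +kernel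

theorem mirror_lb (j : Jt) (c : Ty) : ∀ p ∈ lb j c, ∀ i ∈ p.2.mirror, i ∈ c.mirror := by
  revert j c
  decide +kernel

/-- Chains on corners of chambers below a given one. -/
noncomputable abbrev below (x : Chamber) : Submodule ℤ KK :=
  Finsupp.supported ℤ ℤ {k | ht k.1 < ht x}

theorem kk_mem_below {x : Chamber} {k : Corner} (h : ht k.1 < ht x) : kk k ∈ below x :=
  Finsupp.single_mem_supported ℤ _ h

theorem root_lt {x : Chamber} (h : descents x ≠ []) : ht (1, false, false) < ht x := by
  induction hx : ht x using WellFoundedLT.induction generalizing x with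
  | _ m IH =>
    subst hx
    obtain ⟨s, hs⟩ := List.exists_mem_of_ne_nil _ h
    have hlt := ht_mv_lt (mem_descents.1 hs)
    by_cases h' : descents (mv x s) = []
    · have := eq_root_of_no_desc (x := mv x s) fun s hs => by
        simpa [h'] using mem_descents.2 hs
      rwa [this] at hlt
    · exact (IH _ hlt h' rfl).trans hlt

theorem eq_root {x : Chamber} (h : descents x = []) : x = (1, false, false) :=
  eq_root_of_no_desc fun s hs => by simpa [h] using mem_descents.2 hs

/-- The contraction. -/
noncomputable def contr : KK →ₗ[ℤ] KK :=
  Finsupp.linearCombination ℤ fun k => lsum (fun c => kk (k.1, c)) (con (descents k.1) k.1.2 k.2)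

theorem contr_kk (k : Corner) :
    contr (kk k) = lsum (fun c => kk (k.1, c)) (con (descents k.1) k.1.2 k.2) := by
  simp [contr]

theorem contr_mem_below {x : Chamber} {z : KK} (hz : z ∈ below x) : contr z ∈ below x := by
  rw [contr, Finsupp.linearCombination_apply]
  refine Submodule.finsuppSum_mem _ _ _ _ fun k hk => Submodule.smul_mem _ _ ?_
  have hlt : ht k.1 < ht x := (Finsupp.mem_supported ℤ z).1 hz (Finsupp.mem_support_iff.2 hk)
  exact lsum_mem _ fun p _ => kk_mem_below hlt

theorem kappa_contr (z : KK) : kappa (contr z) = contr z := by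
  have : kappa ∘ₗ contr = contr := KK_ext fun k => by
    rw [LinearMap.comp_apply, contr_kk, map_lsum]
    refine lsum_congr fun p hp => ?_
    rw [kappa_kk, own_of_owned]
    exact ownedTy_iff.1 (ownedTy_con (descents_mem_cliques _) _ _ p hp)
  exact LinearMap.congr_fun this z

theorem lsum_filter_sub {x : Chamber} {c : Ty} (hc : ∀ i ∈ c.mirror, Desc x i)
    {L : List (ℤ × Ty)} (hL : ∀ p ∈ L, ∀ i ∈ p.2.mirror, i ∈ c.mirror) :
    lsum (fun c' => kk (own (x, c'))) L -
      lsum (fun c' => kk (x, c')) (L.filter fun p => ownedTy (descents x) p.2) ∈ below x := by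
  induction L with
  | nil => simp
  | cons p L ih =>
    have ih := ih fun q hq => hL q (by simp [hq])
    by_cases h : ownedTy (descents x) p.2 = true
    · rw [List.filter_cons_of_pos (by simpa using h), lsum_cons, lsum_cons,
        own_of_owned (ownedTy_iff.1 h), add_sub_add_left_eq_sub]
      exact ih
    · rw [List.filter_cons_of_neg (by simpa using h), lsum_cons, add_sub_assoc]
      refine Submodule.add_mem _ (Submodule.smul_mem _ _ (kk_mem_below ?_)) ih
      rcases own_eq_or_ht_lt (x, p.2) fun i hi => hc i (hL p (by simp) i hi) with h' | h'
      · exact absurd (ownedTy_iff.2 (h' ▸ owned_own (x, p.2))) h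
      · exact h'

theorem kappa_del_sub {x : Chamber} {c : Ty} (hc : Owned (x, c)) :
    kappa (del (kk (x, c))) - lsum (fun c' => kk (x, c')) (lbo (descents x) x.2 c) ∈ below x := by
  rw [del_kk, bd, lsum_append, map_add, add_sub_right_comm]
  refine Submodule.add_mem _ ?_ ?_
  · rw [lsum_map, map_lsum]
    simp only [kappa_kk]
    exact lsum_filter_sub hc.2 (mirror_lb x.2 c)
  · rcases h : c.mirror with _ | i
    · simp
    · dsimp only
      rw [lsum_map, map_lsum]
      refine lsum_mem _ fun p hp => ?_
      rw [kappa_kk]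
      refine kk_mem_below ((ht_own_le _ ?_).trans_lt (ht_mv_lt (hc.2 i h)))
      rw [mirror_mb x.2 c p hp]
      simp

theorem sub_homotopy_mem {k : Corner} (hk : Owned k) :
    kk k - kappa (del (contr (kk k))) - contr (kappa (del (kk k))) -
      eps k.2 • kk ((1, false, false), Ty.a) ∈ below k.1 := by
  obtain ⟨x, c⟩ := k
  set v : Ty → KK := fun c' => kk (x, c')
  have hJ := descents_mem_cliques x
  have h0 := lsum_eq_zero_of_cancel (v := v) (fun _ _ h => by rw [of_decide_eq_true h]) _ _
    (cancel_con hJ x.2 c (ownedTy_iff.2 hk))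
  simp only [lsum_cons, lsum_append, lsum_lscale, lsum_lbind, one_smul, neg_one_smul] at h0
  have h1 : kappa (del (contr (kk (x, c)))) -
      lsum (fun t => lsum v (lbo (descents x) x.2 t)) (con (descents x) x.2 c) ∈ below x := by
    rw [contr_kk, map_lsum, map_lsum]
    have : ∀ L : List (ℤ × Ty), (∀ p ∈ L, ownedTy (descents x) p.2 = true) →
        lsum (fun t => kappa (del (kk (x, t)))) L -
          lsum (fun t => lsum v (lbo (descents x) x.2 t)) L ∈ below x := by
      intro L hL
      induction L with
      | nil => simp
      | cons p L ih =>
        rw [lsum_cons, lsum_cons, add_sub_add_comm, ← smul_sub]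
        exact Submodule.add_mem _ (Submodule.smul_mem _ _
          (kappa_del_sub (ownedTy_iff.1 (hL p (by simp))))) (ih fun q hq => hL q (by simp [hq]))
    exact this _ (ownedTy_con hJ x.2 c)
  have h2 : contr (kappa (del (kk (x, c)))) -
      lsum (fun t => lsum v (con (descents x) x.2 t)) (lbo (descents x) x.2 c) ∈ below x := by
    have := contr_mem_below (kappa_del_sub hk)
    rw [map_sub, map_lsum] at this
    simpa only [contr_kk] using this
  have h3 : eps c • kk ((1, false, false), Ty.a) +
      lsum v (if descents x = [] then [(-eps c, .a)] else []) ∈ below x := by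
    split_ifs with h
    · have := eq_root h
      subst this
      simp [v]
    · rw [lsum_nil, add_zero]
      exact Submodule.smul_mem _ _ (kk_mem_below (root_lt h))
  have h4 := Submodule.add_mem _ (Submodule.add_mem _ h1 h2) h3
  rw [← neg_mem_iff]
  convert h4 using 1
  have h5 : kk (x, c) = v c := rfl
  rw [h5, eq_neg_of_add_eq_zero_left h0]
  abel

theorem kaug_kappa (z : KK) : kaug (kappa z) = kaug z := by
  have : kaug ∘ₗ kappa = kaug := KK_ext fun k => by
    rw [LinearMap.comp_apply, kappa_kk, kaug_kk, kaug_kk]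
    refine apply_own (fun k => eps k.2) (fun k s _ => ?_) k
    have : ∀ s c, eps (Ty.twist s c) = eps c := by decide
    exact this s k.2
  exact LinearMap.congr_fun this z

theorem kaug_del (z : KK) : kaug (del z) = 0 := by
  have : kaug ∘ₗ del = 0 := KK_ext fun k => by
    have h : ∀ j c, lsum (fun k : Corner => eps k.2) (bd ((1, j), c)) = 0 := by decide +kernel
    rw [LinearMap.comp_apply, del_kk, map_lsum, ← ctrans_one_eq k, bd_ctrans, lsum_map]
    simp only [kaug_kk]
    exact h k.1.2 k.2
  exact LinearMap.congr_fun this z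

/-- The complex of cells is acyclic. -/
theorem exists_kappa_del_eq {z : KK} (h1 : kappa z = z) (h2 : kappa (del z) = 0)
    (h3 : kaug z = 0) : ∃ w, kappa (del w) = z := by
  by_cases hz : z = 0
  · exact ⟨0, by simp [hz]⟩
  obtain ⟨k₀, hk₀, hmax⟩ := z.support.exists_max_image (fun k => ht k.1)
    (Finsupp.support_nonempty_iff.2 hz)
  induction hm : ht k₀.1 using WellFoundedLT.induction generalizing z k₀ with
  | _ m IH =>
    subst hm
    have key : z - kappa (del (contr z)) ∈ below k₀.1 := by
      have h4 : z - kappa (del (contr z)) = z - kappa (del (contr z)) -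
          contr (kappa (del z)) - kaug z • kk ((1, false, false), Ty.a) := by
        rw [h2, h3]
        simp
      rw [h4]
      let N : KK →ₗ[ℤ] KK := LinearMap.id - kappa ∘ₗ del ∘ₗ contr - contr ∘ₗ kappa ∘ₗ del -
        kaug.smulRight (kk ((1, false, false), Ty.a))
      change N z ∈ _
      rw [← Finsupp.sum_single z, map_finsuppSum]
      refine Submodule.finsuppSum_mem _ _ _ _ fun k hk => ?_
      have hk := Finsupp.mem_support_iff.2 hk
      have hle := hmax k hk
      have hown : Owned k := by
        rw [← h1] at hk
        obtain ⟨y, -, hy⟩ := Finset.mem_image.1 (Finsupp.mapDomain_support hk)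
        exact hy ▸ owned_own y
      rw [show Finsupp.single k (z k) = z k • kk k by simp, map_smul]
      refine Submodule.smul_mem _ _ (Finsupp.supported_mono ?_ (?_ : _ ∈ below k.1))
      · intro y hy
        exact lt_of_lt_of_le hy hle
      · have := sub_homotopy_mem hown
        rw [← kaug_kk] at this
        exact this
    set z' := z - kappa (del (contr z)) with hz'
    have g1 : kappa z' = z' := by rw [hz', map_sub, h1, kappa_kappa]
    have g2 : kappa (del z') = 0 := by
      rw [hz', map_sub, map_sub, h2, kappa_del_kappa, kappa_del_del, sub_zero]
    have g3 : kaug z' = 0 := by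
      rw [hz', map_sub, h3, kaug_kappa, kaug_del, sub_zero]
    suffices ∃ w, kappa (del w) = z' by
      obtain ⟨w, hw⟩ := this
      exact ⟨w + contr z, by rw [map_add, map_add, hw, hz', sub_add_cancel]⟩
    by_cases hz0 : z' = 0
    · exact ⟨0, by simp [hz0]⟩
    obtain ⟨k₁, hk₁, hmax₁⟩ := z'.support.exists_max_image (fun k => ht k.1)
      (Finsupp.support_nonempty_iff.2 hz0)
    exact IH _ ((Finsupp.mem_supported ℤ z').1 key hk₁) g1 g2 g3 hz0 k₁ hk₁ hmax₁ rfl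

end Bianchi

/-! ### Resolutions given by a graded set of generators -/

namespace FreeRes

set_option linter.unusedSectionVars false

variable (G : Type) [Group G]

/-- A resolution of `ℤ` given by a graded set of generators. -/
structure GradedResolution where
  X : Type
  deg : X → ℕ
  d : X → FG G X
  e : X → ℤ
  hom : ∀ x, d x ∈ Finsupp.supported ℤ ℤ {p : G × X | deg p.2 + 1 = deg x}
  d_d : ∀ x, lift d (d x) = 0
  e_d : ∀ x, aug e (d x) = 0
  e_pos : ∀ x, deg x ≠ 0 → e x = 0
  exact : ∀ z, lift d z = 0 → aug e z = 0 → ∃ w, lift d w = z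
  surj : ∃ x, e x = 1

variable {G}

section

variable {X : Type} (deg : X → ℕ) (n : ℕ)

/-- Inclusion of the part of degree `n`. -/
noncomputable def incl : FG G {x // deg x = n} →ₗ[ℤ] FG G X :=
  Finsupp.lmapDomain ℤ ℤ fun p => (p.1, p.2.1)

/-- Inclusion of the part of degree `n` of the coinvariants. -/
noncomputable def cincl : ({x // deg x = n} →₀ ℤ) →ₗ[ℤ] (X →₀ ℤ) :=
  Finsupp.lmapDomain ℤ ℤ Subtype.val

variable {deg n}

@[simp] lemma incl_single (g : G) (x : {x // deg x = n}) (a : ℤ) :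
    incl deg n (Finsupp.single (g, x) a) = Finsupp.single (g, x.1) a := by
  simp [incl]

@[simp] lemma cincl_single (x : {x // deg x = n}) (a : ℤ) :
    cincl deg n (Finsupp.single x a) = Finsupp.single x.1 a := by
  simp [cincl]

lemma incl_injective : Function.Injective (incl (G := G) deg n) :=
  Finsupp.mapDomain_injective fun p q h => by
    rw [Prod.mk.injEq] at h
    exact Prod.ext h.1 (Subtype.ext h.2)

lemma cincl_injective : Function.Injective (cincl deg n) :=
  Finsupp.mapDomain_injective Subtype.val_injective

lemma exists_incl {z : FG G X} (hz : z ∈ Finsupp.supported ℤ ℤ {p : G × X | deg p.2 = n}) :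
    ∃ y, incl deg n y = z := by
  rw [← Finsupp.sum_single z]
  choose! f hf using show ∀ p ∈ z.support, ∃ y : FG G {x // deg x = n},
      incl deg n y = Finsupp.single p (z p) from fun p hp =>
    ⟨Finsupp.single (p.1, ⟨p.2, (Finsupp.mem_supported ℤ z).1 hz hp⟩) (z p), by simp⟩
  exact ⟨∑ p ∈ z.support, f p, by rw [map_sum]; exact Finset.sum_congr rfl hf⟩

lemma exists_cincl {z : X →₀ ℤ} (hz : z ∈ Finsupp.supported ℤ ℤ {x : X | deg x = n}) :
    ∃ y, cincl deg n y = z := by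
  rw [← Finsupp.sum_single z]
  choose! f hf using show ∀ p ∈ z.support, ∃ y : {x // deg x = n} →₀ ℤ,
      cincl deg n y = Finsupp.single p (z p) from fun p hp =>
    ⟨Finsupp.single ⟨p, (Finsupp.mem_supported ℤ z).1 hz hp⟩ (z p), by simp⟩
  exact ⟨∑ p ∈ z.support, f p, by rw [map_sum]; exact Finset.sum_congr rfl hf⟩

lemma incl_act (g : G) (z : FG G {x // deg x = n}) : incl deg n (act g z) = act g (incl deg n z) := by
  have : (incl deg n).comp (act g) = (act g).comp (incl deg n) := hom_ext fun γ x => by simp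
  exact LinearMap.congr_fun this z

lemma coinv_incl (z : FG G {x // deg x = n}) : coinv (incl deg n z) = cincl deg n (coinv z) := by
  have : coinv.comp (incl deg n) = (cincl deg n).comp (coinv (G := G)) := hom_ext fun γ x => by simp
  exact LinearMap.congr_fun this z

lemma aug_incl (e : X → ℤ) (z : FG G {x // deg x = n}) :
    aug e (incl deg n z) = aug (fun x => e x.1) z := by
  have : (aug e).comp (incl deg n) = aug (G := G) (fun x : {x // deg x = n} => e x.1) :=
    hom_ext fun γ x => by simp
  exact LinearMap.congr_fun this z

lemma cincl_mem (z : {x // deg x = n} →₀ ℤ) :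
    cincl deg n z ∈ Finsupp.supported ℤ ℤ {x : X | deg x = n} := by
  induction z using Finsupp.induction_linear with
  | zero => simp
  | add f g hf hg => rw [map_add]; exact Submodule.add_mem _ hf hg
  | single x a =>
    rw [cincl_single]
    exact Finsupp.single_mem_supported ℤ _ x.2

end

namespace GradedResolution

variable (P : GradedResolution G)

lemma exists_d (n : ℕ) (x : {x // P.deg x = n + 1}) : ∃ y, incl P.deg n y = P.d x.1 :=
  exists_incl (by
    refine Finsupp.supported_mono ?_ (P.hom x.1)
    intro p hp
    rw [Set.mem_ofPred_eq, x.2] at hp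
    exact Nat.succ_injective hp)

/-- The differential in a single degree. -/
noncomputable def dn (n : ℕ) (x : {x // P.deg x = n + 1}) : FG G {x // P.deg x = n} :=
  (P.exists_d n x).choose

lemma incl_dn (n : ℕ) (x) : incl P.deg n (P.dn n x) = P.d x.1 := (P.exists_d n x).choose_spec

lemma incl_lift (n : ℕ) (z) : incl P.deg n (lift (P.dn n) z) = lift P.d (incl P.deg (n + 1) z) := by
  have : (incl P.deg n).comp (lift (P.dn n)) = (lift P.d).comp (incl P.deg (n + 1)) :=
    hom_ext fun γ x => by simp [incl_act, incl_dn]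
  exact LinearMap.congr_fun this z

lemma cincl_colift (n : ℕ) (z) :
    cincl P.deg n (colift (P.dn n) z) = colift P.d (cincl P.deg (n + 1) z) := by
  have : (cincl P.deg n).comp (colift (P.dn n)) = (colift P.d).comp (cincl P.deg (n + 1)) :=
    Finsupp.lhom_ext fun x a => by simp [← coinv_incl, incl_dn]
  exact LinearMap.congr_fun this z

open Classical in
lemma exists_lift_eq (n : ℕ) (z : FG G {x // P.deg x = n}) (w : FG G P.X)
    (h : lift P.d w = incl P.deg n z) : ∃ w', lift (P.dn n) w' = z := by
  obtain ⟨w', hw'⟩ := exists_incl (G := G) (deg := P.deg) (n := n + 1)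
    (z := w.filter fun p => P.deg p.2 = n + 1)
    (by
      rw [Finsupp.mem_supported]
      intro p hp
      rw [Finset.mem_coe, Finsupp.support_filter, Finset.mem_filter] at hp
      exact hp.2)
  refine ⟨w', incl_injective ?_⟩
  rw [incl_lift, hw']
  have key : ∀ w : FG G P.X, lift P.d (w.filter fun p => P.deg p.2 = n + 1) =
      (lift P.d w).filter fun p => P.deg p.2 = n := by
    intro w
    induction w using Finsupp.induction_linear with
    | zero => rw [Finsupp.filter_zero, map_zero, Finsupp.filter_zero]
    | add f g hf hg => simp only [Finsupp.filter_add, map_add, hf, hg]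
    | single p a =>
      obtain ⟨γ, x⟩ := p
      have hs : act γ (P.d x) ∈ Finsupp.supported ℤ ℤ {p : G × P.X | P.deg p.2 + 1 = P.deg x} := by
        rw [Finsupp.mem_supported]
        intro p hp
        obtain ⟨q, hq, rfl⟩ := Finset.mem_image.1 (Finsupp.mapDomain_support hp)
        have := (Finsupp.mem_supported ℤ _).1 (P.hom x) (Finset.mem_coe.2 hq)
        exact this
      rw [Finsupp.mem_supported] at hs
      by_cases hx : P.deg x = n + 1
      · rw [Finsupp.filter_single_of_pos _ (by exact hx), lift_single, Finsupp.filter_smul]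
        congr 1
        rw [eq_comm, Finsupp.filter_eq_self_iff]
        intro p hp
        have := hs (Finsupp.mem_support_iff.2 hp)
        rw [Set.mem_ofPred_eq, hx] at this
        exact Nat.succ_injective this
      · rw [Finsupp.filter_single_of_neg _ (by exact hx), lift_single, Finsupp.filter_smul,
          map_zero, eq_comm]
        convert smul_zero a
        rw [Finsupp.filter_eq_zero_iff]
        intro p hp
        by_contra h0
        have := hs (Finsupp.mem_support_iff.2 h0)
        rw [Set.mem_ofPred_eq, hp] at this
        exact hx this.symm
  rw [key, h, Finsupp.filter_eq_self_iff]
  intro p hp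
  obtain ⟨q, -, rfl⟩ := Finset.mem_image.1 (Finsupp.mapDomain_support (Finsupp.mem_support_iff.2 hp))
  exact q.2.2

/-- The corresponding resolution. -/
noncomputable def toResolution : Resolution G where
  X n := {x // P.deg x = n}
  d := P.dn
  e x := P.e x.1
  d_d n x := incl_injective (by rw [incl_lift, incl_dn, P.d_d, map_zero])
  e_d x := by rw [← aug_incl, incl_dn, P.e_d]
  exact n z hz := by
    have h0 : aug P.e (incl P.deg (n + 1) z) = 0 := by
      rw [aug_incl, show (fun x : {x // P.deg x = n + 1} => P.e x.1) = fun _ => 0 from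
        funext fun x => P.e_pos _ (by rw [x.2]; simp)]
      simp [aug, Finsupp.linearCombination_apply]
    obtain ⟨w, hw⟩ := P.exact (incl P.deg (n + 1) z) (by rw [← incl_lift, hz, map_zero]) h0
    exact P.exists_lift_eq _ z w hw
  exact_zero z hz := by
    obtain ⟨w, hw⟩ := P.exact (incl P.deg 0 z) (by
      have : (lift P.d).comp (incl P.deg 0) = 0 := hom_ext fun γ x => by
        have h0 : P.d x.1 = 0 := by
          have := P.hom x.1
          rw [Finsupp.mem_supported, x.2] at this
          rw [← Finsupp.support_eq_empty, Finset.eq_empty_iff_forall_notMem]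
          exact fun p hp => by simpa using this hp
        simp [h0]
      exact LinearMap.congr_fun this z) (by rw [aug_incl, hz])
    exact P.exists_lift_eq _ z w hw
  surj := by
    obtain ⟨x, hx⟩ := P.surj
    have h0 : P.deg x = 0 := by
      by_contra h
      rw [P.e_pos x h] at hx
      exact zero_ne_one hx
    exact ⟨Finsupp.single (1, ⟨x, h0⟩) 1, by simp [hx]⟩

/-- A criterion computing group homology. -/
theorem nonempty_equiv (n : ℕ) {T : Type} [AddCommGroup T] (f : (P.X →₀ ℤ) →ₗ[ℤ] T)
    (h1 : ∀ x, P.deg x = n + 2 → f (coinv (P.d x)) = 0)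
    (h2 : ∀ t, ∃ z ∈ Finsupp.supported ℤ ℤ {x | P.deg x = n + 1}, colift P.d z = 0 ∧ f z = t)
    (h3 : ∀ z ∈ Finsupp.supported ℤ ℤ {x | P.deg x = n + 1}, colift P.d z = 0 → f z = 0 →
      ∃ w ∈ Finsupp.supported ℤ ℤ {x | P.deg x = n + 2}, colift P.d w = z) :
    Nonempty (BarHomology.GroupHomology ℤ G ℤ (n + 1) ≃+ T) := by
  obtain ⟨e⟩ := P.toResolution.groupHomology n
  have hb : ∀ w, f (colift P.d (cincl P.deg (n + 2) w)) = 0 := fun w => by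
    induction w using Finsupp.induction_linear with
    | zero => simp
    | add u v hu hv => rw [map_add, map_add, map_add, hu, hv, add_zero]
    | single x a => rw [cincl_single, colift_single, map_smul, h1 _ x.2, smul_zero]
  let F : P.toResolution.H n →ₗ[ℤ] T := Submodule.liftQ _
    (f ∘ₗ cincl P.deg (n + 1) ∘ₗ (LinearMap.ker (colift (P.toResolution.d n))).subtype) (by
      rintro ⟨z, hz⟩ ⟨w, hw⟩
      rw [LinearMap.mem_ker]
      change f (cincl P.deg (n + 1) z) = 0
      change colift (P.dn (n + 1)) w = z at hw
      rw [← hw]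
      exact (congrArg f (P.cincl_colift (n + 1) w)).trans (hb w))
  refine ⟨e.trans (AddEquiv.ofBijective F.toAddMonoidHom ⟨?_, ?_⟩)⟩
  · rw [injective_iff_map_eq_zero]
    intro a ha
    obtain ⟨⟨z, hz⟩, rfl⟩ := Submodule.Quotient.mk_surjective _ a
    change {x // P.deg x = n + 1} →₀ ℤ at z
    change f (cincl P.deg (n + 1) z) = 0 at ha
    change colift (P.dn n) z = 0 at hz
    obtain ⟨w, hw, hw'⟩ := h3 _ (cincl_mem z) (by rw [← cincl_colift, hz, map_zero]) ha
    obtain ⟨y, rfl⟩ := exists_cincl hw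
    refine (Submodule.Quotient.mk_eq_zero _).2 ⟨y, ?_⟩
    refine cincl_injective ?_
    change cincl P.deg (n + 1) (colift (P.dn (n + 1)) y) = _
    rw [cincl_colift, hw']
    rfl
  · intro t
    obtain ⟨z, hz, hz', rfl⟩ := h2 t
    obtain ⟨y, rfl⟩ := exists_cincl hz
    have hy : colift (P.dn n) y = 0 := cincl_injective (by rw [cincl_colift, hz', map_zero])
    exact ⟨Submodule.Quotient.mk ⟨y, hy⟩, rfl⟩

end GradedResolution

end FreeRes

/-! ### Resolutions for finite groups -/

namespace FreeRes

set_option linter.unusedSectionVars false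

open Finsupp (single)

variable {F F' F'' G : Type} [Group F] [Group F'] [Group F''] [Group G] {R R' : Type}

/-- Extension of scalars along a group homomorphism. -/
noncomputable def emb (h : F →* F') : FG F R →ₗ[ℤ] FG F' R :=
  Finsupp.lmapDomain ℤ ℤ fun p => (h p.1, p.2)

@[simp] lemma emb_single (h : F →* F') (f : F) (r : R) (a : ℤ) :
    emb h (single (f, r) a) = single (h f, r) a := by
  simp [emb]

lemma emb_act (h : F →* F') (f : F) (z : FG F R) : emb h (act f z) = act (h f) (emb h z) := by
  have : (emb h).comp (act f) = (act (h f)).comp (emb (R := R) h) := hom_ext fun γ x => by simp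
  exact LinearMap.congr_fun this z

lemma emb_lift (h : F →* F') (f : R → FG F R') (z : FG F R) :
    emb h (lift f z) = lift (fun r => emb h (f r)) (emb h z) := by
  have : (emb h).comp (lift f) = (lift fun r => emb h (f r)).comp (emb h) :=
    hom_ext fun γ x => by simp [emb_act]
  exact LinearMap.congr_fun this z

lemma emb_emb (h : F →* F') (h' : F' →* F'') (z : FG F R) :
    emb h' (emb h z) = emb (h'.comp h) z := by
  have : (emb h').comp (emb h) = emb (R := R) (h'.comp h) := hom_ext fun γ x => by simp
  exact LinearMap.congr_fun this z

lemma aug_emb (e : R → ℤ) (h : F →* F') (z : FG F R) : aug e (emb h z) = aug e z := by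
  have : (aug e).comp (emb h) = aug e := hom_ext fun γ x => by simp
  exact LinearMap.congr_fun this z

lemma aug_act (e : R → ℤ) (g : G) (z : FG G R) : aug e (act g z) = aug e z := by
  have : (aug e).comp (act g) = aug e := hom_ext fun γ x => by simp
  exact LinearMap.congr_fun this z

lemma coinv_emb (h : F →* F') (z : FG F R) : coinv (emb h z) = coinv z := by
  have : coinv.comp (emb h) = coinv (X := R) := hom_ext fun γ x => by simp
  exact LinearMap.congr_fun this z

/-- Elements involving only generators of a given set. -/
noncomputable abbrev supp (F : Type) (A : Set R) : Submodule ℤ (FG F R) :=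
  Finsupp.supported ℤ ℤ {p : F × R | p.2 ∈ A}

lemma single_mem_supp {A : Set R} (f : F) {r : R} (h : r ∈ A) (a : ℤ) :
    single (f, r) a ∈ supp F A :=
  Finsupp.single_mem_supported ℤ _ h

lemma emb_mem_supp (h : F →* F') {A : Set R} {z : FG F R} (hz : z ∈ supp F A) :
    emb h z ∈ supp F' A := by
  classical
  rw [Finsupp.mem_supported] at hz ⊢
  intro p hp
  obtain ⟨q, hq, rfl⟩ := Finset.mem_image.1 (Finsupp.mapDomain_support hp)
  have := hz hq
  exact this

lemma act_mem_supp (f : F) {A : Set R} {z : FG F R} (hz : z ∈ supp F A) :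
    act f z ∈ supp F A := by
  classical
  rw [Finsupp.mem_supported] at hz ⊢
  intro p hp
  obtain ⟨q, hq, rfl⟩ := Finset.mem_image.1 (Finsupp.mapDomain_support hp)
  have := hz hq
  exact this

/-- A contractible complex of free modules over a group. -/
structure Tower where
  F : Type
  [group : Group F]
  R : Type
  deg : R → ℕ
  d : R → FG F R
  e : R → ℤ
  bot : R
  s : FG F R →ₗ[ℤ] FG F R
  hom : ∀ r, d r ∈ supp F {t | deg t + 1 = deg r}
  d_d : ∀ r, lift d (d r) = 0
  e_d : ∀ r, aug e (d r) = 0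
  e_pos : ∀ r, deg r ≠ 0 → e r = 0
  e_bot : e bot = 1
  s_bot : ∀ f, s (single (f, bot) 1) ∈ supp F {t | deg t = 1}
  contract : ∀ f r, lift d (s (single (f, r) 1)) + s (act f (d r)) =
    single (f, r) 1 - e r • single (1, bot) 1

attribute [instance] Tower.group

namespace Tower

variable (T T' : Tower)

lemma deg_bot : T.deg T.bot = 0 := by
  by_contra h
  have := T.e_bot
  rw [T.e_pos _ h] at this
  exact zero_ne_one this

lemma d_bot : T.d T.bot = 0 := by
  have := T.hom T.bot
  rw [Finsupp.mem_supported, T.deg_bot] at this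
  rw [← Finsupp.support_eq_empty, Finset.eq_empty_iff_forall_notMem]
  exact fun p hp => by simpa using this hp

lemma d_s_bot (f : T.F) :
    lift T.d (T.s (single (f, T.bot) 1)) = single (f, T.bot) 1 - single (1, T.bot) 1 := by
  have := T.contract f T.bot
  rwa [T.d_bot, map_zero, map_zero, add_zero, T.e_bot, one_smul] at this

/-- Maps of towers. -/
structure Hom where
  h : T.F →* T'.F
  φ : T.R → FG T'.F T'.R
  comm : ∀ r, lift T'.d (φ r) = lift φ (emb h (T.d r))
  aug_φ : ∀ r, aug T'.e (φ r) = T.e r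
  deg_φ : ∀ r, φ r ∈ supp T'.F {t | T'.deg t = T.deg r}

section Induced

variable {T} (ι : T.F →* G)

/-- The induced differential. -/
noncomputable def D (r : T.R) : FG G T.R := emb ι (T.d r)

lemma D_D (z : FG G T.R) : lift (T.D ι) (lift (T.D ι) z) = 0 := by
  have : (lift (T.D ι)).comp (lift (T.D ι)) = 0 := hom_ext fun γ x => by
    have : lift (T.D ι) (T.D ι x) = 0 := by
      unfold D
      rw [← emb_lift, T.d_d, map_zero]
    simp [lift_act, this]
  exact LinearMap.congr_fun this z

/-- A coset of the image. -/
def coset (γ : G) : Set G := Set.range fun f => γ * ι f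

lemma coset_mul (γ : G) (f : T.F) : coset ι (γ * ι f) = coset ι γ := by
  ext x
  constructor
  · rintro ⟨f', rfl⟩
    exact ⟨f * f', by simp [mul_assoc]⟩
  · rintro ⟨f', rfl⟩
    exact ⟨f⁻¹ * f', by simp [mul_assoc]⟩

open Classical in
/-- A chosen element of a coset. -/
noncomputable def rep (A : Set G) : G := if h : A.Nonempty then h.choose else 1

lemma exists_rep (γ : G) : ∃ f, γ = rep (coset ι γ) * ι f := by
  have h : (coset ι γ).Nonempty := ⟨γ, 1, by simp⟩
  obtain ⟨f, hf⟩ := h.choose_spec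
  exact ⟨f⁻¹, by rw [rep, dif_pos h, ← hf]; simp⟩

/-- The component along the chosen element. -/
noncomputable def comp (γ : G) : T.F := (exists_rep ι γ).choose

lemma rep_mul_comp (γ : G) : rep (coset ι γ) * ι (comp ι γ) = γ := (exists_rep ι γ).choose_spec.symm

/-- The induced contraction. -/
noncomputable def S : FG G T.R →ₗ[ℤ] FG G T.R :=
  Finsupp.linearCombination ℤ fun p =>
    act (rep (coset ι p.1)) (emb ι (T.s (single (comp ι p.1, p.2) 1)))

variable {ι}

lemma S_act (hι : Function.Injective ι) (γ : G) (z : FG T.F T.R) :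
    S ι (act (rep (coset ι γ)) (emb ι z)) = act (rep (coset ι γ)) (emb ι (T.s z)) := by
  have : (S ι).comp ((act (rep (coset ι γ))).comp (emb ι)) =
      (act (rep (coset ι γ))).comp ((emb ι).comp T.s) := hom_ext fun f r => by
    have h1 : coset ι (rep (coset ι γ) * ι f) = coset ι γ := by
      rw [coset_mul]
      conv_rhs => rw [← rep_mul_comp ι γ, coset_mul]
    have h2 : comp ι (rep (coset ι γ) * ι f) = f := by
      have := rep_mul_comp ι (rep (coset ι γ) * ι f)
      rw [h1] at this
      exact hι (mul_left_cancel this)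
    simp [S, h1, h2]
  exact LinearMap.congr_fun this z

variable (ι) in
/-- The map to the permutation module of cosets. -/
noncomputable def toCoset : FG G T.R →ₗ[ℤ] (Set G →₀ ℤ) :=
  Finsupp.linearCombination ℤ fun p => single (coset ι p.1) (T.e p.2)

variable (T) in
/-- The chosen section of the map to cosets. -/
noncomputable def ofCoset : (Set G →₀ ℤ) →ₗ[ℤ] FG G T.R :=
  Finsupp.linearCombination ℤ fun A => single (rep A, T.bot) 1

lemma contract_induced (hι : Function.Injective ι) (z : FG G T.R) :
    lift (T.D ι) (S ι z) + S ι (lift (T.D ι) z) = z - T.ofCoset (toCoset ι z) := by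
  have : (lift (T.D ι)).comp (S ι) + (S ι).comp (lift (T.D ι)) =
      LinearMap.id - T.ofCoset.comp (toCoset ι) := hom_ext fun γ r => by
    have h1 : S ι (single (γ, r) 1) =
        act (rep (coset ι γ)) (emb ι (T.s (single (comp ι γ, r) 1))) := by simp [S]
    have h2 : lift (T.D ι) (single (γ, r) 1) =
        act (rep (coset ι γ)) (emb ι (act (comp ι γ) (T.d r))) := by
      rw [lift_single, one_smul, emb_act, act_act, rep_mul_comp]
      rfl
    have h3 := congrArg (fun y => act (rep (coset ι γ)) (emb ι y)) (T.contract (comp ι γ) r)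
    simp only [map_add, map_sub, emb_lift, map_smul] at h3
    simp only [LinearMap.add_apply, LinearMap.comp_apply, LinearMap.sub_apply, LinearMap.id_apply,
      h1, h2, S_act hι, lift_act]
    refine h3.trans ?_
    rw [emb_single, act_single, rep_mul_comp]
    simp [toCoset, ofCoset]
  exact LinearMap.congr_fun this z

/-- Exactness of the induced complex. -/
lemma induced_exact (hι : Function.Injective ι) {z : FG G T.R} (h : lift (T.D ι) z = 0)
    (h' : toCoset ι z = 0) : lift (T.D ι) (S ι z) = z := by
  have := contract_induced hι z
  rwa [h, h', map_zero, map_zero, add_zero, sub_zero] at this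

end Induced

end Tower

end FreeRes

/-! ### Periodic resolutions -/

namespace FreeRes

set_option linter.unusedSectionVars false

open Finsupp (single)
open Bianchi (lsum lscale lbind cancel map_lsum lsum_lbind lsum_map lsum_congr lsum_mem
  lsum_eq_zero_of_cancel lsum_append lsum_lscale lsum_cons lsum_nil)

section ListElements

variable {F F' : Type} [Group F] [Group F'] {C C' : Type}

/-- The element of a free module described by a list. -/
noncomputable def ev (L : List (ℤ × (F × C))) : FG F C := lsum (fun p => single p 1) L

/-- Translation of a list. -/
def lact (f : F) (L : List (ℤ × (F × C))) : List (ℤ × (F × C)) :=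
  L.map fun p => (p.1, (f * p.2.1, p.2.2))

/-- Equivariant substitution of lists. -/
def llift (t : C → List (ℤ × (F × C'))) (L : List (ℤ × (F × C))) : List (ℤ × (F × C')) :=
  lbind (fun p => lact p.1 (t p.2)) L

/-- Image of a list under a group homomorphism. -/
def lemb (h : F → F') (L : List (ℤ × (F × C))) : List (ℤ × (F' × C)) :=
  L.map fun p => (p.1, (h p.2.1, p.2.2))

lemma act_ev (f : F) (L : List (ℤ × (F × C))) : act f (ev L) = ev (lact f L) := by
  unfold ev lact
  rw [map_lsum, lsum_map (fun p : F × C => single p (1 : ℤ)) (fun q : F × C => (f * q.1, q.2))]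
  exact lsum_congr fun p _ => act_single _ _ _ _

lemma lift_ev (t : C → List (ℤ × (F × C'))) (L : List (ℤ × (F × C))) :
    lift (fun c => ev (t c)) (ev L) = ev (llift t L) := by
  unfold llift
  rw [ev, ev, map_lsum, lsum_lbind]
  exact lsum_congr fun p _ => by rw [lift_single, one_smul, act_ev]; rfl

lemma linearCombination_ev (t : F × C → List (ℤ × (F × C'))) (L : List (ℤ × (F × C))) :
    Finsupp.linearCombination ℤ (fun p => ev (t p)) (ev L) = ev (lbind t L) := by
  rw [ev, ev, map_lsum, lsum_lbind]
  exact lsum_congr fun p _ => by simp [ev]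

lemma emb_ev (h : F →* F') (L : List (ℤ × (F × C))) : emb h (ev L) = ev (lemb h L) := by
  unfold ev lemb
  rw [map_lsum, lsum_map (fun p : F' × C => single p (1 : ℤ)) (fun q : F × C => (h q.1, q.2))]
  exact lsum_congr fun p _ => emb_single _ _ _ _

lemma aug_ev (e : C → ℤ) (L : List (ℤ × (F × C))) :
    aug e (ev L) = lsum (fun p => e p.2) L := by
  rw [ev, map_lsum]
  exact lsum_congr fun p _ => by rw [aug_single, one_mul]

lemma ev_append (L L' : List (ℤ × (F × C))) : ev (L ++ L') = ev L + ev L' := lsum_append _ _ _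

lemma ev_lscale (a : ℤ) (L : List (ℤ × (F × C))) : ev (lscale a L) = a • ev L :=
  lsum_lscale _ _ _

lemma ev_single (a : ℤ) (p : F × C) : ev [(a, p)] = single p a := by
  simp [ev]

lemma single_eq_ev (p : F × C) : single p (1 : ℤ) = ev [(1, p)] := (ev_single _ _).symm

lemma ev_mem_supp {A : Set C} {L : List (ℤ × (F × C))} (h : ∀ p ∈ L, p.2.2 ∈ A) :
    ev L ∈ supp F A :=
  lsum_mem _ fun p hp => single_mem_supp _ (h p hp) _

/-- A test for equality of the elements described by two lists. -/
def lEq [DecidableEq F] [DecidableEq C] (L L' : List (ℤ × (F × C))) : Bool :=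
  cancel (fun x y => decide (x = y)) (L.length + L'.length) (L ++ lscale (-1) L')

lemma ev_eq_of_lEq [DecidableEq F] [DecidableEq C] {L L' : List (ℤ × (F × C))}
    (h : lEq L L' = true) : ev L = ev L' := by
  have := lsum_eq_zero_of_cancel (v := fun p : F × C => single p (1 : ℤ))
    (fun x y hxy => by rw [of_decide_eq_true hxy]) _ _ h
  change ev _ = 0 at this
  rw [ev_append, ev_lscale, neg_one_smul] at this
  exact sub_eq_zero.1 (by rwa [sub_eq_add_neg])

end ListElements

section Shift

variable {F F' : Type} [Group F] [Group F'] {C : Type}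

/-- The copy of a generator in period `k`. -/
noncomputable def atk (k : ℕ) : FG F C →ₗ[ℤ] FG F (C × ℕ) :=
  Finsupp.lmapDomain ℤ ℤ fun p => (p.1, (p.2, k))

@[simp] lemma atk_single (k : ℕ) (f : F) (c : C) (a : ℤ) :
    atk k (single (f, c) a) = single (f, (c, k)) a := by
  simp [atk]

lemma act_atk (f : F) (k : ℕ) (z : FG F C) : act f (atk k z) = atk k (act f z) := by
  have : (act f).comp (atk k) = (atk k).comp (act (X := C) f) := hom_ext fun γ x => by simp
  exact LinearMap.congr_fun this z

lemma emb_atk (h : F →* F') (k : ℕ) (z : FG F C) : emb h (atk k z) = atk k (emb h z) := by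
  have : (emb h).comp (atk k) = (atk k).comp (emb (R := C) h) := hom_ext fun γ x => by simp
  exact LinearMap.congr_fun this z

lemma atk_mem_supp {k : ℕ} {A : Set C} {B : Set (C × ℕ)} (h : ∀ c ∈ A, (c, k) ∈ B)
    {z : FG F C} (hz : z ∈ supp F A) : atk k z ∈ supp F B := by
  classical
  rw [Finsupp.mem_supported] at hz ⊢
  intro p hp
  obtain ⟨q, hq, rfl⟩ := Finset.mem_image.1 (Finsupp.mapDomain_support hp)
  exact h _ (hz hq)

end Shift

/-- Tables describing a resolution of period four over a finite group, with a contraction. -/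
structure Periodic where
  F : Type
  [group : Group F]
  [deceq : DecidableEq F]
  C : Type
  [deceqC : DecidableEq C]
  cdeg : C → ℕ
  bot : C
  dl : C → List (ℤ × (F × C))
  dp : C → List (ℤ × (F × C))
  sl : F × C → List (ℤ × (F × C))
  sn : F × C → List (ℤ × (F × C))
  deg_bot : cdeg bot = 0
  deg_dl : ∀ c, ∀ p ∈ dl c, cdeg p.2.2 + 1 = cdeg c
  deg_dp : ∀ c, ∀ p ∈ dp c, cdeg p.2.2 + 1 = cdeg c + 4
  dl_dl : ∀ c, lEq (llift dl (dl c)) [] = true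
  dl_dp : ∀ c, lEq (llift dl (dp c) ++ llift dp (dl c)) [] = true
  dp_dp : ∀ c, lEq (llift dp (dp c)) [] = true
  e_dl : ∀ c, lsum (fun p => if p.2 = bot then (1 : ℤ) else 0) (dl c) = 0
  e_dp : ∀ c, lsum (fun p => if p.2 = bot then (1 : ℤ) else 0) (dp c) = 0
  sl_bot : ∀ f, ∀ p ∈ sl (f, bot), cdeg p.2.2 = 1
  sn_bot : ∀ f, sn (f, bot) = []
  contract : ∀ p : F × C, lEq (llift dl (sl p) ++ (llift dp (sn p) ++ lbind sl (lact p.1 (dl p.2))))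
    [(1, p), (if p.2 = bot then -1 else 0, (1, bot))] = true
  contract_prev : ∀ p : F × C, lEq (lbind sn (lact p.1 (dp p.2)))
    [(if p.2 = bot then 1 else 0, (1, bot))] = true
  dl_sn : ∀ p : F × C, lEq (llift dl (sn p) ++ lbind sn (lact p.1 (dl p.2))) [] = true
  dp_sl : ∀ p : F × C, lEq (llift dp (sl p) ++ lbind sl (lact p.1 (dp p.2))) [] = true

attribute [instance] Periodic.group Periodic.deceq Periodic.deceqC

namespace Periodic

variable (P : Periodic)

/-- The differential. -/
noncomputable def d : P.C × ℕ → FG P.F (P.C × ℕ)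
  | (c, 0) => atk 0 (ev (P.dl c))
  | (c, k + 1) => atk (k + 1) (ev (P.dl c)) + atk k (ev (P.dp c))

/-- The contraction. -/
noncomputable def s : FG P.F (P.C × ℕ) →ₗ[ℤ] FG P.F (P.C × ℕ) :=
  Finsupp.linearCombination ℤ fun p =>
    atk p.2.2 (ev (P.sl (p.1, p.2.1))) + atk (p.2.2 + 1) (ev (P.sn (p.1, p.2.1)))

lemma lift_d_zero (z : FG P.F P.C) :
    lift P.d (atk 0 z) = atk 0 (lift (fun c => ev (P.dl c)) z) := by
  have : (lift P.d).comp (atk 0) = (atk 0).comp (lift fun c => ev (P.dl c)) :=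
    hom_ext fun f c => by simp [d, act_atk]
  exact LinearMap.congr_fun this z

lemma lift_d_succ (k : ℕ) (z : FG P.F P.C) :
    lift P.d (atk (k + 1) z) =
      atk (k + 1) (lift (fun c => ev (P.dl c)) z) + atk k (lift (fun c => ev (P.dp c)) z) := by
  have : (lift P.d).comp (atk (k + 1)) = (atk (k + 1)).comp (lift fun c => ev (P.dl c)) +
      (atk k).comp (lift fun c => ev (P.dp c)) :=
    hom_ext fun f c => by simp [d, act_atk]
  exact LinearMap.congr_fun this z

lemma s_atk (k : ℕ) (z : FG P.F P.C) :
    P.s (atk k z) = atk k (Finsupp.linearCombination ℤ (fun p => ev (P.sl p)) z) +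
      atk (k + 1) (Finsupp.linearCombination ℤ (fun p => ev (P.sn p)) z) := by
  have : P.s.comp (atk k) = (atk k).comp (Finsupp.linearCombination ℤ fun p => ev (P.sl p)) +
      (atk (k + 1)).comp (Finsupp.linearCombination ℤ fun p => ev (P.sn p)) :=
    hom_ext fun f c => by simp [s]
  exact LinearMap.congr_fun this z

/-- The augmentation. -/
def e (r : P.C × ℕ) : ℤ := if r.2 = 0 then (if r.1 = P.bot then 1 else 0) else 0

lemma aug_atk_zero (z : FG P.F P.C) :
    aug P.e (atk 0 z) = aug (fun c => if c = P.bot then 1 else 0) z := by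
  have : (aug P.e).comp (atk (F := P.F) 0) = aug (fun c => if c = P.bot then 1 else 0) :=
    hom_ext fun f c => by simp [e]
  exact LinearMap.congr_fun this z

lemma aug_atk_succ (k : ℕ) (z : FG P.F P.C) : aug P.e (atk (k + 1) z) = 0 := by
  have : (aug P.e).comp (atk (F := P.F) (k + 1)) = 0 := hom_ext fun f c => by simp [e]
  exact LinearMap.congr_fun this z

lemma ev_nil' {F C : Type} : ev ([] : List (ℤ × (F × C))) = 0 := rfl

lemma s_single (f : P.F) (c : P.C) (k : ℕ) : P.s (single (f, (c, k)) 1) =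
    atk k (ev (P.sl (f, c))) + atk (k + 1) (ev (P.sn (f, c))) := by
  simp [s]

/-- The resolution described by the tables. -/
noncomputable def tower : Tower where
  F := P.F
  R := P.C × ℕ
  deg r := P.cdeg r.1 + 4 * r.2
  d := P.d
  e := P.e
  bot := (P.bot, 0)
  s := P.s
  hom := by
    have h1 : ∀ c k, atk k (ev (P.dl c)) ∈
        supp P.F {t : P.C × ℕ | P.cdeg t.1 + 4 * t.2 + 1 = P.cdeg c + 4 * k} := fun c k =>
      atk_mem_supp (A := {t | P.cdeg t + 1 = P.cdeg c}) (fun t ht => by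
        have : P.cdeg t + 1 = P.cdeg c := ht
        change P.cdeg t + 4 * k + 1 = P.cdeg c + 4 * k
        omega) (ev_mem_supp (P.deg_dl c))
    rintro ⟨c, _ | k⟩
    · exact h1 c 0
    · refine Submodule.add_mem _ (h1 c (k + 1)) ?_
      exact atk_mem_supp (A := {t | P.cdeg t + 1 = P.cdeg c + 4}) (fun t ht => by
        have : P.cdeg t + 1 = P.cdeg c + 4 := ht
        change P.cdeg t + 4 * k + 1 = P.cdeg c + 4 * (k + 1)
        omega) (ev_mem_supp (P.deg_dp c))
  d_d := by
    have h1 := fun c => ev_eq_of_lEq (P.dl_dl c)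
    have h2 := fun c => ev_eq_of_lEq (P.dl_dp c)
    have h3 := fun c => ev_eq_of_lEq (P.dp_dp c)
    simp only [ev_append, ← lift_ev, ev_nil'] at h1 h2 h3
    rintro ⟨c, _ | _ | k⟩
    · simp only [d, lift_d_zero, h1, map_zero]
    · simp only [d, map_add, lift_d_zero, lift_d_succ, h1, map_zero, zero_add]
      rw [← map_add, add_comm, h2, map_zero]
    · simp only [d, map_add, lift_d_succ, h1, h3, map_zero, zero_add, add_zero]
      rw [← map_add, add_comm (lift _ _), h2, map_zero]
  e_d := by
    rintro ⟨c, _ | _ | k⟩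
    · simp only [d, aug_atk_zero, aug_ev, P.e_dl]
    · simp only [d, map_add, aug_atk_zero, aug_atk_succ, aug_ev, P.e_dp, add_zero]
    · simp only [d, map_add, aug_atk_succ, add_zero]
  e_pos := by
    rintro ⟨c, k⟩ h
    by_contra h'
    simp only [e, ite_eq_right_iff, not_forall] at h'
    obtain ⟨h1, h2, -⟩ := h'
    subst h1 h2
    simp [P.deg_bot] at h
  e_bot := by simp [e]
  s_bot f := by
    rw [s_single, P.sn_bot, ev_nil', map_zero, add_zero]
    exact atk_mem_supp (A := {t | P.cdeg t = 1}) (fun t ht => by simpa using ht)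
      (ev_mem_supp (P.sl_bot f))
  contract := by
    have h1 := fun p => ev_eq_of_lEq (P.contract p)
    have h2 := fun p => ev_eq_of_lEq (P.contract_prev p)
    have h3 := fun p => ev_eq_of_lEq (P.dl_sn p)
    have h4 := fun p => ev_eq_of_lEq (P.dp_sl p)
    simp only [ev_append, ← lift_ev, ev_nil', ← linearCombination_ev, ← act_ev] at h1 h2 h3 h4
    have h5 : ∀ c : P.C, ∀ p : P.F × P.C,
        ev [(1, p), (if c = P.bot then -1 else 0, (1, P.bot))] =
          single p 1 - (if c = P.bot then (1 : ℤ) else 0) • single (1, P.bot) (1 : ℤ) := by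
      intro c p
      split_ifs <;> simp [ev, sub_eq_add_neg]
    have h6 : ∀ c : P.C, ev [(if c = P.bot then 1 else 0, ((1 : P.F), P.bot))] =
          (if c = P.bot then (1 : ℤ) else 0) • single (1, P.bot) (1 : ℤ) := by
      intro c
      simp [ev]
    have h7 : ∀ k, single ((1 : P.F), (P.bot, k)) (1 : ℤ) = atk k (single (1, P.bot) 1) := by simp
    intro f c
    obtain ⟨c, _ | k⟩ := c
    · have h1 := congrArg (atk 0) (h1 (f, c))
      have h3 := congrArg (atk 1) (h3 (f, c))
      simp only [h5, map_add, map_sub, map_smul, map_zero] at h1 h3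
      rw [s_single]
      simp only [d, act_atk, map_add, lift_d_zero, lift_d_succ, s_atk, e, if_true, atk_single]
        at h1 h3 ⊢
      linear_combination (norm := module) h1 + h3
    · have h1 := congrArg (atk (k + 1)) (h1 (f, c))
      have h2 := congrArg (atk (k + 1)) (h2 (f, c))
      have h3 := congrArg (atk (k + 2)) (h3 (f, c))
      have h4 := congrArg (atk k) (h4 (f, c))
      simp only [h5, h6, map_add, map_sub, map_smul, map_zero] at h1 h2 h3 h4
      rw [s_single]
      simp only [d, act_atk, map_add, lift_d_succ, s_atk, e, atk_single,
        Nat.succ_ne_zero, if_false, zero_smul, sub_zero] at h1 h2 h3 h4 ⊢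
      linear_combination (norm := module) h1 + h2 + h3 + h4

end Periodic

end FreeRes

/-! ### The finite groups occurring as stabilisers -/

namespace FreeRes

set_option linter.unusedSectionVars false

open Finsupp (single)
open Bianchi (lsum lscale lbind)

/-- Tables describing a map of periodic resolutions. -/
structure Periodic.Map (P Q : Periodic) where
  h : P.F →* Q.F
  φ : P.C → List (ℤ × (Q.F × Q.C))
  comm_l : ∀ c, lEq (llift Q.dl (φ c)) (llift φ (lemb h (P.dl c))) = true
  comm_p : ∀ c, lEq (llift Q.dp (φ c)) (llift φ (lemb h (P.dp c))) = true
  aug_φ : ∀ c, lsum (fun p => if p.2 = Q.bot then (1 : ℤ) else 0) (φ c) = if c = P.bot then 1 else 0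
  deg_φ : ∀ c, ((φ c).all fun p => Q.cdeg p.2.2 == P.cdeg c) = true

namespace Periodic.Map

variable {P Q : Periodic} (m : P.Map Q)

lemma lift_atk (k : ℕ) (z : FG Q.F P.C) :
    lift (fun r : P.C × ℕ => atk r.2 (ev (m.φ r.1))) (atk k z) =
      atk k (lift (fun c => ev (m.φ c)) z) := by
  have : (lift (fun r : P.C × ℕ => atk r.2 (ev (m.φ r.1)))).comp (atk k) =
      (atk k).comp (lift fun c => ev (m.φ c)) := hom_ext fun f c => by simp [act_atk]
  exact LinearMap.congr_fun this z

lemma comm (r : P.C × ℕ) : lift Q.d (atk r.2 (ev (m.φ r.1))) =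
    lift (fun r : P.C × ℕ => atk r.2 (ev (m.φ r.1))) (emb m.h (P.d r)) := by
  have h1 := fun c => ev_eq_of_lEq (m.comm_l c)
  have h2 := fun c => ev_eq_of_lEq (m.comm_p c)
  simp only [← lift_ev, ← emb_ev] at h1 h2
  obtain ⟨c, _ | k⟩ := r
  · rw [Q.lift_d_zero, Periodic.d, emb_atk, lift_atk, h1]
  · rw [Q.lift_d_succ, Periodic.d, map_add, map_add, emb_atk, lift_atk, emb_atk, lift_atk, h1, h2]

lemma aug_eq (r : P.C × ℕ) : aug Q.e (atk r.2 (ev (m.φ r.1))) = P.e r := by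
  obtain ⟨c, _ | k⟩ := r
  · rw [Q.aug_atk_zero, aug_ev, m.aug_φ]
    rfl
  · exact Q.aug_atk_succ _ _

/-- The map of resolutions described by the tables. -/
noncomputable def hom : Tower.Hom P.tower Q.tower where
  h := m.h
  φ r := atk r.2 (ev (m.φ r.1))
  comm := m.comm
  aug_φ := m.aug_eq
  deg_φ := by
    rintro ⟨c, k⟩
    exact atk_mem_supp (A := {t | Q.cdeg t = P.cdeg c}) (fun t ht => by
        have : Q.cdeg t = P.cdeg c := ht
        change Q.cdeg t + 4 * k = P.cdeg c + 4 * k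
        rw [this]) (ev_mem_supp fun p hp => by
          have := List.all_eq_true.1 (m.deg_φ c) p hp
          exact eq_of_beq this)

end Periodic.Map

/-- The trivial group. -/
noncomputable def towerOne : Tower where
  F := Unit
  R := Unit
  deg _ := 0
  d _ := 0
  e _ := 1
  bot := ()
  s := 0
  hom _ := Submodule.zero_mem _
  d_d _ := map_zero _
  e_d _ := map_zero _
  e_pos _ h := absurd rfl h
  e_bot := rfl
  s_bot _ := Submodule.zero_mem _
  contract f r := by simp

/-- The cyclic group of order two. -/
abbrev Z2 := Multiplicative (ZMod 2)

/-- The cyclic group of order three. -/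
abbrev Z3 := Multiplicative (ZMod 3)

/-- The nontrivial element. -/
abbrev eps2 : Z2 := Multiplicative.ofAdd 1

/-- A generator. -/
abbrev zeta3 : Z3 := Multiplicative.ofAdd 1

/-- The symmetric group on three letters. -/
abbrev D3 := DihedralGroup 3

/-- The resolution for the cyclic group of order two. -/
def perZ2 : Periodic where
  F := Z2
  C := Fin 4
  cdeg c := c
  bot := 0
  dl := ![[], [(1, (eps2, 0)), (-1, (1, 0))], [(1, (eps2, 1)), (1, (1, 1))],
    [(1, (eps2, 2)), (-1, (1, 2))]]
  dp := ![[(1, (eps2, 3)), (1, (1, 3))], [], [], []]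
  sl p := if p.1 = 1 then [] else ![[(1, (1, 1))], [(1, (1, 2))], [(1, (1, 3))], []] p.2
  sn p := if p.1 = eps2 ∧ p.2 = 3 then [(1, (1, 0))] else []
  deg_bot := rfl
  deg_dl := by decide +kernel
  deg_dp := by decide +kernel
  dl_dl := by decide +kernel
  dl_dp := by decide +kernel
  dp_dp := by decide +kernel
  e_dl := by decide +kernel
  e_dp := by decide +kernel
  sl_bot := by decide +kernel
  sn_bot := by decide +kernel
  contract := by decide +kernel
  contract_prev := by decide +kernel
  dl_sn := by decide +kernel
  dp_sl := by decide +kernel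

/-- The resolution for the cyclic group of order three. -/
def perZ3 : Periodic where
  F := Z3
  C := Fin 4
  cdeg c := c
  bot := 0
  dl := ![[], [(1, (zeta3, 0)), (-1, (1, 0))], [(1, (1, 1)), (1, (zeta3, 1)), (1, (zeta3 ^ 2, 1))],
    [(1, (zeta3, 2)), (-1, (1, 2))]]
  dp := ![[(1, (1, 3)), (1, (zeta3, 3)), (1, (zeta3 ^ 2, 3))], [], [], []]
  sl p := if p.1 = 1 then [] else if p.1 = zeta3 then ![[(1, (1, 1))], [], [(1, (1, 3))], []] p.2
    else ![[(1, (1, 1)), (1, (zeta3, 1))], [(1, (1, 2))], [(1, (1, 3)), (1, (zeta3, 3))], []] p.2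
  sn p := if p.1 = zeta3 ^ 2 ∧ p.2 = 3 then [(1, (1, 0))] else []
  deg_bot := rfl
  deg_dl := by decide +kernel
  deg_dp := by decide +kernel
  dl_dl := by decide +kernel
  dl_dp := by decide +kernel
  dp_dp := by decide +kernel
  e_dl := by decide +kernel
  e_dp := by decide +kernel
  sl_bot := by decide +kernel
  sn_bot := by decide +kernel
  contract := by decide +kernel
  contract_prev := by decide +kernel
  dl_sn := by decide +kernel
  dp_sl := by decide +kernel

/-- The elements `1, x, y, xy, yx, xyx`. -/
def D3.el : Fin 6 → D3 :=
  ![1, .sr 0, .sr 1, .r 1, .r 2, .sr 2]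

/-- Read off a list of coefficients, elements and generators. -/
def D3.tab (L : List (ℤ × Fin 6 × Fin 6)) : List (ℤ × (D3 × Fin 6)) :=
  L.map fun p => (p.1, (D3.el p.2.1, p.2.2))

/-- Position in the list `1, x, y, xy, yx, xyx`. -/
def D3.ix : D3 → Fin 6
  | .r i => ![0, 3, 4] i
  | .sr i => ![1, 2, 5] i

/-- The resolution for the symmetric group, with generators `w₀, x₁, y₁, r₁, r₂, w₃`. -/
def perD3 : Periodic where
  F := D3
  C := Fin 6
  cdeg := ![0, 1, 1, 2, 2, 3]
  bot := 0
  dl c := D3.tab <| ![[], [(-1, 0, 0), (1, 1, 0)], [(-1, 0, 0), (1, 2, 0)], [(1, 0, 1), (1, 1, 1)],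
    [(1, 0, 1), (-1, 2, 1), (1, 3, 1), (-1, 0, 2), (1, 1, 2), (-1, 4, 2)],
    [(1, 0, 3), (-1, 1, 3), (-1, 0, 4), (-1, 2, 4), (1, 3, 4), (1, 5, 4)]] c
  dp c := D3.tab <| if c = 0 then
    [(1, 0, 5), (1, 1, 5), (1, 2, 5), (1, 3, 5), (1, 4, 5), (1, 5, 5)] else []
  sl p := D3.tab <| ![
    ![[], [(1, 0, 1)], [(1, 0, 2)], [(1, 0, 1), (1, 1, 2)], [(1, 2, 1), (1, 0, 2)],
      [(1, 0, 1), (1, 3, 1), (1, 1, 2)]],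
    ![[], [(1, 0, 3)], [], [], [(1, 2, 3)], [(1, 3, 3)]],
    ![[], [], [(1, 3, 3), (-1, 0, 4), (-1, 2, 4)], [(1, 2, 3), (-1, 1, 4), (-1, 3, 4)],
      [(-1, 0, 4)], [(1, 0, 3), (-1, 1, 4)]],
    ![[], [(-1, 0, 5), (-1, 3, 5), (-1, 5, 5)], [], [], [(1, 0, 5), (1, 1, 5), (1, 4, 5)],
      [(1, 0, 5), (1, 1, 5), (1, 5, 5)]],
    ![[], [], [], [], [(-1, 2, 5), (-1, 4, 5)], [(-1, 3, 5), (-1, 5, 5)]],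
    ![[], [], [], [], [], []]] p.2 (D3.ix p.1)
  sn p := D3.tab <| if p.2 = 5 then
    ![[], [(1, 0, 0)], [(1, 0, 0)], [(1, 0, 0)], [(-1, 0, 0)], [(-1, 0, 0)]] (D3.ix p.1) else []
  deg_bot := rfl
  deg_dl := by decide +kernel
  deg_dp := by decide +kernel
  dl_dl := by decide +kernel
  dl_dp := by decide +kernel
  dp_dp := by decide +kernel
  e_dl := by decide +kernel
  e_dp := by decide +kernel
  sl_bot := by decide +kernel
  sn_bot := by decide +kernel
  contract := by decide +kernel
  contract_prev := by decide +kernel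
  dl_sn := by decide +kernel
  dp_sl := by decide +kernel

/-- The homomorphism sending the generator to `x`. -/
def homZ2D3 : Z2 →* D3 where
  toFun g := if g = 1 then 1 else .sr 0
  map_one' := rfl
  map_mul' := by decide +kernel

/-- The homomorphism sending the generator to `xy`. -/
def homZ3D3 : Z3 →* D3 where
  toFun g := .r g.toAdd
  map_one' := rfl
  map_mul' := by decide +kernel

/-- The map of resolutions for the subgroup generated by `x`. -/
def mapZ2D3 : perZ2.Map perD3 where
  h := homZ2D3
  φ := fun c : Fin 4 => D3.tab <|
    ![[(1, 0, 0)], [(1, 0, 1)], [(1, 0, 3)], [(1, 1, 5), (1, 2, 5), (1, 4, 5)]] c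
  comm_l := show ∀ c : Fin 4, _ by decide +kernel
  comm_p := show ∀ c : Fin 4, _ by decide +kernel
  aug_φ := show ∀ c : Fin 4, _ by decide +kernel
  deg_φ := show ∀ c : Fin 4, _ by decide +kernel

/-- The map of resolutions for the subgroup generated by `xy`. -/
def mapZ3D3 : perZ3.Map perD3 where
  h := homZ3D3
  φ := fun c : Fin 4 => D3.tab <|
    ![[(1, 0, 0)], [(1, 0, 1), (1, 1, 2)],
      [(1, 1, 3), (1, 2, 3), (1, 5, 3), (-1, 0, 4), (-1, 1, 4), (-1, 2, 4)],
      [(1, 3, 5), (1, 5, 5)]] c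
  comm_l := show ∀ c : Fin 4, _ by decide +kernel
  comm_p := show ∀ c : Fin 4, _ by decide +kernel
  aug_φ := show ∀ c : Fin 4, _ by decide +kernel
  deg_φ := show ∀ c : Fin 4, _ by decide +kernel

end FreeRes

/-! ### The Klein four-group -/

namespace FreeRes

set_option linter.unusedSectionVars false

open Finsupp (single)

/-- The Klein four-group. -/
abbrev V4 := Z2 × Z2

namespace V4

/-- The first generator. -/
abbrev α : V4 := (eps2, 1)

/-- The second generator. -/
abbrev β : V4 := (1, eps2)

/-- The generator in bidegree `(i, k)`. -/
noncomputable def x (f : V4) (i k : ℕ) : FG V4 (ℕ × ℕ) := single (f, (i, k)) 1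

/-- The differential of the total complex. -/
noncomputable def d : ℕ × ℕ → FG V4 (ℕ × ℕ)
  | (0, 0) => 0
  | (i + 1, 0) => x α i 0 + (-1 : ℤ) ^ (i + 1) • x 1 i 0
  | (0, k + 1) => x β 0 k + (-1 : ℤ) ^ (k + 1) • x 1 0 k
  | (i + 1, k + 1) => x α i (k + 1) + (-1 : ℤ) ^ (i + 1) • x 1 i (k + 1) +
      (-1 : ℤ) ^ (i + 1) • (x β (i + 1) k + (-1 : ℤ) ^ (k + 1) • x 1 (i + 1) k)

/-- The contraction on generators. -/
noncomputable def s₀ (f : V4) : ℕ × ℕ → FG V4 (ℕ × ℕ)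
  | (0, k) => (if f.1 = 1 then 0 else x (1, f.2) 1 k) + if f.2 = 1 then 0 else x 1 0 (k + 1)
  | (i + 1, k) => if f.1 = 1 then 0 else x (1, f.2) (i + 2) k

/-- The contraction. -/
noncomputable def s : FG V4 (ℕ × ℕ) →ₗ[ℤ] FG V4 (ℕ × ℕ) :=
  Finsupp.linearCombination ℤ fun p => s₀ p.1 p.2

lemma s_x (f : V4) (i k : ℕ) : s (x f i k) = s₀ f (i, k) := by
  simp [s, x]

lemma lift_d_x (f : V4) (i k : ℕ) : lift d (x f i k) = act f (d (i, k)) := by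
  rw [x, lift_single, one_smul]

lemma act_x (f g : V4) (i k : ℕ) : act f (x g i k) = x (f * g) i k := act_single _ _ _ _

lemma e2_ne : eps2 ≠ 1 := by decide

lemma e2_e2 : eps2 * eps2 = 1 := by decide

lemma one_eq : (1 : V4) = (1, 1) := rfl

lemma forall_V4 {p : V4 → Prop} (h1 : p (1, 1)) (h2 : p (eps2, 1)) (h3 : p (1, eps2))
    (h4 : p (eps2, eps2)) (f : V4) : p f := by
  have : ∀ f : V4, f = (1, 1) ∨ f = (eps2, 1) ∨ f = (1, eps2) ∨ f = (eps2, eps2) := by decide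
  obtain rfl | rfl | rfl | rfl := this f <;> assumption

lemma d_d (r : ℕ × ℕ) : lift d (d r) = 0 := by
  obtain ⟨_ | _ | i, _ | _ | k⟩ := r <;>
  simp only [d, map_zero, map_add, map_smul, lift_d_x, act_x, one_eq, Prod.mk_mul_mk, one_mul,
    mul_one, e2_e2, zero_add, pow_succ, pow_zero, α, β]
  any_goals module
  any_goals rcases neg_one_pow_eq_or ℤ k with h | h <;> rw [h] <;> module
  any_goals rcases neg_one_pow_eq_or ℤ i with h | h <;> rw [h] <;> module
  rcases neg_one_pow_eq_or ℤ i with h | h <;> rcases neg_one_pow_eq_or ℤ k with h' | h' <;>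
    rw [h, h'] <;> module

/-- The augmentation. -/
def e (r : ℕ × ℕ) : ℤ := if r = (0, 0) then 1 else 0

lemma aug_x (f : V4) (i k : ℕ) : aug e (x f i k) = if (i, k) = (0, 0) then 1 else 0 := by
  rw [x, aug_single, one_mul, e]

lemma e_d (r : ℕ × ℕ) : aug e (d r) = 0 := by
  obtain ⟨_ | _ | i, _ | _ | k⟩ := r <;> simp [d, aug_x]

lemma contract (f : V4) (r : ℕ × ℕ) : lift d (s (x f r.1 r.2)) + s (act f (d r)) =
    x f r.1 r.2 - e r • x 1 0 0 := by
  revert f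
  obtain ⟨_ | _ | i, _ | k⟩ := r <;>
  refine forall_V4 ?_ ?_ ?_ ?_ <;>
  simp only [d, s_x, s₀, e, map_zero, map_add, map_smul, lift_d_x, act_x, one_eq, Prod.mk_mul_mk,
    one_mul, mul_one, e2_e2, zero_add, pow_succ, pow_zero, α, β, e2_ne, if_true, if_false,
    Prod.mk.injEq, Nat.succ_ne_zero, and_false, and_true]
  all_goals module

/-- The resolution for the Klein four-group. -/
noncomputable def tower : Tower where
  F := V4
  R := ℕ × ℕ
  deg r := r.1 + r.2
  d := d
  e := e
  bot := (0, 0)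
  s := s
  hom := by
    have h : ∀ (n : ℕ) (f : V4) (i k : ℕ), i + k + 1 = n →
        x f i k ∈ supp V4 {t : ℕ × ℕ | t.1 + t.2 + 1 = n} :=
      fun n f i k hn => single_mem_supp (r := (i, k)) f hn 1
    rintro ⟨_ | i, _ | k⟩
    · exact Submodule.zero_mem _
    · exact add_mem (h _ _ _ _ rfl) (Submodule.smul_mem _ _ (h _ _ _ _ rfl))
    · exact add_mem (h _ _ _ _ rfl) (Submodule.smul_mem _ _ (h _ _ _ _ rfl))
    · refine add_mem (add_mem (h _ _ _ _ (by omega)) (Submodule.smul_mem _ _ (h _ _ _ _ ?_)))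
        (Submodule.smul_mem _ _ (add_mem (h _ _ _ _ ?_) (Submodule.smul_mem _ _ (h _ _ _ _ ?_))))
      all_goals omega
  d_d := d_d
  e_d := e_d
  e_pos := by
    rintro ⟨i, k⟩ h
    have : (i, k) ≠ (0, 0) := by
      rintro ⟨⟩
      exact h rfl
    simp [e, this]
  e_bot := rfl
  s_bot := by
    have h : ∀ (f : V4) (i k : ℕ), i + k = 1 →
        x f i k ∈ supp V4 {t : ℕ × ℕ | t.1 + t.2 = 1} :=
      fun f i k hn => single_mem_supp (r := (i, k)) f hn 1
    intro f
    change s (x f 0 0) ∈ _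
    rw [s_x, s₀]
    refine add_mem ?_ ?_ <;> split_ifs
    · exact Submodule.zero_mem _
    · exact h _ _ _ rfl
    · exact Submodule.zero_mem _
    · exact h _ _ _ rfl
  contract f r := contract f r

lemma pow_four (k : ℕ) : (-1 : ℤ) ^ (4 * k) = 1 := by
  rw [pow_mul]
  norm_num

/-- The degree of a generator of the resolution for the cyclic group of order two. -/
def total (r : Fin 4 × ℕ) : ℕ := r.1 + 4 * r.2

lemma perZ2_d (r : Fin 4 × ℕ) : (total r = 0 ∧ perZ2.d r = 0) ∨
    ∃ r', total r = total r' + 1 ∧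
      perZ2.d r = single (eps2, r') 1 + (-1 : ℤ) ^ total r • single (1, r') 1 := by
  have h : ∀ (k : ℕ) (c : Fin 4) (a : ℤ) (n : ℕ), (-1 : ℤ) ^ n = a →
      atk k (ev [(1, (eps2, c)), (a, ((1 : Z2), c))]) =
        single (eps2, (c, k)) 1 + (-1 : ℤ) ^ n • single (1, (c, k)) 1 := by
    rintro k c a n rfl
    simp [ev]
  have h0 : ∀ k, atk k (ev ([] : List (ℤ × (Z2 × Fin 4)))) = 0 := fun k => by simp [ev]
  have p1 : ∀ n, (-1 : ℤ) ^ (1 + 4 * n) = -1 := fun n => by rw [pow_add, pow_four]; norm_num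
  have p2 : ∀ n, (-1 : ℤ) ^ (2 + 4 * n) = 1 := fun n => by rw [pow_add, pow_four]; norm_num
  have p3 : ∀ n, (-1 : ℤ) ^ (3 + 4 * n) = -1 := fun n => by rw [pow_add, pow_four]; norm_num
  have p4 : ∀ n, (-1 : ℤ) ^ (0 + 4 * (n + 1)) = 1 := fun n => by rw [zero_add, pow_four]
  obtain ⟨c, k⟩ := r
  have : c = 0 ∨ c = 1 ∨ c = 2 ∨ c = 3 := by revert c; decide
  obtain rfl | rfl | rfl | rfl := this <;> rcases k with _ | k
  · exact Or.inl ⟨rfl, h0 0⟩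
  · refine Or.inr ⟨(3, k), ?_, ?_⟩
    · simp [total]
      omega
    · exact (congrArg₂ (· + ·) (h0 _) (h k 3 1 _ (p4 k))).trans (zero_add _)
  · exact Or.inr ⟨(0, 0), rfl, h 0 0 (-1) _ (p1 0)⟩
  · refine Or.inr ⟨(0, k + 1), ?_, ?_⟩
    · simp [total]
      omega
    · exact (congrArg₂ (· + ·) (h (k + 1) 0 (-1) _ (p1 (k + 1))) (h0 _)).trans (add_zero _)
  · exact Or.inr ⟨(1, 0), rfl, h 0 1 1 _ (p2 0)⟩
  · refine Or.inr ⟨(1, k + 1), ?_, ?_⟩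
    · simp [total]
      omega
    · exact (congrArg₂ (· + ·) (h (k + 1) 1 1 _ (p2 (k + 1))) (h0 _)).trans (add_zero _)
  · exact Or.inr ⟨(2, 0), rfl, h 0 2 (-1) _ (p3 0)⟩
  · refine Or.inr ⟨(2, k + 1), ?_, ?_⟩
    · simp [total]
      omega
    · exact (congrArg₂ (· + ·) (h (k + 1) 2 (-1) _ (p3 (k + 1))) (h0 _)).trans (add_zero _)

/-- A map from the resolution for the cyclic group of order two. -/
noncomputable def ofZ2 (h : Z2 →* V4) (φ : ℕ → FG V4 (ℕ × ℕ)) (h0 : lift d (φ 0) = 0)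
    (h1 : ∀ n, lift d (φ (n + 1)) = act (h eps2) (φ n) + (-1 : ℤ) ^ (n + 1) • φ n)
    (h2 : ∀ n, aug e (φ n) = if n = 0 then 1 else 0)
    (h3 : ∀ n, φ n ∈ supp V4 {t : ℕ × ℕ | t.1 + t.2 = n}) : Tower.Hom perZ2.tower tower where
  h := h
  φ r := φ (total r)
  comm := by
    have key : ∀ (r : Fin 4 × ℕ) (y : FG Z2 (Fin 4 × ℕ)), ((total r = 0 ∧ y = 0) ∨
        ∃ r', total r = total r' + 1 ∧
          y = single (eps2, r') 1 + (-1 : ℤ) ^ total r • single (1, r') 1) →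
        lift d (φ (total r)) = lift (fun r : Fin 4 × ℕ => φ (total r)) (emb h y) := by
      rintro r y (⟨hr, rfl⟩ | ⟨r', hr, rfl⟩)
      · rw [hr, h0, map_zero, map_zero]
      · rw [map_add, map_smul, emb_single, emb_single, map_one, map_add, map_smul, lift_single,
          lift_single, hr, h1, act_one, one_smul, one_smul]
    have : ∀ r : Fin 4 × ℕ, lift d (φ (total r)) =
        lift (fun r : Fin 4 × ℕ => φ (total r)) (emb h (perZ2.d r : FG Z2 (Fin 4 × ℕ))) :=
      fun r => key r _ (perZ2_d r)
    exact this
  aug_φ := by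
    have : ∀ r : Fin 4 × ℕ, aug e (φ (total r)) = perZ2.e r := by
      rintro ⟨c, k⟩
      rw [h2]
      have h4 : (total (c, k) = 0) ↔ k = 0 ∧ c = 0 := by
        rw [total, Fin.ext_iff]
        change (c : ℕ) + 4 * k = 0 ↔ k = 0 ∧ (c : ℕ) = 0
        omega
      change _ = if k = 0 then (if c = (0 : Fin 4) then (1 : ℤ) else 0) else 0
      simp only [h4]
      split_ifs <;> simp_all
    exact this
  deg_φ r := h3 (total r)

lemma x_mem {n i k : ℕ} (f : V4) (h : i + k = n) : x f i k ∈ supp V4 {t : ℕ × ℕ | t.1 + t.2 = n} :=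
  single_mem_supp (r := (i, k)) f h 1

/-- Inclusion of the subgroup generated by `α`. -/
noncomputable def homα : Tower.Hom perZ2.tower tower :=
  ofZ2 (MonoidHom.inl Z2 Z2) (fun n => x 1 n 0) (by rw [lift_d_x, d, map_zero])
    (fun n => by
      rw [lift_d_x, act_one, d, act_x, mul_one]
      rfl)
    (fun n => by simp [aug_x]) fun n => x_mem _ (add_zero n)

/-- Inclusion of the subgroup generated by `β`. -/
noncomputable def homβ : Tower.Hom perZ2.tower tower :=
  ofZ2 (MonoidHom.inr Z2 Z2) (fun n => x 1 0 n) (by rw [lift_d_x, d, map_zero])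
    (fun n => by
      rw [lift_d_x, act_one, d, act_x, mul_one]
      rfl)
    (fun n => by simp [aug_x]) fun n => x_mem _ (zero_add n)

/-- The image of the generator of degree `n` under the diagonal map. -/
noncomputable def diag (n : ℕ) : FG V4 (ℕ × ℕ) :=
  ∑ i ∈ Finset.range (n + 1), x (β ^ i) i (n - i)

/-- The first part of the differential. -/
noncomputable def dα (f : V4) : ℕ → ℕ → FG V4 (ℕ × ℕ)
  | 0, _ => 0
  | i + 1, k => x (f * α) i k + (-1 : ℤ) ^ (i + 1) • x f i k

/-- The second part of the differential. -/
noncomputable def dβ (f : V4) (i : ℕ) : ℕ → FG V4 (ℕ × ℕ)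
  | 0 => 0
  | k + 1 => (-1 : ℤ) ^ i • (x (f * β) i k + (-1 : ℤ) ^ (k + 1) • x f i k)

lemma lift_d_eq (f : V4) (i k : ℕ) : lift d (x f i k) = dα f i k + dβ f i k := by
  rw [lift_d_x]
  rcases i with _ | i <;> rcases k with _ | k <;>
  simp only [d, dα, dβ, map_zero, map_add, map_smul, act_x, mul_one, add_zero, zero_add, pow_zero,
    one_smul]

lemma lift_d_diag (n : ℕ) :
    lift d (diag (n + 1)) = act (α * β) (diag n) + (-1 : ℤ) ^ (n + 1) • diag n := by
  rw [diag, map_sum, Finset.sum_congr rfl fun i _ => lift_d_eq _ _ _, Finset.sum_add_distrib,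
    Finset.sum_range_succ', Finset.sum_range_succ (fun i => dβ _ i _), dα, add_zero, Nat.sub_self,
    dβ, add_zero, diag, map_sum, Finset.smul_sum, ← Finset.sum_add_distrib,
    ← Finset.sum_add_distrib]
  refine Finset.sum_congr rfl fun i hi => ?_
  have hi' : i ≤ n := Nat.lt_succ_iff.1 (Finset.mem_range.1 hi)
  obtain ⟨k, rfl⟩ := Nat.exists_eq_add_of_le hi'
  have e1 : i + k + 1 - (i + 1) = k := by omega
  have e2 : i + k + 1 - i = k + 1 := by omega
  have e3 : i + k - i = k := by omega
  rw [e1, e2, e3, dα, dβ, act_x, pow_succ β i]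
  have h1 : β ^ i * β * α = α * β * β ^ i := by rw [mul_comm (α * β), mul_assoc, mul_comm β α]
  rw [h1, pow_succ (-1 : ℤ) i, pow_succ (-1 : ℤ) k, pow_succ (-1 : ℤ) (i + k), pow_add]
  rcases neg_one_pow_eq_or ℤ i with h | h <;> rw [h] <;> module

/-- Inclusion of the subgroup generated by `αβ`. -/
noncomputable def homαβ : Tower.Hom perZ2.tower tower :=
  ofZ2 ((MonoidHom.id Z2).prod (MonoidHom.id Z2)) diag (by simp [diag, lift_d_x, d])
    (fun n => lift_d_diag n)
    (fun n => by
      rw [diag, map_sum, Finset.sum_congr rfl fun i _ => aug_x _ _ _]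
      rcases n with _ | n
      · simp
      · refine Finset.sum_eq_zero fun i hi => if_neg ?_
        rw [Prod.mk.injEq]
        have := Finset.mem_range.1 hi
        omega)
    fun n => Submodule.sum_mem _ fun i hi => x_mem _ (by
      have := Finset.mem_range.1 hi
      omega)

end V4

end FreeRes

/-! ### Assembling resolutions of stabilisers -/

namespace FreeRes

set_option linter.unusedSectionVars false

open Finsupp (single)

variable {G : Type} [Group G] {O : Type} (T : O → Tower)

/-- The generators of the assembled resolution. -/
abbrev Blocks := Σ o, (T o).R

lemma map_mem_of_supp {X M : Type} [AddCommGroup M] {A : Set X} {N : Submodule ℤ M}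
    (φ : FG G X →ₗ[ℤ] M) (h : ∀ γ, ∀ x ∈ A, φ (single (γ, x) 1) ∈ N) {z : FG G X}
    (hz : z ∈ supp G A) : φ z ∈ N := by
  rw [supp, Finsupp.supported_eq_span_single] at hz
  induction hz using Submodule.span_induction with
  | mem x hx =>
    obtain ⟨p, hp, rfl⟩ := hx
    exact h p.1 p.2 hp
  | zero => rw [map_zero]; exact N.zero_mem
  | add x y _ _ hx hy => rw [map_add]; exact N.add_mem hx hy
  | smul a x _ hx => rw [map_smul]; exact N.smul_mem a hx

/-- Inclusion of a block. -/
noncomputable def inc (o : O) : FG G (T o).R →ₗ[ℤ] FG G (Blocks T) :=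
  Finsupp.lmapDomain ℤ ℤ fun p => (p.1, ⟨o, p.2⟩)

variable {T}

@[simp] lemma inc_single (o : O) (γ : G) (r : (T o).R) (a : ℤ) :
    inc T o (single (γ, r) a) = single (γ, ⟨o, r⟩) a := by
  simp [inc]

lemma act_inc (o : O) (γ : G) (z : FG G (T o).R) : act γ (inc T o z) = inc T o (act γ z) := by
  have : (act γ).comp (inc T o) = (inc T o).comp (act γ) := hom_ext fun g x => by simp
  exact LinearMap.congr_fun this z

lemma inc_mem_supp (o : O) {A : Set (T o).R} {B : Set (Blocks T)} (h : ∀ r ∈ A, ⟨o, r⟩ ∈ B)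
    {z : FG G (T o).R} (hz : z ∈ supp G A) : inc T o z ∈ supp G B :=
  map_mem_of_supp (inc T o) (fun γ x hx => by
    rw [inc_single]
    exact single_mem_supp (r := (⟨o, x⟩ : Blocks T)) γ (h x hx) 1) hz

lemma mem_supp_univ {X : Type} (z : FG G X) : z ∈ supp G (Set.univ : Set X) :=
  (Finsupp.mem_supported _ _).2 fun _ _ => trivial

variable (ι : ∀ o, (T o).F →* G)

/-- The differential inside the blocks. -/
noncomputable def bd0 (x : Blocks T) : FG G (Blocks T) := inc T x.1 ((T x.1).D (ι x.1) x.2)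

lemma lift_bd0_inc (o : O) (z : FG G (T o).R) :
    lift (bd0 ι) (inc T o z) = inc T o (lift ((T o).D (ι o)) z) := by
  have : (lift (bd0 ι)).comp (inc T o) = (inc T o).comp (lift ((T o).D (ι o))) :=
    hom_ext fun g x => by simp [bd0, act_inc]
  exact LinearMap.congr_fun this z

/-- The contraction inside the blocks. -/
noncomputable def contr : FG G (Blocks T) →ₗ[ℤ] FG G (Blocks T) :=
  Finsupp.linearCombination ℤ fun p => inc T p.2.1 (Tower.S (ι p.2.1) (single (p.1, p.2.2) 1))

lemma contr_inc (o : O) (z : FG G (T o).R) : contr ι (inc T o z) = inc T o (Tower.S (ι o) z) := by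
  have : (contr ι).comp (inc T o) = (inc T o).comp (Tower.S (ι o)) :=
    hom_ext fun g x => by simp [contr]
  exact LinearMap.congr_fun this z

variable (T) in
/-- The projection to the cellular chains. -/
noncomputable def cell {M : Type} [AddCommGroup M] (k : G → O → M) : FG G (Blocks T) →ₗ[ℤ] M :=
  Finsupp.linearCombination ℤ fun p => (T p.2.1).e p.2.2 • k p.1 p.2.1

lemma cell_single {M : Type} [AddCommGroup M] (k : G → O → M) (γ : G) (x : Blocks T) (a : ℤ) :
    cell T k (single (γ, x) a) = a • (T x.1).e x.2 • k γ x.1 := by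
  simp [cell]

/-- Data assembling resolutions for stabilisers to a resolution. -/
structure Assembly (G : Type) [Group G] where
  O : Type
  T : O → Tower
  dim : O → ℕ
  dim_le : ∀ o, dim o ≤ 2
  ι : ∀ o, (T o).F →* G
  ι_inj : ∀ o, Function.Injective (ι o)
  d : Blocks T → FG G (Blocks T)
  hom : ∀ x, d x ∈ supp G {y : Blocks T | dim y.1 + (T y.1).deg y.2 + 1 = dim x.1 + (T x.1).deg x.2}
  d_d : ∀ x, lift d (d x) = 0
  d_low : ∀ x, d x - (-1 : ℤ) ^ dim x.1 • bd0 ι x ∈ supp G {y : Blocks T | dim y.1 < dim x.1}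
  M : Type
  [grpM : AddCommGroup M]
  k : G → O → M
  k_ι : ∀ γ o f, k (γ * ι o f) o = k γ o
  Q : M →ₗ[ℤ] (O × Set G →₀ ℤ)
  Q_k : ∀ γ o, Q (k γ o) = single (o, Tower.coset (ι o) γ) 1
  Δ : M →ₗ[ℤ] M
  comm : ∀ γ x, cell T k (act γ (d x)) = (T x.1).e x.2 • Δ (k γ x.1)
  augM : M →ₗ[ℤ] ℤ
  augM_k : ∀ γ o, augM (k γ o) = if dim o = 0 then 1 else 0
  augM_Δ : ∀ z, augM (Δ z) = 0
  acyclic : ∀ z, Δ (cell T k z) = 0 → augM (cell T k z) = 0 → ∃ w, Δ (cell T k w) = cell T k z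
  base : O
  dim_base : dim base = 0

attribute [instance] Assembly.grpM

namespace Assembly

variable (P : Assembly G)

/-- The projection to the cellular chains. -/
noncomputable abbrev pi : FG G (Blocks P.T) →ₗ[ℤ] P.M := cell P.T P.k

lemma pi_d (z : FG G (Blocks P.T)) : P.pi (lift P.d z) = P.Δ (P.pi z) := by
  have : P.pi.comp (lift P.d) = P.Δ.comp P.pi := hom_ext fun g x => by
    simp [P.comm, cell_single]
  exact LinearMap.congr_fun this z

lemma pi_inc (o : P.O) (γ : G) (y : FG (P.T o).F (P.T o).R) :
    P.pi (inc P.T o (act γ (emb (P.ι o) y))) = aug (P.T o).e y • P.k γ o := by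
  have : P.pi.comp ((inc P.T o).comp ((act γ).comp (emb (P.ι o)))) =
      (LinearMap.toSpanSingleton ℤ P.M (P.k γ o)).comp (aug (P.T o).e) := hom_ext fun g x => by
    simp [cell_single, P.k_ι]
  exact LinearMap.congr_fun this y

lemma pi_bd0 (z : FG G (Blocks P.T)) : P.pi (lift (bd0 P.ι) z) = 0 := by
  have : P.pi.comp (lift (bd0 P.ι)) = 0 := hom_ext fun g x => by
    simp [bd0, act_inc, Tower.D, P.pi_inc, (P.T x.1).e_d]
  exact LinearMap.congr_fun this z

/-- A section of the projection. -/
noncomputable def sect : (P.O × Set G →₀ ℤ) →ₗ[ℤ] FG G (Blocks P.T) :=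
  Finsupp.linearCombination ℤ fun p => single (Tower.rep p.2, ⟨p.1, (P.T p.1).bot⟩) 1

lemma pi_sect (z : FG G (Blocks P.T)) : P.pi (P.sect (P.Q (P.pi z))) = P.pi z := by
  have : P.pi.comp (P.sect.comp (P.Q.comp P.pi)) = P.pi := hom_ext fun g x => by
    have h : P.k (Tower.rep (Tower.coset (P.ι x.1) g)) x.1 = P.k g x.1 := by
      conv_rhs => rw [← Tower.rep_mul_comp (P.ι x.1) g, P.k_ι]
    simp [cell_single, P.Q_k, sect, (P.T x.1).e_bot, h]
  exact LinearMap.congr_fun this z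

lemma contract (z : FG G (Blocks P.T)) :
    lift (bd0 P.ι) (contr P.ι z) + contr P.ι (lift (bd0 P.ι) z) = z - P.sect (P.Q (P.pi z)) := by
  have : (lift (bd0 P.ι)).comp (contr P.ι) + (contr P.ι).comp (lift (bd0 P.ι)) =
      LinearMap.id - P.sect.comp (P.Q.comp P.pi) := hom_ext fun g ⟨o, r⟩ => by
    have h := congrArg (inc P.T o) (Tower.contract_induced (P.ι_inj o) (single (g, r) 1))
    rw [map_add, ← lift_bd0_inc, ← contr_inc, ← contr_inc, ← lift_bd0_inc, inc_single] at h
    simp only [LinearMap.add_apply, LinearMap.comp_apply, LinearMap.sub_apply, LinearMap.id_apply]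
    rw [h]
    simp [Tower.toCoset, Tower.ofCoset, cell_single, P.Q_k, sect]
  exact LinearMap.congr_fun this z

lemma bd0_mem {A : Set P.O} {z : FG G (Blocks P.T)} (h : z ∈ supp G {x : Blocks P.T | x.1 ∈ A}) :
    lift (bd0 P.ι) z ∈ supp G {x : Blocks P.T | x.1 ∈ A} :=
  map_mem_of_supp _ (fun γ x hx => by
    rw [lift_single, one_smul, bd0, act_inc]
    exact inc_mem_supp x.1 (fun r _ => hx) (mem_supp_univ _)) h

lemma contr_mem {A : Set P.O} {z : FG G (Blocks P.T)} (h : z ∈ supp G {x : Blocks P.T | x.1 ∈ A}) :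
    contr P.ι z ∈ supp G {x : Blocks P.T | x.1 ∈ A} :=
  map_mem_of_supp _ (fun γ x hx => by
    rw [contr, Finsupp.linearCombination_single, one_smul]
    exact inc_mem_supp x.1 (fun r _ => hx) (mem_supp_univ _)) h

lemma sect_mem {A : Set P.O} {z : FG G (Blocks P.T)} (h : z ∈ supp G {x : Blocks P.T | x.1 ∈ A}) :
    P.sect (P.Q (P.pi z)) ∈ supp G {x : Blocks P.T | x.1 ∈ A} := by
  rw [← sub_sub_cancel z (P.sect (P.Q (P.pi z))), ← P.contract]
  exact sub_mem h (add_mem (P.bd0_mem (P.contr_mem h)) (P.contr_mem (P.bd0_mem h)))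

lemma lift_d_d (z : FG G (Blocks P.T)) : lift P.d (lift P.d z) = 0 := by
  have : (lift P.d).comp (lift P.d) = 0 := hom_ext fun g x => by simp [lift_act, P.d_d]
  exact LinearMap.congr_fun this z

lemma exact_aux (p : ℕ) : ∀ z ∈ supp G {x : Blocks P.T | x.1 ∈ {o | P.dim o < p}},
    lift P.d z = 0 → P.pi z = 0 → ∃ w, lift P.d w = z := by
  induction p with
  | zero =>
    intro z hz _ _
    refine ⟨0, ?_⟩
    have : z = 0 := by
      rw [← Finsupp.support_eq_empty, Finset.eq_empty_iff_forall_notMem]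
      intro x hx
      exact absurd ((Finsupp.mem_supported _ _).1 hz hx) (Nat.not_lt_zero _)
    rw [this, map_zero]
  | succ p ih =>
    intro z hz hd hp
    have hsplit : supp G {x : Blocks P.T | x.1 ∈ {o | P.dim o < p + 1}} =
        supp G {x : Blocks P.T | x.1 ∈ {o | P.dim o < p}} ⊔
          supp G {x : Blocks P.T | x.1 ∈ {o | P.dim o = p}} := by
      rw [supp, supp, supp, ← Finsupp.supported_union]
      congr 1
      ext x
      exact Nat.lt_succ_iff_lt_or_eq
    have hdisj : ∀ y, y ∈ supp G {x : Blocks P.T | x.1 ∈ {o | P.dim o < p}} →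
        y ∈ supp G {x : Blocks P.T | x.1 ∈ {o | P.dim o = p}} → y = 0 := by
      intro y h1 h2
      rw [← Finsupp.support_eq_empty, Finset.eq_empty_iff_forall_notMem]
      intro x hx
      have h3 : P.dim x.2.1 < p := (Finsupp.mem_supported _ _).1 h1 hx
      have h4 : P.dim x.2.1 = p := (Finsupp.mem_supported _ _).1 h2 hx
      omega
    have hlow : ∀ y ∈ supp G {x : Blocks P.T | x.1 ∈ {o | P.dim o = p}},
        lift P.d y - (-1 : ℤ) ^ p • lift (bd0 P.ι) y ∈
          supp G {x : Blocks P.T | x.1 ∈ {o | P.dim o < p}} := fun y hy =>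
      map_mem_of_supp (lift P.d - (-1 : ℤ) ^ p • lift (bd0 P.ι)) (fun γ x hx => by
        have hx : P.dim x.1 = p := hx
        have := act_mem_supp γ (P.d_low x)
        rw [hx, map_sub, map_smul] at this
        rw [LinearMap.sub_apply, LinearMap.smul_apply, lift_single, one_smul, lift_single, one_smul]
        exact this) hy
    have hlow' : ∀ y ∈ supp G {x : Blocks P.T | x.1 ∈ {o | P.dim o < p}},
        lift P.d y ∈ supp G {x : Blocks P.T | x.1 ∈ {o | P.dim o < p}} := fun y hy =>
      map_mem_of_supp (lift P.d) (fun γ x hx => by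
        have hx : P.dim x.1 < p := hx
        have h1 : P.d x - (-1 : ℤ) ^ P.dim x.1 • bd0 P.ι x ∈
            supp G {x : Blocks P.T | x.1 ∈ {o | P.dim o < p}} :=
          Finsupp.supported_mono (fun y hy => lt_trans hy hx) (P.d_low x)
        have h2 : bd0 P.ι x ∈ supp G {x : Blocks P.T | x.1 ∈ {o | P.dim o < p}} :=
          inc_mem_supp x.1 (fun r _ => hx) (mem_supp_univ _)
        have := act_mem_supp γ (add_mem h1 (Submodule.smul_mem _ ((-1 : ℤ) ^ P.dim x.1) h2))
        rw [sub_add_cancel] at this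
        simpa using this) hy
    rw [hsplit] at hz
    obtain ⟨z0, hz0, z1, hz1, rfl⟩ := Submodule.mem_sup.1 hz
    have hsq : (-1 : ℤ) ^ p * (-1) ^ p = 1 := by rw [← mul_pow]; norm_num
    have h1 : lift (bd0 P.ι) z1 = 0 := by
      refine hdisj _ ?_ (P.bd0_mem hz1)
      have h2 := Submodule.smul_mem _ (-(-1 : ℤ) ^ p) (add_mem (hlow' z0 hz0) (hlow z1 hz1))
      rw [map_add] at hd
      have h3 : lift P.d z0 + (lift P.d z1 - (-1 : ℤ) ^ p • lift (bd0 P.ι) z1) =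
          -((-1 : ℤ) ^ p • lift (bd0 P.ι) z1) := by
        rw [← add_sub_assoc, hd, zero_sub]
      rwa [h3, smul_neg, neg_smul, neg_neg, smul_smul, hsq, one_smul] at h2
    have h2 : P.sect (P.Q (P.pi z1)) = 0 := by
      refine hdisj _ ?_ (P.sect_mem hz1)
      have h3 : P.sect (P.Q (P.pi z1)) = - P.sect (P.Q (P.pi z0)) := by
        rw [eq_neg_iff_add_eq_zero, ← map_add, ← map_add, ← map_add, add_comm z1, hp, map_zero,
          map_zero]
      rw [h3]
      exact neg_mem (P.sect_mem hz0)
    have h3 : lift (bd0 P.ι) (contr P.ι z1) = z1 := by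
      have := P.contract z1
      rwa [h1, h2, map_zero, add_zero, sub_zero] at this
    have h4 : P.pi (contr P.ι z1) = 0 := by
      have := congrArg P.pi (P.contract (contr P.ι z1))
      rwa [map_add, map_sub, P.pi_sect, sub_self, P.pi_bd0, zero_add, h3] at this
    obtain ⟨w, hw⟩ := ih (z0 + z1 - lift P.d ((-1 : ℤ) ^ p • contr P.ι z1)) (by
        have := Submodule.smul_mem _ ((-1 : ℤ) ^ p) (hlow _ (P.contr_mem hz1))
        rw [smul_sub, smul_smul, hsq, one_smul, h3, ← map_smul] at this
        rw [add_sub_assoc, ← neg_sub (lift P.d _)]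
        exact add_mem hz0 (neg_mem this))
      (by rw [map_sub, hd, P.lift_d_d, sub_zero])
      (by rw [map_sub, hp, P.pi_d, map_smul, h4, smul_zero, map_zero, sub_zero])
    exact ⟨w + (-1 : ℤ) ^ p • contr P.ι z1, by rw [map_add, hw, sub_add_cancel]⟩

/-- The augmentation. -/
def e (x : Blocks P.T) : ℤ := if P.dim x.1 = 0 then (P.T x.1).e x.2 else 0

lemma augM_pi (z : FG G (Blocks P.T)) : P.augM (P.pi z) = aug P.e z := by
  have : P.augM.comp P.pi = aug P.e := hom_ext fun g x => by
    simp [cell_single, P.augM_k, e]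
  exact LinearMap.congr_fun this z

/-- The assembled resolution. -/
noncomputable def resolution : GradedResolution G where
  X := Blocks P.T
  deg x := P.dim x.1 + (P.T x.1).deg x.2
  d := P.d
  e := P.e
  hom := P.hom
  d_d := P.d_d
  e_d x := by
    have := P.pi_d (single (1, x) 1)
    rw [lift_single, one_smul, act_one] at this
    rw [← P.augM_pi, this, P.augM_Δ]
  e_pos x hx := by
    rw [e]
    split_ifs with h
    · exact (P.T x.1).e_pos _ (by omega)
    · rfl
  exact z h1 h2 := by
    obtain ⟨w, hw⟩ := P.acyclic z (by rw [← P.pi_d, h1, map_zero]) (by rw [P.augM_pi, h2])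
    obtain ⟨y, hy⟩ := P.exact_aux 3 (z - lift P.d w)
      ((Finsupp.mem_supported _ _).2 fun x _ => Nat.lt_succ_of_le (P.dim_le _))
      (by rw [map_sub, h1, P.lift_d_d, sub_zero])
      (by rw [map_sub, P.pi_d, hw, sub_self])
    exact ⟨y + w, by rw [map_add, hy, sub_add_cancel]⟩
  surj := ⟨⟨P.base, (P.T P.base).bot⟩, by
    rw [e, if_pos P.dim_base]
    exact (P.T P.base).e_bot⟩

end Assembly

end FreeRes

/-! ### Resolutions from two-dimensional complexes -/

namespace FreeRes

set_option linter.unusedSectionVars false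

open Finsupp (single)
open Bianchi (lsum lscale lbind map_lsum lsum_lbind lsum_map lsum_congr lsum_mem lsum_cons lsum_nil)

/-- An end of an edge: a vertex, a group element and a map of resolutions. -/
structure End (G : Type) {V : Type} (TV : V → Tower) (T : Tower) where
  v : V
  u : G
  m : Tower.Hom T (TV v)

/-- An action of a group on a two-dimensional complex, together with resolutions for stabilisers. -/
structure Cells (G : Type) [Group G] where
  V : Type
  E : Type
  F : Type
  TV : V → Tower
  TE : E → Tower
  ιV : ∀ v, (TV v).F →* G
  ιE : ∀ e, (TE e).F →* G
  ιV_inj : ∀ v, Function.Injective (ιV v)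
  ιE_inj : ∀ e, Function.Injective (ιE e)
  en : Bool → ∀ e, End G TV (TE e)
  compat : ∀ b e f, ιE e f * (en b e).u = (en b e).u * ιV _ ((en b e).m.h f)
  φ_bot : ∀ b e, (en b e).m.φ (TE e).bot = single (1, (TV _).bot) 1
  fe : F → List (ℤ × (G × E))
  fc : F → List (ℤ × (G × Σ v, (TV v).F))
  closed : ∀ t, ev (lbind (fun p => [(1, (p.1 * (en true p.2).u, (en true p.2).v)),
      (-1, (p.1 * (en false p.2).u, (en false p.2).v))]) (fe t) ++
    lbind (fun p => [(1, (p.1 * ιV p.2.1 p.2.2, p.2.1)), (-1, (p.1, p.2.1))]) (fc t)) = 0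
  M : Type
  [grpM : AddCommGroup M]
  k : G → V ⊕ E ⊕ F → M
  kV : ∀ γ v f, k (γ * ιV v f) (.inl v) = k γ (.inl v)
  kE : ∀ γ e f, k (γ * ιE e f) (.inr (.inl e)) = k γ (.inr (.inl e))
  Q : M →ₗ[ℤ] ((V ⊕ E ⊕ F) × Set G →₀ ℤ)
  Q_V : ∀ γ v, Q (k γ (.inl v)) = single (.inl v, Tower.coset (ιV v) γ) 1
  Q_E : ∀ γ e, Q (k γ (.inr (.inl e))) = single (.inr (.inl e), Tower.coset (ιE e) γ) 1
  Q_F : ∀ γ t, Q (k γ (.inr (.inr t))) = single (.inr (.inr t), {γ}) 1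
  Δ : M →ₗ[ℤ] M
  Δ_V : ∀ γ v, Δ (k γ (.inl v)) = 0
  Δ_E : ∀ γ e, Δ (k γ (.inr (.inl e))) =
    k (γ * (en true e).u) (.inl (en true e).v) - k (γ * (en false e).u) (.inl (en false e).v)
  Δ_F : ∀ γ t, Δ (k γ (.inr (.inr t))) = lsum (fun p => k (γ * p.1) (.inr (.inl p.2))) (fe t)
  augM : M →ₗ[ℤ] ℤ
  aug_V : ∀ γ v, augM (k γ (.inl v)) = 1
  aug_EF : ∀ γ x, augM (k γ (.inr x)) = 0
  augM_Δ : ∀ z, augM (Δ z) = 0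
  acyclic : ∀ z ∈ Submodule.span ℤ (Set.range fun p : G × (V ⊕ E ⊕ F) => k p.1 p.2), Δ z = 0 →
    augM z = 0 → ∃ w ∈ Submodule.span ℤ (Set.range fun p : G × (V ⊕ E ⊕ F) => k p.1 p.2), Δ w = z
  v₀ : V

attribute [instance] Cells.grpM

namespace Cells

variable {G : Type} [Group G] (P : Cells G)

/-- The cells. -/
abbrev O := P.V ⊕ P.E ⊕ P.F

/-- The resolutions for stabilisers. -/
noncomputable abbrev T : P.O → Tower
  | .inl v => P.TV v
  | .inr (.inl e) => P.TE e
  | .inr (.inr _) => towerOne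

/-- The dimension of a cell. -/
abbrev dim : P.O → ℕ
  | .inl _ => 0
  | .inr (.inl _) => 1
  | .inr (.inr _) => 2

/-- The inclusions of stabilisers. -/
noncomputable def ι : ∀ o : P.O, (P.T o).F →* G
  | .inl v => P.ιV v
  | .inr (.inl e) => P.ιE e
  | .inr (.inr _) => (1 : Unit →* G)

/-- The generators. -/
abbrev X := Blocks P.T

/-- A generator at a vertex. -/
abbrev xV (v : P.V) (r : (P.TV v).R) : P.X := ⟨.inl v, r⟩

/-- A generator at an edge. -/
abbrev xE (e : P.E) (r : (P.TE e).R) : P.X := ⟨.inr (.inl e), r⟩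

/-- The generator at a face. -/
abbrev xF (t : P.F) : P.X := ⟨.inr (.inr t), ()⟩

/-- Inclusion of a block at a vertex. -/
noncomputable def incV (v : P.V) : FG G (P.TV v).R →ₗ[ℤ] FG G P.X := inc P.T (.inl v)

/-- Inclusion of a block at an edge. -/
noncomputable def incE (e : P.E) : FG G (P.TE e).R →ₗ[ℤ] FG G P.X := inc P.T (.inr (.inl e))

lemma incV_single (v : P.V) (γ : G) (r : (P.TV v).R) (a : ℤ) :
    P.incV v (single (γ, r) a) = single (γ, P.xV v r) a := inc_single (T := P.T) (.inl v) γ r a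

lemma incE_single (e : P.E) (γ : G) (r : (P.TE e).R) (a : ℤ) :
    P.incE e (single (γ, r) a) = single (γ, P.xE e r) a :=
  inc_single (T := P.T) (.inr (.inl e)) γ r a

lemma act_incV (v : P.V) (γ : G) (z : FG G (P.TV v).R) :
    act γ (P.incV v z) = P.incV v (act γ z) := act_inc (T := P.T) (.inl v) γ z

lemma act_incE (e : P.E) (γ : G) (z : FG G (P.TE e).R) :
    act γ (P.incE e z) = P.incE e (act γ z) := act_inc (T := P.T) (.inr (.inl e)) γ z

/-- The contribution of an end of an edge. -/
noncomputable def endT (b : Bool) (e : P.E) : FG (P.TE e).F (P.TE e).R →ₗ[ℤ] FG G P.X :=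
  (P.incV (P.en b e).v).comp <| (act (P.en b e).u).comp <| (emb (P.ιV (P.en b e).v)).comp <|
    (lift (P.en b e).m.φ).comp (emb (P.en b e).m.h)

/-- The path at a vertex from a translate of the base point. -/
noncomputable def path (p : G × Σ v, (P.TV v).F) : FG G P.X :=
  P.incV p.2.1 (act p.1 (emb (P.ιV p.2.1) ((P.TV p.2.1).s (single (p.2.2, (P.TV p.2.1).bot) 1))))

/-- The differential. -/
noncomputable def d : P.X → FG G P.X
  | ⟨.inl v, r⟩ => P.incV v (emb (P.ιV v) ((P.TV v).d r))
  | ⟨.inr (.inl e), r⟩ => P.endT true e (single (1, r) 1) - P.endT false e (single (1, r) 1) -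
      P.incE e (emb (P.ιE e) ((P.TE e).d r))
  | ⟨.inr (.inr t), _⟩ => lsum (fun p => single (p.1, P.xE p.2 (P.TE p.2).bot) 1) (P.fe t) +
      lsum P.path (P.fc t)

lemma lift_d_V (v : P.V) (z : FG (P.TV v).F (P.TV v).R) :
    lift P.d (P.incV v (emb (P.ιV v) z)) = P.incV v (emb (P.ιV v) (lift (P.TV v).d z)) := by
  have : (lift P.d).comp ((P.incV v).comp (emb (P.ιV v))) =
      (P.incV v).comp ((emb (P.ιV v)).comp (lift (P.TV v).d)) := hom_ext fun f r => by
    simp [incV_single, d, act_incV, emb_act]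
  exact LinearMap.congr_fun this z

lemma act_endT (b : Bool) (e : P.E) (f : (P.TE e).F) (z : FG (P.TE e).F (P.TE e).R) :
    act (P.ιE e f) (P.endT b e z) = P.endT b e (act f z) := by
  simp only [endT, LinearMap.comp_apply]
  rw [act_incV, act_act, P.compat, ← act_act, ← emb_act, ← lift_act, ← emb_act]

lemma lift_d_E (e : P.E) (z : FG (P.TE e).F (P.TE e).R) :
    lift P.d (P.incE e (emb (P.ιE e) z)) = P.endT true e z - P.endT false e z -
      P.incE e (emb (P.ιE e) (lift (P.TE e).d z)) := by
  have : (lift P.d).comp ((P.incE e).comp (emb (P.ιE e))) = P.endT true e - P.endT false e -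
      (P.incE e).comp ((emb (P.ιE e)).comp (lift (P.TE e).d)) := hom_ext fun f r => by
    simp only [LinearMap.comp_apply, LinearMap.sub_apply, emb_single, incE_single, lift_single,
      one_smul, d, map_sub, act_endT, act_incE, emb_act, act_single, mul_one]
  exact LinearMap.congr_fun this z

lemma lift_d_endT (b : Bool) (e : P.E) (r : (P.TE e).R) :
    lift P.d (P.endT b e (single (1, r) 1)) = P.endT b e ((P.TE e).d r) := by
  simp only [endT, LinearMap.comp_apply]
  rw [← act_incV, lift_act, lift_d_V, emb_single, lift_single, one_smul, map_one, act_one,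
    (P.en b e).m.comm, act_incV]

lemma endT_bot (b : Bool) (e : P.E) : P.endT b e (single (1, (P.TE e).bot) 1) =
    single ((P.en b e).u, P.xV (P.en b e).v (P.TV _).bot) 1 := by
  simp only [endT, LinearMap.comp_apply]
  rw [emb_single, map_one, lift_single, one_smul, act_one, P.φ_bot, emb_single, map_one, act_single,
    mul_one, incV_single]

lemma d_E_bot (e : P.E) : P.d (P.xE e (P.TE e).bot) =
    single ((P.en true e).u, P.xV (P.en true e).v (P.TV _).bot) 1 -
      single ((P.en false e).u, P.xV (P.en false e).v (P.TV _).bot) 1 := by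
  rw [d, endT_bot, endT_bot, Tower.d_bot, map_zero, map_zero, sub_zero]

lemma lift_d_path (p : G × Σ v, (P.TV v).F) : lift P.d (P.path p) =
    single (p.1 * P.ιV p.2.1 p.2.2, P.xV p.2.1 (P.TV _).bot) 1 -
      single (p.1, P.xV p.2.1 (P.TV _).bot) 1 := by
  rw [path, ← act_incV, lift_act, lift_d_V, Tower.d_s_bot, map_sub, map_sub, emb_single, emb_single,
    incV_single, incV_single, map_sub, act_single, act_single, map_one, mul_one]

lemma d_d (x : P.X) : lift P.d (P.d x) = 0 := by
  obtain ⟨v | e | t, r⟩ := x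
  · rw [d, lift_d_V, Tower.d_d, map_zero, map_zero]
  · rw [d, map_sub, map_sub, lift_d_endT, lift_d_endT, lift_d_E, Tower.d_d, map_zero, map_zero]
    abel
  · have h1 := congrArg
      (lift fun v : P.V => single ((1 : G), P.xV v (P.TV v).bot) (1 : ℤ)) (P.closed t)
    rw [ev_append, map_add, ev, ev, map_lsum, map_lsum, lsum_lbind, lsum_lbind, map_zero] at h1
    rw [d, map_add, map_lsum, map_lsum, ← h1]
    congr 1
    · refine lsum_congr fun p _ => ?_
      rw [lift_single, one_smul, d_E_bot]
      simp [sub_eq_add_neg]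
    · refine lsum_congr fun p _ => ?_
      rw [lift_d_path]
      simp [sub_eq_add_neg]

lemma incV_mem {v : P.V} {A : Set (P.TV v).R} {B : Set P.X} (h : ∀ r ∈ A, P.xV v r ∈ B)
    {z : FG G (P.TV v).R} (hz : z ∈ supp G A) : P.incV v z ∈ supp G B :=
  inc_mem_supp (T := P.T) (.inl v) h hz

lemma incE_mem {e : P.E} {A : Set (P.TE e).R} {B : Set P.X} (h : ∀ r ∈ A, P.xE e r ∈ B)
    {z : FG G (P.TE e).R} (hz : z ∈ supp G A) : P.incE e z ∈ supp G B :=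
  inc_mem_supp (T := P.T) (.inr (.inl e)) h hz

lemma endT_mem {b : Bool} {e : P.E} {r : (P.TE e).R} {B : Set P.X}
    (h : ∀ r', (P.TV (P.en b e).v).deg r' = (P.TE e).deg r → P.xV (P.en b e).v r' ∈ B) :
    P.endT b e (single (1, r) 1) ∈ supp G B := by
  simp only [endT, LinearMap.comp_apply]
  rw [emb_single, lift_single, one_smul, map_one, act_one]
  exact P.incV_mem h (act_mem_supp _ (emb_mem_supp _ ((P.en b e).m.deg_φ r)))

lemma path_mem {p : G × Σ v, (P.TV v).F} {B : Set P.X}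
    (h : ∀ r', (P.TV p.2.1).deg r' = 1 → P.xV p.2.1 r' ∈ B) : P.path p ∈ supp G B :=
  P.incV_mem h (act_mem_supp _ (emb_mem_supp _ ((P.TV p.2.1).s_bot p.2.2)))

lemma hom (x : P.X) : P.d x ∈
    supp G {y : P.X | P.dim y.1 + (P.T y.1).deg y.2 + 1 = P.dim x.1 + (P.T x.1).deg x.2} := by
  obtain ⟨v | e | t, r⟩ := x
  · refine P.incV_mem (fun r' h => ?_) (emb_mem_supp _ ((P.TV v).hom r))
    have h : (P.TV v).deg r' + 1 = (P.TV v).deg r := h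
    change 0 + (P.TV v).deg r' + 1 = 0 + (P.TV v).deg r
    omega
  · have h1 : ∀ b, P.endT b e (single (1, r) 1) ∈ supp G {y : P.X |
        P.dim y.1 + (P.T y.1).deg y.2 + 1 = 1 + (P.TE e).deg r} := fun b =>
      P.endT_mem fun r' h => by
        change 0 + (P.TV (P.en b e).v).deg r' + 1 = 1 + (P.TE e).deg r
        omega
    refine sub_mem (sub_mem (h1 _) (h1 _)) (P.incE_mem (fun r' h => ?_)
      (emb_mem_supp _ ((P.TE e).hom r)))
    have h : (P.TE e).deg r' + 1 = (P.TE e).deg r := h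
    change 1 + (P.TE e).deg r' + 1 = 1 + (P.TE e).deg r
    omega
  · refine add_mem (lsum_mem _ fun p _ => single_mem_supp _ ?_ _) (lsum_mem _ fun p _ =>
      P.path_mem fun r' h => ?_)
    · change 1 + (P.TE _).deg _ + 1 = 2 + 0
      rw [Tower.deg_bot]
    · change 0 + (P.TV _).deg _ + 1 = 2 + 0
      rw [h]

lemma d_low (x : P.X) : P.d x - (-1 : ℤ) ^ P.dim x.1 • bd0 P.ι x ∈
    supp G {y : P.X | P.dim y.1 < P.dim x.1} := by
  obtain ⟨v | e | t, r⟩ := x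
  · have : P.d ⟨.inl v, r⟩ - (-1 : ℤ) ^ P.dim (.inl v) • bd0 P.ι ⟨.inl v, r⟩ = 0 := by
      rw [pow_zero, one_smul]
      exact sub_self _
    exact this ▸ Submodule.zero_mem _
  · have : P.d ⟨.inr (.inl e), r⟩ - (-1 : ℤ) ^ P.dim (.inr (.inl e)) •
        bd0 P.ι ⟨.inr (.inl e), r⟩ =
        P.endT true e (single (1, r) 1) - P.endT false e (single (1, r) 1) := by
      rw [pow_one, neg_one_smul, sub_neg_eq_add]
      exact sub_add_cancel _ _
    rw [this]
    exact sub_mem (P.endT_mem fun r' _ => Nat.zero_lt_one) (P.endT_mem fun r' _ => Nat.zero_lt_one)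
  · have : bd0 P.ι ⟨.inr (.inr t), r⟩ = 0 := by
      change inc P.T _ (emb _ 0) = 0
      rw [map_zero, map_zero]
    rw [this, smul_zero, sub_zero]
    exact add_mem (lsum_mem _ fun p _ => single_mem_supp (r := P.xE p.2.2 (P.TE p.2.2).bot) _
      (show (1 : ℕ) < 2 from Nat.one_lt_two) _) (lsum_mem _ fun p _ =>
      P.path_mem fun r' h => Nat.zero_lt_two)

/-- The projection to the cellular chains. -/
noncomputable abbrev pi : FG G P.X →ₗ[ℤ] P.M := cell P.T P.k

lemma pi_incV (v : P.V) (γ : G) (z : FG (P.TV v).F (P.TV v).R) :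
    P.pi (P.incV v (act γ (emb (P.ιV v) z))) = aug (P.TV v).e z • P.k γ (.inl v) := by
  have : P.pi.comp ((P.incV v).comp ((act γ).comp (emb (P.ιV v)))) =
      (LinearMap.toSpanSingleton ℤ P.M (P.k γ (.inl v))).comp (aug (P.TV v).e) :=
    hom_ext fun g x => by
      simp [incV_single, cell_single, P.kV]
  exact LinearMap.congr_fun this z

lemma pi_incE (e : P.E) (γ : G) (z : FG (P.TE e).F (P.TE e).R) :
    P.pi (P.incE e (act γ (emb (P.ιE e) z))) = aug (P.TE e).e z • P.k γ (.inr (.inl e)) := by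
  have : P.pi.comp ((P.incE e).comp ((act γ).comp (emb (P.ιE e)))) =
      (LinearMap.toSpanSingleton ℤ P.M (P.k γ (.inr (.inl e)))).comp (aug (P.TE e).e) :=
    hom_ext fun g x => by
      simp [incE_single, cell_single, P.kE]
  exact LinearMap.congr_fun this z

lemma pi_endT (b : Bool) (e : P.E) (γ : G) (r : (P.TE e).R) :
    P.pi (act γ (P.endT b e (single (1, r) 1))) =
      (P.TE e).e r • P.k (γ * (P.en b e).u) (.inl (P.en b e).v) := by
  simp only [endT, LinearMap.comp_apply]
  rw [emb_single, lift_single, one_smul, map_one, act_one, act_incV, act_act, pi_incV,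
    (P.en b e).m.aug_φ]

lemma aug_eq_zero (T : Tower) {z : FG T.F T.R} (h : z ∈ supp T.F {t | T.deg t = 1}) :
    aug T.e z = 0 := by
  have := map_mem_of_supp (N := ⊥) (aug T.e) (fun γ x hx => by
    have hx : T.deg x = 1 := hx
    rw [aug_single, T.e_pos x (by omega), mul_zero]
    exact Submodule.zero_mem _) h
  exact this

lemma pi_path (γ : G) (p : G × Σ v, (P.TV v).F) : P.pi (act γ (P.path p)) = 0 := by
  rw [path, act_incV, act_act, pi_incV, aug_eq_zero _ ((P.TV p.2.1).s_bot p.2.2), zero_smul]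

lemma comm (γ : G) (x : P.X) : P.pi (act γ (P.d x)) = (P.T x.1).e x.2 • P.Δ (P.k γ x.1) := by
  obtain ⟨v | e | t, r⟩ := x
  · rw [d, act_incV, pi_incV, Tower.e_d, zero_smul, P.Δ_V, smul_zero]
  · rw [d, map_sub, map_sub, map_sub, map_sub, pi_endT, pi_endT, act_incE, pi_incE, Tower.e_d,
      zero_smul, sub_zero, P.Δ_E, smul_sub]
  · rw [d, map_add, map_add, map_lsum, map_lsum, map_lsum, map_lsum]
    have h1 : lsum (fun p => P.pi (act γ (P.path p))) (P.fc t) = 0 := by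
      refine (lsum_congr (v' := fun _ => 0) fun p _ => P.pi_path γ p.2).trans ?_
      simp [lsum]
    rw [h1, add_zero, P.Δ_F]
    refine Eq.trans (lsum_congr fun p _ => ?_) (one_smul _ _).symm
    rw [act_single, cell_single, one_smul]
    exact (congrArg (· • _) (P.TE p.2.2).e_bot).trans (one_smul _ _)

lemma pi_mem (z : FG G P.X) :
    P.pi z ∈ Submodule.span ℤ (Set.range fun p : G × (P.V ⊕ P.E ⊕ P.F) => P.k p.1 p.2) :=
  map_mem_of_supp P.pi (fun γ x _ => by
    rw [cell_single]
    exact Submodule.smul_mem _ _ (Submodule.smul_mem _ _ (Submodule.subset_span ⟨(γ, x.1), rfl⟩)))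
    (mem_supp_univ z)

lemma exists_pi {y : P.M}
    (hy : y ∈ Submodule.span ℤ (Set.range fun p : G × (P.V ⊕ P.E ⊕ P.F) => P.k p.1 p.2)) :
    ∃ z, P.pi z = y := by
  suffices h : Submodule.span ℤ (Set.range fun p : G × (P.V ⊕ P.E ⊕ P.F) => P.k p.1 p.2) ≤
      LinearMap.range P.pi from h hy
  rw [Submodule.span_le]
  rintro _ ⟨⟨γ, o⟩, rfl⟩
  exact ⟨single (γ, ⟨o, (P.T o).bot⟩) 1, by rw [cell_single, Tower.e_bot, one_smul, one_smul]⟩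

/-- The assembly described by the complex. -/
noncomputable def assembly : Assembly G where
  O := P.O
  T := P.T
  dim := P.dim
  dim_le := by rintro (v | e | t) <;> simp [dim]
  ι := P.ι
  ι_inj := by
    rintro (v | e | t)
    · exact P.ιV_inj v
    · exact P.ιE_inj e
    · exact fun _ _ _ => rfl
  d := P.d
  hom := P.hom
  d_d := P.d_d
  d_low := P.d_low
  M := P.M
  k := P.k
  k_ι := by
    rintro γ (v | e | t) f
    · exact P.kV γ v f
    · exact P.kE γ e f
    · exact congrArg (P.k · _) (mul_one γ)
  Q := P.Q
  Q_k := by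
    rintro γ (v | e | t)
    · exact P.Q_V γ v
    · exact P.Q_E γ e
    · rw [P.Q_F]
      congr 2
      ext x
      constructor
      · rintro rfl
        exact ⟨(), mul_one _⟩
      · rintro ⟨f, rfl⟩
        exact mul_one _
  Δ := P.Δ
  comm := P.comm
  augM := P.augM
  augM_k := by
    rintro γ (v | e | t)
    · exact P.aug_V γ v
    · exact P.aug_EF γ _
    · exact P.aug_EF γ _
  augM_Δ := P.augM_Δ
  acyclic z h1 h2 := by
    obtain ⟨w, hw, hw'⟩ := P.acyclic _ (P.pi_mem z) h1 h2
    obtain ⟨y, rfl⟩ := P.exists_pi hw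
    exact ⟨y, hw'⟩
  base := .inl P.v₀
  dim_base := rfl

end Cells

end FreeRes

/-! ### The complex of the Bianchi group -/

namespace Bianchi

open FreeRes
open Finsupp (single)

/-- The class of a matrix given by its entries. -/
def m (a0 a1 b0 b1 c0 c1 d0 d1 : ℤ) : Γ :=
  if h : a0 * d0 - 13 * (a1 * d1) - (b0 * c0 - 13 * (b1 * c1)) = 1 ∧
      a0 * d1 + a1 * d0 - (b0 * c1 + b1 * c0) = 0 then
    Γ.mk ⟨a0, a1, b0, b1, c0, c1, d0, d1, h.1, h.2⟩ else 1

/-- The inversion. -/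
def mW : Γ := m 0 0 1 0 (-1) 0 0 0
/-- The translation by one. -/
def mT : Γ := m 1 0 1 0 0 0 1 0
/-- The translation by `√-13`. -/
def mU : Γ := m 1 0 0 1 0 0 1 0
/-- A matrix relating two vertices. -/
def mA : Γ := m 1 1 (-5) 0 3 0 (-1) 1
/-- The complex conjugate of `mA`. -/
def mA' : Γ := m 1 (-1) (-5) 0 3 0 (-1) (-1)
/-- A matrix relating two vertices. -/
def mB : Γ := m 1 (-1) 5 0 (-3) 0 (-1) (-1)
/-- The complex conjugate of `mB`. -/
def mB' : Γ := m 1 1 5 0 (-3) 0 (-1) 1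
/-- A matrix relating two edges. -/
def mC : Γ := m 14 (-1) 0 4 0 (-4) 14 1

/-- The orbits of vertices. -/
abbrev OV := Fin 4 ⊕ Fin 2

/-- The orbits of edges. -/
abbrev OE := Fin 7 ⊕ Fin 2 ⊕ Fin 5

/-- The orbits of cells. -/
abbrev OC := OV ⊕ OE ⊕ Fin 8

/-- Generators `x` of stabilisers of vertices. -/
def gx : Fin 4 → Γ :=
  ![m 0 1 4 0 3 0 0 (-1), m 0 1 (-4) 0 (-3) 0 0 (-1), m 2 1 2 (-1) 4 0 (-2) (-1),
    m 2 (-1) 2 1 4 0 (-2) 1]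

/-- Generators `y` of stabilisers of vertices. -/
def gy : Fin 4 → Γ := ![mW, mW, m 4 0 (-2) (-1) 2 (-1) (-4) 0, m 4 0 (-2) 1 2 1 (-4) 0]

/-- Generators `α` of stabilisers of vertices. -/
def gα : Fin 2 → Γ := ![m 0 1 4 0 3 0 0 (-1), m 0 1 (-4) 0 (-3) 0 0 (-1)]

/-- Generators `β` of stabilisers of vertices. -/
def gβ : Fin 2 → Γ := ![m 5 0 0 (-2) 0 (-1) (-5) 0, m 5 0 0 2 0 1 (-5) 0]

/-- Generators of stabilisers of edges of order two. -/
def gε : Fin 7 → Γ :=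
  ![m 0 1 4 0 3 0 0 (-1), m 0 1 (-4) 0 (-3) 0 0 (-1), m 2 1 2 (-1) 4 0 (-2) (-1),
    m 2 (-1) 2 1 4 0 (-2) 1, mW, m 4 0 (-2) (-1) 2 (-1) (-4) 0, m 0 1 6 0 2 0 0 (-1)]

/-- Generators of stabilisers of edges of order three. -/
def gζ : Fin 2 → Γ := ![mT * mW, m 4 0 0 (-1) 0 (-1) (-3) 0]

/-- Stabilisers isomorphic to the symmetric group. -/
def ιD3 (i : Fin 4) : D3 →* Γ where
  toFun g := ![1, gx i, gy i, gx i * gy i, gy i * gx i, gx i * gy i * gx i] (D3.ix g)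
  map_one' := rfl
  map_mul' := by
    revert i
    decide +kernel

/-- Stabilisers isomorphic to the four group. -/
def ιV4 (i : Fin 2) : V4 →* Γ where
  toFun g := (if g.1 = 1 then 1 else gα i) * (if g.2 = 1 then 1 else gβ i)
  map_one' := rfl
  map_mul' := by
    revert i
    decide +kernel

/-- Stabilisers of order two. -/
def ιZ2 (i : Fin 7) : Z2 →* Γ where
  toFun g := if g = 1 then 1 else gε i
  map_one' := rfl
  map_mul' := by
    revert i
    decide +kernel

/-- Stabilisers of order three. -/
def ιZ3 (i : Fin 2) : Z3 →* Γ where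
  toFun g := if g = 1 then 1 else if g = zeta3 then gζ i else gζ i * gζ i
  map_one' := rfl
  map_mul' := by
    revert i
    decide +kernel

/-- The map from the trivial resolution. -/
noncomputable def homOne (T : Tower) : Tower.Hom towerOne T where
  h := (1 : Unit →* T.F)
  φ _ := single (1, T.bot) 1
  comm _ := by
    rw [lift_single, T.d_bot, map_zero, smul_zero]
    exact (congrArg _ (map_zero _)).trans (map_zero _) |>.symm
  aug_φ _ := by
    rw [aug_single, one_mul, T.e_bot]
    rfl
  deg_φ _ := single_mem_supp (r := T.bot) _ (show T.deg T.bot = 0 from T.deg_bot) _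

/-- Resolutions for stabilisers of vertices. -/
noncomputable def TV : OV → Tower
  | .inl _ => perD3.tower
  | .inr _ => V4.tower

/-- Resolutions for stabilisers of edges. -/
noncomputable def TE : OE → Tower
  | .inl _ => perZ2.tower
  | .inr (.inl _) => perZ3.tower
  | .inr (.inr _) => towerOne

/-- Stabilisers of vertices. -/
def ιV : ∀ v, (TV v).F →* Γ
  | .inl i => ιD3 i
  | .inr i => ιV4 i

/-- Stabilisers of edges. -/
def ιE : ∀ e, (TE e).F →* Γ
  | .inl i => ιZ2 i
  | .inr (.inl i) => ιZ3 i
  | .inr (.inr _) => (1 : Unit →* Γ)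

/-- Base corners of vertices. -/
def baseV : OV → Corner
  | .inl i => ![((1, (false, false)), .a), ((1, (false, true)), .a), ((1, (false, false)), .a2),
      ((1, (false, true)), .a2)] i
  | .inr i => ![((1, (false, false)), .b), ((1, (false, true)), .b)] i

/-- Base corners of edges. -/
def baseE : OE → Corner
  | .inl i => ![((1, (false, false)), .e06), ((1, (false, true)), .e06),
      ((1, (false, false)), .e27), ((1, (false, true)), .e27), ((1, (false, false)), .r104),
      ((1, (false, false)), .r947), ((1, (false, false)), .r305)] i
  | .inr (.inl i) => ![((1, (false, false)), .r124), ((1, (false, false)), .r946)] i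
  | .inr (.inr i) => ![((1, (false, false)), .e4), ((1, (false, true)), .e4),
      ((1, (false, false)), .e5), ((1, (true, false)), .e5), ((1, (false, false)), .r325)] i

/-- Base corners of cells. -/
def baseC : OC → Corner
  | .inl v => baseV v
  | .inr (.inl e) => baseE e
  | .inr (.inr t) => ![((1, (false, false)), .f), ((1, (true, false)), .f),
      ((1, (false, true)), .f), ((1, (true, true)), .f), ((1, (false, false)), .q14),
      ((1, (false, false)), .q94), ((1, (false, false)), .q35), ((1, (true, false)), .q35)] t

/-- The ends of the edges. -/
noncomputable def en : Bool → ∀ e, End Γ TV (TE e)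
  | true, .inl i => (![⟨.inr 0, 1, V4.homα⟩, ⟨.inr 1, 1, V4.homα⟩, ⟨.inr 1, mA, V4.homβ⟩,
      ⟨.inr 0, mA', V4.homβ⟩, ⟨.inl 0, m 4 0 0 (-1) 0 (-1) (-3) 0, mapZ2D3.hom⟩,
      ⟨.inl 2, mT * mW, mapZ2D3.hom⟩, ⟨.inr 0, 1, V4.homαβ⟩] : Fin 7 → End Γ TV perZ2.tower) i
  | false, .inl i => (![⟨.inl 0, 1, mapZ2D3.hom⟩, ⟨.inl 1, 1, mapZ2D3.hom⟩,
      ⟨.inl 2, 1, mapZ2D3.hom⟩, ⟨.inl 3, 1, mapZ2D3.hom⟩,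
      ⟨.inl 1, m 4 0 0 1 0 1 (-3) 0, mapZ2D3.hom⟩, ⟨.inl 3, mC * mT * mW, mapZ2D3.hom⟩,
      ⟨.inr 1, mU, V4.homαβ⟩] : Fin 7 → End Γ TV perZ2.tower) i
  | true, .inr (.inl i) => (![⟨.inl 2, 1, mapZ3D3.hom⟩, ⟨.inl 0, 1, mapZ3D3.hom⟩] :
      Fin 2 → End Γ TV perZ3.tower) i
  | false, .inr (.inl i) => (![⟨.inl 3, 1, mapZ3D3.hom⟩, ⟨.inl 1, mC, mapZ3D3.hom⟩] :
      Fin 2 → End Γ TV perZ3.tower) i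
  | true, .inr (.inr i) => (![⟨.inl 2, 1, homOne _⟩, ⟨.inl 3, 1, homOne _⟩, ⟨.inr 1, mA, homOne _⟩,
      ⟨.inr 1, mB, homOne _⟩, ⟨.inr 1, mA, homOne _⟩] : Fin 5 → End Γ TV towerOne) i
  | false, .inr (.inr i) => (![⟨.inl 0, 1, homOne _⟩, ⟨.inl 1, 1, homOne _⟩, ⟨.inr 0, 1, homOne _⟩,
      ⟨.inr 0, 1, homOne _⟩, ⟨.inr 0, mU * mA', homOne _⟩] : Fin 5 → End Γ TV towerOne) i

/-- The edges of the faces. -/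
def fe : Fin 8 → List (ℤ × (Γ × OE)) := ![
  [(1, (1, .inr (.inr 0))), (1, (1, .inl 2)), (-1, (1, .inr (.inr 2))), (-1, (1, .inl 0))],
  [(1, (mW, .inr (.inr 0))), (1, (mT⁻¹, .inl 2)), (-1, (1, .inr (.inr 3))), (-1, (1, .inl 0))],
  [(1, (1, .inr (.inr 1))), (1, (1, .inl 3)), (1, (mA', .inr (.inr 2))), (-1, (1, .inl 1))],
  [(1, (mW, .inr (.inr 1))), (1, (mT⁻¹, .inl 3)), (1, (mB', .inr (.inr 3))), (-1, (1, .inl 1))],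
  [(1, (1, .inr (.inr 0))), (-1, (1, .inr (.inr 1))), (-1, (1, .inr (.inl 0))), (1, (1, .inl 4))],
  [(1, (1, .inr (.inr 0))), (-1, (mC, .inr (.inr 1))), (-1, (1, .inl 5)),
    (1, (1, .inr (.inl 1)))],
  [(1, (1, .inr (.inr 2))), (1, (mU * mA', .inr (.inr 2))), (-1, (1, .inr (.inr 4))),
    (1, (1, .inl 6))],
  [(1, (1, .inr (.inr 3))), (1, (mU * mB', .inr (.inr 3))), (-1, (mT⁻¹, .inr (.inr 4))),
    (1, (1, .inl 6))]]

/-- An element of the stabiliser of a vertex of the first kind. -/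
def atD3 (i : Fin 4) (g : D3) : Σ v, (TV v).F := ⟨.inl i, g⟩

/-- An element of the stabiliser of a vertex of the second kind. -/
def atV4 (i : Fin 2) (g : V4) : Σ v, (TV v).F := ⟨.inr i, g⟩

/-- The corrections at the corners of the faces. -/
def fc : Fin 8 → List (ℤ × (Γ × Σ v, (TV v).F)) := ![
  [],
  [(1, (mW, atD3 2 (.r 2))), (-1, (mW, atD3 0 (.sr 1))), (1, (mT⁻¹ * mA, atV4 1 V4.α))],
  [],
  [(1, (mW, atD3 3 (.r 2))), (-1, (mW, atD3 1 (.sr 1))), (1, (mT⁻¹ * mA', atV4 0 V4.α))],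
  [(-1, (1, atD3 0 (.r 1))), (1, (1, atD3 1 (.r 1)))],
  [(1, (1, atD3 2 (.r 1))), (-1, (mC, atD3 3 (.r 1)))],
  [],
  [(1, (mB, atV4 1 V4.α)), (-1, (mU * mB', atV4 0 V4.α))]]

/-- Selection by label. -/
def sel {α : Type} (j : Jt) (a b c d : α) : α :=
  bif j.2 then (bif j.1 then d else c) else (bif j.1 then b else a)

/-- The orbit of a corner. -/
def orb (j : Jt) : Ty → OC
  | .a => bif j.2 then .inl (.inl 1) else .inl (.inl 0)
  | .b => bif j.2 then .inl (.inr 1) else .inl (.inr 0)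
  | .a2 => bif j.2 then .inl (.inl 3) else .inl (.inl 2)
  | .b2 => bif j.2 then .inl (.inr 0) else .inl (.inr 1)
  | .e06 => bif j.2 then .inr (.inl (.inl 1)) else .inr (.inl (.inl 0))
  | .e27 => bif j.2 then .inr (.inl (.inl 3)) else .inr (.inl (.inl 2))
  | .e4 => bif j.2 then .inr (.inl (.inr (.inr 1))) else .inr (.inl (.inr (.inr 0)))
  | .e5 => bif j.1 then .inr (.inl (.inr (.inr 3))) else .inr (.inl (.inr (.inr 2)))
  | .f => sel j (.inr (.inr 0)) (.inr (.inr 1)) (.inr (.inr 2)) (.inr (.inr 3))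
  | .r104 => .inr (.inl (.inl 4))
  | .r124 => .inr (.inl (.inr (.inl 0)))
  | .r946 => .inr (.inl (.inr (.inl 1)))
  | .r947 => .inr (.inl (.inl 5))
  | .r305 | .r857 => .inr (.inl (.inl 6))
  | .r325 | .r856 => .inr (.inl (.inr (.inr 4)))
  | .q14 => .inr (.inr 4)
  | .q94 => .inr (.inr 5)
  | .q35 | .q85 => bif j.1 then .inr (.inr 7) else .inr (.inr 6)

/-- The position of a corner in its orbit. -/
def tw (j : Jt) : Ty → Γ
  | .a | .b | .e06 | .f | .r104 => 1
  | .a2 | .e27 | .r124 => bif j.1 then mT⁻¹ else 1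
  | .b2 => sel j mA mB mA' mB'
  | .e4 | .q14 => bif j.1 then mW else 1
  | .e5 => sel j 1 1 mA' mB'
  | .r946 | .r947 | .q94 => sel j 1 mW mC⁻¹ (mW * mC⁻¹)
  | .r305 | .q35 => bif j.2 then mU⁻¹ else 1
  | .r325 => sel j 1 mT⁻¹ mU⁻¹ (mT⁻¹ * mU⁻¹)
  | .r856 => sel j (mA * mU⁻¹) (mB * mT⁻¹ * mU⁻¹) mA' (mB' * mT⁻¹)
  | .r857 | .q85 => sel j (mA * mU⁻¹) (mB * mU⁻¹) mA' mB'

/-- Membership in the stabiliser of a cell. -/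
def inStab : OC → Γ → Bool
  | .inl (.inl i), γ => decide (∃ f : D3, ιD3 i f = γ)
  | .inl (.inr i), γ => decide (∃ f : V4, ιV4 i f = γ)
  | .inr (.inl (.inl i)), γ => decide (∃ f : Z2, ιZ2 i f = γ)
  | .inr (.inl (.inr (.inl i))), γ => decide (∃ f : Z3, ιZ3 i f = γ)
  | .inr (.inl (.inr (.inr _))), γ => decide (γ = 1)
  | .inr (.inr _), γ => decide (γ = 1)

/-- The coset of an element modulo the stabiliser of a cell. -/
def cosC : OC → Γ → Set Γ
  | .inl v, γ => Tower.coset (ιV v) γ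
  | .inr (.inl e), γ => Tower.coset (ιE e) γ
  | .inr (.inr _), γ => {γ}

lemma cosC_mul (o : OC) (γ δ : Γ) (h : inStab o δ = true) : cosC o (γ * δ) = cosC o γ := by
  rcases o with (i | i) | (i | i | i) | t
  · obtain ⟨f, rfl⟩ := of_decide_eq_true h
    exact Tower.coset_mul (T := TV (.inl i)) _ γ f
  · obtain ⟨f, rfl⟩ := of_decide_eq_true h
    exact Tower.coset_mul (T := TV (.inr i)) _ γ f
  · obtain ⟨f, rfl⟩ := of_decide_eq_true h
    exact Tower.coset_mul (T := TE (.inl i)) _ γ f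
  · obtain ⟨f, rfl⟩ := of_decide_eq_true h
    exact Tower.coset_mul (T := TE (.inr (.inl i))) _ γ f
  · rw [of_decide_eq_true h, mul_one]
  · rw [of_decide_eq_true h, mul_one]

lemma orb_cmv (j : Jt) (c : Ty) (s : Fin 10) (hs : s ∈ c.walls ∨ s ∈ c.mirror) :
    orb (jmv j s) (c.twist s) = orb j c ∧
      inStab (orb j c) ((tw j c)⁻¹ * (cross j s * tw (jmv j s) (c.twist s))) = true := by
  revert j c s
  decide +kernel

/-- The orbit and the coset of a corner. -/
def posC (k : Corner) : OC × Set Γ :=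
  (orb k.1.2 k.2, cosC (orb k.1.2 k.2) (k.1.1 * tw k.1.2 k.2))

lemma posC_cmv (k : Corner) (s : Fin 10) (hs : s ∈ k.2.walls ∨ s ∈ k.2.mirror) :
    posC (cmv k s) = posC k := by
  obtain ⟨⟨γ, j⟩, c⟩ := k
  obtain ⟨h1, h2⟩ := orb_cmv j c s hs
  have h3 := cosC_mul _ (γ * tw j c) _ h2
  rw [mul_assoc, mul_inv_cancel_left] at h3
  change (orb (jmv j s) (c.twist s), cosC (orb (jmv j s) (c.twist s))
    (γ * cross j s * tw (jmv j s) (c.twist s))) = (orb j c, cosC (orb j c) (γ * tw j c))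
  rw [h1, mul_assoc, h3]

lemma orb_base (o : OC) : orb (baseC o).1.2 (baseC o).2 = o ∧ tw (baseC o).1.2 (baseC o).2 = 1 ∧
    (baseC o).1.1 = 1 := by
  revert o
  decide +kernel

/-- The translate of a base cell. -/
noncomputable def kc (γ : Γ) (o : OC) : KK := kk (own (ctrans γ (baseC o)))

/-- Recording the orbits and the cosets of corners. -/
noncomputable def QC : KK →ₗ[ℤ] (OC × Set Γ →₀ ℤ) := Finsupp.lmapDomain ℤ ℤ posC

lemma QC_kc (γ : Γ) (o : OC) : QC (kc γ o) = single (o, cosC o γ) 1 := by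
  obtain ⟨h1, h2, h3⟩ := orb_base o
  rw [QC, kc, Finsupp.lmapDomain_apply, Finsupp.mapDomain_single, apply_own posC posC_cmv]
  simp only [posC, ctrans, trans, h1, h2, h3, mul_one]

lemma kc_mul {γ δ : Γ} {o : OC} (h : conn 6 (ctrans δ (baseC o)) (baseC o) = true) :
    kc (γ * δ) o = kc γ o := by
  have := own_eq_of_conn γ 6 _ _ h
  rw [kc, kc, ← this]
  simp [ctrans, trans, mul_assoc]

end Bianchi

namespace Bianchi

open FreeRes
open Finsupp (single)

lemma conn_D3 (i : Fin 4) (f : D3) :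
    conn 6 (ctrans (ιD3 i f) (baseC (.inl (.inl i)))) (baseC (.inl (.inl i))) = true := by
  revert i f
  decide +kernel

lemma conn_V4 (i : Fin 2) (f : V4) :
    conn 6 (ctrans (ιV4 i f) (baseC (.inl (.inr i)))) (baseC (.inl (.inr i))) = true := by
  revert i f
  decide +kernel

lemma conn_Z2 (i : Fin 7) (f : Z2) :
    conn 6 (ctrans (ιZ2 i f) (baseC (.inr (.inl (.inl i))))) (baseC (.inr (.inl (.inl i)))) = true := by
  revert i f
  decide +kernel

lemma conn_Z3 (i : Fin 2) (f : Z3) :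
    conn 6 (ctrans (ιZ3 i f) (baseC (.inr (.inl (.inr (.inl i))))))
      (baseC (.inr (.inl (.inr (.inl i))))) = true := by
  revert i f
  decide +kernel

lemma conn_base (j : Jt) (c : Ty) :
    conn 6 ((1, j), c) (ctrans (tw j c) (baseC (orb j c))) = true := by
  revert j c
  decide +kernel

lemma kc_V (γ : Γ) (v : OV) (f : (TV v).F) : kc (γ * ιV v f) (.inl v) = kc γ (.inl v) := by
  rcases v with i | i
  · exact kc_mul (conn_D3 i f)
  · exact kc_mul (conn_V4 i f)

lemma kc_E (γ : Γ) (e : OE) (f : (TE e).F) :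
    kc (γ * ιE e f) (.inr (.inl e)) = kc γ (.inr (.inl e)) := by
  rcases e with i | i | i
  · exact kc_mul (conn_Z2 i f)
  · exact kc_mul (conn_Z3 i f)
  · exact congrArg (kc · _) (mul_one γ)

lemma kk_own_eq_kc (k : Corner) : ∃ γ o, kk (own k) = kc γ o := by
  obtain ⟨⟨γ, j⟩, c⟩ := k
  refine ⟨γ * tw j c, orb j c, ?_⟩
  have := own_eq_of_conn γ 6 _ _ (conn_base j c)
  rw [kc, show ctrans (γ * tw j c) (baseC (orb j c)) =
    ctrans γ (ctrans (tw j c) (baseC (orb j c))) by simp [ctrans, trans, mul_assoc], ← this]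
  simp [ctrans, trans]

/-- The boundary of the complex. -/
noncomputable def ΔC : KK →ₗ[ℤ] KK := kappa ∘ₗ del

lemma ΔC_kc (γ : Γ) (o : OC) :
    ΔC (kc γ o) = lsum (fun y => kk (own (ctrans γ y))) (bd (baseC o)) := by
  obtain ⟨-, -, h⟩ := orb_base o
  rw [ΔC, LinearMap.comp_apply, kc, kappa_del_own, kappa_del_kk]
  have h1 : (ctrans γ (baseC o)).1.1 = γ := by simp [ctrans, trans, h]
  have h2 : (((1, (ctrans γ (baseC o)).1.2), (ctrans γ (baseC o)).2) : Corner) = baseC o := by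
    rw [← h]
    rfl
  rw [h1, h2]

/-- The corners of a list of translates of base cells. -/
def corners (L : List (ℤ × (Γ × OC))) : List (ℤ × Corner) :=
  L.map fun p => (p.1, ctrans p.2.1 (baseC p.2.2))

lemma ΔC_kc_eq (γ : Γ) (o : OC) (L : List (ℤ × (Γ × OC)))
    (h : cancel (conn 4) 20 (bd (baseC o) ++ lscale (-1) (corners L)) = true) :
    ΔC (kc γ o) = lsum (fun p => kc (γ * p.1) p.2) L := by
  have h1 := kappa_lsum_bd_ctrans γ _ h
  rw [lsum_append, lsum_lscale, neg_one_smul, ← sub_eq_add_neg, sub_eq_zero] at h1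
  rw [ΔC_kc, h1]
  refine (lsum_map (fun k => kk (own (ctrans γ k)))
    (fun p : Γ × OC => ctrans p.1 (baseC p.2)) L).trans (lsum_congr fun p _ => ?_)
  simp [kc, ctrans, trans, mul_assoc]

lemma cancel_E : ∀ e : OE, cancel (conn 4) 20 (bd (baseC (.inr (.inl e))) ++ lscale (-1)
    (corners [(1, ((en true e).u, .inl (en true e).v)),
      (-1, ((en false e).u, .inl (en false e).v))])) = true := by
  decide +kernel

lemma cancel_F : ∀ t : Fin 8, cancel (conn 4) 20 (bd (baseC (.inr (.inr t))) ++ lscale (-1)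
    (corners ((fe t).map fun p => (p.1, (p.2.1, .inr (.inl p.2.2)))))) = true := by
  decide +kernel

lemma bd_baseV (v : OV) : bd (baseC (.inl v)) = [] := by
  revert v
  decide +kernel

lemma kaug_kc (γ : Γ) (o : OC) : kaug (kc γ o) = eps (baseC o).2 := by
  rw [kc, ← kappa_kk, kaug_kappa, kaug_kk]
  rfl

lemma kappa_kc (γ : Γ) (o : OC) : kappa (kc γ o) = kc γ o := by
  rw [kc, kappa_kk, own_of_owned (owned_own _)]

lemma compat (b : Bool) (e : OE) (f : (TE e).F) :
    ιE e f * (en b e).u = (en b e).u * ιV _ ((en b e).m.h f) := by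
  rcases b <;> rcases e with i | i | i
  all_goals revert i
  · exact show ∀ (i : Fin 7), (∀ f : Z2, _) by decide +kernel
  · exact show ∀ (i : Fin 2), (∀ f : Z3, _) by decide +kernel
  · exact show ∀ (i : Fin 5), (∀ f : Unit, _) by decide +kernel
  · exact show ∀ (i : Fin 7), (∀ f : Z2, _) by decide +kernel
  · exact show ∀ (i : Fin 2), (∀ f : Z3, _) by decide +kernel
  · exact show ∀ (i : Fin 5), (∀ f : Unit, _) by decide +kernel

end Bianchi

namespace Bianchi

open FreeRes
open Finsupp (single)

lemma ιV_inj (v : OV) : Function.Injective (ιV v) := by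
  rcases v with i | i
  · revert i
    exact show ∀ (i : Fin 4) (f f' : D3), ιD3 i f = ιD3 i f' → f = f' by decide +kernel
  · revert i
    exact show ∀ (i : Fin 2) (f f' : V4), ιV4 i f = ιV4 i f' → f = f' by decide +kernel

lemma ιE_inj (e : OE) : Function.Injective (ιE e) := by
  rcases e with i | i | i
  · revert i
    exact show ∀ (i : Fin 7) (f f' : Z2), ιZ2 i f = ιZ2 i f' → f = f' by decide +kernel
  · revert i
    exact show ∀ (i : Fin 2) (f f' : Z3), ιZ3 i f = ιZ3 i f' → f = f' by decide +kernel
  · exact fun _ _ _ => rfl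

lemma Z2D3_bot : mapZ2D3.hom.φ perZ2.tower.bot = single (1, perD3.tower.bot) 1 := by
  change atk 0 (ev [((1 : ℤ), ((1 : D3), (0 : Fin 6)))]) = _
  simp only [ev, lsum_cons, lsum_nil, add_zero, one_smul]
  exact atk_single _ _ _ _

lemma Z3D3_bot : mapZ3D3.hom.φ perZ3.tower.bot = single (1, perD3.tower.bot) 1 := by
  change atk 0 (ev [((1 : ℤ), ((1 : D3), (0 : Fin 6)))]) = _
  simp only [ev, lsum_cons, lsum_nil, add_zero, one_smul]
  exact atk_single _ _ _ _

lemma αβ_bot : V4.homαβ.φ perZ2.tower.bot = single (1, V4.tower.bot) 1 := by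
  change V4.diag 0 = _
  simp only [V4.diag, zero_add, Finset.sum_range_one, pow_zero]
  rfl

lemma φ_bot (b : Bool) (e : OE) :
    (en b e).m.φ (TE e).bot = single (1, (TV (en b e).v).bot) 1 := by
  rcases e with i | i | i <;> rcases b <;> fin_cases i <;>
    first | rfl | exact Z2D3_bot | exact Z3D3_bot | exact αβ_bot

lemma closed (t : Fin 8) : ev (lbind (fun p => [(1, (p.1 * (en true p.2).u, (en true p.2).v)),
      (-1, (p.1 * (en false p.2).u, (en false p.2).v))]) (fe t) ++
    lbind (fun p => [(1, (p.1 * ιV p.2.1 p.2.2, p.2.1)), (-1, (p.1, p.2.1))]) (fc t)) = 0 := by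
  refine ev_eq_of_lEq (L' := []) ?_
  revert t
  decide +kernel

open Submodule in
lemma kappa_mem_span (w : KK) : kappa w ∈ span ℤ (Set.range fun p : Γ × OC => kc p.1 p.2) := by
  induction w using Finsupp.induction_linear with
  | zero => simp
  | add x y hx hy => rw [map_add]; exact add_mem hx hy
  | single k a =>
    obtain ⟨γ, o, h⟩ := kk_own_eq_kc k
    rw [← mul_one a, ← smul_eq_mul, ← Finsupp.smul_single, map_smul]
    refine smul_mem _ _ (subset_span ⟨(γ, o), ?_⟩)
    rw [show (single k 1 : KK) = kk k from rfl, kappa_kk, h]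

open Submodule in
lemma kappa_of_mem_span {z : KK} (hz : z ∈ span ℤ (Set.range fun p : Γ × OC => kc p.1 p.2)) :
    kappa z = z := by
  induction hz using span_induction with
  | mem x hx =>
    obtain ⟨p, rfl⟩ := hx
    exact kappa_kc _ _
  | zero => exact map_zero _
  | add x y _ _ hx hy => rw [map_add, hx, hy]
  | smul a x _ hx => rw [map_smul, hx]

open Submodule in
lemma acyclic (z : KK) (hz : z ∈ span ℤ (Set.range fun p : Γ × OC => kc p.1 p.2)) (h : ΔC z = 0)
    (h' : kaug z = 0) : ∃ w ∈ span ℤ (Set.range fun p : Γ × OC => kc p.1 p.2), ΔC w = z := by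
  obtain ⟨w, hw⟩ := exists_kappa_del_eq (kappa_of_mem_span hz) h h'
  exact ⟨kappa w, kappa_mem_span w, by rw [ΔC, LinearMap.comp_apply, kappa_del_kappa, hw]⟩

lemma ΔC_E (γ : Γ) (e : OE) : ΔC (kc γ (.inr (.inl e))) =
    kc (γ * (en true e).u) (.inl (en true e).v) - kc (γ * (en false e).u) (.inl (en false e).v) := by
  rw [ΔC_kc_eq γ _ _ (cancel_E e)]
  simp [lsum_cons, lsum_nil, sub_eq_add_neg]

lemma ΔC_F (γ : Γ) (t : Fin 8) : ΔC (kc γ (.inr (.inr t))) =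
    lsum (fun p => kc (γ * p.1) (.inr (.inl p.2))) (fe t) := by
  rw [ΔC_kc_eq γ _ _ (cancel_F t)]
  exact lsum_map (fun p : Γ × OC => kc (γ * p.1) p.2) (fun p : Γ × OE => (p.1, .inr (.inl p.2))) _

lemma eps_baseV (v : OV) : eps (baseC (.inl v)).2 = 1 := by
  revert v
  decide +kernel

lemma eps_baseEF (x : OE ⊕ Fin 8) : eps (baseC (.inr x)).2 = 0 := by
  revert x
  decide +kernel

/-- The complex of the Bianchi group with resolutions for the stabilisers. -/
noncomputable def cells : Cells Γ where
  V := OV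
  E := OE
  F := Fin 8
  TV := TV
  TE := TE
  ιV := ιV
  ιE := ιE
  ιV_inj := ιV_inj
  ιE_inj := ιE_inj
  en := en
  compat := compat
  φ_bot := φ_bot
  fe := fe
  fc := fc
  closed := closed
  M := KK
  k := kc
  kV := kc_V
  kE := kc_E
  Q := QC
  Q_V γ v := QC_kc γ _
  Q_E γ e := QC_kc γ _
  Q_F γ t := QC_kc γ _
  Δ := ΔC
  Δ_V γ v := by rw [ΔC_kc, bd_baseV, lsum_nil]
  Δ_E := ΔC_E
  Δ_F := ΔC_F
  augM := kaug
  aug_V γ v := by rw [kaug_kc, eps_baseV]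
  aug_EF γ x := by rw [kaug_kc, eps_baseEF]
  augM_Δ z := by rw [ΔC, LinearMap.comp_apply, kaug_kappa, kaug_del]
  acyclic := acyclic
  v₀ := .inl 0

end Bianchi

/-! ### The complex of coinvariants -/

namespace FreeRes

open Finsupp (single)
open Bianchi (lsum map_lsum lsum_congr)

namespace Cells

variable {G : Type} [Group G] (P : Cells G)

lemma aug_incV (c : P.X → ℤ) (v : P.V) (z : FG G (P.TV v).R) :
    aug c (P.incV v z) = aug (fun r => c (P.xV v r)) z := by
  have : (aug c).comp (P.incV v) = aug fun r => c (P.xV v r) := hom_ext fun γ x => by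
    simp [incV_single]
  exact LinearMap.congr_fun this z

lemma aug_incE (c : P.X → ℤ) (e : P.E) (z : FG G (P.TE e).R) :
    aug c (P.incE e z) = aug (fun r => c (P.xE e r)) z := by
  have : (aug c).comp (P.incE e) = aug fun r => c (P.xE e r) := hom_ext fun γ x => by
    simp [incE_single]
  exact LinearMap.congr_fun this z

lemma aug_d_V (c : P.X → ℤ) (v : P.V) (r : (P.TV v).R) :
    aug c (P.d (P.xV v r)) = aug (fun r => c (P.xV v r)) ((P.TV v).d r) := by
  rw [d, aug_incV, aug_emb]

lemma aug_endT (c : P.X → ℤ) (b : Bool) (e : P.E) (r : (P.TE e).R) :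
    aug c (P.endT b e (single (1, r) 1)) =
      aug (fun r => c (P.xV (P.en b e).v r)) ((P.en b e).m.φ r) := by
  simp only [endT, LinearMap.comp_apply]
  rw [aug_incV, aug_act, aug_emb, emb_single, lift_single, one_smul, aug_act]

lemma aug_d_E (c : P.X → ℤ) (e : P.E) (r : (P.TE e).R) :
    aug c (P.d (P.xE e r)) = aug (fun r => c (P.xV (P.en true e).v r)) ((P.en true e).m.φ r) -
      aug (fun r => c (P.xV (P.en false e).v r)) ((P.en false e).m.φ r) -
      aug (fun r => c (P.xE e r)) ((P.TE e).d r) := by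
  rw [d, map_sub, map_sub, aug_endT, aug_endT, aug_incE, aug_emb]

lemma aug_d_F (c : P.X → ℤ) (t : P.F) :
    aug c (P.d (P.xF t)) = lsum (fun p => c (P.xE p.2 (P.TE p.2).bot)) (P.fe t) +
      lsum (fun p => aug (fun r => c (P.xV p.2.1 r))
        ((P.TV p.2.1).s (single (p.2.2, (P.TV p.2.1).bot) 1))) (P.fc t) := by
  change aug c (lsum _ _ + lsum _ _) = _
  rw [map_add, map_lsum, map_lsum]
  congr 1
  · exact lsum_congr fun p _ => by rw [aug_single, one_mul]
  · exact lsum_congr fun p _ => by rw [path, aug_incV, aug_act, aug_emb]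

end Cells

lemma aug_atk {F C : Type} [Group F] (c : C × ℕ → ℤ) (k : ℕ) (L : List (ℤ × (F × C))) :
    aug c (atk k (ev L)) = lsum (fun p => c (p.2, k)) L := by
  have : (aug c).comp (atk (F := F) k) = aug fun r => c (r, k) := hom_ext fun f r => by simp
  exact (LinearMap.congr_fun this (ev L)).trans (aug_ev _ _)

namespace Periodic

variable (P : Periodic)

lemma aug_d_zero (c : P.C × ℕ → ℤ) (g : P.C) :
    aug c (P.d (g, 0)) = lsum (fun p => c (p.2, 0)) (P.dl g) := aug_atk c 0 _

lemma aug_d_succ (c : P.C × ℕ → ℤ) (g : P.C) (k : ℕ) : aug c (P.d (g, k + 1)) =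
    lsum (fun p => c (p.2, k + 1)) (P.dl g) + lsum (fun p => c (p.2, k)) (P.dp g) := by
  rw [d, map_add, aug_atk, aug_atk]

lemma aug_s_single (c : P.C × ℕ → ℤ) (f : P.F) (g : P.C) (k : ℕ) :
    aug c (P.s (single (f, (g, k)) 1)) =
      lsum (fun p => c (p.2, k)) (P.sl (f, g)) + lsum (fun p => c (p.2, k + 1)) (P.sn (f, g)) := by
  rw [s_single, map_add, aug_atk, aug_atk]

end Periodic

lemma aug_apply {G X : Type} [Group G] [DecidableEq X] (z : FG G X) (y : X) :
    coinv z y = aug (fun x => if x = y then 1 else 0) z := by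
  have : (Finsupp.lapply y).comp (coinv (G := G)) = aug fun x => if x = y then (1 : ℤ) else 0 :=
    hom_ext fun g x => by simp [Finsupp.single_apply]
  exact LinearMap.congr_fun this z

end FreeRes

namespace Bianchi

open FreeRes
open Finsupp (single)

/-- The generators of the complex of coinvariants. -/
inductive Gen
  | w (i : Fin 4) (c : Fin 6) (k : ℕ)
  | v (i : Fin 2) (a b : ℕ)
  | e (j : Fin 7) (m : ℕ)
  | z (j : Fin 2) (m : ℕ)
  | t (j : Fin 5)
  | f (j : Fin 8)
  deriving DecidableEq

/-- Generators at vertices. -/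
def genV : ∀ v : OV, (TV v).R → Gen
  | .inl i => fun r : Fin 6 × ℕ => .w i r.1 r.2
  | .inr i => fun r : ℕ × ℕ => .v i r.1 r.2

/-- Generators at edges. -/
def genE : ∀ e : OE, (TE e).R → Gen
  | .inl j => fun r : Fin 4 × ℕ => .e j (r.1 + 4 * r.2)
  | .inr (.inl j) => fun r : Fin 4 × ℕ => .z j (r.1 + 4 * r.2)
  | .inr (.inr j) => fun _ => .t j

/-- The generators of the resolution. -/
abbrev CX := cells.X

/-- The names of the generators of the resolution. -/
def gen : CX → Gen
  | ⟨.inl v, r⟩ => genV v r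
  | ⟨.inr (.inl e), r⟩ => genE e r
  | ⟨.inr (.inr t), _⟩ => .f t

lemma gen_injective : Function.Injective gen := by
  have h : ∀ r r' : Fin 4 × ℕ, (r.1 : ℕ) + 4 * r.2 = r'.1 + 4 * r'.2 → r = r' := by
    rintro ⟨c, k⟩ ⟨c', k'⟩ h
    simp only at h
    ext <;> simp <;> omega
  rintro ⟨(i | i) | (i | i | i) | i, r⟩ ⟨(i' | i') | (i' | i' | i') | i', r'⟩ hr <;>
    simp only [gen, genV, genE, Gen.w.injEq, Gen.v.injEq, Gen.e.injEq, Gen.z.injEq, Gen.t.injEq,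
      reduceCtorEq] at hr
  · obtain ⟨rfl, h1, h2⟩ := hr
    exact congrArg (Sigma.mk _) (Prod.ext h1 h2)
  · obtain ⟨rfl, h1, h2⟩ := hr
    exact congrArg (Sigma.mk _) (Prod.ext h1 h2)
  · obtain ⟨rfl, h1⟩ := hr
    exact congrArg (Sigma.mk _) (h _ _ h1)
  · obtain ⟨rfl, h1⟩ := hr
    exact congrArg (Sigma.mk _) (h _ _ h1)
  · subst hr
    rfl
  · obtain rfl : i = i' := Gen.f.inj hr
    rfl

/-- Degrees of generators. -/
def Gen.deg : Gen → ℕ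
  | .w _ c k => ![0, 1, 1, 2, 2, 3] c + 4 * k
  | .v _ a b => a + b
  | .e _ m => m + 1
  | .z _ m => m + 1
  | .t _ => 1
  | .f _ => 2

lemma deg_gen (x : CX) : cells.assembly.resolution.deg x = (gen x).deg := by
  obtain ⟨(i | i) | (i | i | i) | i, r⟩ := x
  · exact zero_add _
  · exact zero_add _
  · exact Nat.add_comm _ _
  · exact Nat.add_comm _ _
  · rfl
  · rfl

lemma gen_surjective : Function.Surjective gen := by
  have h : ∀ m : ℕ, (⟨m % 4, Nat.mod_lt _ (by norm_num)⟩ : Fin 4).val + 4 * (m / 4) = m :=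
    fun m => Nat.mod_add_div m 4
  rintro (⟨i, c, k⟩ | ⟨i, a, b⟩ | ⟨j, m⟩ | ⟨j, m⟩ | j | j)
  · exact ⟨⟨.inl (.inl i), (c, k)⟩, rfl⟩
  · exact ⟨⟨.inl (.inr i), (a, b)⟩, rfl⟩
  · exact ⟨⟨.inr (.inl (.inl j)), (⟨m % 4, Nat.mod_lt _ (by norm_num)⟩, m / 4)⟩,
      congrArg (Gen.e j) (h m)⟩
  · exact ⟨⟨.inr (.inl (.inr (.inl j))), (⟨m % 4, Nat.mod_lt _ (by norm_num)⟩, m / 4)⟩,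
      congrArg (Gen.z j) (h m)⟩
  · exact ⟨⟨.inr (.inl (.inr (.inr j))), ()⟩, rfl⟩
  · exact ⟨⟨.inr (.inr j), ()⟩, rfl⟩

end Bianchi

namespace Bianchi

open FreeRes
open Finsupp (single)

/-- Pairing with the image of a generator for a subgroup of order two. -/
def onZ2 (c : Gen → ℤ) (i : Fin 4) (m : ℕ) : ℤ :=
  if m % 4 = 0 then c (.w i 0 (m / 4)) else if m % 4 = 1 then c (.w i 1 (m / 4)) else
    if m % 4 = 2 then c (.w i 3 (m / 4)) else 3 * c (.w i 5 (m / 4))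

/-- Pairing with the image of a generator for a subgroup of order three. -/
def onZ3 (c : Gen → ℤ) (i : Fin 4) (m : ℕ) : ℤ :=
  if m % 4 = 0 then c (.w i 0 (m / 4)) else
    if m % 4 = 1 then c (.w i 1 (m / 4)) + c (.w i 2 (m / 4)) else
    if m % 4 = 2 then 3 * c (.w i 3 (m / 4)) - 3 * c (.w i 4 (m / 4)) else 2 * c (.w i 5 (m / 4))

/-- Pairing with the image of a generator under the diagonal map. -/
def onDiag (c : Gen → ℤ) (i : Fin 2) (m : ℕ) : ℤ :=
  ∑ a ∈ Finset.range (m + 1), c (.v i a (m - a))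

/-- The codifferential. -/
def cob (c : Gen → ℤ) : Gen → ℤ
  | .w i g k => ![if k = 0 then 0 else 6 * c (.w i 5 (k - 1)), 0, 0, 2 * c (.w i 1 k),
      c (.w i 1 k) - c (.w i 2 k), 0] g
  | .v i a b => (if a % 2 = 0 ∧ a ≠ 0 then 2 * c (.v i (a - 1) b) else 0) +
      if b % 2 = 0 ∧ b ≠ 0 then (if a % 2 = 0 then 2 else -2) * c (.v i a (b - 1)) else 0
  | .e j m => ![c (.v 0 m 0) - onZ2 c 0 m, c (.v 1 m 0) - onZ2 c 1 m, c (.v 1 0 m) - onZ2 c 2 m,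
      c (.v 0 0 m) - onZ2 c 3 m, onZ2 c 0 m - onZ2 c 1 m, onZ2 c 2 m - onZ2 c 3 m,
      onDiag c 0 m - onDiag c 1 m] j - if m % 2 = 0 ∧ m ≠ 0 then 2 * c (.e j (m - 1)) else 0
  | .z j m => ![onZ3 c 2 m - onZ3 c 3 m, onZ3 c 0 m - onZ3 c 1 m] j -
      if m % 2 = 0 ∧ m ≠ 0 then 3 * c (.z j (m - 1)) else 0
  | .t j => ![c (.w 2 0 0) - c (.w 0 0 0), c (.w 3 0 0) - c (.w 1 0 0), c (.v 1 0 0) - c (.v 0 0 0),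
      c (.v 1 0 0) - c (.v 0 0 0), c (.v 1 0 0) - c (.v 0 0 0)] j
  | .f j => ![c (.t 0) + c (.e 2 0) - c (.t 2) - c (.e 0 0),
      c (.t 0) + c (.e 2 0) - c (.t 3) - c (.e 0 0) + c (.w 2 1 0) + c (.w 2 2 0) - c (.w 0 2 0) +
        c (.v 1 1 0),
      c (.t 1) + c (.e 3 0) + c (.t 2) - c (.e 1 0),
      c (.t 1) + c (.e 3 0) + c (.t 3) - c (.e 1 0) + c (.w 3 1 0) + c (.w 3 2 0) - c (.w 1 2 0) +
        c (.v 0 1 0),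
      c (.t 0) - c (.t 1) - c (.z 0 0) + c (.e 4 0) - c (.w 0 1 0) - c (.w 0 2 0) + c (.w 1 1 0) +
        c (.w 1 2 0),
      c (.t 0) - c (.t 1) - c (.e 5 0) + c (.z 1 0) + c (.w 2 1 0) + c (.w 2 2 0) - c (.w 3 1 0) -
        c (.w 3 2 0),
      2 * c (.t 2) - c (.t 4) + c (.e 6 0),
      2 * c (.t 3) - c (.t 4) + c (.e 6 0) + c (.v 1 1 0) - c (.v 0 1 0)] j

lemma aug_perD3_d (c : Fin 6 × ℕ → ℤ) (g : Fin 6) (k : ℕ) :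
    aug c (perD3.d (g, k) : FG D3 (Fin 6 × ℕ)) =
      ![if k = 0 then 0 else 6 * c (5, k - 1), 0, 0, 2 * c (1, k), c (1, k) - c (2, k), 0] g := by
  rcases k with _ | k
  · refine (perD3.aug_d_zero c g).trans ?_
    fin_cases g <;> simp [perD3, D3.tab] <;> ring
  · refine (perD3.aug_d_succ c g k).trans ?_
    fin_cases g <;> simp [perD3, D3.tab] <;> ring

lemma aug_perZ3_d (c : Fin 4 × ℕ → ℤ) (c' : ℕ → ℤ) (hc : ∀ r, c r = c' (r.1 + 4 * r.2))
    (g : Fin 4) (k : ℕ) :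
    aug c (perZ3.d (g, k) : FG Z3 (Fin 4 × ℕ)) =
      if ((g : ℕ) + 4 * k) % 2 = 0 ∧ (g : ℕ) + 4 * k ≠ 0 then 3 * c' (g + 4 * k - 1) else 0 := by
  rcases k with _ | k
  · refine (perZ3.aug_d_zero c g).trans ?_
    fin_cases g <;> simp [perZ3, hc] <;> ring
  · refine (perZ3.aug_d_succ c g k).trans ?_
    fin_cases g <;> simp [perZ3, hc]
    · rw [if_pos (by omega), show 4 * (k + 1) - 1 = 3 + 4 * k by omega]
      ring
    · omega
    · rw [if_pos (by omega)]
      ring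
    · omega

lemma aug_perZ2_d (c : Fin 4 × ℕ → ℤ) (c' : ℕ → ℤ) (hc : ∀ r, c r = c' (r.1 + 4 * r.2))
    (r : Fin 4 × ℕ) :
    aug c (perZ2.d r : FG Z2 (Fin 4 × ℕ)) =
      if ((r.1 : ℕ) + 4 * r.2) % 2 = 0 ∧ (r.1 : ℕ) + 4 * r.2 ≠ 0 then
        2 * c' (r.1 + 4 * r.2 - 1) else 0 := by
  have key : ∀ y : FG Z2 (Fin 4 × ℕ), ((V4.total r = 0 ∧ y = 0) ∨
      ∃ r', V4.total r = V4.total r' + 1 ∧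
        y = single (eps2, r') 1 + (-1 : ℤ) ^ V4.total r • single (1, r') 1) →
      aug c y = if V4.total r % 2 = 0 ∧ V4.total r ≠ 0 then 2 * c' (V4.total r - 1) else 0 := by
    rintro y (⟨hr, rfl⟩ | ⟨r', hr, rfl⟩)
    · simp [hr]
    · rw [map_add, map_smul, aug_single, aug_single, hc r']
      change _ * c' (V4.total r') + (_ • (_ * c' (V4.total r')) : ℤ) = _
      rw [hr, Nat.add_sub_cancel]
      rcases Nat.even_or_odd (V4.total r') with h | h
      · rw [if_neg (by have := Nat.even_iff.1 h; omega), h.add_one.neg_one_pow]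
        simp
      · rw [if_pos (by have := Nat.odd_iff.1 h; omega), h.add_one.neg_one_pow]
        simp
        ring
  exact key _ (V4.perZ2_d r)

lemma aug_V4_x (c : ℕ × ℕ → ℤ) (f : V4) (a b : ℕ) : aug c (V4.x f a b) = c (a, b) := by
  rw [V4.x, aug_single, one_mul]

lemma aug_V4_d (c : ℕ × ℕ → ℤ) (a b : ℕ) : aug c (V4.d (a, b)) =
    (if a % 2 = 0 ∧ a ≠ 0 then 2 * c (a - 1, b) else 0) +
      if b % 2 = 0 ∧ b ≠ 0 then (if a % 2 = 0 then 2 else -2) * c (a, b - 1) else 0 := by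
  have hp : ∀ n : ℕ, (-1 : ℤ) ^ n = if n % 2 = 0 then 1 else -1 := fun n => by
    split_ifs with h
    · exact (Nat.even_iff.2 h).neg_one_pow
    · exact (Nat.odd_iff.2 (by omega)).neg_one_pow
  rcases a with _ | a <;> rcases b with _ | b <;>
    simp only [V4.d, map_zero, map_add, map_smul, aug_V4_x, hp, Nat.add_sub_cancel, smul_eq_mul] <;>
    split_ifs <;> first | omega | ring

lemma aug_Z2D3 (c : Gen → ℤ) (i : Fin 4) (r : Fin 4 × ℕ) :
    aug (fun r : Fin 6 × ℕ => c (.w i r.1 r.2)) (mapZ2D3.hom.φ r : FG D3 (Fin 6 × ℕ)) =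
      onZ2 c i (r.1 + 4 * r.2) := by
  obtain ⟨g, k⟩ := r
  refine (aug_atk (F := D3) (C := Fin 6) _ k (mapZ2D3.φ g)).trans ?_
  have h1 : ((g : ℕ) + 4 * k) % 4 = g := by omega
  have h2 : ((g : ℕ) + 4 * k) / 4 = k := by omega
  rw [onZ2, h1, h2]
  fin_cases g <;> simp [mapZ2D3, D3.tab]
  ring

lemma aug_Z3D3 (c : Gen → ℤ) (i : Fin 4) (r : Fin 4 × ℕ) :
    aug (fun r : Fin 6 × ℕ => c (.w i r.1 r.2)) (mapZ3D3.hom.φ r : FG D3 (Fin 6 × ℕ)) =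
      onZ3 c i (r.1 + 4 * r.2) := by
  obtain ⟨g, k⟩ := r
  refine (aug_atk (F := D3) (C := Fin 6) _ k (mapZ3D3.φ g)).trans ?_
  have h1 : ((g : ℕ) + 4 * k) % 4 = g := by omega
  have h2 : ((g : ℕ) + 4 * k) / 4 = k := by omega
  rw [onZ3, h1, h2]
  fin_cases g <;> simp [mapZ3D3, D3.tab] <;> ring

lemma aug_homα (c : Gen → ℤ) (i : Fin 2) (r : Fin 4 × ℕ) :
    aug (fun r : ℕ × ℕ => c (.v i r.1 r.2)) (V4.homα.φ r : FG V4 (ℕ × ℕ)) =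
      c (.v i (r.1 + 4 * r.2) 0) := aug_V4_x _ _ _ _

lemma aug_homβ (c : Gen → ℤ) (i : Fin 2) (r : Fin 4 × ℕ) :
    aug (fun r : ℕ × ℕ => c (.v i r.1 r.2)) (V4.homβ.φ r : FG V4 (ℕ × ℕ)) =
      c (.v i 0 (r.1 + 4 * r.2)) := aug_V4_x _ _ _ _

lemma aug_homαβ (c : Gen → ℤ) (i : Fin 2) (r : Fin 4 × ℕ) :
    aug (fun r : ℕ × ℕ => c (.v i r.1 r.2)) (V4.homαβ.φ r : FG V4 (ℕ × ℕ)) =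
      onDiag c i (r.1 + 4 * r.2) := by
  change aug _ (V4.diag (r.1 + 4 * r.2)) = _
  rw [V4.diag, map_sum, onDiag]
  exact Finset.sum_congr rfl fun a _ => aug_V4_x _ _ _ _

lemma aug_homOne (c : ∀ v, (TV v).R → ℤ) (v : OV) (r : Unit) :
    aug (c v) ((homOne (TV v)).φ r) = c v (TV v).bot := (aug_single _ _ _ _).trans (one_mul _)

lemma aug_path_D3 (c : Gen → ℤ) (i : Fin 4) (f : D3) :
    aug (fun r : Fin 6 × ℕ => c (.w i r.1 r.2)) (perD3.s (single (f, ((0 : Fin 6), 0)) 1)) =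
      lsum (fun p => c (.w i p.2 0)) (perD3.sl (f, (0 : Fin 6))) :=
  (perD3.aug_s_single _ f (0 : Fin 6) 0).trans (add_zero _)

lemma aug_path_V4 (c : Gen → ℤ) (i : Fin 2) :
    aug (fun r : ℕ × ℕ => c (.v i r.1 r.2)) (V4.s (single (V4.α, ((0 : ℕ), 0)) 1)) =
      c (.v i 1 0) := by
  change aug _ (V4.s (V4.x V4.α 0 0)) = _
  rw [V4.s_x]
  simp [V4.s₀, V4.e2_ne, aug_V4_x]

end Bianchi

namespace Bianchi

open FreeRes
open Finsupp (single)

lemma aug_d_edge2 (c : Gen → ℤ) (j : Fin 7) (r : Fin 4 × ℕ) {x y : ℤ}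
    (hx : aug (fun r => c (genV (en true (.inl j)).v r)) ((en true (.inl j)).m.φ r) = x)
    (hy : aug (fun r => c (genV (en false (.inl j)).v r)) ((en false (.inl j)).m.φ r) = y) :
    aug (fun x => c (gen x)) (cells.d ⟨.inr (.inl (.inl j)), r⟩) = x - y -
      if ((r.1 : ℕ) + 4 * r.2) % 2 = 0 ∧ (r.1 : ℕ) + 4 * r.2 ≠ 0 then
        2 * c (.e j (r.1 + 4 * r.2 - 1)) else 0 := by
  refine (cells.aug_d_E _ (.inl j) r).trans ?_
  refine congrArg₂ (· - ·) (congrArg₂ (· - ·) hx hy) ?_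
  exact aug_perZ2_d (fun r => c (.e j (r.1 + 4 * r.2))) (fun m => c (.e j m)) (fun _ => rfl) r

lemma aug_d_edge3 (c : Gen → ℤ) (j : Fin 2) (r : Fin 4 × ℕ) {x y : ℤ}
    (hx : aug (fun r => c (genV (en true (.inr (.inl j))).v r))
      ((en true (.inr (.inl j))).m.φ r) = x)
    (hy : aug (fun r => c (genV (en false (.inr (.inl j))).v r))
      ((en false (.inr (.inl j))).m.φ r) = y) :
    aug (fun x => c (gen x)) (cells.d ⟨.inr (.inl (.inr (.inl j))), r⟩) = x - y -
      if ((r.1 : ℕ) + 4 * r.2) % 2 = 0 ∧ (r.1 : ℕ) + 4 * r.2 ≠ 0 then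
        3 * c (.z j (r.1 + 4 * r.2 - 1)) else 0 := by
  refine (cells.aug_d_E _ (.inr (.inl j)) r).trans ?_
  refine congrArg₂ (· - ·) (congrArg₂ (· - ·) hx hy) ?_
  exact aug_perZ3_d (fun r => c (.z j (r.1 + 4 * r.2))) (fun m => c (.z j m)) (fun _ => rfl) r.1 r.2

lemma aug_d_edge1 (c : Gen → ℤ) (j : Fin 5) : aug (fun x => c (gen x))
      (cells.d ⟨.inr (.inl (.inr (.inr j))), ()⟩) =
    c (genV (en true (.inr (.inr j))).v (TV (en true (.inr (.inr j))).v).bot) -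
      c (genV (en false (.inr (.inr j))).v (TV (en false (.inr (.inr j))).v).bot) := by
  refine (cells.aug_d_E _ (.inr (.inr j)) ()).trans ?_
  have h : ∀ v, aug (fun r => c (genV v r)) ((homOne (TV v)).φ ()) = c (genV v (TV v).bot) :=
    fun v => aug_homOne (fun v r => c (genV v r)) v ()
  refine (congrArg₂ (· - ·) (congrArg₂ (· - ·) ?_ ?_) (map_zero _)).trans (sub_zero _) <;>
    fin_cases j <;> exact h _

/-- Pairing with the path belonging to an element of the stabiliser of a vertex. -/
noncomputable def onPath (c : Gen → ℤ) (p : Σ v, (TV v).F) : ℤ :=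
  aug (fun r => c (genV p.1 r)) ((TV p.1).s (single (p.2, (TV p.1).bot) 1))

lemma onPath_atD3 (c : Gen → ℤ) (i : Fin 4) (f : D3) : onPath c (atD3 i f) =
    lsum (fun p => c (.w i p.2 0)) (perD3.sl (f, (0 : Fin 6))) := aug_path_D3 c i f

lemma onPath_atV4 (c : Gen → ℤ) (i : Fin 2) : onPath c (atV4 i V4.α) = c (.v i 1 0) :=
  aug_path_V4 c i

/-- Pairing with the edge of the trivial position. -/
def onEdge (c : Gen → ℤ) : OE → ℤ
  | .inl j => c (.e j 0)
  | .inr (.inl j) => c (.z j 0)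
  | .inr (.inr j) => c (.t j)

lemma onEdge_eq (c : Gen → ℤ) (e : OE) : c (genE e (TE e).bot) = onEdge c e := by
  rcases e with j | j | j <;> rfl

lemma aug_d_face (c : Gen → ℤ) (i : Fin 8) :
    aug (fun x => c (gen x)) (cells.d ⟨.inr (.inr i), ()⟩) =
      lsum (fun p => onEdge c p.2) (fe i) + lsum (fun p => onPath c p.2) (fc i) := by
  have h : ∀ e : OE, c (gen (cells.xE e (cells.TE e).bot)) = onEdge c e := onEdge_eq c
  exact (cells.aug_d_F _ i).trans (congrArg₂ (· + ·) (lsum_congr fun p _ => h p.2.2) rfl)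

lemma aug_d (c : Gen → ℤ) (x : CX) : aug (fun x => c (gen x)) (cells.d x) = cob c (gen x) := by
  obtain ⟨(i | i) | (i | i | i) | i, r⟩ := x
  · exact (cells.aug_d_V _ (.inl i) r).trans (aug_perD3_d (fun r => c (.w i r.1 r.2)) r.1 r.2)
  · exact (cells.aug_d_V _ (.inr i) r).trans (aug_V4_d (fun r => c (.v i r.1 r.2)) r.1 r.2)
  · fin_cases i
    · exact aug_d_edge2 c 0 r (aug_homα c 0 r) (aug_Z2D3 c 0 r)
    · exact aug_d_edge2 c 1 r (aug_homα c 1 r) (aug_Z2D3 c 1 r)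
    · exact aug_d_edge2 c 2 r (aug_homβ c 1 r) (aug_Z2D3 c 2 r)
    · exact aug_d_edge2 c 3 r (aug_homβ c 0 r) (aug_Z2D3 c 3 r)
    · exact aug_d_edge2 c 4 r (aug_Z2D3 c 0 r) (aug_Z2D3 c 1 r)
    · exact aug_d_edge2 c 5 r (aug_Z2D3 c 2 r) (aug_Z2D3 c 3 r)
    · exact aug_d_edge2 c 6 r (aug_homαβ c 0 r) (aug_homαβ c 1 r)
  · fin_cases i
    · exact aug_d_edge3 c 0 r (aug_Z3D3 c 2 r) (aug_Z3D3 c 3 r)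
    · exact aug_d_edge3 c 1 r (aug_Z3D3 c 0 r) (aug_Z3D3 c 1 r)
  · refine (aug_d_edge1 c i).trans ?_
    fin_cases i <;> rfl
  · refine (aug_d_face c i).trans ?_
    change _ = cob c (.f i)
    change Fin 8 at i
    have h1 : D3.ix (.r 1) = 3 := by decide
    have h2 : D3.ix (.r 2) = 4 := by decide
    have h3 : D3.ix (.sr 1) = 2 := by decide
    fin_cases i <;> simp [h1, h2, h3, gen, cob, fe, fc, onEdge, onPath_atD3, onPath_atV4, perD3, D3.tab] <;> ring

end Bianchi

namespace Bianchi

open FreeRes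
open Finsupp (single)

/-- Contribution of the edges with stabilisers of order two to a vertex of the first kind. -/
def fromE (z : Gen → ℤ) (i : Fin 4) (m : ℕ) : ℤ :=
  ![-z (.e 0 m) + z (.e 4 m), -z (.e 1 m) - z (.e 4 m), -z (.e 2 m) + z (.e 5 m),
    -z (.e 3 m) - z (.e 5 m)] i

/-- Contribution of the edges with stabilisers of order three to a vertex of the first kind. -/
def fromZ (z : Gen → ℤ) (i : Fin 4) (m : ℕ) : ℤ :=
  ![z (.z 1 m), -z (.z 1 m), z (.z 0 m), -z (.z 0 m)] i

/-- The differential of the complex of coinvariants, in coordinates. -/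
def bnd (z : Gen → ℤ) : Gen → ℤ
  | .w i c k => ![fromE z i (4 * k) + fromZ z i (4 * k) +
        (if k = 0 then ![-z (.t 0), -z (.t 1), z (.t 0), z (.t 1)] i else 0),
      2 * z (.w i 3 k) + z (.w i 4 k) + fromE z i (4 * k + 1) + fromZ z i (4 * k + 1) +
        (if k = 0 then ![-z (.f 4), z (.f 4), z (.f 1) + z (.f 5), z (.f 3) - z (.f 5)] i else 0),
      -z (.w i 4 k) + fromZ z i (4 * k + 1) + (if k = 0 then ![-z (.f 1) - z (.f 4),
        -z (.f 3) + z (.f 4), z (.f 1) + z (.f 5), z (.f 3) - z (.f 5)] i else 0),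
      fromE z i (4 * k + 2) + 3 * fromZ z i (4 * k + 2),
      -3 * fromZ z i (4 * k + 2),
      6 * z (.w i 0 (k + 1)) + 3 * fromE z i (4 * k + 3) + 2 * fromZ z i (4 * k + 3)] c
  | .v i a b => (if a % 2 = 1 then 2 * z (.v i (a + 1) b) else 0) +
      (if b % 2 = 1 then (if a % 2 = 0 then 2 else -2) * z (.v i a (b + 1)) else 0) +
      (if b = 0 then ![z (.e 0 a), z (.e 1 a)] i else 0) +
      (if a = 0 then ![z (.e 3 b), z (.e 2 b)] i else 0) +
      ![1, -1] i * z (.e 6 (a + b)) +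
      (if a = 0 ∧ b = 0 then ![-1, 1] i * (z (.t 2) + z (.t 3) + z (.t 4)) else 0) +
      (if a = 1 ∧ b = 0 then ![z (.f 3) - z (.f 7), z (.f 1) + z (.f 7)] i else 0)
  | .e j m => (if m % 2 = 1 then -2 * z (.e j (m + 1)) else 0) +
      if m = 0 then ![-z (.f 0) - z (.f 1), -z (.f 2) - z (.f 3), z (.f 0) + z (.f 1),
        z (.f 2) + z (.f 3), z (.f 4), -z (.f 5), z (.f 6) + z (.f 7)] j else 0
  | .z j m => (if m % 2 = 1 then -3 * z (.z j (m + 1)) else 0) +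
      if m = 0 then ![-z (.f 4), z (.f 5)] j else 0
  | .t j => ![z (.f 0) + z (.f 1) + z (.f 4) + z (.f 5), z (.f 2) + z (.f 3) - z (.f 4) - z (.f 5),
      -z (.f 0) + z (.f 2) + 2 * z (.f 6), -z (.f 1) + z (.f 3) + 2 * z (.f 7),
      -z (.f 6) - z (.f 7)] j
  | .f _ => 0

/-- The indicator of a generator. -/
def ind (y : Gen) (x : Gen) : ℤ := if x = y then 1 else 0

lemma onDiag_ind (i i' : Fin 2) (m a b : ℕ) :
    onDiag (ind (.v i' a b)) i m = if i = i' ∧ m = a + b then 1 else 0 := by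
  simp only [onDiag, ind, Gen.v.injEq]
  split_ifs with h
  · rw [Finset.sum_eq_single a]
    · rw [if_pos ⟨h.1, rfl, by omega⟩]
    · intro c _ hc
      rw [if_neg fun h => hc h.2.1]
    · intro hc
      simp at hc
      omega
  · refine Finset.sum_eq_zero fun c hc => if_neg fun h' => h ⟨h'.1, ?_⟩
    simp at hc
    omega

lemma onDiag_ind_w (i' : Fin 4) (c' : Fin 6) (k' : ℕ) (i : Fin 2) (m : ℕ) :
    onDiag (ind (.w i' c' k')) i m = 0 := by
  simp [onDiag, ind]

lemma cob_ind_w (i : Fin 4) (c : Fin 6) (k : ℕ) (y : Gen) :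
    cob (ind y) (.w i c k) = bnd (ind (.w i c k)) y := by
  have h1 : ∀ i' m, fromE (ind (.w i c k)) i' m = 0 := fun i' m => by
    fin_cases i' <;> simp [fromE, ind]
  have h2 : ∀ i' m, fromZ (ind (.w i c k)) i' m = 0 := fun i' m => by
    fin_cases i' <;> simp [fromZ, ind]
  have h3 : ∀ i' : Fin 4, ![0, 0, 0, 0] i' = (0 : ℤ) := by decide
  rcases y with ⟨i', c', k'⟩ | ⟨i', a', b'⟩ | ⟨j', m'⟩ | ⟨j', m'⟩ | j' | j'
  · by_cases hi : i = i'
    · subst hi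
      fin_cases c <;> fin_cases c' <;> simp [cob, bnd, h1, h2, ind, h3] <;> grind
    · have hi' : i' ≠ i := Ne.symm hi
      have h4 : bnd (ind (.w i c k)) (.w i' c' k') = 0 := by
        fin_cases c' <;> simp [bnd, h1, h2, ind, h3, hi']
      rw [h4]
      fin_cases c <;> simp [cob, ind, hi]
  · fin_cases c <;> fin_cases i' <;> simp [cob, bnd, ind]
  · fin_cases c <;> fin_cases j' <;> simp [cob, bnd, ind]
  · fin_cases c <;> fin_cases j' <;> simp [cob, bnd, ind]
  · fin_cases c <;> fin_cases j' <;> simp [cob, bnd, ind]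
  · fin_cases c <;> simp [cob, bnd, ind]

lemma cob_ind_v (i : Fin 2) (a b : ℕ) (y : Gen) :
    cob (ind y) (.v i a b) = bnd (ind (.v i a b)) y := by
  rcases y with ⟨i', c', k'⟩ | ⟨i', a', b'⟩ | ⟨j', m'⟩ | ⟨j', m'⟩ | j' | j'
  · fin_cases i' <;> fin_cases c' <;> simp [cob, bnd, ind, fromE, fromZ]
  · fin_cases i' <;> simp [cob, bnd, ind] <;> grind
  · fin_cases j' <;> simp [cob, bnd, ind]
  · fin_cases j' <;> simp [cob, bnd, ind]
  · fin_cases j' <;> simp [cob, bnd, ind]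
  · fin_cases j' <;> simp [cob, bnd, ind]

/-- Incidences of edges with stabilisers of order two and vertices of the first kind. -/
def incE (j : Fin 7) (i : Fin 4) : ℤ :=
  ![![-1, 0, 0, 0], ![0, -1, 0, 0], ![0, 0, -1, 0], ![0, 0, 0, -1], ![1, -1, 0, 0], ![0, 0, 1, -1],
    ![0, 0, 0, 0]] j i

/-- Incidences of edges with stabilisers of order three and vertices of the first kind. -/
def incZ (j : Fin 2) (i : Fin 4) : ℤ := ![![0, 0, 1, -1], ![1, -1, 0, 0]] j i

lemma fromE_ind (j : Fin 7) (m : ℕ) (i : Fin 4) (m' : ℕ) :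
    fromE (ind (.e j m)) i m' = if m' = m then incE j i else 0 := by
  by_cases h : m' = m
  · subst h
    fin_cases j <;> fin_cases i <;> simp [fromE, ind, incE]
  · fin_cases i <;> simp [fromE, ind, h]

lemma fromZ_ind (j : Fin 2) (m : ℕ) (i : Fin 4) (m' : ℕ) :
    fromZ (ind (.z j m)) i m' = if m' = m then incZ j i else 0 := by
  by_cases h : m' = m
  · subst h
    fin_cases j <;> fin_cases i <;> simp [fromZ, ind, incZ]
  · fin_cases i <;> simp [fromZ, ind, h]

lemma onZ2_ind (i i' : Fin 4) (c : Fin 6) (k m : ℕ) : onZ2 (ind (.w i' c k)) i m =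
    (if i = i' then 1 else 0) * ![if 4 * k = m then 1 else 0, if 4 * k + 1 = m then 1 else 0, 0,
      if 4 * k + 2 = m then 1 else 0, 0, if 4 * k + 3 = m then 3 else 0] c := by
  fin_cases c <;> simp [onZ2, ind] <;> grind

lemma onZ3_ind (i i' : Fin 4) (c : Fin 6) (k m : ℕ) : onZ3 (ind (.w i' c k)) i m =
    (if i = i' then 1 else 0) * ![if 4 * k = m then 1 else 0, if 4 * k + 1 = m then 1 else 0,
      if 4 * k + 1 = m then 1 else 0, if 4 * k + 2 = m then 3 else 0,
      if 4 * k + 2 = m then -3 else 0, if 4 * k + 3 = m then 2 else 0] c := by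
  fin_cases c <;> simp [onZ3, ind] <;> grind

lemma cob_ind_e (j : Fin 7) (m : ℕ) (y : Gen) :
    cob (ind y) (.e j m) = bnd (ind (.e j m)) y := by
  rcases y with ⟨i', c', k'⟩ | ⟨i', a', b'⟩ | ⟨j', m'⟩ | ⟨j', m'⟩ | j' | j'
  · have h : cob (ind (.w i' c' k')) (.e j m) = incE j i' * ![if 4 * k' = m then 1 else 0,
        if 4 * k' + 1 = m then 1 else 0, 0, if 4 * k' + 2 = m then 1 else 0, 0,
        if 4 * k' + 3 = m then 3 else 0] c' := by
      simp only [cob, onZ2_ind, onDiag_ind_w]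
      generalize ![_, _, _, _, _, _] c' = u
      fin_cases j <;> fin_cases i' <;> simp [incE, ind]
    have h2 : ∀ i' m', fromZ (ind (.e j m)) i' m' = 0 := fun i' m => by
      fin_cases i' <;> simp [fromZ, ind]
    have h3 : ∀ i' : Fin 4, ![0, 0, 0, 0] i' = (0 : ℤ) := by decide
    rw [h]
    fin_cases c' <;> simp [bnd, fromE_ind, h2, h3, ind] <;> grind
  · fin_cases j <;> fin_cases i' <;> simp [cob, bnd, ind, onZ2, onDiag_ind] <;> grind
  · have h : cob (ind (.e j' m')) (.e j m) =
        -if m % 2 = 0 ∧ m ≠ 0 then 2 * ind (.e j' m') (.e j (m - 1)) else 0 := by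
      fin_cases j <;> simp [cob, ind, onZ2, onDiag]
    have h3 : ∀ i : Fin 7, ![0, 0, 0, 0, 0, 0, 0] i = (0 : ℤ) := by decide
    rw [h]
    simp [bnd, ind, h3]
    grind
  · fin_cases j <;> fin_cases j' <;> simp [cob, bnd, ind, onZ2, onDiag]
  · fin_cases j <;> fin_cases j' <;> simp [cob, bnd, ind, onZ2, onDiag]
  · fin_cases j <;> simp [cob, bnd, ind, onZ2, onDiag]

lemma cob_ind_z (j : Fin 2) (m : ℕ) (y : Gen) :
    cob (ind y) (.z j m) = bnd (ind (.z j m)) y := by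
  rcases y with ⟨i', c', k'⟩ | ⟨i', a', b'⟩ | ⟨j', m'⟩ | ⟨j', m'⟩ | j' | j'
  · have h : cob (ind (.w i' c' k')) (.z j m) = incZ j i' * ![if 4 * k' = m then 1 else 0,
      if 4 * k' + 1 = m then 1 else 0, if 4 * k' + 1 = m then 1 else 0,
      if 4 * k' + 2 = m then 3 else 0, if 4 * k' + 2 = m then -3 else 0,
      if 4 * k' + 3 = m then 2 else 0] c' := by
      simp only [cob, onZ3_ind]
      generalize ![_, _, _, _, _, _] c' = u
      fin_cases j <;> fin_cases i' <;> simp [incZ, ind]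
    have h2 : ∀ i' m', fromE (ind (.z j m)) i' m' = 0 := fun i' m => by
      fin_cases i' <;> simp [fromE, ind]
    have h3 : ∀ i' : Fin 4, ![0, 0, 0, 0] i' = (0 : ℤ) := by decide
    rw [h]
    fin_cases c' <;> simp [bnd, fromZ_ind, h2, h3, ind] <;> grind
  · fin_cases j <;> fin_cases i' <;> simp [cob, bnd, ind, onZ3]
  · fin_cases j <;> fin_cases j' <;> simp [cob, bnd, ind, onZ3]
  · fin_cases j <;> fin_cases j' <;> simp [cob, bnd, ind, onZ3] <;> grind
  · fin_cases j <;> fin_cases j' <;> simp [cob, bnd, ind, onZ3]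
  · fin_cases j <;> simp [cob, bnd, ind, onZ3]

lemma cob_ind_t (j : Fin 5) (y : Gen) : cob (ind y) (.t j) = bnd (ind (.t j)) y := by
  rcases y with ⟨i', c', _ | k'⟩ | ⟨i', a', b'⟩ | ⟨j', m'⟩ | ⟨j', m'⟩ | j' | j'
  · revert j i' c'
    decide +kernel
  · fin_cases c' <;> fin_cases i' <;> simp [bnd, fromE, fromZ, ind] <;>
      fin_cases j <;> simp [cob, ind]
  · fin_cases j <;> fin_cases i' <;> simp [cob, bnd, ind] <;> grind
  · fin_cases j <;> fin_cases j' <;> simp [cob, bnd, ind]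
  · fin_cases j <;> fin_cases j' <;> simp [cob, bnd, ind]
  · fin_cases j <;> fin_cases j' <;> simp [cob, bnd, ind]
  · fin_cases j <;> simp [cob, bnd, ind]

lemma cob_ind_f (j : Fin 8) (y : Gen) : cob (ind y) (.f j) = bnd (ind (.f j)) y := by
  rcases y with ⟨i', c', _ | k'⟩ | ⟨i', a', b'⟩ | ⟨j', _ | m'⟩ | ⟨j', _ | m'⟩ | j' | j'
  · revert j i' c'
    decide +kernel
  · have h3 : ![0, 0, 0, 0, 0, 0, 0, 0] j = (0 : ℤ) := by revert j; decide
    fin_cases c' <;> fin_cases i' <;> simp [bnd, fromE, fromZ, ind, cob, h3]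
  · fin_cases j <;> fin_cases i' <;> simp [cob, bnd, ind] <;> grind
  · revert j j'
    decide +kernel
  · have h3 : ![0, 0, 0, 0, 0, 0, 0, 0] j = (0 : ℤ) := by revert j; decide
    simp [bnd, ind, cob, h3]
  · revert j j'
    decide +kernel
  · have h3 : ![0, 0, 0, 0, 0, 0, 0, 0] j = (0 : ℤ) := by revert j; decide
    simp [bnd, ind, cob, h3]
  · revert j j'
    decide +kernel
  · revert j j'
    decide +kernel

lemma cob_ind (x y : Gen) : cob (ind y) x = bnd (ind x) y := by
  rcases x with ⟨i, c, k⟩ | ⟨i, a, b⟩ | ⟨j, m⟩ | ⟨j, m⟩ | j | j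
  · exact cob_ind_w i c k y
  · exact cob_ind_v i a b y
  · exact cob_ind_e j m y
  · exact cob_ind_z j m y
  · exact cob_ind_t j y
  · exact cob_ind_f j y

end Bianchi

namespace Bianchi

open FreeRes
open Finsupp (single)

lemma bnd_add_mul (z z' : Gen → ℤ) (a : ℤ) (y : Gen) :
    bnd (fun x => z x + a * z' x) y = bnd z y + a * bnd z' y := by
  rcases y with ⟨i, c, k⟩ | ⟨i, a, b⟩ | ⟨j, m⟩ | ⟨j, m⟩ | j | j
  · fin_cases c <;> fin_cases i <;> simp only [bnd, fromE, fromZ] <;> dsimp <;>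
      (try split_ifs) <;> ring
  · fin_cases i <;> simp [bnd] <;> split_ifs <;> ring
  · fin_cases j <;> simp [bnd] <;> split_ifs <;> ring
  · fin_cases j <;> simp [bnd] <;> split_ifs <;> ring
  · fin_cases j <;> simp [bnd] <;> ring
  · simp [bnd]

lemma bnd_add_smul (z z' : Gen → ℤ) (a : ℤ) : bnd (z + a • z') = bnd z + a • bnd z' :=
  funext (bnd_add_mul z z' a)

lemma bnd_zero : bnd 0 = 0 := by simpa using bnd_add_smul 0 0 (-1)

/-- Restriction to the generators of a given degree. -/
def trunc (n : ℕ) (z : Gen → ℤ) (x : Gen) : ℤ := if x.deg = n then z x else 0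

lemma bnd_trunc (z : Gen → ℤ) (y : Gen) : bnd (trunc (y.deg + 1) z) y = bnd z y := by
  rcases y with ⟨i, c, k⟩ | ⟨i, a, b⟩ | ⟨j, m⟩ | ⟨j, m⟩ | j | j
  · fin_cases c <;> fin_cases i <;> simp [bnd, fromE, fromZ, trunc, Gen.deg] <;> grind
  · fin_cases i <;> simp [bnd, trunc, Gen.deg] <;> grind
  · fin_cases j <;> simp [bnd, trunc, Gen.deg] <;> grind
  · fin_cases j <;> simp [bnd, trunc, Gen.deg] <;> grind
  · fin_cases j <;> simp [bnd, trunc, Gen.deg]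
  · simp [bnd]

lemma finite_deg (n : ℕ) : {x : Gen | x.deg = n}.Finite := by
  let f : (Fin 4 × Fin 6 × Fin (n + 1)) ⊕ (Fin 2 × Fin (n + 1) × Fin (n + 1)) ⊕
      (Fin 7 × Fin (n + 1)) ⊕ (Fin 2 × Fin (n + 1)) ⊕ Fin 5 ⊕ Fin 8 → Gen :=
    Sum.elim (fun p => .w p.1 p.2.1 p.2.2) <| Sum.elim (fun p => .v p.1 p.2.1 p.2.2) <|
    Sum.elim (fun p => .e p.1 p.2) <| Sum.elim (fun p => .z p.1 p.2) <|
    Sum.elim (fun p => .t p) fun p => .f p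
  refine (Set.finite_range f).subset ?_
  rintro (⟨i, c, k⟩ | ⟨i, a, b⟩ | ⟨j, m⟩ | ⟨j, m⟩ | j | j) (h : _ = _) <;> simp only [Gen.deg] at h
  · exact ⟨.inl (i, c, ⟨k, by omega⟩), rfl⟩
  · exact ⟨.inr (.inl (i, ⟨a, by omega⟩, ⟨b, by omega⟩)), rfl⟩
  · exact ⟨.inr (.inr (.inl (j, ⟨m, by omega⟩))), rfl⟩
  · exact ⟨.inr (.inr (.inr (.inl (j, ⟨m, by omega⟩)))), rfl⟩
  · exact ⟨.inr (.inr (.inr (.inr (.inl j)))), rfl⟩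
  · exact ⟨.inr (.inr (.inr (.inr (.inr j)))), rfl⟩

/-- The names of the generators, as an equivalence. -/
noncomputable def genEquiv : CX ≃ Gen := Equiv.ofBijective gen ⟨gen_injective, gen_surjective⟩

/-- Coordinates of a chain. -/
noncomputable def coord : (CX →₀ ℤ) →+ (Gen → ℤ) where
  toFun z y := z (genEquiv.symm y)
  map_zero' := rfl
  map_add' _ _ := rfl

lemma coord_gen (z : CX →₀ ℤ) (x : CX) : coord z (gen x) = z x :=
  congrArg z (genEquiv.symm_apply_apply x)

lemma coord_injective : Function.Injective coord := fun z z' h => Finsupp.ext fun x => by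
  rw [← coord_gen, ← coord_gen, h]

lemma coord_colift (z : CX →₀ ℤ) : coord (colift cells.d z) = bnd (coord z) := by
  classical
  induction z using Finsupp.induction_linear with
  | zero => rw [map_zero, map_zero, bnd_zero]
  | add z z' h h' =>
    have := bnd_add_smul (coord z) (coord z') 1
    rw [one_smul, one_smul] at this
    rw [map_add, map_add, map_add, this, h, h']
  | single x a =>
    have h1 : coord (single x a) = (0 : Gen → ℤ) + a • ind (gen x) := by
      ext y
      obtain ⟨y, rfl⟩ := gen_surjective y
      rw [coord_gen]
      by_cases h : y = x
      · subst h
        simp [ind]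
      · have h' : gen y ≠ gen x := fun h' => h (gen_injective h')
        have h'' : x ≠ y := Ne.symm h
        simp [ind, h', h'']
    rw [h1, bnd_add_smul, bnd_zero, zero_add, colift_single]
    ext y
    obtain ⟨y, rfl⟩ := gen_surjective y
    rw [coord_gen, Pi.smul_apply, Finsupp.smul_apply, ← cob_ind, ← aug_d, aug_apply]
    congr 2
    ext x
    simp [ind, gen_injective.eq_iff]

lemma exists_coord (n : ℕ) (z : Gen → ℤ) : ∃ w : CX →₀ ℤ,
    w ∈ Finsupp.supported ℤ ℤ {x | cells.assembly.resolution.deg x = n} ∧ coord w = trunc n z := by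
  have hs : (Function.support fun x : CX => trunc n z (gen x)).Finite :=
    ((finite_deg n).preimage gen_injective.injOn).subset fun x hx => by
      by_contra h
      exact hx (if_neg h)
  refine ⟨Finsupp.ofSupportFinite _ hs, ?_, ?_⟩
  · refine (Finsupp.mem_supported' _ _).2 fun x hx => if_neg fun h => hx ?_
    exact (deg_gen x).trans h
  · ext y
    obtain ⟨y, rfl⟩ := gen_surjective y
    rw [coord_gen]
    rfl

lemma trunc_coord {n : ℕ} {z : CX →₀ ℤ}
    (hz : z ∈ Finsupp.supported ℤ ℤ {x | cells.assembly.resolution.deg x = n}) :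
    trunc n (coord z) = coord z := by
  ext y
  obtain ⟨y, rfl⟩ := gen_surjective y
  rw [trunc]
  split_ifs with h
  · rfl
  · rw [coord_gen]
    exact ((Finsupp.mem_supported' _ _).1 hz y fun h' => h ((deg_gen y).symm.trans h')).symm

lemma bnd_trunc_succ (n : ℕ) (z : Gen → ℤ) : bnd (trunc (n + 1) z) = trunc n (bnd z) := by
  ext y
  rw [trunc]
  split_ifs with h
  · subst h
    exact bnd_trunc z y
  · have : trunc (y.deg + 1) (trunc (n + 1) z) = 0 := by
      ext x
      simp only [trunc, Pi.zero_apply]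
      grind
    rw [← bnd_trunc, this, bnd_zero]
    rfl

/-- Computation of homology in coordinates. -/
theorem homology_of_coord (n : ℕ) {T : Type} [AddCommGroup T] (f : (Gen → ℤ) →+ T)
    (hf : ∀ z, f (trunc (n + 1) z) = f z)
    (h1 : ∀ w, f (bnd w) = 0)
    (h2 : ∀ t, ∃ z, (∀ y : Gen, y.deg = n → bnd z y = 0) ∧ f z = t)
    (h3 : ∀ z, (∀ y : Gen, y.deg = n → bnd z y = 0) → f z = 0 →
      ∃ w, ∀ y : Gen, y.deg = n + 1 → bnd w y = z y) :
    Nonempty (BarHomology.GroupHomology ℤ Γ ℤ (n + 1) ≃+ T) := by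
  have hd : ∀ x : CX, coord (coinv (cells.d x)) = bnd (coord (single x 1)) := fun x => by
    rw [← coord_colift, colift_single, one_smul]
  refine cells.assembly.resolution.nonempty_equiv n (f.comp coord).toIntLinearMap ?_ ?_ ?_
  · intro x _
    exact (congrArg f (hd x)).trans (h1 _)
  · intro t
    obtain ⟨z, hz, rfl⟩ := h2 t
    obtain ⟨w, hw, hwz⟩ := exists_coord (n + 1) z
    have h : colift cells.d w = 0 := coord_injective <| by
      rw [coord_colift, hwz, bnd_trunc_succ, map_zero]
      ext y
      exact ite_eq_right_iff.2 (hz y)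
    exact ⟨w, hw, h, (congrArg f hwz).trans (hf z)⟩
  · intro (z : CX →₀ ℤ) hz (hz' : colift cells.d z = 0) hfz
    have hc : bnd (coord z) = 0 := by rw [← coord_colift, hz', map_zero]
    obtain ⟨w, hw⟩ := h3 (coord z) (fun y _ => congrFun hc y) hfz
    obtain ⟨u, hu, huw⟩ := exists_coord (n + 2) w
    have h : colift cells.d u = z := coord_injective <| by
      rw [coord_colift, huw, bnd_trunc_succ, ← trunc_coord hz]
      ext y
      exact ite_congr rfl (hw y) fun _ => rfl
    exact ⟨u, hu, h⟩

end Bianchi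

namespace Bianchi

/-- A chain from its coordinates. -/
def chain (W : Fin 4 → Fin 6 → ℕ → ℤ) (V : Fin 2 → ℕ → ℕ → ℤ) (E : Fin 7 → ℕ → ℤ)
    (Z : Fin 2 → ℕ → ℤ) : Gen → ℤ
  | .w i c k => W i c k
  | .v i a b => V i a b
  | .e j m => E j m
  | .z j m => Z j m
  | .t _ => 0
  | .f _ => 0

lemma bnd_v_of_odd_odd (z : Gen → ℤ) (i : Fin 2) {a b : ℕ} (ha : a % 2 = 1) (hb : b % 2 = 1) :
    bnd z (.v i a b) =
      2 * z (.v i (a + 1) b) - 2 * z (.v i a (b + 1)) + ![1, -1] i * z (.e 6 (a + b)) := by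
  simp only [bnd, ha, hb]
  grind

lemma bnd_v_of_even_even (z : Gen → ℤ) (i : Fin 2) {a b : ℕ} (ha : a % 2 = 0) (hb : b % 2 = 0)
    (h : a + b ≠ 0) : bnd z (.v i a b) = (if b = 0 then ![z (.e 0 a), z (.e 1 a)] i else 0) +
      (if a = 0 then ![z (.e 3 b), z (.e 2 b)] i else 0) + ![1, -1] i * z (.e 6 (a + b)) := by
  simp only [bnd, ha, hb]
  grind

lemma bnd_v_of_odd_even (z : Gen → ℤ) (i : Fin 2) {a b : ℕ} (ha : a % 2 = 1) (hb : b % 2 = 0)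
    (h : a + b ≠ 1) : bnd z (.v i a b) = 2 * z (.v i (a + 1) b) +
      (if b = 0 then ![z (.e 0 a), z (.e 1 a)] i else 0) + ![1, -1] i * z (.e 6 (a + b)) := by
  simp only [bnd, ha, hb]
  grind

lemma bnd_v_of_even_odd (z : Gen → ℤ) (i : Fin 2) {a b : ℕ} (ha : a % 2 = 0) (hb : b % 2 = 1) :
    bnd z (.v i a b) = 2 * z (.v i a (b + 1)) +
      (if a = 0 then ![z (.e 3 b), z (.e 2 b)] i else 0) + ![1, -1] i * z (.e 6 (a + b)) := by
  simp only [bnd, ha, hb]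
  grind

/-- The components at `2` of the invariants in odd degrees. -/
def oddInv (l : ℕ) (cl : Fin 4 → (Gen → ℤ) →+ ℤ) :
    (Gen → ℤ) →+ (Fin (l + 1) ⊕ Fin l ⊕ Fin 2 → ZMod 2) where
  toFun z := Sum.elim
    (fun q => ((z (.v 0 (2 * q + 1) (2 * l + 2 - 2 * q)) + z (.v 1 1 (2 * l + 2)) : ℤ) : ZMod 2)) <|
    Sum.elim
    (fun q => ((z (.v 1 (2 * q + 3) (2 * l - 2 * q)) + z (.v 1 1 (2 * l + 2)) : ℤ) : ZMod 2))
    ![((z (.v 0 (2 * l + 3) 0) + z (.v 1 (2 * l + 3) 0) + cl 0 z + cl 1 z : ℤ) : ZMod 2),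
      ((z (.v 0 0 (2 * l + 3)) + z (.v 1 0 (2 * l + 3)) + cl 2 z + cl 3 z : ℤ) : ZMod 2)]
  map_zero' := by
    ext (q | q | q)
    · simp
    · simp
    · fin_cases q <;> simp
  map_add' z z' := by
    ext (q | q | q)
    · simp
      ring
    · simp
      ring
    · fin_cases q <;> simp <;> ring

lemma oddInv_trunc (l : ℕ) (cl : Fin 4 → (Gen → ℤ) →+ ℤ) (z : Gen → ℤ)
    (hcl : ∀ i, cl i (trunc (2 * l + 3) z) = cl i z) :
    oddInv l cl (trunc (2 * l + 3) z) = oddInv l cl z := by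
  have h : ∀ i a b, a + b = 2 * l + 3 → trunc (2 * l + 3) z (.v i a b) = z (.v i a b) :=
    fun i a b hab => if_pos hab
  ext (q | q | q)
  · simp [oddInv, h 0 (2 * q + 1) (2 * l + 2 - 2 * q) (by omega), h 1 1 (2 * l + 2) (by omega)]
  · simp [oddInv, h 1 (2 * q + 3) (2 * l - 2 * q) (by omega), h 1 1 (2 * l + 2) (by omega)]
  · fin_cases q <;> simp [oddInv, h, hcl]

lemma oddInv_bnd (l : ℕ) (cl : Fin 4 → (Gen → ℤ) →+ ℤ) (w : Gen → ℤ)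
    (hcl : ∀ i, (cl i (bnd w) - fromE w i (2 * l + 3)) % 2 = 0) : oddInv l cl (bnd w) = 0 := by
  have h : ∀ x : ℤ, x % 2 = 0 → ((x : ℤ) : ZMod 2) = 0 := fun x hx =>
    (ZMod.intCast_zmod_eq_zero_iff_dvd x 2).2 (Int.dvd_of_emod_eq_zero hx)
  have h0 := hcl 0
  have h1 := hcl 1
  have h2 := hcl 2
  have h3 := hcl 3
  simp only [fromE] at h0 h1 h2 h3
  dsimp at h0 h1 h2 h3
  ext (q | q | q)
  · refine h _ ?_
    rw [bnd_v_of_odd_even _ _ (by omega) (by omega) (by omega),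
      bnd_v_of_odd_even _ _ (by omega) (by omega) (by omega), if_neg (by omega), if_neg (by omega)]
    have : 2 * (q : ℕ) + 1 + (2 * l + 2 - 2 * q) = 1 + (2 * l + 2) := by omega
    rw [this]
    dsimp
    omega
  · refine h _ ?_
    rw [bnd_v_of_odd_even _ _ (by omega) (by omega) (by omega),
      bnd_v_of_odd_even _ _ (by omega) (by omega) (by omega), if_neg (by omega), if_neg (by omega)]
    have : 2 * (q : ℕ) + 3 + (2 * l - 2 * q) = 1 + (2 * l + 2) := by omega
    rw [this]
    dsimp
    omega
  · fin_cases q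
    · refine h _ ?_
      change (bnd w (.v 0 (2 * l + 3) 0) + bnd w (.v 1 (2 * l + 3) 0) + _ + _) % 2 = 0
      rw [bnd_v_of_odd_even _ _ (by omega) (by omega) (by omega),
        bnd_v_of_odd_even _ _ (by omega) (by omega) (by omega), if_pos rfl, if_pos rfl]
      dsimp
      omega
    · refine h _ ?_
      change (bnd w (.v 0 0 (2 * l + 3)) + bnd w (.v 1 0 (2 * l + 3)) + _ + _) % 2 = 0
      rw [bnd_v_of_even_odd _ _ (by omega) (by omega),
        bnd_v_of_even_odd _ _ (by omega) (by omega), if_pos rfl, if_pos rfl]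
      dsimp
      omega

/-- A cycle in odd degree with prescribed invariants. -/
def oddCycle (l : ℕ) (t : Fin (l + 1) ⊕ Fin l ⊕ Fin 2 → ℤ) (W : Fin 4 → Fin 6 → ℕ → ℤ) :
    Gen → ℤ :=
  chain W (fun i a b => if a = 0 then (if i = 0 then t (.inr (.inr 1)) else 0) else
    if b = 0 then (if i = 0 then t (.inr (.inr 0)) else 0) else
    if h : (a - 1) / 2 < l + 1 then
      (if i = 0 then t (.inl ⟨(a - 1) / 2, h⟩) else
        if h' : 0 < (a - 1) / 2 then t (.inr (.inl ⟨(a - 1) / 2 - 1, by omega⟩)) else 0) else 0)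
    (fun _ _ => 0) (fun _ _ => 0)

lemma bnd_oddCycle_v (l : ℕ) (t W) (i : Fin 2) (a b : ℕ) (h : a + b = 2 * l + 2) :
    bnd (oddCycle l t W) (.v i a b) = 0 := by
  by_cases ha : a % 2 = 0
  · rw [bnd_v_of_even_even _ _ ha (by omega) (by omega)]
    fin_cases i <;> simp [oddCycle, chain]
  · rw [bnd_v_of_odd_odd _ _ (by omega) (by omega)]
    have : (a + 1 - 1) / 2 = (a - 1) / 2 := by omega
    simp only [oddCycle, chain, this]
    rw [if_neg (by omega), if_neg (by omega), if_neg (by omega), if_neg (by omega)]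
    ring

lemma oddInv_oddCycle (l : ℕ) (cl : Fin 4 → (Gen → ℤ) →+ ℤ) (t W)
    (hcl : ∀ i, cl i (oddCycle l t W) % 2 = 0) :
    oddInv l cl (oddCycle l t W) = fun q => (t q : ZMod 2) := by
  have h : ∀ i, ((cl i (oddCycle l t W) : ℤ) : ZMod 2) = 0 := fun i =>
    (ZMod.intCast_zmod_eq_zero_iff_dvd _ 2).2 (Int.dvd_of_emod_eq_zero (hcl i))
  ext (q | q | q)
  · simp [oddInv, oddCycle, chain]
    rw [if_neg (by omega), if_pos (by omega)]
  · have h1 : ¬ 2 * l - 2 * (q : ℕ) = 0 := by omega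
    simp [oddInv, oddCycle, chain, h1]
  · fin_cases q <;> simp [oddInv, h]  <;> simp [oddCycle, chain]

lemma oddInv_even (l : ℕ) (cl : Fin 4 → (Gen → ℤ) →+ ℤ) {z : Gen → ℤ}
    (hz : ∀ i a b, a + b = 2 * l + 2 → bnd z (.v i a b) = 0) (he : z (.e 6 (2 * l + 2)) = 0)
    (hf : oddInv l cl z = 0) (i : Fin 2) (a b : ℕ) (ha : a ≠ 0) (hb : b ≠ 0)
    (h : a + b = 2 * l + 3) : (z (.v i a b) + z (.v 1 1 (2 * l + 2))) % 2 = 0 := by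
  have h2 : ∀ x : ℤ, ((x : ℤ) : ZMod 2) = 0 → x % 2 = 0 := fun x hx =>
    Int.emod_eq_zero_of_dvd ((ZMod.intCast_zmod_eq_zero_iff_dvd x 2).1 hx)
  have key : ∀ q, q ≤ l → (z (.v i (2 * q + 1) (2 * l + 2 - 2 * q)) + z (.v 1 1 (2 * l + 2))) % 2
      = 0 := by
    intro q hq
    fin_cases i
    · exact h2 _ (congrFun hf (.inl ⟨q, by omega⟩))
    · rcases q with _ | q
      · change (z (.v 1 1 (2 * l + 2)) + z (.v 1 1 (2 * l + 2))) % 2 = 0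
        omega
      · have := h2 _ (congrFun hf (.inr (.inl ⟨q, by omega⟩)))
        rwa [show 2 * l + 2 - 2 * (q + 1) = 2 * l - 2 * q by omega,
          show 2 * (q + 1) + 1 = 2 * q + 3 by omega]
  by_cases hp : a % 2 = 1
  · have := key (a / 2) (by omega)
    rwa [show 2 * (a / 2) + 1 = a by omega, show 2 * l + 2 - 2 * (a / 2) = b by omega] at this
  · have h1 := key ((a - 1) / 2) (by omega)
    rw [show 2 * ((a - 1) / 2) + 1 = a - 1 by omega,
      show 2 * l + 2 - 2 * ((a - 1) / 2) = b + 1 by omega] at h1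
    have h3 := hz i (a - 1) b (by omega)
    rw [bnd_v_of_odd_odd _ _ (by omega) (by omega), show a - 1 + b = 2 * l + 2 by omega, he,
      show a - 1 + 1 = a by omega] at h3
    omega

lemma oddInv_ends (l : ℕ) (cl : Fin 4 → (Gen → ℤ) →+ ℤ) {z : Gen → ℤ} (hf : oddInv l cl z = 0) :
    (z (.v 0 (2 * l + 3) 0) + z (.v 1 (2 * l + 3) 0) + cl 0 z + cl 1 z) % 2 = 0 ∧
      (z (.v 0 0 (2 * l + 3)) + z (.v 1 0 (2 * l + 3)) + cl 2 z + cl 3 z) % 2 = 0 := by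
  have h2 : ∀ x : ℤ, ((x : ℤ) : ZMod 2) = 0 → x % 2 = 0 := fun x hx =>
    Int.emod_eq_zero_of_dvd ((ZMod.intCast_zmod_eq_zero_iff_dvd x 2).1 hx)
  exact ⟨h2 _ (congrFun hf (.inr (.inr 0))), h2 _ (congrFun hf (.inr (.inr 1)))⟩

/-- A chain bounding a cycle of odd degree. -/
def oddWitness (l : ℕ) (z : Gen → ℤ) (W : Fin 4 → Fin 6 → ℕ → ℤ) (p q : ℤ) (Z : Fin 2 → ℤ) :
    Gen → ℤ :=
  chain W (fun i a b => if a = 0 ∨ b = 0 then 0 else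
      (z (.v i (a - 1) b) - ![1, -1] i * z (.v 1 1 (2 * l + 2))) / 2)
    (fun j _ => ![z (.v 0 (2 * l + 3) 0) - z (.v 1 1 (2 * l + 2)),
      z (.v 1 (2 * l + 3) 0) + z (.v 1 1 (2 * l + 2)), z (.v 1 0 (2 * l + 3)) + z (.v 1 1 (2 * l + 2)),
      z (.v 0 0 (2 * l + 3)) - z (.v 1 1 (2 * l + 2)), p, q, z (.v 1 1 (2 * l + 2))] j)
    (fun j _ => Z j)

lemma bnd_oddWitness_v (l : ℕ) (cl : Fin 4 → (Gen → ℤ) →+ ℤ) {z : Gen → ℤ}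
    (hz : ∀ i a b, a + b = 2 * l + 2 → bnd z (.v i a b) = 0) (he : z (.e 6 (2 * l + 2)) = 0)
    (hf : oddInv l cl z = 0) (W p q Z) (i : Fin 2) (a b : ℕ) (h : a + b = 2 * l + 3) :
    bnd (oddWitness l z W p q Z) (.v i a b) = z (.v i a b) := by
  have key := oddInv_even l cl hz he hf i
  have hs : ![(1 : ℤ), -1] i = 1 ∨ ![(1 : ℤ), -1] i = -1 := by fin_cases i <;> simp
  by_cases ha : a % 2 = 1
  · rw [bnd_v_of_odd_even _ _ ha (by omega) (by omega)]
    by_cases hb : b = 0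
    · subst hb
      obtain rfl : a = 2 * l + 3 := by omega
      fin_cases i <;> simp [oddWitness, chain]
    · have := key a b (by omega) hb h
      simp [oddWitness, chain, hb]
      rcases hs with hs | hs <;> rw [hs] <;> omega
  · rw [bnd_v_of_even_odd _ _ (by omega) (by omega)]
    by_cases ha' : a = 0
    · subst ha'
      obtain rfl : b = 2 * l + 3 := by omega
      fin_cases i <;> simp [oddWitness, chain]
    · have h1 := key a b ha' (by omega) h
      have h3 := hz i (a - 1) b (by omega)
      rw [bnd_v_of_odd_odd _ _ (by omega) (by omega), show a - 1 + b = 2 * l + 2 by omega, he,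
        show a - 1 + 1 = a by omega] at h3
      simp [oddWitness, chain, ha']
      rcases hs with hs | hs <;> rw [hs] <;> omega

end Bianchi

namespace Bianchi

open BarHomology

/-- Functions on index types of the same cardinality. -/
lemma nonempty_reindex {ι : Type} [Fintype ι] {N : ℕ} (h : Fintype.card ι = N) (A : Type)
    [AddCommGroup A] : Nonempty ((ι → A) ≃+ (Fin N → A)) :=
  ⟨(LinearEquiv.funCongrLeft ℤ A (Fintype.equivFinOfCardEq h).symm).toAddEquiv⟩

lemma zmod_three_intCast_eq_zero {x : ℤ} : ((x : ℤ) : ZMod 3) = 0 ↔ x % 3 = 0 :=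
  (ZMod.intCast_zmod_eq_zero_iff_dvd x 3).trans
    ⟨Int.emod_eq_zero_of_dvd, Int.dvd_of_emod_eq_zero⟩

/-- Components at `3` of invariants, from classes at vertices of the first kind. -/
def pairInv (cl : Fin 4 → (Gen → ℤ) →+ ℤ) : (Gen → ℤ) →+ (Fin 2 → ZMod 3) where
  toFun z := ![((cl 0 z + cl 1 z : ℤ) : ZMod 3), ((cl 2 z + cl 3 z : ℤ) : ZMod 3)]
  map_zero' := by
    ext j
    fin_cases j <;> simp
  map_add' z z' := by
    ext j
    fin_cases j <;> simp <;> ring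

theorem homology_four_mul_add_three (k : ℕ) : Nonempty (GroupHomology ℤ Γ ℤ (4 * k + 3) ≃+
    (Fin (4 * k + 3) → ZMod 2) × (Fin 2 → ZMod 3)) := by
  let cl (i : Fin 4) : (Gen → ℤ) →+ ℤ := Pi.evalAddMonoidHom _ (.w i 5 k)
  have hcl : ∀ i z, cl i z = z (.w i 5 k) := fun _ _ => rfl
  have hl : 4 * k + 3 = 2 * (2 * k) + 3 := by ring
  obtain ⟨r⟩ := nonempty_reindex (ι := Fin (2 * k + 1) ⊕ Fin (2 * k) ⊕ Fin 2) (N := 4 * k + 3)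
    (by simp; ring) (ZMod 2)
  suffices Nonempty (GroupHomology ℤ Γ ℤ (4 * k + 2 + 1) ≃+
      (Fin (2 * k + 1) ⊕ Fin (2 * k) ⊕ Fin 2 → ZMod 2) × (Fin 2 → ZMod 3)) from
    this.map fun e => e.trans (r.prodCongr (AddEquiv.refl _))
  refine homology_of_coord _ ((oddInv (2 * k) cl).prod (pairInv cl)) ?_ ?_ ?_ ?_
  · intro z
    have h : ∀ i, cl i (trunc (2 * (2 * k) + 3) z) = cl i z := fun i =>
      if_pos (by simp [Gen.deg]; ring)
    refine Prod.ext ?_ ?_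
    · exact (congrArg (fun n => oddInv (2 * k) cl (trunc n z)) hl).trans (oddInv_trunc _ cl z h)
    · refine (congrArg (fun n => pairInv cl (trunc n z)) hl).trans ?_
      ext j
      fin_cases j <;> simp [pairInv, h]
  · intro w
    have h : ∀ i, cl i (bnd w) = 6 * w (.w i 0 (k + 1)) + 3 * fromE w i (4 * k + 3) +
      2 * fromZ w i (4 * k + 3) := fun i => rfl
    refine Prod.ext (oddInv_bnd _ _ _ fun i => ?_) ?_
    · rw [h, ← hl]
      omega
    · ext j
      fin_cases j
      · refine zmod_three_intCast_eq_zero.2 ?_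
        change (cl 0 (bnd w) + cl 1 (bnd w)) % 3 = 0
        rw [h, h]
        simp [fromZ]
        omega
      · refine zmod_three_intCast_eq_zero.2 ?_
        change (cl 2 (bnd w) + cl 3 (bnd w)) % 3 = 0
        rw [h, h]
        simp [fromZ]
        omega
  · rintro ⟨t, t'⟩
    choose u hu using fun q => ZMod.intCast_surjective (t q)
    choose u' hu' using fun q => ZMod.intCast_surjective (t' q)
    refine ⟨oddCycle (2 * k) u fun i _ _ => ![4 * u' 0, 0, 4 * u' 1, 0] i, ?_, Prod.ext ?_ ?_⟩
    · rintro (⟨i, c, k'⟩ | ⟨i, a, b⟩ | ⟨j, m⟩ | ⟨j, m⟩ | j | j) h <;> simp only [Gen.deg] at h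
      · fin_cases c <;> simp at h
        · omega
        · omega
        · omega
        · fin_cases i <;> simp [bnd, fromE, fromZ, oddCycle, chain]
        · fin_cases i <;> simp [bnd, fromE, fromZ, oddCycle, chain]
        · omega
      · exact bnd_oddCycle_v _ _ _ i a b (by omega)
      · simp [bnd, oddCycle, chain]
        omega
      · simp [bnd, oddCycle, chain]
        omega
      · omega
      · rfl
    · refine (oddInv_oddCycle _ _ _ _ fun i => ?_).trans (funext hu)
      fin_cases i <;> simp [hcl, oddCycle, chain] <;> omega
    · ext j
      fin_cases j
      · refine Eq.trans ?_ (hu' 0)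
        simp [pairInv, hcl, oddCycle, chain]
        linear_combination (u' 0 : ZMod 3) * (by decide : (3 : ZMod 3) = 0)
      · refine Eq.trans ?_ (hu' 1)
        simp [pairInv, hcl, oddCycle, chain]
        linear_combination (u' 1 : ZMod 3) * (by decide : (3 : ZMod 3) = 0)
  · intro z hz hf
    have he : ∀ j, z (.e j (4 * k + 2)) = 0 := fun j => by
      have h := hz (.e j (4 * k + 1)) rfl
      simp only [bnd] at h
      rw [if_pos (by omega), if_neg (by omega)] at h
      have : -2 * z (.e j (4 * k + 2)) + 0 = 0 := h
      omega
    have hz' : ∀ j, z (.z j (4 * k + 2)) = 0 := fun j => by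
      have h := hz (.z j (4 * k + 1)) rfl
      simp only [bnd] at h
      rw [if_pos (by omega), if_neg (by omega)] at h
      have : -3 * z (.z j (4 * k + 2)) + 0 = 0 := h
      omega
    have hzv : ∀ i a b, a + b = 2 * (2 * k) + 2 → bnd z (.v i a b) = 0 := fun i a b h =>
      hz _ (show a + b = _ by omega)
    have he6 : z (.e 6 (2 * (2 * k) + 2)) = 0 := by
      rw [← he 6]
      congr 2
      ring
    have hf1 : oddInv (2 * k) cl z = 0 := congrArg Prod.fst hf
    have hf2 : pairInv cl z = 0 := congrArg Prod.snd hf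
    obtain ⟨h0, h1⟩ := oddInv_ends _ _ hf1
    have h2 : (cl 0 z + cl 1 z) % 3 = 0 := zmod_three_intCast_eq_zero.1 (congrFun hf2 0)
    have h3 : (cl 2 z + cl 3 z) % 3 = 0 := zmod_three_intCast_eq_zero.1 (congrFun hf2 1)
    simp only [hcl] at h0 h1 h2 h3
    let ε := z (.v 1 1 (2 * (2 * k) + 2))
    let p := z (.w 0 5 k) + 3 * (z (.v 0 (2 * (2 * k) + 3) 0) - ε)
    let q := z (.w 2 5 k) + 3 * (z (.v 1 0 (2 * (2 * k) + 3)) + ε)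
    refine ⟨oddWitness (2 * k) z (fun i _ _ => ![0, (z (.w 0 5 k) + z (.w 1 5 k) +
      3 * (z (.v 0 (2 * (2 * k) + 3) 0) + z (.v 1 (2 * (2 * k) + 3) 0))) / 6, 0,
      (z (.w 2 5 k) + z (.w 3 5 k) + 3 * (z (.v 0 0 (2 * (2 * k) + 3)) +
        z (.v 1 0 (2 * (2 * k) + 3)))) / 6] i) p q ![-q, -p], ?_⟩
    rintro (⟨i, c, k'⟩ | ⟨i, a, b⟩ | ⟨j, m⟩ | ⟨j, m⟩ | j | j) h <;> simp only [Gen.deg] at h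
    · fin_cases c <;> simp at h
      · omega
      · omega
      · omega
      · omega
      · omega
      · obtain rfl : k' = k := by omega
        fin_cases i <;> simp [bnd, fromE, fromZ, oddWitness, chain, p, q] <;> omega
    · exact bnd_oddWitness_v _ _ hzv he6 hf1 _ _ _ _ i a b (by omega)
    · obtain rfl : m = 4 * k + 2 := by omega
      rw [he]
      simp [bnd]
      omega
    · obtain rfl : m = 4 * k + 2 := by omega
      rw [hz']
      simp [bnd]
      omega
    · omega
    · omega

end Bianchi

namespace Bianchi

open BarHomology

theorem homology_four_mul_add_five (k : ℕ) : Nonempty (GroupHomology ℤ Γ ℤ (4 * k + 5) ≃+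
    (Fin (4 * k + 5) → ZMod 2)) := by
  let cl (i : Fin 4) : (Gen → ℤ) →+ ℤ :=
    Pi.evalAddMonoidHom _ (.w i 1 (k + 1)) + Pi.evalAddMonoidHom _ (.w i 2 (k + 1))
  have hcl : ∀ i z, cl i z = z (.w i 1 (k + 1)) + z (.w i 2 (k + 1)) := fun _ _ => rfl
  have hl : 4 * k + 5 = 2 * (2 * k + 1) + 3 := by ring
  obtain ⟨r⟩ := nonempty_reindex (ι := Fin (2 * k + 1 + 1) ⊕ Fin (2 * k + 1) ⊕ Fin 2)
    (N := 4 * k + 5) (by simp; ring) (ZMod 2)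
  suffices Nonempty (GroupHomology ℤ Γ ℤ (4 * k + 4 + 1) ≃+
      (Fin (2 * k + 1 + 1) ⊕ Fin (2 * k + 1) ⊕ Fin 2 → ZMod 2)) from this.map fun e => e.trans r
  refine homology_of_coord _ (oddInv (2 * k + 1) cl) ?_ ?_ ?_ ?_
  · intro z
    have h : ∀ i, cl i (trunc (2 * (2 * k + 1) + 3) z) = cl i z := fun i => by
      have h : 1 + 4 * (k + 1) = 2 * (2 * k + 1) + 3 := by ring
      simp [hcl, trunc, Gen.deg, h]
    exact (congrArg (fun n => oddInv (2 * k + 1) cl (trunc n z)) hl).trans (oddInv_trunc _ cl z h)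
  · intro w
    refine oddInv_bnd _ _ _ fun i => ?_
    rw [hcl, ← hl]
    simp only [bnd]
    rw [if_neg (by omega), if_neg (by omega), show 4 * (k + 1) + 1 = 4 * k + 5 by ring]
    dsimp
    have : fromZ w i (4 * k + 5) + fromZ w i (4 * k + 5) = 2 * fromZ w i (4 * k + 5) := by ring
    omega
  · intro t
    choose u hu using fun q => ZMod.intCast_surjective (t q)
    refine ⟨oddCycle (2 * k + 1) u 0, ?_, ?_⟩
    · rintro (⟨i, c, k'⟩ | ⟨i, a, b⟩ | ⟨j, m⟩ | ⟨j, m⟩ | j | j) h <;> simp only [Gen.deg] at h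
      · fin_cases c <;> simp at h
        · fin_cases i <;> simp [bnd, fromE, fromZ, oddCycle, chain]
        · omega
        · omega
        · omega
        · omega
        · omega
      · exact bnd_oddCycle_v _ _ _ i a b (by omega)
      · simp [bnd, oddCycle, chain]
        omega
      · simp [bnd, oddCycle, chain]
        omega
      · omega
      · rfl
    · refine (oddInv_oddCycle _ _ _ _ fun i => ?_).trans (funext hu)
      simp [hcl, oddCycle, chain]
  · intro z hz hf
    have he : ∀ j, z (.e j (4 * k + 4)) = 0 := fun j => by
      have h := hz (.e j (4 * k + 3)) rfl
      simp only [bnd] at h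
      rw [if_pos (by omega), if_neg (by omega)] at h
      have : -2 * z (.e j (4 * k + 4)) + 0 = 0 := h
      omega
    have hz' : ∀ j, z (.z j (4 * k + 4)) = 0 := fun j => by
      have h := hz (.z j (4 * k + 3)) rfl
      simp only [bnd] at h
      rw [if_pos (by omega), if_neg (by omega)] at h
      have : -3 * z (.z j (4 * k + 4)) + 0 = 0 := h
      omega
    have hzv : ∀ i a b, a + b = 2 * (2 * k + 1) + 2 → bnd z (.v i a b) = 0 := fun i a b h =>
      hz _ (show a + b = _ by omega)
    have he6 : z (.e 6 (2 * (2 * k + 1) + 2)) = 0 := by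
      rw [← he 6]
      congr 2
      ring
    obtain ⟨h0, h1⟩ := oddInv_ends _ _ hf
    let ε := z (.v 1 1 (2 * (2 * k + 1) + 2))
    let p := cl 0 z + (z (.v 0 (2 * (2 * k + 1) + 3) 0) - ε)
    let q := cl 2 z + (z (.v 1 0 (2 * (2 * k + 1) + 3)) + ε)
    refine ⟨oddWitness (2 * k + 1) z (fun i c k' => if c = 4 then -z (.w i 2 (k + 1)) else
      ![0, (z (.v 0 (2 * (2 * k + 1) + 3) 0) + z (.v 1 (2 * (2 * k + 1) + 3) 0) + cl 0 z +
        cl 1 z) / 2, 0, (z (.v 0 0 (2 * (2 * k + 1) + 3)) + z (.v 1 0 (2 * (2 * k + 1) + 3)) +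
        cl 2 z + cl 3 z) / 2] i) p q 0, ?_⟩
    rintro (⟨i, c, k'⟩ | ⟨i, a, b⟩ | ⟨j, m⟩ | ⟨j, m⟩ | j | j) h <;> simp only [Gen.deg] at h
    · simp only [hcl] at h0 h1
      fin_cases c <;> simp at h
      · omega
      · obtain rfl : k' = k + 1 := by omega
        fin_cases i <;> simp [bnd, fromE, fromZ, oddWitness, chain, p, q, hcl] <;> omega
      · obtain rfl : k' = k + 1 := by omega
        fin_cases i <;> simp [bnd, fromZ, oddWitness, chain]
      · omega
      · omega
      · omega
    · exact bnd_oddWitness_v _ _ hzv he6 hf _ _ _ _ i a b (by omega)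
    · obtain rfl : m = 4 * k + 4 := by omega
      rw [he]
      simp [bnd]
      omega
    · obtain rfl : m = 4 * k + 4 := by omega
      rw [hz']
      simp [bnd]
      omega
    · omega
    · omega

end Bianchi

namespace Bianchi

open BarHomology

/-- The components at `2` of the invariants in even degrees. -/
def evenInv (l : ℕ) : (Gen → ℤ) →+ (Fin 2 × Fin (l + 2) → ZMod 2) where
  toFun z p := ((z (.v p.1 (2 * p.2 + 1) (2 * l + 3 - 2 * p.2)) + z (.v p.1 2 (2 * l + 2)) : ℤ) :
    ZMod 2)
  map_zero' := by
    ext p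
    simp
  map_add' z z' := by
    ext p
    simp
    ring

lemma evenInv_trunc (l : ℕ) (z : Gen → ℤ) : evenInv l (trunc (2 * l + 4) z) = evenInv l z := by
  have h : ∀ i a b, a + b = 2 * l + 4 → trunc (2 * l + 4) z (.v i a b) = z (.v i a b) :=
    fun i a b hab => if_pos hab
  ext ⟨i, q⟩
  simp [evenInv, h i (2 * q + 1) (2 * l + 3 - 2 * q) (by omega), h i 2 (2 * l + 2) (by omega)]

lemma evenInv_bnd (l : ℕ) (w : Gen → ℤ) : evenInv l (bnd w) = 0 := by
  have h : ∀ x : ℤ, x % 2 = 0 → ((x : ℤ) : ZMod 2) = 0 := fun x hx =>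
    (ZMod.intCast_zmod_eq_zero_iff_dvd x 2).2 (Int.dvd_of_emod_eq_zero hx)
  ext ⟨i, q⟩
  refine h _ ?_
  rw [bnd_v_of_odd_odd _ _ (by omega) (by omega),
    bnd_v_of_even_even _ _ (by omega) (by omega) (by omega), if_neg (by omega), if_neg (by omega)]
  have : 2 * (q : ℕ) + 1 + (2 * l + 3 - 2 * q) = 2 + (2 * l + 2) := by omega
  dsimp only
  rw [this]
  have h2 : ![(1 : ℤ), -1] i = 1 ∨ ![(1 : ℤ), -1] i = -1 := by fin_cases i <;> simp
  rcases h2 with h2 | h2 <;> rw [h2] <;> omega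

/-- A cycle in even degree with prescribed invariants. -/
def evenCycle (l : ℕ) (t : Fin 2 × Fin (l + 2) → ℤ) (W : Fin 4 → Fin 6 → ℕ → ℤ) (Z : Fin 2 → ℤ) :
    Gen → ℤ :=
  chain W (fun i a _ => if a % 2 = 0 then 0 else
    if h : a / 2 < l + 2 then t (i, ⟨a / 2, h⟩) else 0) (fun _ _ => 0) (fun j _ => Z j)

lemma bnd_evenCycle_v (l : ℕ) (t W Z) (i : Fin 2) (a b : ℕ) (h : a + b = 2 * l + 3) :
    bnd (evenCycle l t W Z) (.v i a b) = 0 := by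
  by_cases ha : a % 2 = 0
  · rw [bnd_v_of_even_odd _ _ ha (by omega)]
    fin_cases i <;> simp [evenCycle, chain, ha]
  · rw [bnd_v_of_odd_even _ _ (by omega) (by omega) (by omega)]
    have : (a + 1) % 2 = 0 := by omega
    fin_cases i <;> simp [evenCycle, chain, this]

lemma evenInv_evenCycle (l : ℕ) (t W Z) :
    evenInv l (evenCycle l t W Z) = fun q => (t q : ZMod 2) := by
  ext ⟨i, q⟩
  have h1 : (2 * (q : ℕ) + 1) % 2 = 1 := by omega
  have h2 : (2 * (q : ℕ) + 1) / 2 = q := by omega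
  simp [evenInv, evenCycle, chain, h1, h2]

lemma even_cycle_relations (l : ℕ) {z : Gen → ℤ}
    (hz : ∀ i a b, a + b = 2 * l + 3 → bnd z (.v i a b) = 0) :
    z (.e 6 (2 * l + 3)) = -2 * z (.v 0 2 (2 * l + 2)) ∧
    (∀ i a b, a % 2 = 0 → a ≠ 0 → b ≠ 0 → a + b = 2 * l + 4 →
      z (.v i a b) = ![1, -1] i * z (.v 0 2 (2 * l + 2))) ∧
    z (.e 0 (2 * l + 3)) = -2 * (z (.v 0 (2 * l + 4) 0) - z (.v 0 2 (2 * l + 2))) ∧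
    z (.e 1 (2 * l + 3)) = -2 * (z (.v 1 (2 * l + 4) 0) + z (.v 0 2 (2 * l + 2))) ∧
    z (.e 2 (2 * l + 3)) = -2 * (z (.v 1 0 (2 * l + 4)) + z (.v 0 2 (2 * l + 2))) ∧
    z (.e 3 (2 * l + 3)) = -2 * (z (.v 0 0 (2 * l + 4)) - z (.v 0 2 (2 * l + 2))) := by
  have h6 : z (.e 6 (2 * l + 3)) = -2 * z (.v 0 2 (2 * l + 2)) := by
    have h := hz 0 1 (2 * l + 2) (by omega)
    rw [bnd_v_of_odd_even _ _ (by omega) (by omega) (by omega), if_neg (by omega),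
      show 1 + (2 * l + 2) = 2 * l + 3 by ring] at h
    simp at h
    omega
  have h0 := hz 0 (2 * l + 3) 0 (by omega)
  have h1 := hz 1 (2 * l + 3) 0 (by omega)
  have h2 := hz 1 0 (2 * l + 3) (by omega)
  have h3 := hz 0 0 (2 * l + 3) (by omega)
  rw [bnd_v_of_odd_even _ _ (by omega) (by omega) (by omega), if_pos rfl, add_zero, h6] at h0 h1
  rw [bnd_v_of_even_odd _ _ (by omega) (by omega), if_pos rfl, zero_add, h6] at h2 h3
  dsimp at h0 h1 h2 h3
  refine ⟨h6, fun i a b ha ha' hb hab => ?_, ?_, ?_, ?_, ?_⟩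
  · have h := hz i (a - 1) b (by omega)
    rw [bnd_v_of_odd_even _ _ (by omega) (by omega) (by omega), if_neg hb,
      show a - 1 + b = 2 * l + 3 by omega, show a - 1 + 1 = a by omega, h6] at h
    linarith
  · linarith
  · linarith
  · linarith
  · linarith

/-- A chain bounding a cycle of even degree. -/
def evenWitness (l : ℕ) (z : Gen → ℤ) (p q : ℤ) (Z : Fin 2 → ℤ) : Gen → ℤ :=
  chain 0 (fun i a b => if a % 2 = 0 then
      (z (.v i (a - 1) b) - ![1, -1] i * z (.v 0 2 (2 * l + 2))) / 2 else 0)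
    (fun j _ => ![z (.v 0 (2 * l + 4) 0) - z (.v 0 2 (2 * l + 2)),
      z (.v 1 (2 * l + 4) 0) + z (.v 0 2 (2 * l + 2)), z (.v 1 0 (2 * l + 4)) + z (.v 0 2 (2 * l + 2)),
      z (.v 0 0 (2 * l + 4)) - z (.v 0 2 (2 * l + 2)), p, q, z (.v 0 2 (2 * l + 2))] j)
    (fun j _ => Z j)

lemma bnd_evenWitness_v (l : ℕ) {z : Gen → ℤ}
    (hz : ∀ i a b, a + b = 2 * l + 3 → bnd z (.v i a b) = 0)
    (hf : evenInv l z = 0) (p q Z) (i : Fin 2) (a b : ℕ) (h : a + b = 2 * l + 4) :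
    bnd (evenWitness l z p q Z) (.v i a b) = z (.v i a b) := by
  obtain ⟨-, key, -⟩ := even_cycle_relations l hz
  have hs : ![(1 : ℤ), -1] i = 1 ∨ ![(1 : ℤ), -1] i = -1 := by fin_cases i <;> simp
  by_cases ha : a % 2 = 0
  · rw [bnd_v_of_even_even _ _ ha (by omega) (by omega)]
    by_cases ha' : a = 0
    · subst ha'
      obtain rfl : b = 2 * l + 4 := by omega
      fin_cases i <;> simp [evenWitness, chain]
    · by_cases hb : b = 0
      · subst hb
        obtain rfl : a = 2 * l + 4 := by omega
        fin_cases i <;> simp [evenWitness, chain]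
      · rw [if_neg ha', if_neg hb, key i a b ha ha' hb h]
        simp [evenWitness, chain]
  · have h2 : ∀ x : ℤ, ((x : ℤ) : ZMod 2) = 0 → x % 2 = 0 := fun x hx =>
      Int.emod_eq_zero_of_dvd ((ZMod.intCast_zmod_eq_zero_iff_dvd x 2).1 hx)
    have h3 := h2 _ (congrFun hf (i, ⟨a / 2, by omega⟩))
    dsimp only at h3
    rw [show 2 * (a / 2) + 1 = a by omega, show 2 * l + 3 - 2 * (a / 2) = b by omega,
      key i 2 (2 * l + 2) (by omega) (by omega) (by omega) (by omega)] at h3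
    rw [bnd_v_of_odd_odd _ _ (by omega) (by omega)]
    have h4 : (a + 1) % 2 = 0 := by omega
    simp [evenWitness, chain, ha, h4]
    rcases hs with hs | hs <;> rw [hs] at h3 ⊢ <;> omega

end Bianchi

namespace Bianchi

open BarHomology

theorem homology_four_mul_add_four (k : ℕ) : Nonempty (GroupHomology ℤ Γ ℤ (4 * k + 4) ≃+
    (Fin (4 * k + 4) → ZMod 2)) := by
  have hl : 4 * k + 4 = 2 * (2 * k) + 4 := by ring
  obtain ⟨r⟩ := nonempty_reindex (ι := Fin 2 × Fin (2 * k + 2)) (N := 4 * k + 4)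
    (by simp; ring) (ZMod 2)
  suffices Nonempty (GroupHomology ℤ Γ ℤ (4 * k + 3 + 1) ≃+
      (Fin 2 × Fin (2 * k + 2) → ZMod 2)) from this.map fun e => e.trans r
  refine homology_of_coord _ (evenInv (2 * k)) ?_ (evenInv_bnd _) ?_ ?_
  · intro z
    exact (congrArg (fun n => evenInv (2 * k) (trunc n z)) hl).trans (evenInv_trunc _ z)
  · intro t
    choose u hu using fun q => ZMod.intCast_surjective (t q)
    refine ⟨evenCycle (2 * k) u 0 0, ?_, (evenInv_evenCycle _ _ _ _).trans (funext hu)⟩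
    rintro (⟨i, c, k'⟩ | ⟨i, a, b⟩ | ⟨j, m⟩ | ⟨j, m⟩ | j | j) h <;> simp only [Gen.deg] at h
    · fin_cases c <;> simp at h <;>
        fin_cases i <;> simp [bnd, fromE, fromZ, evenCycle, chain]
    · exact bnd_evenCycle_v _ _ _ _ i a b (by omega)
    · simp [bnd, evenCycle, chain]
      omega
    · simp [bnd, evenCycle, chain]
      omega
    · omega
    · rfl
  · intro z hz hf
    have hzv : ∀ i a b, a + b = 2 * (2 * k) + 3 → bnd z (.v i a b) = 0 := fun i a b h =>
      hz _ (show a + b = _ by omega)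
    obtain ⟨h6, -, h0, h1, h2, h3⟩ := even_cycle_relations _ hzv
    rw [show 2 * (2 * k) + 3 = 4 * k + 3 by ring] at h0 h1 h2 h3 h6
    have hw : ∀ i, 6 * z (.w i 0 (k + 1)) + 3 * fromE z i (4 * k + 3) +
      2 * fromZ z i (4 * k + 3) = 0 := fun i => hz (.w i 5 k) (show 3 + 4 * k = _ by ring)
    have w0 := hw 0
    have w1 := hw 1
    have w2 := hw 2
    have w3 := hw 3
    simp [fromE, fromZ] at w0 w1 w2 w3
    refine ⟨evenWitness (2 * k) z (-z (.e 4 (4 * k + 3)) / 2) (-z (.e 5 (4 * k + 3)) / 2)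
      fun j => -z (.z j (4 * k + 3)) / 3, ?_⟩
    rintro (⟨i, c, k'⟩ | ⟨i, a, b⟩ | ⟨j, m⟩ | ⟨j, m⟩ | j | j) h <;> simp only [Gen.deg] at h
    · fin_cases c <;> simp at h
      · obtain rfl : k' = k + 1 := by omega
        fin_cases i <;> simp [bnd, fromE, fromZ, evenWitness, chain] <;> omega
      · omega
      · omega
      · omega
      · omega
      · omega
    · exact bnd_evenWitness_v _ hzv hf _ _ _ i a b (by omega)
    · obtain rfl : m = 4 * k + 3 := by omega
      simp only [bnd]
      rw [if_pos (by omega), if_neg (by omega)]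
      fin_cases j <;> simp [evenWitness, chain] <;> omega
    · obtain rfl : m = 4 * k + 3 := by omega
      simp only [bnd]
      rw [if_pos (by omega), if_neg (by omega)]
      fin_cases j <;> simp [evenWitness, chain] <;> omega
    · omega
    · omega

/-- Components at `3` of invariants, from the edges with stabilisers of order three. -/
def edgeInv (m : ℕ) : (Gen → ℤ) →+ (Fin 2 → ZMod 3) where
  toFun z j := (z (.z j m) : ZMod 3)
  map_zero' := by
    ext j
    simp
  map_add' z z' := by
    ext j
    simp

theorem homology_four_mul_add_six (k : ℕ) : Nonempty (GroupHomology ℤ Γ ℤ (4 * k + 6) ≃+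
    (Fin (4 * k + 6) → ZMod 2) × (Fin 2 → ZMod 3)) := by
  have hl : 4 * k + 6 = 2 * (2 * k + 1) + 4 := by ring
  obtain ⟨r⟩ := nonempty_reindex (ι := Fin 2 × Fin (2 * k + 1 + 2)) (N := 4 * k + 6)
    (by simp; ring) (ZMod 2)
  suffices Nonempty (GroupHomology ℤ Γ ℤ (4 * k + 5 + 1) ≃+
      (Fin 2 × Fin (2 * k + 1 + 2) → ZMod 2) × (Fin 2 → ZMod 3)) from
    this.map fun e => e.trans (r.prodCongr (AddEquiv.refl _))
  refine homology_of_coord _ ((evenInv (2 * k + 1)).prod (edgeInv (4 * k + 5))) ?_ ?_ ?_ ?_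
  · intro z
    refine Prod.ext ?_ ?_
    · exact (congrArg (fun n => evenInv (2 * k + 1) (trunc n z)) hl).trans (evenInv_trunc _ z)
    · ext j
      simp [edgeInv, trunc, Gen.deg]
  · intro w
    refine Prod.ext (evenInv_bnd _ _) ?_
    ext j
    refine zmod_three_intCast_eq_zero.2 ?_
    simp only [bnd]
    rw [if_pos (by omega), if_neg (by omega)]
    omega
  · rintro ⟨t, t'⟩
    choose u hu using fun q => ZMod.intCast_surjective (t q)
    choose u' hu' using fun q => ZMod.intCast_surjective (t' q)
    refine ⟨evenCycle (2 * k + 1) u (fun i c _ => ![0, 0, 0, -1, 1, 0] c *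
      ![u' 1, -u' 1, u' 0, -u' 0] i) u', ?_,
      Prod.ext ((evenInv_evenCycle _ _ _ _).trans (funext hu)) (funext hu')⟩
    rintro (⟨i, c, k'⟩ | ⟨i, a, b⟩ | ⟨j, m⟩ | ⟨j, m⟩ | j | j) h <;> simp only [Gen.deg] at h
    · fin_cases c <;> simp at h
      · omega
      · obtain rfl : k' = k + 1 := by omega
        fin_cases i <;> simp [bnd, fromE, fromZ, evenCycle, chain] <;> ring
      · obtain rfl : k' = k + 1 := by omega
        fin_cases i <;> simp [bnd, fromZ, evenCycle, chain]
      · omega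
      · omega
      · omega
    · exact bnd_evenCycle_v _ _ _ _ i a b (by omega)
    · simp [bnd, evenCycle, chain]
      omega
    · simp only [bnd]
      rw [if_neg (by omega), if_neg (by omega)]
      rfl
    · omega
    · rfl
  · intro z hz hf
    have hzv : ∀ i a b, a + b = 2 * (2 * k + 1) + 3 → bnd z (.v i a b) = 0 := fun i a b h =>
      hz _ (show a + b = _ by omega)
    have hf1 : evenInv (2 * k + 1) z = 0 := congrArg Prod.fst hf
    have hf2 : ∀ j, z (.z j (4 * k + 5)) % 3 = 0 := fun j =>
      zmod_three_intCast_eq_zero.1 (congrFun (congrArg Prod.snd hf) j)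
    obtain ⟨h6, -, h0, h1, h2, h3⟩ := even_cycle_relations _ hzv
    rw [show 2 * (2 * k + 1) + 3 = 4 * k + 5 by ring] at h0 h1 h2 h3 h6
    have hx : ∀ i, 2 * z (.w i 3 (k + 1)) + z (.w i 4 (k + 1)) + fromE z i (4 * k + 5) +
      fromZ z i (4 * k + 5) + 0 = 0 := fun i => hz (.w i 1 (k + 1)) (show 1 + 4 * (k + 1) = _ by ring)
    have hy : ∀ i, -z (.w i 4 (k + 1)) + fromZ z i (4 * k + 5) + 0 = 0 := fun i =>
      hz (.w i 2 (k + 1)) (show 1 + 4 * (k + 1) = _ by ring)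
    have x0 := hx 0
    have x1 := hx 1
    have x2 := hx 2
    have x3 := hx 3
    have y0 := hy 0
    have y1 := hy 1
    have y2 := hy 2
    have y3 := hy 3
    have z0 := hf2 0
    have z1 := hf2 1
    simp [fromE, fromZ] at x0 x1 x2 x3 y0 y1 y2 y3
    refine ⟨evenWitness (2 * k + 1) z (-z (.e 4 (4 * k + 5)) / 2) (-z (.e 5 (4 * k + 5)) / 2)
      fun j => -z (.z j (4 * k + 5)) / 3, ?_⟩
    rintro (⟨i, c, k'⟩ | ⟨i, a, b⟩ | ⟨j, m⟩ | ⟨j, m⟩ | j | j) h <;> simp only [Gen.deg] at h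
    · fin_cases c <;> simp at h
      · omega
      · omega
      · omega
      · obtain rfl : k' = k + 1 := by omega
        fin_cases i <;> simp [bnd, fromE, fromZ, evenWitness, chain] <;> omega
      · obtain rfl : k' = k + 1 := by omega
        fin_cases i <;> simp [bnd, fromZ, evenWitness, chain] <;> omega
      · omega
    · exact bnd_evenWitness_v _ hzv hf1 _ _ _ i a b (by omega)
    · obtain rfl : m = 4 * k + 5 := by omega
      simp only [bnd]
      rw [if_pos (by omega), if_neg (by omega)]
      fin_cases j <;> simp [evenWitness, chain] <;> omega
    · obtain rfl : m = 4 * k + 5 := by omega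
      simp only [bnd]
      rw [if_pos (by omega), if_neg (by omega)]
      fin_cases j <;> simp [evenWitness, chain] <;> omega
    · omega
    · omega

end Bianchi

namespace Bianchi

open BarHomology

lemma zmod_two_intCast_eq_zero {x : ℤ} : ((x : ℤ) : ZMod 2) = 0 ↔ x % 2 = 0 :=
  (ZMod.intCast_zmod_eq_zero_iff_dvd x 2).trans
    ⟨Int.emod_eq_zero_of_dvd, Int.dvd_of_emod_eq_zero⟩

lemma zmod_four_intCast_eq_zero {x : ℤ} : ((x : ℤ) : ZMod 4) = 0 ↔ x % 4 = 0 :=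
  (ZMod.intCast_zmod_eq_zero_iff_dvd x 4).trans
    ⟨Int.emod_eq_zero_of_dvd, Int.dvd_of_emod_eq_zero⟩

/-- The invariants in degree one. -/
def invOne : (Gen → ℤ) →+ (Fin 3 → ℤ) × (Fin 2 → ZMod 2) where
  toFun z := (![z (.e 4 0) + z (.z 0 0), z (.e 5 0) + z (.z 1 0), z (.e 6 0) + z (.t 4)],
    ![((z (.v 0 1 0) + z (.v 1 1 0) + z (.w 0 1 0) + z (.w 0 2 0) + z (.w 1 1 0) +
        z (.w 1 2 0) : ℤ) : ZMod 2),
      ((z (.v 0 0 1) + z (.v 1 0 1) + z (.w 2 1 0) + z (.w 2 2 0) + z (.w 3 1 0) +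
        z (.w 3 2 0) : ℤ) : ZMod 2)])
  map_zero' := by
    refine Prod.ext ?_ ?_ <;> ext j <;> fin_cases j <;> simp
  map_add' z z' := by
    refine Prod.ext ?_ ?_ <;> ext j <;> fin_cases j <;> simp <;> ring

/-- A cycle of degree one with prescribed invariants. -/
def cycleOne (a b c p q : ℤ) : Gen → ℤ
  | .w _ _ _ => 0
  | .v i m n => if i = 0 then m * p + n * q else 0
  | .e j _ => ![0, 0, a + b, -a - b, 0, 0, 0] j
  | .z j _ => ![a, b] j
  | .t j => ![b, -b, -a - b - c, 0, c] j
  | .f _ => 0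

/-- A chain bounding a cycle of degree one. -/
def witnessOne (z : Gen → ℤ) : Gen → ℤ
  | .w i c _ => if c = 3 then
      ![0, (z (.v 0 1 0) + z (.v 1 1 0) + z (.w 0 1 0) + z (.w 0 2 0) + z (.w 1 1 0) +
        z (.w 1 2 0)) / 2, 0,
        (z (.v 0 0 1) + z (.v 1 0 1) + z (.w 2 1 0) + z (.w 2 2 0) + z (.w 3 1 0) +
        z (.w 3 2 0)) / 2 - z (.t 3)] i else
      -z (.w i 2 0) + ![-z (.e 4 0), -z (.t 3) + z (.e 4 0), z (.z 1 0), z (.t 3) - z (.z 1 0)] i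
  | .v _ _ _ => 0
  | .e j _ => ![z (.v 0 1 0) - z (.t 3), z (.v 1 1 0), z (.v 1 0 1), z (.v 0 0 1),
      z (.w 0 1 0) + z (.w 0 2 0) + z (.v 0 1 0) - z (.t 3) + 2 * z (.e 4 0),
      z (.w 2 1 0) + z (.w 2 2 0) + z (.v 1 0 1) - 2 * z (.z 1 0), 0] j
  | .z _ _ => 0
  | .t _ => 0
  | .f j => ![-z (.e 0 0), 0, -z (.e 1 0) - z (.t 3), z (.t 3), z (.e 4 0), z (.z 1 0),
      z (.e 6 0), 0] j

theorem homology_one :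
    Nonempty (GroupHomology ℤ Γ ℤ 1 ≃+ (Fin 3 → ℤ) × (Fin 2 → ZMod 2)) := by
  refine homology_of_coord 0 invOne ?_ ?_ ?_ ?_
  · intro z
    refine Prod.ext ?_ ?_ <;> ext j <;> fin_cases j <;> simp [invOne, trunc, Gen.deg]
  · intro w
    refine Prod.ext ?_ ?_
    · ext j
      fin_cases j <;> simp [invOne, bnd]
    · ext j
      fin_cases j <;> refine zmod_two_intCast_eq_zero.2 ?_ <;>
        simp [bnd, fromE, fromZ] <;> omega
  · rintro ⟨t, t'⟩
    choose u hu using fun q => ZMod.intCast_surjective (t' q)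
    refine ⟨cycleOne (t 0) (t 1) (t 2) (u 0) (u 1), ?_, Prod.ext ?_ ?_⟩
    · rintro (⟨i, c, k'⟩ | ⟨i, a, b⟩ | ⟨j, m⟩ | ⟨j, m⟩ | j | j) h <;> simp only [Gen.deg] at h
      · obtain rfl : k' = 0 := by omega
        fin_cases c <;> simp at h
        fin_cases i <;> simp [bnd, fromE, fromZ, cycleOne]
      · obtain rfl : a = 0 := by omega
        obtain rfl : b = 0 := by omega
        fin_cases i <;> simp [bnd, cycleOne] <;> ring
      · omega
      · omega
      · omega
      · rfl
    · ext j
      fin_cases j <;> simp [invOne, cycleOne]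
    · ext j
      fin_cases j <;> simp [invOne, cycleOne, hu]
  · intro z hz hf
    have hf1 := congrArg Prod.fst hf
    have hf2 := congrArg Prod.snd hf
    have a0 : z (.e 4 0) + z (.z 0 0) = 0 := congrFun hf1 0
    have a1 : z (.e 5 0) + z (.z 1 0) = 0 := congrFun hf1 1
    have a2 : z (.e 6 0) + z (.t 4) = 0 := congrFun hf1 2
    have b0 := zmod_two_intCast_eq_zero.1 (congrFun hf2 0)
    have b1 := zmod_two_intCast_eq_zero.1 (congrFun hf2 1)
    have w0 := hz (.w 0 0 0) rfl
    have w1 := hz (.w 1 0 0) rfl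
    have w2 := hz (.w 2 0 0) rfl
    have w3 := hz (.w 3 0 0) rfl
    have v0 := hz (.v 0 0 0) rfl
    have v1 := hz (.v 1 0 0) rfl
    simp [bnd, fromE, fromZ] at w0 w1 w2 w3 v0 v1
    refine ⟨witnessOne z, ?_⟩
    rintro (⟨i, c, k'⟩ | ⟨i, a, b⟩ | ⟨j, m⟩ | ⟨j, m⟩ | j | j) h <;> simp only [Gen.deg] at h
    · obtain rfl : k' = 0 := by omega
      fin_cases c <;> simp at h <;>
        fin_cases i <;> simp [bnd, fromE, fromZ, witnessOne] <;> omega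
    · obtain ⟨rfl, rfl⟩ | ⟨rfl, rfl⟩ : a = 0 ∧ b = 1 ∨ a = 1 ∧ b = 0 := by omega
      · fin_cases i <;> simp [bnd, witnessOne]
      · fin_cases i <;> simp [bnd, witnessOne]
    · obtain rfl : m = 0 := by omega
      fin_cases j <;> simp [bnd, witnessOne] <;> omega
    · obtain rfl : m = 0 := by omega
      fin_cases j <;> simp [bnd, witnessOne] <;> omega
    · fin_cases j <;> simp [bnd, witnessOne] <;> omega
    · omega

end Bianchi

namespace Bianchi

open BarHomology

/-- The invariants in degree two. -/
def invTwo : (Gen → ℤ) →+ (Fin 2 → ℤ) × ZMod 4 × (Fin 2 → ZMod 3) × ZMod 2 where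
  toFun z := (![z (.f 2), z (.f 6)], ((z (.e 6 1) + 2 * z (.v 0 1 1) : ℤ) : ZMod 4),
    edgeInv 1 z, ((z (.v 0 1 1) + z (.v 1 1 1) : ℤ) : ZMod 2))
  map_zero' := by
    refine Prod.ext ?_ (Prod.ext ?_ (Prod.ext ?_ ?_))
    · ext j
      fin_cases j <;> simp
    · simp
    · simp
    · simp
  map_add' z z' := by
    refine Prod.ext ?_ (Prod.ext ?_ (Prod.ext ?_ ?_))
    · ext j
      fin_cases j <;> simp
    · simp
      ring
    · simp
    · simp
      ring

/-- A cycle of degree two with prescribed invariants. -/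
def cycleTwo (g h c z₀ z₁ y : ℤ) : Gen → ℤ
  | .w i n _ => if n = 3 then ![0, 0, 0, 2 * g + 2 * h] i else
      ![z₁ + g + 2 * h, -z₁ + g, z₀ - g - 2 * h, -z₀ - g] i
  | .v i a _ => if i = 1 ∧ a = 1 then y else 0
  | .e j _ => ![-c + g - h, c + g + 3 * h, c, -c, -c - 3 * h - 2 * z₁,
      c - 2 * z₀ + 2 * g + 4 * h, c] j
  | .z j _ => ![z₀, z₁] j
  | .t _ => 0
  | .f j => ![g + 2 * h, -g - 2 * h, g, -g, 0, 0, h, -h] j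

/-- A chain bounding a cycle of degree two. -/
def witnessTwo (z : Gen → ℤ) : Gen → ℤ
  | .w _ _ _ => 0
  | .v i a _ => if a = 2 then (z (.v i 1 1) + ![1, -1] i * (z (.e 6 1) / 2)) / 2 else 0
  | .e j _ => -z (.e j 1) / 2
  | .z j _ => -z (.z j 1) / 3
  | .t _ => 0
  | .f _ => 0

theorem homology_two : Nonempty (GroupHomology ℤ Γ ℤ 2 ≃+
    (Fin 2 → ℤ) × ZMod 4 × (Fin 2 → ZMod 3) × ZMod 2) := by
  refine homology_of_coord 1 invTwo ?_ ?_ ?_ ?_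
  · intro z
    refine Prod.ext ?_ (Prod.ext ?_ (Prod.ext ?_ ?_))
    · ext j
      fin_cases j <;> simp [invTwo, trunc, Gen.deg]
    · simp [invTwo, trunc, Gen.deg]
    · ext j
      simp [invTwo, edgeInv, trunc, Gen.deg]
    · simp [invTwo, trunc, Gen.deg]
  · intro w
    refine Prod.ext ?_ (Prod.ext ?_ (Prod.ext ?_ ?_))
    · ext j
      fin_cases j <;> simp [invTwo, bnd]
    · refine zmod_four_intCast_eq_zero.2 ?_
      simp [bnd]
      omega
    · ext j
      refine zmod_three_intCast_eq_zero.2 ?_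
      simp [bnd]
    · refine zmod_two_intCast_eq_zero.2 ?_
      simp [bnd]
      omega
  · rintro ⟨t, c, s, y⟩
    obtain ⟨c, rfl⟩ := ZMod.intCast_surjective c
    obtain ⟨y, rfl⟩ := ZMod.intCast_surjective y
    choose u hu using fun q => ZMod.intCast_surjective (s q)
    refine ⟨cycleTwo (t 0) (t 1) c (u 0) (u 1) y, ?_,
      Prod.ext ?_ (Prod.ext ?_ (Prod.ext ?_ ?_))⟩
    · rintro (⟨i, c, k'⟩ | ⟨i, a, b⟩ | ⟨j, m⟩ | ⟨j, m⟩ | j | j) h <;> simp only [Gen.deg] at h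
      · obtain rfl : k' = 0 := by omega
        fin_cases c <;> simp at h <;>
          fin_cases i <;> simp [bnd, fromE, fromZ, cycleTwo] <;> ring
      · obtain ⟨rfl, rfl⟩ | ⟨rfl, rfl⟩ : a = 0 ∧ b = 1 ∨ a = 1 ∧ b = 0 := by omega
        · fin_cases i <;> simp [bnd, cycleTwo]
        · fin_cases i <;> simp [bnd, cycleTwo] <;> ring
      · obtain rfl : m = 0 := by omega
        fin_cases j <;> simp [bnd, cycleTwo] <;> ring
      · obtain rfl : m = 0 := by omega
        fin_cases j <;> simp [bnd, cycleTwo]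
      · fin_cases j <;> simp [bnd, cycleTwo]
      · omega
    · ext j
      fin_cases j <;> simp [invTwo, cycleTwo]
    · simp [invTwo, cycleTwo]
    · ext j
      fin_cases j <;> simp [invTwo, edgeInv, cycleTwo, hu]
    · simp [invTwo, cycleTwo]
  · intro z hz hf
    have hf1 := congrArg Prod.fst hf
    have hf2 := congrArg Prod.snd hf
    have hf3 := congrArg Prod.snd hf2
    have g0 : z (.f 2) = 0 := congrFun hf1 0
    have g1 : z (.f 6) = 0 := congrFun hf1 1
    have c0 := zmod_four_intCast_eq_zero.1 (congrArg Prod.fst hf2)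
    have z0 := zmod_three_intCast_eq_zero.1 (congrFun (congrArg Prod.fst hf3) 0)
    have z1 := zmod_three_intCast_eq_zero.1 (congrFun (congrArg Prod.fst hf3) 1)
    have y0 := zmod_two_intCast_eq_zero.1 (congrArg Prod.snd hf3)
    have e0 := hz (.e 0 0) rfl
    have e1 := hz (.e 1 0) rfl
    have e4 := hz (.e 4 0) rfl
    have e5 := hz (.e 5 0) rfl
    have e6 := hz (.e 6 0) rfl
    have t2 := hz (.t 2) rfl
    simp [bnd] at e0 e1 e4 e5 e6 t2
    have f0 : z (.f 0) = 0 := by omega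
    have f1 : z (.f 1) = 0 := by omega
    have f3 : z (.f 3) = 0 := by omega
    have f7 : z (.f 7) = 0 := by omega
    have w0 := hz (.w 0 1 0) rfl
    have w1 := hz (.w 1 1 0) rfl
    have w2 := hz (.w 2 1 0) rfl
    have w3 := hz (.w 3 1 0) rfl
    have x0 := hz (.w 0 2 0) rfl
    have x1 := hz (.w 1 2 0) rfl
    have x2 := hz (.w 2 2 0) rfl
    have x3 := hz (.w 3 2 0) rfl
    have v0 := hz (.v 0 0 1) rfl
    have v1 := hz (.v 1 0 1) rfl
    have v2 := hz (.v 0 1 0) rfl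
    have v3 := hz (.v 1 1 0) rfl
    simp [bnd, fromE, fromZ, e4, e5, f1, f3, f7] at w0 w1 w2 w3 x0 x1 x2 x3 v0 v1 v2 v3
    refine ⟨witnessTwo z, ?_⟩
    rintro (⟨i, c, k'⟩ | ⟨i, a, b⟩ | ⟨j, m⟩ | ⟨j, m⟩ | j | j) h <;> simp only [Gen.deg] at h
    · obtain rfl : k' = 0 := by omega
      fin_cases c <;> simp at h <;>
        fin_cases i <;> simp [bnd, fromE, fromZ, witnessTwo] <;> omega
    · obtain ⟨rfl, rfl⟩ | ⟨rfl, rfl⟩ | ⟨rfl, rfl⟩ :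
          a = 0 ∧ b = 2 ∨ a = 1 ∧ b = 1 ∨ a = 2 ∧ b = 0 := by omega
      · fin_cases i <;> simp [bnd, witnessTwo] <;> omega
      · fin_cases i <;> simp [bnd, witnessTwo] <;> omega
      · fin_cases i <;> simp [bnd, witnessTwo] <;> omega
    · obtain rfl : m = 1 := by omega
      fin_cases j <;> simp [bnd, witnessTwo] <;> omega
    · obtain rfl : m = 1 := by omega
      fin_cases j <;> simp [bnd, witnessTwo] <;> omega
    · omega
    · fin_cases j <;> simp [bnd, *]

end Bianchi

/-- The integral homology of `PSL₂(𝒪₋₁₃)`, where `𝒪₋₁₃` is the ring of integers of `ℚ(√-13)`. -/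
theorem homology_PSL2_O13 (K : Type) [Field K] [NumberField K]
    (hdeg : Module.finrank ℚ K = 2) (hK : ∃ α : K, α ^ 2 = -13)
    (q : ℕ) (hq : 1 ≤ q) :
    (q = 1 → Nonempty (GroupHomology ℤ (PSL2 (NumberField.RingOfIntegers K)) ℤ q ≃+
      ((Fin 3 → ℤ) × (Fin 2 → ZMod 2)))) ∧
    (q = 2 → Nonempty (GroupHomology ℤ (PSL2 (NumberField.RingOfIntegers K)) ℤ q ≃+
      ((Fin 2 → ℤ) × ZMod 4 × (Fin 2 → ZMod 3) × ZMod 2))) ∧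
    (∀ k : ℕ,
      (q = 4 * k + 3 → Nonempty (GroupHomology ℤ (PSL2 (NumberField.RingOfIntegers K)) ℤ q ≃+
        ((Fin (4 * k + 3) → ZMod 2) × (Fin 2 → ZMod 3)))) ∧
      (q = 4 * k + 4 → Nonempty (GroupHomology ℤ (PSL2 (NumberField.RingOfIntegers K)) ℤ q ≃+
        (Fin (4 * k + 4) → ZMod 2))) ∧
      (q = 4 * k + 5 → Nonempty (GroupHomology ℤ (PSL2 (NumberField.RingOfIntegers K)) ℤ q ≃+
        (Fin (4 * k + 5) → ZMod 2))) ∧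
      (q = 4 * k + 6 → Nonempty (GroupHomology ℤ (PSL2 (NumberField.RingOfIntegers K)) ℤ q ≃+
        ((Fin (4 * k + 6) → ZMod 2) × (Fin 2 → ZMod 3))))) := by
  obtain ⟨e⟩ := Bianchi.equiv_PSL2 K hdeg hK
  obtain ⟨c⟩ := FreeRes.groupHomology_congr e q
  refine ⟨?_, ?_, fun k => ⟨?_, ?_, ?_, ?_⟩⟩ <;> rintro rfl
  · exact Bianchi.homology_one.map c.trans
  · exact Bianchi.homology_two.map c.trans
  · exact (Bianchi.homology_four_mul_add_three k).map c.trans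
  · exact (Bianchi.homology_four_mul_add_four k).map c.trans
  · exact (Bianchi.homology_four_mul_add_five k).map c.trans
  · exact (Bianchi.homology_four_mul_add_six k).map c.trans
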